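/- The Chern classes c_{n+1} of rank-(n+1) complex vector bundles over S^{2n+2} realize exactly the multiples of n! in H^{2n+2}(S^{2n+2}; ℤ) ≅ ℤ. -/

import Mathlib

open scoped unitInterval

namespace CB

/-- homotopy of maps `X → Y` through maps into `S`. -/
def Hm {X Y : Type*} [TopologicalSpace X] [TopologicalSpace Y] (S : Set Y) (f g : X → Y) : Prop :=
  ∃ H : I → X → Y, Continuous (fun p : I × X => H p.1 p.2) ∧ (∀ t x, H t x ∈ S) ∧
    (∀ x, H 0 x = f x) ∧ ∀ x, H 1 x = g x

section
variable {X X' Y Z : Type*} [TopologicalSpace X] [TopologicalSpace X'] [TopologicalSpace Y]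
  [TopologicalSpace Z] {S : Set Y} {f g h : X → Y}

theorem Hm.refl (hf : Continuous f) (h : ∀ x, f x ∈ S) : Hm S f f :=
  ⟨fun _ x => f x, by fun_prop, fun _ x => h x, fun _ => rfl, fun _ => rfl⟩

theorem Hm.symm (h : Hm S f g) : Hm S g f := by
  obtain ⟨H, c, m, h0, h1⟩ := h
  exact ⟨fun t x => H (σ t) x, by
    have : Continuous fun p : I × X => ((σ p.1, p.2) : I × X) := by fun_prop
    exact c.comp this, fun t x => m _ _, by simpa using h1, by simpa using h0⟩

theorem Hm.cont_left (h : Hm S f g) : Continuous f := by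
  obtain ⟨H, c, m, h0, h1⟩ := h
  have : f = fun x => H 0 x := by ext x; exact (h0 x).symm
  rw [this]
  have h2 : Continuous fun x : X => ((0, x) : I × X) := by fun_prop
  exact c.comp h2

theorem Hm.mem_left (h : Hm S f g) (x : X) : f x ∈ S := by
  obtain ⟨H, c, m, h0, h1⟩ := h
  rw [← h0]; exact m _ _

theorem Hm.cont_right (h : Hm S f g) : Continuous g := h.symm.cont_left
theorem Hm.mem_right (h : Hm S f g) (x : X) : g x ∈ S := h.symm.mem_left x

theorem Hm.trans (h1 : Hm S f g) (h2 : Hm S g h) : Hm S f h := by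
  have key : ∀ {f g : X → Y} (h : Hm S f g),
      ContinuousMap.Homotopic (⟨fun x => ⟨f x, h.mem_left x⟩, by
        have := h.cont_left; fun_prop⟩ : C(X, S)) ⟨fun x => ⟨g x, h.mem_right x⟩, by
        have := h.cont_right; fun_prop⟩ := by
    intro f g h
    have h' := h
    obtain ⟨H, c, m, h0, h1⟩ := h'
    exact ⟨⟨⟨fun p => ⟨H p.1 p.2, m _ _⟩, by fun_prop⟩, fun x => Subtype.ext (h0 x),
      fun x => Subtype.ext (h1 x)⟩⟩
  obtain ⟨F⟩ := (key h1).trans (key h2)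
  exact ⟨fun t x => F (t, x), continuous_subtype_val.comp F.continuous, fun t x => (F (t, x)).2, fun x => by simp, fun x => by simp⟩

theorem Hm.comp_left {T : Set Z} (φ : Y → Z) (hφ : ContinuousOn φ S) (hm : ∀ y ∈ S, φ y ∈ T)
    (h : Hm S f g) : Hm T (fun x => φ (f x)) (fun x => φ (g x)) := by
  obtain ⟨H, c, m, h0, h1⟩ := h
  exact ⟨fun t x => φ (H t x), hφ.comp_continuous c (fun p => m _ _), fun t x => hm _ (m _ _),
    fun x => by simp [h0], fun x => by simp [h1]⟩

theorem Hm.comp_right (φ : X' → X) (hφ : Continuous φ) 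
    (h : Hm S f g) : Hm S (fun x => f (φ x)) (fun x => g (φ x)) := by
  obtain ⟨H, c, m, h0, h1⟩ := h
  refine ⟨fun t x => H t (φ x), ?_, fun t x => (m _ _),
    fun x => by simp [h0], fun x => by simp [h1]⟩
  have : Continuous fun p : I × X' => ((p.1, φ p.2) : I × X) := by fun_prop
  exact c.comp this

/-- precomposition with a homotopy of the source -/
theorem Hm.source (hf : Continuous f) (hS : ∀ x, f x ∈ S) (K : I → X' → X)
    (hK : Continuous (fun p : I × X' => K p.1 p.2)) :
    Hm S (fun x => f (K 0 x)) (fun x => f (K 1 x)) :=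
  ⟨fun t x => f (K t x), hf.comp hK, fun _ _ => hS _, fun _ => rfl, fun _ => rfl⟩

theorem Hm.congr {f' g' : X → Y} (h : Hm S f g) (h1 : ∀ x, f x = f' x) (h2 : ∀ x, g x = g' x) :
    Hm S f' g' := by
  have e1 : f = f' := funext h1
  have e2 : g = g' := funext h2
  subst e1 e2; exact h

theorem Hm.prod {T : Set Z} {f' g' : X → Z} (h : Hm S f g) (h' : Hm T f' g') :
    Hm (S ×ˢ T) (fun x => (f x, f' x)) (fun x => (g x, g' x)) := by
  obtain ⟨H, c, m, h0, h1⟩ := h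
  obtain ⟨H', c', m', h0', h1'⟩ := h'
  exact ⟨fun t x => (H t x, H' t x), by fun_prop, fun t x => ⟨m _ _, m' _ _⟩,
    fun x => by simp [h0, h0'], fun x => by simp [h1, h1']⟩

end

/-- straight-line homotopy -/
theorem Hm.line {X Y : Type*} [TopologicalSpace X] [AddCommGroup Y] [Module ℝ Y] [TopologicalSpace Y]
    [ContinuousAdd Y] [ContinuousSMul ℝ Y] {S : Set Y} {f g : X → Y}
    (hf : Continuous f) (hg : Continuous g)
    (h : ∀ x, ∀ t : ℝ, 0 ≤ t → t ≤ 1 → (1 - t) • f x + t • g x ∈ S) : Hm S f g :=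
  ⟨fun t x => (1 - (t : ℝ)) • f x + (t : ℝ) • g x, by fun_prop, fun t x => h x t t.2.1 t.2.2,
    by simp, by simp⟩

/-! ### matrices -/
open Matrix

/-- the set of invertible matrices -/
abbrev GLs (ι : Type*) [Fintype ι] [DecidableEq ι] : Set (Matrix ι ι ℂ) := {M | IsUnit M}

section
variable {X : Type*} [TopologicalSpace X] {ι κ : Type*} [Fintype ι] [DecidableEq ι] [Fintype κ]
  [DecidableEq κ]

theorem continuousOn_matrix_inv : ContinuousOn (fun M : Matrix ι ι ℂ => M⁻¹) (GLs ι) := by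
  have : (fun M : Matrix ι ι ℂ => M⁻¹) = fun M => (M.det)⁻¹ • M.adjugate := by
    ext1 M; rw [Matrix.inv_def]; simp
  rw [this]
  refine ContinuousOn.fun_smul ?_ ?_
  · apply ContinuousOn.inv₀ (by fun_prop)
    intro M hM
    exact ((Matrix.isUnit_iff_isUnit_det _).1 hM).ne_zero
  · exact (Continuous.matrix_adjugate continuous_id).continuousOn

theorem cont_inv {f : X → Matrix ι ι ℂ} (hf : Continuous f) (h : ∀ x, IsUnit (f x)) :
    Continuous (fun x => (f x)⁻¹) := continuousOn_matrix_inv.comp_continuous hf h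

theorem Hm.mul {f g f' g' : X → Matrix ι ι ℂ} (h : Hm (GLs ι) f g) (h' : Hm (GLs ι) f' g') :
    Hm (GLs ι) (fun x => f x * f' x) (fun x => g x * g' x) :=
  (h.prod h').comp_left (fun p => p.1 * p.2) (by fun_prop) (fun y hy => hy.1.mul hy.2)

theorem Hm.inv {f g : X → Matrix ι ι ℂ} (h : Hm (GLs ι) f g) :
    Hm (GLs ι) (fun x => (f x)⁻¹) (fun x => (g x)⁻¹) :=
  h.comp_left (fun p => p⁻¹) continuousOn_matrix_inv (fun y hy => by
    have : IsUnit y := hy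
    exact (Matrix.isUnit_nonsing_inv_iff).2 this)

theorem isUnit_blockdiag {A : Matrix ι ι ℂ} {B : Matrix κ κ ℂ} (hA : IsUnit A) (hB : IsUnit B) :
    IsUnit (fromBlocks A 0 0 B) := by
  rw [Matrix.isUnit_iff_isUnit_det] at *
  rw [Matrix.det_fromBlocks_zero₂₁]; exact hA.mul hB

theorem Hm.blockdiag {f g : X → Matrix ι ι ℂ} {f' g' : X → Matrix κ κ ℂ}
    (h : Hm (GLs ι) f g) (h' : Hm (GLs κ) f' g') :
    Hm (GLs (ι ⊕ κ)) (fun x => fromBlocks (f x) 0 0 (f' x)) (fun x => fromBlocks (g x) 0 0 (g' x)) :=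
  (h.prod h').comp_left (fun p => fromBlocks p.1 0 0 p.2)
    (by
      have : Continuous fun p : Matrix ι ι ℂ × Matrix κ κ ℂ => fromBlocks p.1 0 0 p.2 :=
        Continuous.matrix_fromBlocks (by fun_prop) (by fun_prop) (by fun_prop) (by fun_prop)
      exact this.continuousOn) (fun y hy => isUnit_blockdiag hy.1 hy.2)

theorem isUnit_reindex (e : ι ≃ κ) {A : Matrix ι ι ℂ} (h : IsUnit A) : IsUnit (reindex e e A) := by
  rw [Matrix.isUnit_iff_isUnit_det] at *
  simpa using h

theorem Hm.reindex (e : ι ≃ κ) {f g : X → Matrix ι ι ℂ} (h : Hm (GLs ι) f g) :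
    Hm (GLs κ) (fun x => reindex e e (f x)) (fun x => reindex e e (g x)) :=
  h.comp_left (fun p => Matrix.reindex e e p) (by
    have : Continuous fun p : Matrix ι ι ℂ => Matrix.reindex e e p := by
      simp only [reindex_apply]; exact Continuous.matrix_submatrix continuous_id _ _
    exact this.continuousOn) (fun y hy => isUnit_reindex e hy)

/-- `GL_N(ℂ)` is path connected. -/
theorem Hm.const (A : Matrix ι ι ℂ) (hA : IsUnit A) : Hm (GLs ι) (fun _ : X => A) (fun _ => 1) := by
  let p : Polynomial ℂ := (1 + (Polynomial.X : Polynomial ℂ) • (A - 1).map Polynomial.C : Matrix ι ι (Polynomial ℂ)).det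
  have hp : ∀ t : ℂ, p.eval t = (1 + t • (A - 1)).det := by
    intro t
    have := RingHom.map_det (Polynomial.evalRingHom t) (1 + (Polynomial.X : Polynomial ℂ) • (A - 1).map Polynomial.C : Matrix ι ι (Polynomial ℂ))
    simp only [Polynomial.coe_evalRingHom] at this
    rw [this]; congr 1
    ext i j
    by_cases hij : i = j <;> simp [hij, mul_comm t]
  have hp0 : p ≠ 0 := by
    intro h
    have := hp 0
    rw [h] at this; simp at this
  have hfin : ({z : ℂ | p.IsRoot z}).Countable := (Polynomial.finite_setOfPred_isRoot hp0).countable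
  have hc := hfin.isPathConnected_compl_of_one_lt_rank (by rw [Complex.rank_real_complex]; exact_mod_cast one_lt_two)
  obtain ⟨γ, hγ⟩ := hc.joinedIn 1 (by
    simp only [Set.mem_compl_iff, Set.mem_ofPred_eq, Polynomial.IsRoot, hp]; simpa using ((Matrix.isUnit_iff_isUnit_det _).1 hA).ne_zero) 0 (by
    simp [Polynomial.IsRoot, hp])
  refine ⟨fun t _ => 1 + γ t • (A - 1), by fun_prop, fun t x => ?_, by simp, by simp⟩
  have := hγ t
  simp only [Set.mem_compl_iff, Set.mem_ofPred_eq, Polynomial.IsRoot, hp] at this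
  exact (Matrix.isUnit_iff_isUnit_det _).2 (isUnit_iff_ne_zero.2 this)

end
end CB

namespace CB
open MeasureTheory Matrix
open scoped ContDiff Topology

theorem two_le_inf : (2 : ℕ∞ω) ≤ ∞ := WithTop.coe_le_coe.2 (le_top : (2 : ℕ∞) ≤ ⊤)
theorem one_le_inf : (1 : ℕ∞ω) ≤ ∞ := WithTop.coe_le_coe.2 (le_top : (1 : ℕ∞) ≤ ⊤)

section alg
variable {ι E : Type*} [Fintype ι] [DecidableEq ι] [AddCommGroup E] [Module ℝ E]

theorem cramer_basis (b : Module.Basis ι ℝ E) (v : ι → E) (c : E) :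
    ∑ j, b.det (Function.update v j c) • v j = b.det v • c := by
  apply b.repr.injective
  ext i
  have h := congrFun (Matrix.mulVec_cramer (b.toMatrix v) (b.repr c)) i
  simp only [Matrix.mulVec, dotProduct, Matrix.cramer_apply, ← Module.Basis.toMatrix_update, Pi.smul_apply,
    ← Module.Basis.det_apply, smul_eq_mul, Module.Basis.toMatrix_apply] at h
  simp only [map_sum, map_smul, Finsupp.coe_finset_sum, Finset.sum_apply, Finsupp.smul_apply, smul_eq_mul]
  rw [← h]
  exact Finset.sum_congr rfl fun j _ => mul_comm _ _

theorem update_antisymm (b : Module.Basis ι ℝ E) (v : ι → E) (c w : E) {j k : ι} (hjk : k ≠ j) :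
    b.det (Function.update (Function.update v j c) k w) =
      - b.det (Function.update (Function.update v k c) j w) := by
  rw [← b.det.map_swap _ hjk]
  congr 1
  ext1 i
  simp only [Function.comp]
  by_cases h1 : i = j
  · subst h1; simp [hjk, hjk.symm]
  · by_cases h2 : i = k
    · subst h2; simp [hjk, hjk.symm]
    · rw [Equiv.swap_apply_of_ne_of_ne h2 h1]; simp [h1, h2]

theorem sum_antisymm (b : Module.Basis ι ℝ E) (v : ι → E) (c : E) (B : ι → ι → E)
    (hB : ∀ j k, B j k = B k j) (d : ι → E) :
    ∑ j, ∑ k, b.det (Function.update (Function.update v j c) k (if k = j then d j else B j k)) =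
      ∑ j, b.det (Function.update v j (d j)) := by
  have h1 : ∀ j k, b.det (Function.update (Function.update v j c) k (if k = j then d j else B j k)) =
      (if k = j then b.det (Function.update v j (d j)) else 0) +
      (if k = j then 0 else b.det (Function.update (Function.update v j c) k (B j k))) := by
    intro j k
    by_cases h : k = j
    · subst h; simp
    · simp [h]
  simp only [h1, Finset.sum_add_distrib, Finset.sum_ite_eq', Finset.sum_ite_eq, Finset.mem_univ, if_true]
  have h2 : ∑ j, ∑ k, (if k = j then 0 else b.det (Function.update (Function.update v j c) k (B j k))) =
      - ∑ j, ∑ k, (if k = j then 0 else b.det (Function.update (Function.update v j c) k (B j k))) := by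
    conv_lhs => rw [Finset.sum_comm]
    rw [← Finset.sum_neg_distrib]
    refine Finset.sum_congr rfl fun j _ => ?_
    rw [← Finset.sum_neg_distrib]
    refine Finset.sum_congr rfl fun k _ => ?_
    by_cases h : j = k
    · simp [h]
    · rw [if_neg h, if_neg (Ne.symm h), hB k j, update_antisymm b v c _ h]
  have h3 : ∑ j, ∑ k, (if k = j then 0 else b.det (Function.update (Function.update v j c) k (B j k))) = 0 := by
    linarith
  rw [h3, add_zero]
end alg

section deg
variable {E : Type*} [NormedAddCommGroup E] [NormedSpace ℝ E] [FiniteDimensional ℝ E]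

/-- determinant form of a basis as a continuous multilinear map -/
noncomputable def detC {ι : Type*} [Fintype ι] [DecidableEq ι] (b : Module.Basis ι ℝ E) :
    ContinuousMultilinearMap ℝ (fun _ : ι => E) ℝ :=
  { b.det.toMultilinearMap with
    cont := by
      have : Continuous fun v : ι → E => (b.toMatrix v).det := by
        apply Continuous.matrix_det
        refine continuous_matrix fun i j => ?_
        simp only [Module.Basis.toMatrix_apply]
        have : Continuous fun x : E => b.repr x i :=
          (LinearMap.continuous_of_finiteDimensional ((Finsupp.lapply i).comp b.repr.toLinearMap))
        exact this.comp (continuous_apply j)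
      have h2 : (fun v : ι → E => (b.toMatrix v).det) = b.det := by
        ext v; rw [Module.Basis.det_apply]
      rw [h2] at this; exact this }

@[simp] theorem detC_apply {ι : Type*} [Fintype ι] [DecidableEq ι] (b : Module.Basis ι ℝ E) (v : ι → E) :
    detC b v = b.det v := rfl

theorem pointwise_identity {ι : Type*} [Fintype ι] [DecidableEq ι] (b : Module.Basis ι ℝ E)
    (ρ : E → ℝ) (hρ : ContDiff ℝ ∞ ρ) (Φ : ℝ × E → E) (hΦ : ContDiff ℝ ∞ Φ) (p : ℝ × E) :
    fderiv ℝ (fun p => ρ (Φ p) * b.det (fun i => fderiv ℝ Φ p (0, b i))) p (1, 0) =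
    ∑ j, fderiv ℝ (fun p => ρ (Φ p) * b.det (Function.update (fun i => fderiv ℝ Φ p (0, b i)) j
      (fderiv ℝ Φ p (1, 0)))) p (0, b j) := by
  have hΦd : HasFDerivAt Φ (fderiv ℝ Φ p) p := (hΦ.differentiable (by simp)).differentiableAt.hasFDerivAt
  have hd2 : ContDiff ℝ ∞ (fderiv ℝ Φ) := hΦ.fderiv_right (by simp)
  have hD2 : HasFDerivAt (fderiv ℝ Φ) (fderiv ℝ (fderiv ℝ Φ) p) p :=
    (hd2.differentiable (by simp)).differentiableAt.hasFDerivAt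
  have hρd : HasFDerivAt ρ (fderiv ℝ ρ (Φ p)) (Φ p) :=
    (hρ.differentiable (by simp)).differentiableAt.hasFDerivAt
  have hsym : ∀ u w, fderiv ℝ (fderiv ℝ Φ) p u w = fderiv ℝ (fderiv ℝ Φ) p w u :=
    hΦ.contDiffAt.isSymmSndFDerivAt (by simpa using two_le_inf)
  set B := fderiv ℝ (fderiv ℝ Φ) p with hB
  have hv : ∀ w, HasFDerivAt (fun p => fderiv ℝ Φ p w) (B.flip w) p := fun w => by
    have := hD2.clm_apply (hasFDerivAt_const w p)
    simpa using this
  have hρΦ : HasFDerivAt (fun p => ρ (Φ p)) ((fderiv ℝ ρ (Φ p)).comp (fderiv ℝ Φ p)) p := hρd.comp p hΦd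
  have e0 : fderiv ℝ (fun p => ρ (Φ p) * b.det (fun i => fderiv ℝ Φ p (0, b i))) p (1, 0) =
      ρ (Φ p) * (∑ i, b.det (Function.update (fun i => fderiv ℝ Φ p (0, b i)) i (B (1,0) (0, b i)))) +
      b.det (fun i => fderiv ℝ Φ p (0, b i)) * fderiv ℝ ρ (Φ p) (fderiv ℝ Φ p (1, 0)) := by
    have h1 := HasFDerivAt.multilinear_comp (detC b) (g := fun i p => fderiv ℝ Φ p (0, b i)) (fun i => hv (0, b i))
    have h2 := (hρΦ.mul h1).fderiv
    simp only [detC_apply] at h2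
    change fderiv ℝ ((fun p => ρ (Φ p)) * (fun p => b.det (fun i => fderiv ℝ Φ p (0, b i)))) p (1, 0) = _
    rw [h2]
    simp
  have ej : ∀ j, fderiv ℝ (fun p => ρ (Φ p) * b.det (Function.update (fun i => fderiv ℝ Φ p (0, b i)) j
      (fderiv ℝ Φ p (1, 0)))) p (0, b j) =
      ρ (Φ p) * (∑ k, b.det (Function.update (Function.update (fun i => fderiv ℝ Φ p (0, b i)) j (fderiv ℝ Φ p (1, 0))) k 
        (if k = j then B (0, b j) (1, 0) else B (0, b j) (0, b k)))) +
      b.det (Function.update (fun i => fderiv ℝ Φ p (0, b i)) j (fderiv ℝ Φ p (1, 0))) * fderiv ℝ ρ (Φ p) (fderiv ℝ Φ p (0, b j)) := by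
    intro j
    have hu : ∀ p, (Function.update (fun i => fderiv ℝ Φ p (0, b i)) j (fderiv ℝ Φ p (1, 0))) =
        fun i => fderiv ℝ Φ p (if i = j then (1,0) else (0, b i)) := by
      intro p; ext1 i; by_cases h : i = j
      · subst h; simp
      · simp [h]
    have h1 := HasFDerivAt.multilinear_comp (detC b) (g := fun i p => fderiv ℝ Φ p (if i = j then (1,0) else (0, b i)))
      (fun i => hv (if i = j then (1,0) else (0, b i)))
    have h2 := (hρΦ.mul h1).fderiv
    simp only [detC_apply] at h2
    simp only [hu]
    change fderiv ℝ ((fun p => ρ (Φ p)) * (fun p => b.det (fun i => fderiv ℝ Φ p (if i = j then (1,0) else (0, b i))))) p (0, b j) = _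
    rw [h2]
    simp only [_root_.add_apply, FunLike.coe_add, Pi.add_apply, FunLike.coe_smul, Pi.smul_apply, smul_eq_mul,
      ContinuousLinearMap.coe_sum', Finset.sum_apply, ContinuousLinearMap.comp_apply,
      ContinuousMultilinearMap.toContinuousLinearMap_apply, detC_apply, ContinuousLinearMap.flip_apply]
    congr 2
    refine Finset.sum_congr rfl fun k _ => ?_
    congr 2
    split_ifs <;> rfl
  rw [e0]
  simp only [ej, Finset.sum_add_distrib, ← Finset.mul_sum]
  rw [sum_antisymm b _ _ (fun j k => B (0, b j) (0, b k)) (fun j k => hsym _ _) (fun j => B (0, b j) (1, 0))]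
  simp only [hsym (0, b _) (1, 0)]
  congr 1
  have := congrArg (fderiv ℝ ρ (Φ p)) (cramer_basis b (fun i => fderiv ℝ Φ p (0, b i)) (fderiv ℝ Φ p (1, 0)))
  simp only [map_sum, map_smul, smul_eq_mul] at this
  exact this.symm
end deg
end CB

namespace CB
open MeasureTheory Matrix
open scoped ContDiff Topology

section deg
variable {E : Type*} [NormedAddCommGroup E] [NormedSpace ℝ E] [FiniteDimensional ℝ E]
  [MeasurableSpace E] [BorelSpace E]

theorem integral_fderiv_zero (μ : Measure E) [μ.IsAddHaarMeasure] (g : E → ℝ) (hg : ContDiff ℝ 1 g) (hc : HasCompactSupport g) (v : E) :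
    ∫ x, fderiv ℝ g x v ∂μ = 0 := by
  have hc' : HasCompactSupport (fun x => fderiv ℝ g x v) := hc.fderiv_apply ℝ v
  have hcont : Continuous (fun x => fderiv ℝ g x v) :=
    (hg.continuous_fderiv (by simp)).clm_apply continuous_const
  have := integral_mul_fderiv_eq_neg_fderiv_mul_of_integrable (μ := μ) (f := fun _ : E => (1:ℝ)) (g := g) (v := v)
    (by simp) (by simpa using hcont.integrable_of_hasCompactSupport hc')
    (by simpa using hg.continuous.integrable_of_hasCompactSupport hc)
    (fun x _ => by fun_prop) (fun x _ => (hg.differentiable (by simp)).differentiableAt)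
  simpa using this

/-- the analytic degree integral -/
noncomputable def Dg (μ : Measure E) (ρ : E → ℝ) (P : E → E) : ℝ :=
  ∫ x, ρ (P x) * (fderiv ℝ P x : E →ₗ[ℝ] E).det ∂μ

theorem det_eq_basis {ι : Type*} [Fintype ι] [DecidableEq ι] (b : Module.Basis ι ℝ E) (A : E →ₗ[ℝ] E) :
    A.det = b.det (fun i => A (b i)) := by
  have := b.det_comp A b
  rw [b.det_self, mul_one] at this
  exact this.symm

theorem Dg_homotopy_aux (μ : Measure E) [μ.IsAddHaarMeasure] (ρ : E → ℝ) (hρ : ContDiff ℝ ∞ ρ) (hρ1 : ∀ x, 1 ≤ ‖x‖ → ρ x = 0)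
    (Φ : ℝ × E → E) (hΦ : ContDiff ℝ ∞ Φ) (R : ℝ) (hR : ∀ t x, R ≤ ‖x‖ → 1 ≤ ‖Φ (t, x)‖)
    (h0 : ∀ t x, t ≤ 0 → Φ (t, x) = Φ (0, x)) (h1 : ∀ t x, 1 ≤ t → Φ (t, x) = Φ (1, x)) :
    Dg μ ρ (fun x => Φ (0, x)) = Dg μ ρ (fun x => Φ (1, x)) := by
  classical
  let b := Module.finBasis ℝ E
  let q : ℝ × E → ℝ := fun p => ρ (Φ p) * b.det (fun i => fderiv ℝ Φ p (0, b i))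
  have hdΦ : ContDiff ℝ ∞ (fderiv ℝ Φ) := hΦ.fderiv_right (by simp)
  have hqs : ContDiff ℝ ∞ q := by
    refine (hρ.comp hΦ).mul ?_
    have : ContDiff ℝ ∞ (fun p => (fun i => fderiv ℝ Φ p (0, b i))) := by
      rw [contDiff_pi]; intro i; exact hdΦ.clm_apply contDiff_const
    exact (detC b).contDiff.comp this
  have hXs : ∀ j, ContDiff ℝ ∞ (fun p => ρ (Φ p) * b.det (Function.update (fun i => fderiv ℝ Φ p (0, b i)) j
      (fderiv ℝ Φ p (1, 0)))) := by
    intro j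
    refine (hρ.comp hΦ).mul ?_
    have : ContDiff ℝ ∞ (fun p => Function.update (fun i => fderiv ℝ Φ p (0, b i)) j
      (fderiv ℝ Φ p (1, 0))) := by
      rw [contDiff_pi]; intro i
      by_cases h : i = j
      · subst h; simp only [Function.update_self]; exact hdΦ.clm_apply contDiff_const
      · simp only [Function.update_of_ne h]; exact hdΦ.clm_apply contDiff_const
    exact (detC b).contDiff.comp this
  have hq0 : ∀ t x, R ≤ ‖x‖ → q (t, x) = 0 := fun t x hx => by
    simp only [q]; rw [hρ1 _ (hR t x hx), zero_mul]
  -- spatial derivative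
  have hsl : ∀ t x, fderiv ℝ (fun x => Φ (t, x)) x = (fderiv ℝ Φ (t, x)).comp (ContinuousLinearMap.inr ℝ ℝ E) := by
    intro t x
    have hd : HasFDerivAt Φ (fderiv ℝ Φ (t, x)) (t, x) := (hΦ.differentiable (by simp)).differentiableAt.hasFDerivAt
    exact (hd.comp x (hasFDerivAt_prodMk_right t x)).fderiv
  have hD : ∀ t, Dg μ ρ (fun x => Φ (t, x)) = ∫ x, q (t, x) ∂μ := by
    intro t
    unfold Dg
    refine integral_congr_ae (Filter.Eventually.of_forall fun x => ?_)
    simp only [q]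
    rw [det_eq_basis b, hsl]
    rfl
  let k : ℝ × E → ℝ := fun p => fderiv ℝ q p (1, 0)
  have hk : Continuous k := (hqs.continuous_fderiv (by simp)).clm_apply continuous_const
  have hkt : ∀ t x, HasDerivAt (fun t => q (t, x)) (k (t, x)) t := by
    intro t x
    have hd : HasFDerivAt q (fderiv ℝ q (t, x)) (t, x) := (hqs.differentiable (by simp)).differentiableAt.hasFDerivAt
    have := (hd.comp t (hasFDerivAt_prodMk_left t x)).hasDerivAt
    have e : k (t, x) = ((fderiv ℝ q (t, x)).comp (ContinuousLinearMap.inl ℝ ℝ E)) 1 := by simp [k]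
    rw [e]; exact this
  have hqt0 : ∀ t x, t ≤ 0 → q (t, x) = q (0, x) := by
    intro t x ht
    simp only [q]
    rw [h0 t x ht]
    congr 2; ext1 i
    have e1 := congrArg (fun L : E →L[ℝ] E => L (b i)) (hsl t x)
    have e2 := congrArg (fun L : E →L[ℝ] E => L (b i)) (hsl 0 x)
    simp only [ContinuousLinearMap.comp_apply, ContinuousLinearMap.inr_apply] at e1 e2
    rw [← e1, ← e2]
    have : (fun x => Φ (t, x)) = fun x => Φ (0, x) := by ext1 x; exact h0 t x ht
    rw [this]
  have hqt1 : ∀ t x, 1 ≤ t → q (t, x) = q (1, x) := by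
    intro t x ht
    simp only [q]
    rw [h1 t x ht]
    congr 2; ext1 i
    have e1 := congrArg (fun L : E →L[ℝ] E => L (b i)) (hsl t x)
    have e2 := congrArg (fun L : E →L[ℝ] E => L (b i)) (hsl 1 x)
    simp only [ContinuousLinearMap.comp_apply, ContinuousLinearMap.inr_apply] at e1 e2
    rw [← e1, ← e2]
    have : (fun x => Φ (t, x)) = fun x => Φ (1, x) := by ext1 x; exact h1 t x ht
    rw [this]
  have hkR : ∀ t x, R < ‖x‖ → k (t, x) = 0 := by
    intro t x hx
    have h2 : (fun t => q (t, x)) = fun _ => 0 := by ext1 t; exact hq0 t x hx.le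
    have := hkt t x
    rw [h2] at this
    exact this.unique (hasDerivAt_const t 0)
  have hk0 : ∀ t x, t < 0 → k (t, x) = 0 := by
    intro t x ht
    have h2 : (fun t => q (t, x)) =ᶠ[𝓝 t] fun _ => q (0, x) := by
      filter_upwards [Iio_mem_nhds ht] with s hs using hqt0 s x hs.le
    exact (hkt t x).unique ((hasDerivAt_const t _).congr_of_eventuallyEq h2)
  have hk1 : ∀ t x, 1 < t → k (t, x) = 0 := by
    intro t x ht
    have h2 : (fun t => q (t, x)) =ᶠ[𝓝 t] fun _ => q (1, x) := by
      filter_upwards [Ioi_mem_nhds ht] with s hs using hqt1 s x hs.le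
    exact (hkt t x).unique ((hasDerivAt_const t _).congr_of_eventuallyEq h2)
  have hkc : HasCompactSupport k := by
    refine HasCompactSupport.intro ((isCompact_Icc (a := (0:ℝ)) (b := 1)).prod (isCompact_closedBall (0:E) R)) ?_
    rintro ⟨t, x⟩ hp
    by_contra hne
    apply hp
    refine ⟨⟨?_, ?_⟩, ?_⟩
    · by_contra h; exact hne (hk0 t x (by simpa using h))
    · by_contra h; exact hne (hk1 t x (by simpa using h))
    · simp only [mem_closedBall_zero_iff]; by_contra h; exact hne (hkR t x (by simpa using h))
  have hint_t : ∀ x, ∫ t, k (t, x) = q (1, x) - q (0, x) := by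
    intro x
    refine integral_of_hasDerivAt_of_tendsto (f := fun t => q (t, x)) (fun t => hkt t x) ?_ ?_ ?_
    · refine Continuous.integrable_of_hasCompactSupport (by fun_prop) ?_
      refine HasCompactSupport.intro (isCompact_Icc (a := (0:ℝ)) (b := 1)) ?_
      intro t ht
      simp only [Set.mem_Icc, not_and_or, not_le] at ht
      rcases ht with h | h
      · exact hk0 t x h
      · exact hk1 t x h
    · refine tendsto_const_nhds.congr' ?_
      filter_upwards [Filter.eventually_le_atBot 0] with t ht using (hqt0 t x ht).symm
    · refine tendsto_const_nhds.congr' ?_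
      filter_upwards [Filter.eventually_ge_atTop 1] with t ht using (hqt1 t x ht).symm
  have hint_x : ∀ t, ∫ x, k (t, x) ∂μ = 0 := by
    intro t
    have : ∀ x, k (t, x) = ∑ j, fderiv ℝ (fun x => ρ (Φ (t, x)) * b.det (Function.update (fun i => fderiv ℝ Φ (t, x) (0, b i)) j
      (fderiv ℝ Φ (t, x) (1, 0)))) x (b j) := by
      intro x
      have := pointwise_identity b ρ hρ Φ hΦ (t, x)
      simp only [k, q]
      rw [this]
      refine Finset.sum_congr rfl fun j _ => ?_
      have hd := ((hXs j).differentiable (by simp)).differentiableAt (x := (t, x)) |>.hasFDerivAt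
      have h2 := (hd.comp x (hasFDerivAt_prodMk_right t x)).fderiv
      have h3 := congrArg (fun L : E →L[ℝ] ℝ => L (b j)) h2
      simp only [ContinuousLinearMap.comp_apply, ContinuousLinearMap.inr_apply] at h3
      exact h3.symm
    simp only [this]
    have hXt : ∀ j, ContDiff ℝ 1 (fun x => ρ (Φ (t, x)) * b.det (Function.update (fun i => fderiv ℝ Φ (t, x) (0, b i)) j
      (fderiv ℝ Φ (t, x) (1, 0)))) := fun j => 
        ((hXs j).comp (contDiff_prodMk_right t)).of_le one_le_inf
    have hXc : ∀ j, HasCompactSupport (fun x => ρ (Φ (t, x)) * b.det (Function.update (fun i => fderiv ℝ Φ (t, x) (0, b i)) j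
      (fderiv ℝ Φ (t, x) (1, 0)))) := fun j => by
        refine HasCompactSupport.intro (isCompact_closedBall (0:E) R) fun x hx => ?_
        simp only [mem_closedBall_zero_iff, not_le] at hx
        rw [hρ1 _ (hR t x hx.le), zero_mul]
    rw [integral_finsetSum]
    · exact Finset.sum_eq_zero fun j _ => integral_fderiv_zero μ _ (hXt j) (hXc j) _
    · intro j _
      exact (((hXt j).continuous_fderiv (by simp)).clm_apply continuous_const).integrable_of_hasCompactSupport
        ((hXc j).fderiv_apply ℝ _)
  have hswap := integral_integral_swap_of_hasCompactSupport (μ := (volume : Measure ℝ)) (ν := μ) (f := fun t x => k (t, x)) hk hkc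
  simp only [hint_t, hint_x, integral_zero] at hswap
  have hqi : ∀ t, Integrable (fun x => q (t, x)) μ := fun t => by
    refine Continuous.integrable_of_hasCompactSupport (hqs.continuous.comp (by fun_prop)) ?_
    refine HasCompactSupport.intro (isCompact_closedBall (0:E) R) fun x hx => ?_
    simp only [mem_closedBall_zero_iff, not_le] at hx
    exact hq0 t x hx.le
  rw [integral_sub (hqi 1) (hqi 0)] at hswap
  rw [hD, hD]
  linarith

theorem Dg_homotopy (μ : Measure E) [μ.IsAddHaarMeasure] (ρ : E → ℝ) (hρ : ContDiff ℝ ∞ ρ) (hρ1 : ∀ x, 1 ≤ ‖x‖ → ρ x = 0)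
    (Φ : ℝ × E → E) (hΦ : ContDiff ℝ ∞ Φ) (R : ℝ) (hR : ∀ t x, 0 ≤ t → t ≤ 1 → R ≤ ‖x‖ → 1 ≤ ‖Φ (t, x)‖) :
    Dg μ ρ (fun x => Φ (0, x)) = Dg μ ρ (fun x => Φ (1, x)) := by
  have := Dg_homotopy_aux μ ρ hρ hρ1 (fun p => Φ (Real.smoothTransition p.1, p.2))
    (hΦ.comp (((Real.smoothTransition.contDiff).comp contDiff_fst).prodMk contDiff_snd)) R
    (fun t x hx => hR _ _ (Real.smoothTransition.nonneg _) (Real.smoothTransition.le_one _) hx)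
    (fun t x ht => by simp [Real.smoothTransition.zero_of_nonpos ht])
    (fun t x ht => by simp [Real.smoothTransition.one_of_one_le ht])
  simpa using this
end deg
end CB

namespace CB
open MeasureTheory Matrix
open scoped ContDiff Topology

theorem smooth_approx {E G : Type*} [NormedAddCommGroup E] [NormedSpace ℝ E] [FiniteDimensional ℝ E]
    [NormedAddCommGroup G] [NormedSpace ℝ G] (F : E → G) (hF : Continuous F) (ε : ℝ) (hε : 0 < ε) :
    ∃ P : E → G, ContDiff ℝ ∞ P ∧ ∀ x, ‖P x - F x‖ < ε := by
  obtain ⟨g, hg⟩ := exists_contMDiffMap_forall_mem_convex_of_local_const (n := ⊤) (modelWithCornersSelf ℝ E)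
    (t := fun x : E => Metric.ball (F x) ε) (fun x => convex_ball _ _) (fun x => ⟨F x, by
      have : ∀ᶠ y in 𝓝 x, dist (F y) (F x) < ε := (Metric.tendsto_nhds.1 hF.continuousAt) ε hε
      filter_upwards [this] with y hy
      rw [Metric.mem_ball, dist_comm]; exact hy⟩)
  exact ⟨g, g.contMDiff.contDiff, fun x => by
    have := hg x
    rwa [Metric.mem_ball, dist_eq_norm] at this⟩

/-- smooth bump of integral one supported in the unit ball -/
structure Bmp (E : Type*) [NormedAddCommGroup E] [NormedSpace ℝ E] [MeasureSpace E] where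
  ρ : E → ℝ
  smooth : ContDiff ℝ ∞ ρ
  supp : ∀ x, 1 ≤ ‖x‖ → ρ x = 0
  int : ∫ x, ρ x = 1

section deg
variable {E : Type*} [NormedAddCommGroup E] [NormedSpace ℝ E] [FiniteDimensional ℝ E]
  [MeasureSpace E] [BorelSpace E] [(volume : Measure E).IsAddHaarMeasure]

/-- `F` is bounded away from zero near infinity -/
def Adm (F : E → E) : Prop := Continuous F ∧ ∃ R δ : ℝ, 0 < δ ∧ ∀ x, R ≤ ‖x‖ → δ ≤ ‖F x‖

/-- `P` is a smooth approximation to a multiple of `F` -/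
def IsApp (F P : E → E) : Prop := ContDiff ℝ ∞ P ∧ ∃ l R : ℝ, 0 < l ∧
  ∀ x, R ≤ ‖x‖ → ‖P x - l • F x‖ ≤ l * ‖F x‖ - 1

open Classical in
/-- degree of a map bounded away from zero at infinity -/
noncomputable def dgc (β : Bmp E) (F : E → E) : ℝ :=
  if h : ∃ P, IsApp F P then Dg volume β.ρ h.choose else 0

theorem IsApp.scale {P : E → E} (β : Bmp E) (hP : ContDiff ℝ ∞ P) {R : ℝ} (h1 : ∀ x, R ≤ ‖x‖ → 1 ≤ ‖P x‖)
    {c : ℝ} (hc : 1 ≤ c) : Dg volume β.ρ P = Dg volume β.ρ (fun x => c • P x) := by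
  have := Dg_homotopy volume β.ρ β.smooth β.supp (fun p => (1 + p.1 * (c - 1)) • P p.2)
    (by fun_prop) R (fun t x ht _ hx => by
      rw [norm_smul]
      have h2 := h1 x hx
      have h3 : 1 ≤ 1 + t * (c - 1) := by nlinarith
      rw [Real.norm_of_nonneg (by linarith)]
      nlinarith)
  simpa using this

theorem IsApp.unique {F P Q : E → E} (β : Bmp E) (hP : IsApp F P) (hQ : IsApp F Q) :
    Dg volume β.ρ P = Dg volume β.ρ Q := by
  -- reduce to the same scale
  have key : ∀ {F P Q : E → E} {l R : ℝ}, ContDiff ℝ ∞ P → ContDiff ℝ ∞ Q →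
      (∀ x, R ≤ ‖x‖ → ‖P x - l • F x‖ ≤ l * ‖F x‖ - 1) → (∀ x, R ≤ ‖x‖ → ‖Q x - l • F x‖ ≤ l * ‖F x‖ - 1) → 0 < l →
      Dg volume β.ρ P = Dg volume β.ρ Q := by
    intro F P Q l R hP hQ h1 h2 hl
    have := Dg_homotopy volume β.ρ β.smooth β.supp (fun p => (1 - p.1) • P p.2 + p.1 • Q p.2)
      (by fun_prop) R (fun t x ht ht' hx => by
        have e : (1 - t) • P x + t • Q x = l • F x + ((1 - t) • (P x - l • F x) + t • (Q x - l • F x)) := by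
          module
        have h3 : ‖(1 - t) • (P x - l • F x) + t • (Q x - l • F x)‖ ≤ l * ‖F x‖ - 1 := by
          refine (norm_add_le _ _).trans ?_
          rw [norm_smul, norm_smul, Real.norm_of_nonneg ht, Real.norm_of_nonneg (by linarith : 0 ≤ 1 - t)]
          nlinarith [h1 x hx, h2 x hx]
        have h4 : ‖l • F x‖ = l * ‖F x‖ := by rw [norm_smul, Real.norm_of_nonneg hl.le]
        have h5 := norm_sub_le ((1 - t) • P x + t • Q x) ((1 - t) • (P x - l • F x) + t • (Q x - l • F x))
        have h6 : ((1 - t) • P x + t • Q x) - ((1 - t) • (P x - l • F x) + t • (Q x - l • F x)) = l • F x := by module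
        rw [h6, h4] at h5
        linarith)
    simpa using this
  obtain ⟨hPs, l, R, hl, h1⟩ := hP
  obtain ⟨hQs, l', R', hl', h2⟩ := hQ
  have scale : ∀ {P : E → E} {l R m : ℝ}, ContDiff ℝ ∞ P → 0 < l → l ≤ m → 
      (∀ x, R ≤ ‖x‖ → ‖P x - l • F x‖ ≤ l * ‖F x‖ - 1) → Dg volume β.ρ P = Dg volume β.ρ (fun x => (m / l) • P x) ∧
      (∀ x, R ≤ ‖x‖ → ‖(m / l) • P x - m • F x‖ ≤ m * ‖F x‖ - 1) := by
    intro P l R m hP hl hm h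
    have hml : 1 ≤ m / l := by rwa [one_le_div hl]
    refine ⟨IsApp.scale (R := R) β hP (fun x hx => ?_) hml, fun x hx => ?_⟩
    · have := norm_sub_norm_le (l • F x) (P x)
      rw [norm_smul, Real.norm_of_nonneg hl.le, norm_sub_rev] at this
      linarith [h x hx]
    · have e : (m / l) • P x - m • F x = (m / l) • (P x - l • F x) := by
        rw [smul_sub, smul_smul, div_mul_cancel₀ _ hl.ne']
      rw [e, norm_smul, Real.norm_of_nonneg (by linarith)]
      have h3 := mul_le_mul_of_nonneg_left (h x hx) (by linarith : 0 ≤ m / l)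
      have h4 : m / l * (l * ‖F x‖ - 1) = m * ‖F x‖ - m / l := by field_simp
      linarith
  obtain ⟨e1, g1⟩ := scale hPs hl (le_max_left l l') h1
  obtain ⟨e2, g2⟩ := scale hQs hl' (le_max_right l l') h2
  rw [e1, e2]
  refine key (F := F) (l := max l l') (R := max R R') (by fun_prop) (by fun_prop) (fun x hx => g1 x ((le_max_left _ _).trans hx))
    (fun x hx => g2 x ((le_max_right _ _).trans hx)) (lt_max_of_lt_left hl)

theorem dgc_eq {F P : E → E} (β : Bmp E) (hP : IsApp F P) : dgc β F = Dg volume β.ρ P := by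
  have h : ∃ P, IsApp F P := ⟨P, hP⟩
  unfold dgc
  rw [dif_pos h]
  exact IsApp.unique β h.choose_spec hP

/-- approximations within `δ/2` work after scaling by `2/δ` -/
theorem isApp_of_close {F P : E → E} {R δ : ℝ} (hδ : 0 < δ) (hP : ContDiff ℝ ∞ P) (hF : ∀ x, R ≤ ‖x‖ → δ ≤ ‖F x‖)
    (hPF : ∀ x, R ≤ ‖x‖ → ‖P x - F x‖ ≤ δ / 2) : IsApp F (fun x => (2 / δ) • P x) := by
  refine ⟨by fun_prop, 2 / δ, R, by positivity, fun x hx => ?_⟩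
  rw [← smul_sub, norm_smul, Real.norm_of_nonneg (by positivity)]
  have h1 := hF x hx
  have h2 := hPF x hx
  have h3 : 2 / δ * ‖P x - F x‖ ≤ 1 := by
    calc 2 / δ * ‖P x - F x‖ ≤ 2 / δ * (δ / 2) := by gcongr
      _ = 1 := by field_simp
  have h4 : 2 ≤ 2 / δ * ‖F x‖ := by
    calc (2:ℝ) = 2 / δ * δ := by field_simp
      _ ≤ _ := by gcongr
  linarith

theorem dgc_homotopy (β : Bmp E) (H : ℝ → E → E) (hH : Continuous (fun p : ℝ × E => H p.1 p.2))
    (R δ : ℝ) (hδ : 0 < δ) (h : ∀ t x, 0 ≤ t → t ≤ 1 → R ≤ ‖x‖ → δ ≤ ‖H t x‖) :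
    dgc β (H 0) = dgc β (H 1) := by
  obtain ⟨P, hP, hPH⟩ := smooth_approx (fun p : ℝ × E => H p.1 p.2) hH (δ / 2) (by positivity)
  have hPt : ∀ t, ContDiff ℝ ∞ (fun x => P (t, x)) := fun t => hP.comp (contDiff_prodMk_right t)
  rw [dgc_eq β (isApp_of_close hδ (hPt 0) (fun x hx => h 0 x le_rfl zero_le_one hx) (fun x _ => (hPH (0, x)).le)),
    dgc_eq β (isApp_of_close hδ (hPt 1) (fun x hx => h 1 x zero_le_one le_rfl hx) (fun x _ => (hPH (1, x)).le))]
  refine Dg_homotopy volume β.ρ β.smooth β.supp (fun p => (2 / δ) • P p) (by fun_prop) R (fun t x ht ht' hx => ?_)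
  rw [norm_smul, Real.norm_of_nonneg (by positivity)]
  have h1 := norm_sub_norm_le (H t x) (P (t, x))
  rw [norm_sub_rev] at h1
  have h2 := hPH (t, x)
  have h3 := h t x ht ht' hx
  have : δ / 2 ≤ ‖P (t, x)‖ := by simp only at h2; linarith
  calc (1:ℝ) = 2 / δ * (δ / 2) := by field_simp
    _ ≤ _ := by gcongr

theorem dgc_smooth (β : Bmp E) {P : E → E} (hP : ContDiff ℝ ∞ P) {R : ℝ} (h : ∀ x, R ≤ ‖x‖ → 1 ≤ ‖P x‖) :
    dgc β P = Dg volume β.ρ P := by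
  refine dgc_eq β ⟨hP, 1, R, one_pos, fun x hx => ?_⟩
  have := h x hx
  simpa using this

theorem dgc_id (β : Bmp E) : dgc β (fun x => x) = 1 := by
  rw [dgc_smooth (P := fun x : E => x) β contDiff_fun_id (R := 1) (fun x hx => hx)]
  unfold Dg
  have h1 : ∀ x : E, fderiv ℝ (fun x : E => x) x = ContinuousLinearMap.id ℝ E := fun x => fderiv_fun_id
  have : ∀ x : E, ((fderiv ℝ (fun x : E => x) x : E →L[ℝ] E) : E →ₗ[ℝ] E).det = 1 := by
    intro x
    rw [h1, ContinuousLinearMap.coe_id, LinearMap.det_id]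
  simp only [this, mul_one, β.int]

/-- additivity under cutting along a hyperplane; the hyperplane is thickened by a collapsing map -/
theorem dgc_split_aux (β : Bmp E) (ℓ : E →L[ℝ] ℝ) {F F1 F2 : E → E} (hF1 : Adm F1) (hF2 : Adm F2)
    (e1 : ∀ x, ℓ x ≤ 1 → F x = F1 x) (e2 : ∀ x, -1 ≤ ℓ x → F x = F2 x)
    {δ : ℝ} (hδ : 0 < δ) (n1 : ∀ x, -1 ≤ ℓ x → δ ≤ ‖F1 x‖) (n2 : ∀ x, ℓ x ≤ 1 → δ ≤ ‖F2 x‖) :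
    dgc β F = dgc β F1 + dgc β F2 := by
  obtain ⟨c1, R1, δ1, hδ1, a1⟩ := hF1
  obtain ⟨c2, R2, δ2, hδ2, a2⟩ := hF2
  let ε := min δ (min δ1 δ2)
  have hε : 0 < ε := by simp [ε, hδ, hδ1, hδ2]
  have hε0 : ε ≤ δ := min_le_left _ _
  have hε1 : ε ≤ δ1 := (min_le_right _ _).trans (min_le_left _ _)
  have hε2 : ε ≤ δ2 := (min_le_right _ _).trans (min_le_right _ _)
  obtain ⟨P1, hP1, hq1⟩ := smooth_approx F1 c1 (ε / 2) (by positivity)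
  obtain ⟨P2, hP2, hq2⟩ := smooth_approx F2 c2 (ε / 2) (by positivity)
  let χ : E → ℝ := fun x => Real.smoothTransition ((ℓ x + 1) / 2)
  have hχ : ContDiff ℝ ∞ χ := Real.smoothTransition.contDiff.comp (by fun_prop)
  let P : E → E := fun x => (1 - χ x) • P1 x + χ x • P2 x
  have hP : ContDiff ℝ ∞ P := by fun_prop
  have χ0 : ∀ x, ℓ x ≤ -1 → χ x = 0 := fun x hx => Real.smoothTransition.zero_of_nonpos (by linarith)
  have χ1 : ∀ x, 1 ≤ ℓ x → χ x = 1 := fun x hx => Real.smoothTransition.one_of_one_le (by linarith)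
  have hPF : ∀ x, ‖P x - F x‖ ≤ ε / 2 := by
    intro x
    by_cases h1 : ℓ x ≤ -1
    · simp only [P, χ0 x h1, e1 x (by linarith)]; simpa using (hq1 x).le
    · by_cases h2 : 1 ≤ ℓ x
      · simp only [P, χ1 x h2, e2 x (by linarith)]; simpa using (hq2 x).le
      · have e : P x - F x = (1 - χ x) • (P1 x - F1 x) + χ x • (P2 x - F2 x) := by
          rw [← e1 x (by linarith), ← e2 x (by linarith)]; simp only [P]; module
        rw [e]
        have hx0 : 0 ≤ χ x := Real.smoothTransition.nonneg _
        have hx1 : χ x ≤ 1 := Real.smoothTransition.le_one _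
        refine (norm_add_le _ _).trans ?_
        rw [norm_smul, norm_smul, Real.norm_of_nonneg hx0, Real.norm_of_nonneg (by linarith : 0 ≤ 1 - χ x)]
        nlinarith [hq1 x, hq2 x]
  have hFn : ∀ x, max R1 R2 ≤ ‖x‖ → ε ≤ ‖F x‖ := by
    intro x hx
    by_cases h : ℓ x ≤ 1
    · rw [e1 x h]; exact hε1.trans (a1 x ((le_max_left _ _).trans hx))
    · rw [e2 x (by linarith)]; exact hε2.trans (a2 x ((le_max_right _ _).trans hx))
  have A1 := isApp_of_close (F := F1) (P := P1) hε hP1 (fun x hx => hε1.trans (a1 x hx)) (fun x _ => (hq1 x).le)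
  have A2 := isApp_of_close (F := F2) (P := P2) hε hP2 (fun x hx => hε2.trans (a2 x hx)) (fun x _ => (hq2 x).le)
  have A := isApp_of_close (F := F) (P := P) hε hP hFn (fun x _ => hPF x)
  rw [dgc_eq β A1, dgc_eq β A2, dgc_eq β A]
  have hrho : ∀ {F P : E → E} (x : E), ‖P x - F x‖ ≤ ε / 2 → ε ≤ ‖F x‖ → β.ρ ((2 / ε) • P x) = 0 := by
    intro F P x h1 h2
    apply β.supp
    rw [norm_smul, Real.norm_of_nonneg (by positivity)]
    have h3 := norm_sub_norm_le (F x) (P x)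
    rw [norm_sub_rev] at h3
    have : ε / 2 ≤ ‖P x‖ := by linarith
    calc (1:ℝ) = 2 / ε * (ε / 2) := by field_simp
      _ ≤ _ := by gcongr
  have hIntg : ∀ {F P : E → E} {R : ℝ}, ContDiff ℝ ∞ P → (∀ x, ‖P x - F x‖ ≤ ε / 2) → (∀ x, R ≤ ‖x‖ → ε ≤ ‖F x‖) →
      Integrable (fun x => β.ρ ((2 / ε) • P x) * (fderiv ℝ (fun x => (2 / ε) • P x) x : E →ₗ[ℝ] E).det) := by
    intro F P R hP h1 h2
    have hP' : ContDiff ℝ ∞ (fun x => (2 / ε) • P x) := by fun_prop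
    refine Continuous.integrable_of_hasCompactSupport ?_ ?_
    · refine (β.smooth.continuous.comp hP'.continuous).mul ?_
      have hd : Continuous (fderiv ℝ (fun x => (2 / ε) • P x)) := hP'.continuous_fderiv (by simp)
      exact ContinuousLinearMap.continuous_det.comp hd
    · refine HasCompactSupport.intro (isCompact_closedBall (0:E) R) fun x hx => ?_
      simp only [mem_closedBall_zero_iff, not_le] at hx
      rw [hrho x (h1 x) (h2 x hx.le), zero_mul]
  unfold Dg
  rw [← integral_add (hIntg (F := F1) hP1 (fun x => (hq1 x).le) (fun x hx => hε1.trans (a1 x hx)))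
    (hIntg (F := F2) hP2 (fun x => (hq2 x).le) (fun x hx => hε2.trans (a2 x hx)))]
  refine integral_congr_ae (Filter.Eventually.of_forall fun x => ?_)
  simp only
  by_cases h1 : ℓ x < -1
  · rw [hrho (F := F2) (P := P2) x (hq2 x).le (hε0.trans (n2 x (by linarith))), zero_mul, add_zero]
    have : (fun x => (2 / ε) • P x) =ᶠ[𝓝 x] fun x => (2 / ε) • P1 x := by
      filter_upwards [(ℓ.continuous.isOpen_preimage _ isOpen_Iio).mem_nhds h1] with y hy
      have : ℓ y < -1 := hy
      simp [P, χ0 y this.le]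
    rw [this.fderiv_eq]
    congr 2
    exact this.self_of_nhds
  · by_cases h2 : 1 < ℓ x
    · rw [hrho (F := F1) (P := P1) x (hq1 x).le (hε0.trans (n1 x (by linarith))), zero_mul, zero_add]
      have : (fun x => (2 / ε) • P x) =ᶠ[𝓝 x] fun x => (2 / ε) • P2 x := by
        filter_upwards [(ℓ.continuous.isOpen_preimage _ isOpen_Ioi).mem_nhds h2] with y hy
        have : 1 < ℓ y := hy
        simp [P, χ1 y this.le]
      rw [this.fderiv_eq]
      congr 2
      exact this.self_of_nhds
    · rw [hrho (F := F1) (P := P1) x (hq1 x).le (hε0.trans (n1 x (by linarith))),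
        hrho (F := F2) (P := P2) x (hq2 x).le (hε0.trans (n2 x (by linarith))),
        hrho (F := F) (P := P) x (hPF x) ?_]
      · ring
      · rw [e1 x (by linarith)]; exact hε0.trans (n1 x (by linarith))

end deg
end CB

namespace CB
open MeasureTheory Matrix
open scoped ContDiff Topology

section prod
variable {E : Type*} [NormedAddCommGroup E] [NormedSpace ℝ E] [FiniteDimensional ℝ E]
  [MeasureSpace E] [BorelSpace E] [(volume : Measure E).IsAddHaarMeasure]
variable {G : Type*} [NormedAddCommGroup G] [NormedSpace ℝ G] [FiniteDimensional ℝ G]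
  [MeasureSpace G] [BorelSpace G] [(volume : Measure G).IsAddHaarMeasure]

/-- product bump -/
noncomputable def Bmp.prod (β : Bmp E) (β' : Bmp G) : Bmp (E × G) where
  ρ p := β.ρ p.1 * β'.ρ p.2
  smooth := (β.smooth.comp contDiff_fst).mul (β'.smooth.comp contDiff_snd)
  supp p hp := by
    rw [Prod.norm_def, le_max_iff] at hp
    rcases hp with h | h
    · rw [β.supp _ h, zero_mul]
    · rw [β'.supp _ h, mul_zero]
  int := by
    have := integral_prod_mul (μ := (volume : Measure E)) (ν := (volume : Measure G)) β.ρ β'.ρ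
    rw [β.int, β'.int, mul_one] at this
    exact this

instance : (volume : Measure (E × G)).IsAddHaarMeasure :=
  inferInstanceAs ((volume : Measure E).prod (volume : Measure G)).IsAddHaarMeasure

theorem dgc_prod (β : Bmp E) (β' : Bmp G) {F : E → E} {F' : G → G} (hF : Adm F) (hF' : Adm F') :
    dgc (β.prod β') (fun p : E × G => (F p.1, F' p.2)) = dgc β F * dgc β' F' := by
  obtain ⟨c1, R1, δ1, hδ1, a1⟩ := hF
  obtain ⟨c2, R2, δ2, hδ2, a2⟩ := hF'
  let ε := min δ1 δ2
  have hε : 0 < ε := lt_min hδ1 hδ2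
  have hε1 : ε ≤ δ1 := min_le_left _ _
  have hε2 : ε ≤ δ2 := min_le_right _ _
  obtain ⟨P1, hP1, hq1⟩ := smooth_approx F c1 (ε / 2) (by positivity)
  obtain ⟨P2, hP2, hq2⟩ := smooth_approx F' c2 (ε / 2) (by positivity)
  rw [dgc_eq β (isApp_of_close hε hP1 (fun x hx => hε1.trans (a1 x hx)) (fun x _ => (hq1 x).le)),
    dgc_eq β' (isApp_of_close hε hP2 (fun x hx => hε2.trans (a2 x hx)) (fun x _ => (hq2 x).le)),
    dgc_eq (β.prod β') (isApp_of_close (P := fun p : E × G => (P1 p.1, P2 p.2)) (R := max R1 R2) hε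
      ((hP1.comp contDiff_fst).prodMk (hP2.comp contDiff_snd)) (fun x hx => ?_) (fun x _ => ?_))]
  · unfold Dg
    rw [← integral_prod_mul]
    change ∫ x : E × G, _ = ∫ x : E × G, _
    refine integral_congr_ae (Filter.Eventually.of_forall fun p => ?_)
    simp only
    have h1 : HasFDerivAt (fun x => (2 / ε) • P1 x) (fderiv ℝ (fun x => (2 / ε) • P1 x) p.1) p.1 :=
      ((hP1.const_smul (2 / ε)).differentiable (by simp) p.1).hasFDerivAt
    have h2 : HasFDerivAt (fun x => (2 / ε) • P2 x) (fderiv ℝ (fun x => (2 / ε) • P2 x) p.2) p.2 :=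
      ((hP2.const_smul (2 / ε)).differentiable (by simp) p.2).hasFDerivAt
    have h3 : HasFDerivAt (fun x : E × G => (2 / ε) • (P1 x.1, P2 x.2)) _ p := HasFDerivAt.prodMap p h1 h2
    rw [h3.fderiv]
    rw [show ((((fderiv ℝ (fun x => (2 / ε) • P1 x) p.1).prodMap (fderiv ℝ (fun x => (2 / ε) • P2 x) p.2)) :
        E × G →L[ℝ] E × G) : E × G →ₗ[ℝ] E × G) =
        LinearMap.prodMap (fderiv ℝ (fun x => (2 / ε) • P1 x) p.1 : E →ₗ[ℝ] E)
        (fderiv ℝ (fun x => (2 / ε) • P2 x) p.2 : G →ₗ[ℝ] G) from rfl, LinearMap.det_prodMap]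
    change β.ρ ((2 / ε) • P1 p.1) * β'.ρ ((2 / ε) • P2 p.2) * _ = _
    ring
  · rw [Prod.norm_def] at *
    have : R1 ≤ ‖x.1‖ ∨ R2 ≤ ‖x.2‖ := by
      by_contra! h
      have := max_lt_max h.1 h.2
      linarith
    rcases this with h | h
    · exact le_max_of_le_left (hε1.trans (a1 _ h))
    · exact le_max_of_le_right (hε2.trans (a2 _ h))
  · rw [Prod.norm_def]
    exact max_le (hq1 _).le (hq2 _).le

/-- transport along a linear isomorphism -/
theorem dgc_transport (L : G ≃L[ℝ] E) (hL : ∀ v, ‖v‖ ≤ ‖L v‖) (β : Bmp E) :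
    ∃ β' : Bmp G, ∀ F : E → E, Adm F → dgc β' (fun v => L.symm (F (L v))) = dgc β F := by
  obtain ⟨c, hc⟩ : ∃ c : ℝ, ∀ f : E → ℝ, ∫ x, f x = c * ∫ v, f (L v) := by
    have hH : (Measure.map L (volume : Measure G)).IsAddHaarMeasure := L.isAddHaarMeasure_map _
    have h1 := Measure.isAddLeftInvariant_eq_smul (volume : Measure E) (Measure.map L (volume : Measure G))
    refine ⟨(Measure.addHaarScalarFactor (volume : Measure E) (Measure.map L (volume : Measure G)) : NNReal), fun f => ?_⟩
    conv_lhs => rw [h1]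
    rw [integral_smul_nnreal_measure]
    have hme : MeasurableEmbedding (L : G → E) := L.toHomeomorph.measurableEmbedding
    rw [hme.integral_map]
    rfl
  let β' : Bmp G := ⟨fun v => c * β.ρ (L v), by
    have := β.smooth.comp L.contDiff
    exact contDiff_const.mul this, fun v hv => by rw [β.supp _ (hv.trans (hL v)), mul_zero], by
    rw [integral_const_mul, ← hc, β.int]⟩
  refine ⟨β', ?_⟩
  rintro F ⟨cF, R, δ, hδ, a⟩
  have hLs : ∀ w, ‖L.symm w‖ ≤ ‖w‖ := fun w => by simpa using hL (L.symm w)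
  let M := max 1 ‖(L : G →L[ℝ] E)‖
  have hM : 0 < M := lt_max_of_lt_left one_pos
  have hLM : ∀ v, ‖L v‖ ≤ M * ‖v‖ := fun v =>
    ((L : G →L[ℝ] E).le_opNorm v).trans (by gcongr; exact le_max_right _ _)
  let ε := δ / M
  have hε : 0 < ε := by positivity
  have hεδ : ε ≤ δ := div_le_self hδ.le (le_max_left _ _)
  obtain ⟨P, hP, hq⟩ := smooth_approx F cF (ε / 2) (by positivity)
  rw [dgc_eq β (isApp_of_close hε hP (fun x hx => hεδ.trans (a x hx)) (fun x _ => (hq x).le)),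
    dgc_eq β' (isApp_of_close (P := fun v => L.symm (P (L v))) (R := R) hε
      (L.symm.contDiff.comp (hP.comp L.contDiff)) (fun v hv => ?_) (fun v _ => ?_))]
  · unfold Dg
    rw [hc, ← integral_const_mul]
    refine integral_congr_ae (Filter.Eventually.of_forall fun v => ?_)
    simp only
    have h1 : HasFDerivAt (fun x => (2 / ε) • P x) (fderiv ℝ (fun x => (2 / ε) • P x) (L v)) (L v) :=
      ((hP.const_smul (2 / ε)).differentiable (by simp) (L v)).hasFDerivAt
    have h2 : HasFDerivAt (fun v => (2 / ε) • L.symm (P (L v))) 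
      ((L.symm : E →L[ℝ] G).comp ((fderiv ℝ (fun x => (2 / ε) • P x) (L v)).comp (L : G →L[ℝ] E))) v := by
      have := (L.symm : E →L[ℝ] G).hasFDerivAt.comp v (h1.comp v (L : G →L[ℝ] E).hasFDerivAt)
      refine this.congr_of_eventuallyEq (Filter.Eventually.of_forall fun w => ?_)
      simp
    rw [h2.fderiv]
    have h3 : ((((L.symm : E →L[ℝ] G).comp ((fderiv ℝ (fun x => (2 / ε) • P x) (L v)).comp (L : G →L[ℝ] E))) :
      G →L[ℝ] G) : G →ₗ[ℝ] G).det = (fderiv ℝ (fun x => (2 / ε) • P x) (L v) : E →ₗ[ℝ] E).det := by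
      have := LinearMap.det_conj (fderiv ℝ (fun x => (2 / ε) • P x) (L v) : E →ₗ[ℝ] E) L.symm.toLinearEquiv
      rw [← this]; rfl
    rw [h3]
    simp only [β', map_smul, ContinuousLinearEquiv.apply_symm_apply]
    ring
  · have h1 := a (L v) (hv.trans (hL v))
    have h2 := hLM (L.symm (F (L v)))
    rw [ContinuousLinearEquiv.apply_symm_apply] at h2
    rw [div_le_iff₀ hM]; linarith
  · rw [← map_sub]; exact (hLs _).trans (hq _).le

end prod
end CB

namespace CB
open MeasureTheory Matrix
open scoped ContDiff Topology

noncomputable def rad0 (s : ℝ) : ℝ := Real.smoothTransition (1 - s ^ 2)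

theorem rad0_zero {s : ℝ} (h : 1 ≤ s) : rad0 s = 0 := Real.smoothTransition.zero_of_nonpos (by nlinarith)

theorem rad0_smooth : ContDiff ℝ ∞ (fun z : ℂ => rad0 ‖z‖) := by
  unfold rad0
  refine Real.smoothTransition.contDiff.comp ?_
  exact contDiff_const.sub (contDiff_norm_sq ℝ)

theorem rad0_cont : Continuous rad0 := by unfold rad0; fun_prop

theorem rad0_int_pos : 0 < ∫ z : ℂ, rad0 ‖z‖ := by
  refine integral_pos_of_integrable_nonneg_nonzero (x := 0) rad0_smooth.continuous ?_ (fun z => Real.smoothTransition.nonneg _) ?_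
  · refine Continuous.integrable_of_hasCompactSupport rad0_smooth.continuous ?_
    refine HasCompactSupport.intro (isCompact_closedBall (0:ℂ) 1) fun x hx => ?_
    simp only [mem_closedBall_zero_iff, not_le] at hx
    exact rad0_zero hx.le
  · simp [rad0, Real.smoothTransition.one_of_one_le]

noncomputable def bumpC : Bmp ℂ where
  ρ z := (∫ z : ℂ, rad0 ‖z‖)⁻¹ * rad0 ‖z‖
  smooth := contDiff_const.mul rad0_smooth
  supp z hz := by rw [rad0_zero hz, mul_zero]
  int := by rw [integral_const_mul]; exact inv_mul_cancel₀ rad0_int_pos.ne'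

theorem det_smulRight (a : ℂ) :
    (((ContinuousLinearMap.toSpanSingleton ℂ a).restrictScalars ℝ : ℂ →L[ℝ] ℂ) : ℂ →ₗ[ℝ] ℂ).det = ‖a‖ ^ 2 := by
  rw [← LinearMap.det_toMatrix Complex.basisOneI, Matrix.det_fin_two]
  simp [LinearMap.toMatrix_apply, Complex.sq_norm, Complex.normSq_apply]

theorem rad0_int (n : ℕ) (hn : n ≠ 0) :
    ∫ z : ℂ, rad0 (‖z‖ ^ n) * (n ^ 2 * ‖z‖ ^ (2 * (n - 1))) = n * ∫ z : ℂ, rad0 ‖z‖ := by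
  have h1 := integral_fun_norm_addHaar (volume : Measure ℂ) (fun r : ℝ => rad0 (r ^ n) * (n ^ 2 * r ^ (2 * (n - 1))))
  have h2 := integral_fun_norm_addHaar (volume : Measure ℂ) (fun r : ℝ => rad0 r)
  rw [h1, h2]
  have h3 := integral_comp_rpow_Ioi (fun r : ℝ => r * rad0 r) (p := n) (by exact_mod_cast hn)
  simp only [Complex.finrank_real_complex, smul_eq_mul, nsmul_eq_mul]
  have h4 : ∫ y in Set.Ioi (0:ℝ), y ^ (2 - 1) * (rad0 (y ^ n) * (n ^ 2 * y ^ (2 * (n - 1)))) =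
      n * ∫ y in Set.Ioi (0:ℝ), y ^ (2 - 1) * rad0 y := by
    have h5 : ∫ y in Set.Ioi (0:ℝ), y ^ (2 - 1) * rad0 y = ∫ y in Set.Ioi (0:ℝ), y * rad0 y := by simp
    rw [h5, ← h3, ← integral_const_mul]
    refine setIntegral_congr_fun measurableSet_Ioi fun y hy => ?_
    have hy : 0 < y := hy
    simp only [smul_eq_mul, Nat.abs_cast, Real.rpow_natCast]
    have h6 : y ^ ((n : ℝ) - 1) = y ^ (n - 1) := by
      rw [← Real.rpow_natCast]; congr 1
      rw [Nat.cast_sub (Nat.one_le_iff_ne_zero.2 hn)]; simp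
    rw [h6]
    obtain ⟨k, rfl⟩ := Nat.exists_eq_succ_of_ne_zero hn
    simp only [Nat.succ_eq_add_one, Nat.add_sub_cancel]
    ring
  rw [h4]; ring

theorem dgc_conj_pow (n : ℕ) (hn : n ≠ 0) : dgc bumpC (fun z : ℂ => (starRingEnd ℂ z) ^ n) = -n := by
  have hcd : ContDiff ℝ ∞ (fun z : ℂ => (starRingEnd ℂ z) ^ n) := by
    have : ContDiff ℝ ∞ (fun z : ℂ => (starRingEnd ℂ z)) := Complex.conjCLE.contDiff
    exact this.pow n
  rw [dgc_smooth (R := 1) bumpC hcd (fun x hx => by simpa using one_le_pow₀ hx)]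
  unfold Dg
  have key : ∀ z : ℂ, bumpC.ρ ((starRingEnd ℂ z) ^ n) *
      (fderiv ℝ (fun z : ℂ => (starRingEnd ℂ z) ^ n) z : ℂ →ₗ[ℝ] ℂ).det = 
      (-(∫ z : ℂ, rad0 ‖z‖)⁻¹) * (rad0 (‖z‖ ^ n) * (n ^ 2 * ‖z‖ ^ (2 * (n - 1)))) := by
    intro z
    have h1 : HasFDerivAt (fun z : ℂ => z ^ n)
       ((ContinuousLinearMap.toSpanSingleton ℂ (n * (starRingEnd ℂ z) ^ (n - 1))).restrictScalars ℝ) (starRingEnd ℂ z) := by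
      exact (hasDerivAt_pow n (starRingEnd ℂ z)).hasFDerivAt.restrictScalars ℝ
    have h2 : HasFDerivAt (fun z : ℂ => (starRingEnd ℂ z)) (Complex.conjCLE : ℂ →L[ℝ] ℂ) z := Complex.conjCLE.hasFDerivAt
    have h3 : HasFDerivAt (fun z : ℂ => (starRingEnd ℂ z) ^ n) _ z := h1.comp z h2
    rw [h3.fderiv, ContinuousLinearMap.toLinearMap_comp, LinearMap.det_comp, det_smulRight]
    have h4 : ((Complex.conjCLE : ℂ →L[ℝ] ℂ) : ℂ →ₗ[ℝ] ℂ).det = -1 := Complex.det_conjAe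
    rw [h4]
    simp only [bumpC, norm_pow, norm_mul, Complex.norm_natCast, RCLike.norm_conj]
    ring
  simp only [key]
  rw [integral_const_mul, rad0_int n hn]
  have := rad0_int_pos.ne'
  field_simp

end CB

namespace CB
open MeasureTheory Matrix
open scoped ContDiff Topology

/-- nonzero vectors -/
abbrev Nz (E : Type*) [Zero E] := {v : E // v ≠ 0}
/-- the set of nonzero vectors -/
abbrev nzs (E : Type*) [Zero E] : Set E := {v | v ≠ 0}

section cone
variable {E G : Type*} [NormedAddCommGroup E] [NormedSpace ℝ E] [NormedAddCommGroup G] [NormedSpace ℝ G]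

/-- radial projection -/
noncomputable def uv (x : E) (h : x ≠ 0) : Nz E := ⟨‖x‖⁻¹ • x, smul_ne_zero (inv_ne_zero (norm_ne_zero_iff.2 h)) h⟩

theorem uv_norm (x : E) (h : x ≠ 0) : ‖(uv x h : E)‖ = 1 := by
  simp [uv, norm_smul, inv_mul_cancel₀ (norm_ne_zero_iff.2 h)]

open Classical in
/-- conical extension -/
noncomputable def cn (q : Nz E → G) (x : E) : G := if h : x ≠ 0 then ‖x‖ • q (uv x h) else 0

theorem cn_zero (q : Nz E → G) : cn q 0 = 0 := by simp [cn]
theorem cn_of_ne (q : Nz E → G) {x : E} (h : x ≠ 0) : cn q x = ‖x‖ • q (uv x h) := by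
  unfold cn; rw [dif_pos h]

variable [FiniteDimensional ℝ E]

theorem cone_bounds {K : I → Nz E → G} (hK : Continuous fun p : I × Nz E => K p.1 p.2) :
    ∃ C : ℝ, 0 < C ∧ ∀ t (x : Nz E), ‖(x : E)‖ = 1 → ‖K t x‖ ≤ C := by
  have hc : IsCompact (Metric.sphere (0:E) 1) := isCompact_sphere _ _
  let j : I × Metric.sphere (0:E) 1 → I × Nz E := fun p => (p.1, ⟨p.2, by
    intro h; have := p.2.2; rw [h] at this; simp at this⟩)
  have hj : Continuous j := by fun_prop
  have : CompactSpace (Metric.sphere (0:E) 1) := isCompact_iff_compactSpace.1 hc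
  obtain ⟨C, hC⟩ := (isCompact_range (hK.comp hj).norm).bddAbove
  refine ⟨max C 1, by positivity, fun t x hx => le_max_of_le_left (hC ⟨(t, ⟨x, by simpa using hx⟩), rfl⟩)⟩

theorem cone_bounds_below {K : I → Nz E → G} (hK : Continuous fun p : I × Nz E => K p.1 p.2)
    (h0 : ∀ t x, K t x ≠ 0) : ∃ c : ℝ, 0 < c ∧ ∀ t (x : Nz E), ‖(x : E)‖ = 1 → c ≤ ‖K t x‖ := by
  obtain ⟨C, hC, hb⟩ := cone_bounds (K := fun t x => ‖K t x‖⁻¹) (by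
    exact hK.norm.inv₀ (fun p => norm_ne_zero_iff.2 (h0 _ _)))
  refine ⟨C⁻¹, by positivity, fun t x hx => ?_⟩
  have h1 := hb t x hx
  rw [norm_inv, norm_norm] at h1
  have := norm_pos_iff.2 (h0 t x)
  exact inv_le_of_inv_le₀ this h1

theorem cone_cont {K : I → Nz E → G} (hK : Continuous fun p : I × Nz E => K p.1 p.2) :
    Continuous fun p : I × E => cn (K p.1) p.2 := by
  obtain ⟨C, hC, hb⟩ := cone_bounds hK
  have hle : ∀ t (x : E), ‖cn (K t) x‖ ≤ C * ‖x‖ := by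
    intro t x
    by_cases h : x = 0
    · simp [h, cn_zero]
    · rw [cn_of_ne _ h, norm_smul, norm_norm, mul_comm]
      gcongr
      exact hb _ _ (uv_norm x h)
  rw [continuous_iff_continuousAt]
  rintro ⟨t, x⟩
  by_cases h : x = 0
  · subst h
    rw [ContinuousAt, cn_zero, tendsto_zero_iff_norm_tendsto_zero]
    refine squeeze_zero (fun _ => norm_nonneg _) (fun p => hle p.1 p.2) ?_
    have : Continuous fun p : I × E => C * ‖p.2‖ := by fun_prop
    simpa using this.tendsto (t, 0)
  · have ho : IsOpen {p : I × E | p.2 ≠ 0} := isOpen_ne_fun continuous_snd continuous_const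
    have : ContinuousOn (fun p : I × E => cn (K p.1) p.2) {p : I × E | p.2 ≠ 0} := by
      rw [continuousOn_iff_continuous_restrict]
      have e : Set.domRestrict {p : I × E | p.2 ≠ 0} (fun p : I × E => cn (K p.1) p.2) =
        fun p => ‖p.1.2‖ • K p.1.1 (uv p.1.2 p.2) := by
        ext1 p
        exact cn_of_ne _ p.2
      rw [e]
      refine Continuous.smul (by fun_prop) ?_
      have h2 : Continuous fun p : {p : I × E | p.2 ≠ 0} => ((p.1.1, uv p.1.2 p.2) : I × Nz E) := by
        refine Continuous.prodMk (by fun_prop) ?_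
        refine Continuous.subtype_mk ?_ _
        refine Continuous.smul (Continuous.inv₀ (by fun_prop) (fun p => norm_ne_zero_iff.2 p.2)) (by fun_prop)
      exact hK.comp h2
    exact this.continuousAt (ho.mem_nhds h)
end cone

section sdeg
variable {E : Type*} [NormedAddCommGroup E] [NormedSpace ℝ E] [FiniteDimensional ℝ E]
  [MeasureSpace E] [BorelSpace E] [(volume : Measure E).IsAddHaarMeasure]

/-- degree of a self-map of the punctured space -/
noncomputable def sdeg (β : Bmp E) (q : Nz E → E) : ℝ := dgc β (cn q)

theorem cn_adm {q : Nz E → E} (hq : Continuous q) (h0 : ∀ x, q x ≠ 0) : Adm (cn q) := by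
  have hK : Continuous fun p : I × Nz E => (fun (_ : I) x => q x) p.1 p.2 := by fun_prop
  obtain ⟨c, hc, hb⟩ := cone_bounds_below hK (fun _ => h0)
  have hcc : Continuous (cn q) := (cone_cont (K := fun (_ : I) x => q x) hK).comp (Continuous.prodMk_right (0 : I))
  refine ⟨hcc, 1, c, hc, fun x hx => ?_⟩
  have h : x ≠ 0 := by rintro rfl; simp at hx; linarith
  rw [cn_of_ne _ h, norm_smul, norm_norm]
  have := hb 0 _ (uv_norm x h)
  nlinarith

theorem sdeg_hm (β : Bmp E) {q q' : Nz E → E} (h : Hm (nzs E) q q') : sdeg β q = sdeg β q' := by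
  obtain ⟨K, hK, h0, e0, e1⟩ := h
  obtain ⟨c, hc, hb⟩ := cone_bounds_below hK h0
  have := dgc_homotopy β (fun t x => cn (K (Set.projIcc 0 1 zero_le_one t)) x) (by
    have h2 : Continuous fun p : ℝ × E => ((Set.projIcc 0 1 zero_le_one p.1, p.2) : I × E) := by fun_prop
    exact (cone_cont hK).comp h2) 1 c hc (fun t x ht ht' hx => by
      have h : x ≠ 0 := by rintro rfl; simp at hx; linarith
      rw [cn_of_ne _ h, norm_smul, norm_norm]
      have := hb (Set.projIcc 0 1 zero_le_one t) _ (uv_norm x h)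
      nlinarith)
  have e0' : K 0 = q := funext e0
  have e1' : K 1 = q' := funext e1
  simpa [e0', e1', sdeg] using this

theorem sdeg_eq_dgc (β : Bmp E) {F : E → E} (hF : Continuous F) (h0 : ∀ x, x ≠ 0 → F x ≠ 0)
    {δ : ℝ} (hδ : 0 < δ) (h : ∀ x, 1 ≤ ‖x‖ → δ ≤ ‖F x‖) : sdeg β (fun x : Nz E => F x) = dgc β F := by
  have hn : ∀ t (x : E), 0 ≤ t → t ≤ 1 → 1 ≤ ‖x‖ → 1 ≤ ‖(1 - t + t * (max 1 ‖x‖)⁻¹) • x‖ := by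
    intro t x ht ht' hx
    rw [max_eq_right hx, norm_smul, Real.norm_of_nonneg (by
      have := inv_nonneg.2 (norm_nonneg x); nlinarith), add_mul, mul_assoc, inv_mul_cancel₀ (by linarith)]
    nlinarith
  have s1 := dgc_homotopy β (fun t x => F ((1 - t + t * (max 1 ‖x‖)⁻¹) • x)) (by
    have : Continuous fun p : ℝ × E => (1 - p.1 + p.1 * (max 1 ‖p.2‖)⁻¹) • p.2 := by
      have h2 : Continuous fun p : ℝ × E => (max 1 ‖p.2‖)⁻¹ := Continuous.inv₀ (by fun_prop) (fun p => by
        have := le_max_left 1 ‖p.2‖; linarith)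
      fun_prop
    exact hF.comp this) 1 δ hδ (fun t x ht ht' hx => h _ (hn t x ht ht' hx))
  simp only [sub_zero, zero_mul, add_zero, one_smul, sub_self, zero_add, one_mul] at s1
  have hq : Continuous (fun x : Nz E => F x) := by fun_prop
  have hA := cn_adm hq (fun x => h0 x x.2)
  have hFc : Continuous fun x => F ((max 1 ‖x‖)⁻¹ • x) := by
    have h2 : Continuous fun x : E => (max 1 ‖x‖)⁻¹ := Continuous.inv₀ (by fun_prop) (fun p => by
        have := le_max_left 1 ‖p‖; linarith)
    fun_prop
  rw [s1, sdeg]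
  have s2 := dgc_homotopy β (fun t x => (1 - t) • cn (fun x : Nz E => F x) x + t • F ((max 1 ‖x‖)⁻¹ • x)) (by
    have h1 := hA.1
    have h2 : Continuous fun p : ℝ × E => F ((max 1 ‖p.2‖)⁻¹ • p.2) := hFc.comp continuous_snd
    have h3 : Continuous fun p : ℝ × E => cn (fun x : Nz E => F x) p.2 := h1.comp continuous_snd
    exact ((continuous_const.sub continuous_fst).smul h3).add (continuous_fst.smul h2)) 1 δ hδ (fun t x ht ht' hx => by
      have hx0 : x ≠ 0 := by rintro rfl; simp at hx; linarith
      rw [cn_of_ne _ hx0, max_eq_right hx]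
      simp only [uv]
      rw [smul_smul, ← add_smul, norm_smul, Real.norm_of_nonneg (by nlinarith)]
      have h1 := h (‖x‖⁻¹ • x) (uv_norm x hx0).ge
      have h2 : 1 ≤ (1 - t) * ‖x‖ + t := by nlinarith
      nlinarith)
  simpa using s2

theorem cn_id : cn (fun x : Nz E => (x : E)) = fun x => x := by
  ext1 x
  by_cases h : x = 0
  · simp [h, cn_zero]
  · rw [cn_of_ne _ h, uv, smul_smul, mul_inv_cancel₀ (norm_ne_zero_iff.2 h), one_smul]

theorem sdeg_id (β : Bmp E) : sdeg β (fun x : Nz E => (x : E)) = 1 := by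
  rw [sdeg, cn_id, dgc_id]

end sdeg
end CB

namespace CB
open MeasureTheory Matrix
open scoped ContDiff Topology

section transport
variable {E : Type*} [NormedAddCommGroup E] [NormedSpace ℝ E] [FiniteDimensional ℝ E]
  [MeasureSpace E] [BorelSpace E] [(volume : Measure E).IsAddHaarMeasure]
variable {G : Type*} [NormedAddCommGroup G] [NormedSpace ℝ G] [FiniteDimensional ℝ G]
  [MeasureSpace G] [BorelSpace G] [(volume : Measure G).IsAddHaarMeasure]

/-- image of a nonzero vector under a linear equivalence -/
def nzmap (L : G ≃L[ℝ] E) (v : Nz G) : Nz E := ⟨L v, fun h => v.2 (by simpa using h)⟩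

theorem nzmap_cont (L : G ≃L[ℝ] E) : Continuous (nzmap L) := by
  unfold nzmap
  exact Continuous.subtype_mk (L.continuous.comp continuous_subtype_val) _

theorem sdeg_transport (L : G ≃L[ℝ] E) (hL : ∀ v, ‖v‖ ≤ ‖L v‖) (β : Bmp E) :
    ∃ β' : Bmp G, ∀ q : Nz E → E, Continuous q → (∀ x, q x ≠ 0) →
      sdeg β' (fun v => L.symm (q (nzmap L v))) = sdeg β q := by
  obtain ⟨β', h⟩ := dgc_transport L hL β
  refine ⟨β', fun q hq h0 => ?_⟩
  have hA := cn_adm hq h0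
  rw [sdeg, sdeg, ← h (cn q) hA, ← sdeg]
  have hA' := hA
  obtain ⟨c1, -⟩ := hA
  obtain ⟨c, hc, hb⟩ := cone_bounds_below (K := fun (_ : I) x => q x) (by fun_prop) (fun _ => h0)
  have hLs : ∀ w, ‖L.symm w‖ ≤ ‖w‖ := fun w => by simpa using hL (L.symm w)
  let M := max 1 ‖(L : G →L[ℝ] E)‖
  have hM : 0 < M := lt_max_of_lt_left one_pos
  have hLM : ∀ v, ‖L v‖ ≤ M * ‖v‖ := fun v =>
    ((L : G →L[ℝ] E).le_opNorm v).trans (by gcongr; exact le_max_right _ _)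
  have hL0 : ∀ v : G, v ≠ 0 → L v ≠ 0 := fun v hv h => hv (by simpa using h)
  have hne : ∀ v : G, v ≠ 0 → cn q (L v) ≠ 0 := by
    intro v hv
    rw [cn_of_ne q (hL0 v hv)]
    exact smul_ne_zero (norm_ne_zero_iff.2 (hL0 v hv)) (h0 _)
  rw [← sdeg_eq_dgc β' (F := fun v => L.symm (cn q (L v))) (δ := c / M)
    (L.symm.continuous.comp (c1.comp L.continuous)) (fun v hv h => hne v hv (by simpa using h)) (by positivity) ?_]
  · refine sdeg_hm β' ?_
    have hpos : ∀ (t : I) (v : Nz G), 0 < (1 - (t:ℝ)) + t * ‖L v‖⁻¹ := by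
      intro t v
      have h1 : 0 < ‖L v‖⁻¹ := inv_pos.2 (norm_pos_iff.2 (hL0 v v.2))
      rcases eq_or_lt_of_le t.2.1 with h | h
      · rw [← h]; simp
      · have := t.2.2; have := mul_pos h h1; linarith
    have hpos' : ∀ (t : I) (v : Nz G), 0 < (1 - (t:ℝ)) + t * ‖L v‖ := by
      intro t v
      have h1 : 0 < ‖L v‖ := (norm_pos_iff.2 (hL0 v v.2))
      rcases eq_or_lt_of_le t.2.1 with h | h
      · rw [← h]; simp
      · have := t.2.2; have := mul_pos h h1; linarith
    refine ⟨fun t v => L.symm (((1 - (t:ℝ)) + t * ‖L v‖) • q ⟨((1 - (t:ℝ)) + t * ‖L v‖⁻¹) • L v,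
      smul_ne_zero (hpos t v).ne' (hL0 v v.2)⟩), ?_, ?_, ?_, ?_⟩
    · refine L.symm.continuous.comp (Continuous.smul ?_ (hq.comp (Continuous.subtype_mk ?_ _)))
      · have := L.continuous; fun_prop
      · have h2 : Continuous fun p : I × Nz G => L p.2 := L.continuous.comp (by fun_prop)
        have h1 : Continuous fun p : I × Nz G => ‖L p.2‖⁻¹ := by
          refine Continuous.inv₀ h2.norm fun p => norm_ne_zero_iff.2 (hL0 _ p.2.2)
        fun_prop
    · intro t v h
      rw [map_eq_zero_iff _ L.symm.injective] at h
      exact smul_ne_zero (hpos' t v).ne' (h0 _) h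
    · intro v
      simp [nzmap]
    · intro v
      simp only [Set.Icc.coe_one, sub_self, zero_add, one_mul]
      rw [cn_of_ne q (hL0 v v.2)]
      rfl
  · intro v hv
    have hv0 : v ≠ 0 := by rintro rfl; simp at hv; linarith
    have h1 := hLM (L.symm (cn q (L v)))
    rw [ContinuousLinearEquiv.apply_symm_apply] at h1
    rw [div_le_iff₀ hM, mul_comm]
    refine le_trans ?_ h1
    rw [cn_of_ne q (hL0 v hv0), norm_smul, norm_norm]
    have := hb 0 _ (uv_norm (L v) (hL0 v hv0))
    have h3 := hL v
    nlinarith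

theorem sdeg_prod_conj (β : Bmp E) (n : ℕ) (hn : n ≠ 0) {g : Nz E → E} (hg : Continuous g) (h0 : ∀ x, g x ≠ 0) :
    sdeg (β.prod bumpC) (fun v : Nz (E × ℂ) => (cn g v.1.1, (starRingEnd ℂ v.1.2) ^ n)) = - n * sdeg β g := by
  obtain ⟨c, hc, hb⟩ := cone_bounds_below (K := fun (_ : I) x => g x) (by fun_prop) (fun _ => h0)
  have hA := cn_adm hg h0
  have hB : Adm (fun z : ℂ => (starRingEnd ℂ z) ^ n) := ⟨by fun_prop, 1, 1, one_pos, fun z hz => by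
    simpa using one_le_pow₀ hz⟩
  have hge : ∀ x : E, x ≠ 0 → c * ‖x‖ ≤ ‖cn g x‖ := by
    intro x hx
    rw [cn_of_ne g hx, norm_smul, norm_norm, mul_comm]
    gcongr
    exact hb 0 _ (uv_norm x hx)
  rw [sdeg_eq_dgc (β.prod bumpC) (F := fun v : E × ℂ => (cn g v.1, (starRingEnd ℂ v.2) ^ n)) (δ := min c 1),
    dgc_prod β bumpC hA hB, dgc_conj_pow n hn, sdeg, mul_comm]
  · exact (hA.1.comp continuous_fst).prodMk (hB.1.comp continuous_snd)
  · rintro ⟨x, z⟩ hxz h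
    simp only [Prod.mk_eq_zero] at h hxz
    apply hxz
    try rw [Prod.mk_eq_zero]
    constructor
    · by_contra hx
      have := hge x hx
      rw [h.1, norm_zero] at this
      have h2 := norm_pos_iff.2 hx
      nlinarith
    · simpa [hn] using h.2
  · exact lt_min hc one_pos
  · rintro ⟨x, z⟩ hxz
    rw [Prod.norm_def, le_max_iff] at hxz
    rw [Prod.norm_def]
    rcases hxz with h | h
    · refine le_max_of_le_left ((min_le_left _ _).trans ?_)
      have hx0 : x ≠ 0 := by rintro rfl; simp at h; linarith
      have := hge x hx0
      simp only at h ⊢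
      nlinarith
    · refine le_max_of_le_right ((min_le_right _ _).trans ?_)
      simpa using one_le_pow₀ h

end transport
end CB

namespace CB
open MeasureTheory Matrix
open scoped ContDiff Topology

/-- coordinates adapted to the cube -/
abbrev V (m : ℕ) := (Fin m → ℝ) × ℝ
/-- the cube -/
abbrev Cb (m : ℕ) := Fin m → I
/-- north pole -/
def ev (m : ℕ) : V m := (0, 1)

theorem ev_norm (m : ℕ) : ‖ev m‖ = 1 := by simp [ev, Prod.norm_def]
theorem ev_ne (m : ℕ) : ev m ≠ 0 := by
  intro h; have := ev_norm m; rw [h] at this; simp at this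

/-- clamping to the interval -/
noncomputable def pI (t : ℝ) : I := Set.projIcc 0 1 zero_le_one t
theorem pI_cont : Continuous pI := continuous_projIcc (h := zero_le_one)
theorem pI_of_le {t : ℝ} (h : t ≤ 0) : pI t = 0 := Set.projIcc_of_le_left _ h
theorem pI_of_ge {t : ℝ} (h : 1 ≤ t) : pI t = 1 := Set.projIcc_of_right_le _ h
theorem pI_coe (t : I) : pI t = t := Set.projIcc_val _ t
theorem pI_of_mem {t : ℝ} (h : t ∈ Set.Icc (0:ℝ) 1) : (pI t : ℝ) = t := by
  rw [pI, Set.projIcc_of_mem _ h]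
theorem coe_pI (t : ℝ) : (pI t : ℝ) = max 0 (min 1 t) := by rw [pI, Set.coe_projIcc]

/-- clamping to the cube -/
noncomputable def pj {m : ℕ} (y : Fin m → ℝ) : Cb m := fun i => pI (y i)
theorem pj_cont {m : ℕ} : Continuous (pj (m := m)) := continuous_pi fun i => pI_cont.comp (continuous_apply i)
theorem pj_coe {m : ℕ} (x : Cb m) : pj (fun i => (x i : ℝ)) = x := funext fun i => pI_coe _
theorem pj_bd {m : ℕ} {y : Fin m → ℝ} (i : Fin m) (h : y i ≤ 0 ∨ 1 ≤ y i) : pj y ∈ Cube.boundary (Fin m) := by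
  refine ⟨i, ?_⟩
  rcases h with h | h
  · left; exact pI_of_le h
  · right; exact pI_of_ge h

theorem exists_coord {m : ℕ} (hm : 0 < m) (y : Fin m → ℝ) : ∃ i, ‖y‖ = |y i| := by
  haveI : Nonempty (Fin m) := ⟨⟨0, hm⟩⟩
  obtain ⟨i, hi⟩ := Finite.exists_max fun i => ‖y i‖
  exact ⟨i, le_antisymm ((pi_norm_le_iff_of_nonneg (norm_nonneg _)).2 hi) (norm_le_pi_norm y i)⟩

theorem fam_bounds {X G : Type*} [TopologicalSpace X] [CompactSpace X] [NormedAddCommGroup G] (K : X → G) (hK : Continuous K) :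
    ∃ C : ℝ, 0 < C ∧ ∀ x, ‖K x‖ ≤ C := by
  obtain ⟨C, hC⟩ := isCompact_univ.exists_bound_of_continuousOn hK.continuousOn
  exact ⟨max C 1, by positivity, fun x => (hC x trivial).trans (le_max_left _ _)⟩

theorem fam_bounds_below {X G : Type*} [TopologicalSpace X] [CompactSpace X] [NormedAddCommGroup G] (K : X → G) (hK : Continuous K)
    (h0 : ∀ x, K x ≠ 0) : ∃ c : ℝ, 0 < c ∧ ∀ x, c ≤ ‖K x‖ := by
  obtain ⟨C, hC, hb⟩ := fam_bounds (fun x => ‖K x‖⁻¹) (hK.norm.inv₀ fun x => norm_ne_zero_iff.2 (h0 x))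
  refine ⟨C⁻¹, by positivity, fun x => ?_⟩
  have := hb x
  rw [norm_inv, norm_norm] at this
  exact inv_le_of_inv_le₀ (norm_pos_iff.2 (h0 x)) this

theorem dg_fam {m : ℕ} (β : Bmp (V m)) (K : I → Cb m → V m) (hK : Continuous fun p : I × Cb m => K p.1 p.2)
    (h0 : ∀ t x, K t x ≠ 0) (he : ∀ t, ∀ x ∈ Cube.boundary (Fin m), K t x = ev m)
    (Ψ : I → V m → Cb m) (hΨ : Continuous fun p : I × V m => Ψ p.1 p.2)
    (hM : ∀ R : ℝ, ∃ M : ℝ, ∀ t v, |v.2| ≤ R → M ≤ ‖v.1‖ → Ψ t v ∈ Cube.boundary (Fin m)) :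
    (Adm (fun v => K 0 (Ψ 0 v) + max 0 (v.2 + 1) • ev m)) ∧
    dgc β (fun v => K 0 (Ψ 0 v) + max 0 (v.2 + 1) • ev m) =
      dgc β (fun v => K 1 (Ψ 1 v) + max 0 (v.2 + 1) • ev m) := by
  obtain ⟨C, hC, hb⟩ := fam_bounds (fun p : I × Cb m => K p.1 p.2) hK
  obtain ⟨c, hc, hbb⟩ := fam_bounds_below (fun p : I × Cb m => K p.1 p.2) hK fun p => h0 _ _
  obtain ⟨M, hM⟩ := hM (C + 1)
  have hcont : Continuous (fun p : ℝ × V m => K (pI p.1) (Ψ (pI p.1) p.2) + max 0 (p.2.2 + 1) • ev m) := by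
    have h1 : Continuous fun p : ℝ × V m => ((pI p.1, p.2) : I × V m) := by
      have := pI_cont; fun_prop
    have h2 : Continuous fun p : ℝ × V m => ((pI p.1, Ψ (pI p.1) p.2) : I × Cb m) := by
      have := pI_cont
      have := hΨ.comp h1
      exact Continuous.prodMk (by fun_prop) this
    have := hK.comp h2
    simp only [Function.comp_def] at this
    fun_prop
  have hest : ∀ (t : I) (x : V m), max (C + 2) M ≤ ‖x‖ → min c 1 ≤ ‖K t (Ψ t x) + max 0 (x.2 + 1) • ev m‖ := by
    intro t v hv
    have hv1 := (le_max_left _ _).trans hv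
    have hv2 := (le_max_right _ _).trans hv
    by_cases h1 : v.2 ≤ -1
    · rw [max_eq_left (by linarith), zero_smul, add_zero]
      exact (min_le_left _ _).trans (hbb (t, _))
    by_cases h2 : C + 1 ≤ v.2
    · refine (min_le_right _ _).trans ?_
      have h3 := norm_sub_le (K t (Ψ t v) + max 0 (v.2 + 1) • ev m) (K t (Ψ t v))
      rw [add_sub_cancel_left, norm_smul, ev_norm, Real.norm_of_nonneg (le_max_left _ _)] at h3
      have h4 := hb (t, Ψ t v)
      have h5 := le_max_right 0 (v.2 + 1)
      simp only at h4
      linarith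
    · push Not at h1 h2
      have hab : |v.2| ≤ C + 1 := abs_le.2 ⟨by linarith, h2.le⟩
      have h3 : ‖v‖ = ‖v.1‖ := by
        rw [Prod.norm_def] at hv1 ⊢
        refine max_eq_left ?_
        rw [le_max_iff] at hv1
        rw [Real.norm_eq_abs] at *
        rcases hv1 with h | h <;> linarith
      rw [h3] at hv2
      rw [he t _ (hM t v hab hv2)]
      refine (min_le_right _ _).trans ?_
      have h5 := le_max_left 0 (v.2 + 1)
      have : ev m + max 0 (v.2 + 1) • ev m = (1 + max 0 (v.2 + 1)) • ev m := by module
      rw [this, norm_smul, ev_norm, Real.norm_of_nonneg (by linarith)]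
      linarith
  refine ⟨⟨?_, max (C + 2) M, min c 1, lt_min hc one_pos, hest 0⟩, ?_⟩
  · have h3 : Continuous fun v : V m => ((0, v) : ℝ × V m) := by fun_prop
    have := hcont.comp h3
    simpa [Function.comp_def, pI_of_le le_rfl] using this
  · have := dgc_homotopy β (fun t v => K (pI t) (Ψ (pI t) v) + max 0 (v.2 + 1) • ev m) hcont
      (max (C + 2) M) (min c 1) (lt_min hc one_pos) (fun t x _ _ hx => hest _ x hx)
    simpa [pI_of_le le_rfl, pI_of_ge le_rfl] using this

/-- degree of a map of the cube sending the boundary to the base point -/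
noncomputable def Deg {m : ℕ} (β : Bmp (V m)) (k : Cb m → V m) : ℝ :=
  dgc β (fun v => k (pj v.1) + max 0 (v.2 + 1) • ev m)

theorem pj_far {m : ℕ} (hm : 0 < m) {y : Fin m → ℝ} (h : 1 ≤ ‖y‖) : pj y ∈ Cube.boundary (Fin m) := by
  obtain ⟨i, hi⟩ := exists_coord hm y
  refine pj_bd i ?_
  rw [hi] at h
  rcases le_abs.1 h with h | h
  · right; exact h
  · left; linarith

theorem Deg_hm {m : ℕ} (hm : 0 < m) (β : Bmp (V m)) (K : I → Cb m → V m) (hK : Continuous fun p : I × Cb m => K p.1 p.2)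
    (h0 : ∀ t x, K t x ≠ 0) (he : ∀ t, ∀ x ∈ Cube.boundary (Fin m), K t x = ev m) :
    Deg β (K 0) = Deg β (K 1) := by
  refine (dg_fam β K hK h0 he (fun _ v => pj v.1) ?_ ?_).2
  · exact pj_cont.comp (by fun_prop)
  · intro R
    exact ⟨1, fun t v _ h => pj_far hm h⟩

theorem pj_update {m : ℕ} (y : Fin m → ℝ) (i : Fin m) (s : ℝ) :
    pj (Function.update y i s) = Function.update (pj y) i (pI s) := by
  ext j
  by_cases h : j = i
  · subst h; simp [pj]
  · simp [pj, h]

theorem pj_update_far {m : ℕ} (hm : 0 < m) {y : Fin m → ℝ} (i : Fin m) {s : ℝ} (h : 3 ≤ ‖y‖)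
    (h1 : 3 ≤ y i → 1 ≤ s) (h2 : y i ≤ -3 → s ≤ 0) : pj (Function.update y i s) ∈ Cube.boundary (Fin m) := by
  obtain ⟨j, hj⟩ := exists_coord hm y
  refine pj_bd j ?_
  rw [hj] at h
  by_cases hij : j = i
  · subst hij
    simp only [Function.update_self]
    rcases le_abs.1 h with h | h
    · right; exact h1 h
    · left; exact h2 (by linarith)
  · rw [Function.update_of_ne hij]
    rcases le_abs.1 h with h | h
    · right; linarith
    · left; linarith

theorem e_add_norm {m : ℕ} (s : ℝ) : 1 ≤ ‖ev m + max 0 s • ev m‖ := by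
  have h5 := le_max_left 0 s
  have : ev m + max 0 s • ev m = (1 + max 0 s) • ev m := by module
  rw [this, norm_smul, ev_norm, Real.norm_of_nonneg (by linarith)]
  linarith

theorem Deg_add {m : ℕ} (hm : 0 < m) (β : Bmp (V m)) (i : Fin m) {k k1 k2 : Cb m → V m} (hk : Continuous k)
    (hk1 : Continuous k1) (hk2 : Continuous k2) (n1 : ∀ x, k1 x ≠ 0) (n2 : ∀ x, k2 x ≠ 0)
    (b : ∀ x ∈ Cube.boundary (Fin m), k x = ev m)
    (b1 : ∀ x ∈ Cube.boundary (Fin m), k1 x = ev m) (b2 : ∀ x ∈ Cube.boundary (Fin m), k2 x = ev m)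
    (h1 : ∀ t, (t i : ℝ) ≤ 1 / 2 → k t = k1 (Function.update t i (pI (2 * t i))))
    (h2 : ∀ t, ¬ (t i : ℝ) ≤ 1 / 2 → k t = k2 (Function.update t i (pI (2 * t i - 1)))) :
    Deg β k = Deg β k1 + Deg β k2 := by
  have n0 : ∀ x, k x ≠ 0 := by
    intro x
    by_cases h : (x i : ℝ) ≤ 1 / 2
    · rw [h1 x h]; exact n1 _
    · rw [h2 x h]; exact n2 _
  let φ : ℝ → ℝ := fun y => ((pI (y + 2) : ℝ) + pI (y - 1)) / 2
  have hφ : Continuous φ := by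
    have := pI_cont
    fun_prop
  have hφ0 : ∀ y, φ y ∈ Set.Icc (0:ℝ) 1 := fun y => by
    have h1 := (pI (y + 2)).2
    have h2 := (pI (y - 1)).2
    constructor
    · have := h1.1; have := h2.1; simp only [φ]; linarith
    · have := h1.2; have := h2.2; simp only [φ]; linarith
  have hup : ∀ f : I × V m → ℝ, Continuous f → Continuous fun p : I × V m => pj (Function.update p.2.1 i (f p)) := by
    intro f hf
    exact pj_cont.comp (Continuous.update (by fun_prop) i hf)
  -- step 1
  have s1 := (dg_fam β (fun _ => k) (by fun_prop) (fun _ => n0) (fun _ => b)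
    (fun t v => pj (Function.update v.1 i ((1 - (t:ℝ)) * v.1 i + t * φ (v.1 i)))) (hup _ (by fun_prop))
    (fun R => ⟨3, fun t v _ hv => pj_update_far hm i hv (fun h => by
      have : φ (v.1 i) = 1 := by
        simp only [φ]; rw [pI_of_ge (by linarith), pI_of_ge (by linarith)]; norm_num
      rw [this]; have := t.2.2; nlinarith) (fun h => by
      have : φ (v.1 i) = 0 := by
        simp only [φ]; rw [pI_of_le (by linarith), pI_of_le (by linarith)]; norm_num
      rw [this]; have := t.2.2; nlinarith)⟩)).2
  have s2 := dg_fam β (fun _ => k1) (by fun_prop) (fun _ => n1) (fun _ => b1)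
    (fun t v => pj (Function.update v.1 i (v.1 i + 2 * (1 - (t:ℝ))))) (hup _ (by fun_prop))
    (fun R => ⟨3, fun t v _ hv => pj_update_far hm i hv (fun h => by
      have := t.2.2; linarith) (fun h => by have := t.2.1; linarith)⟩)
  have s3 := dg_fam β (fun _ => k2) (by fun_prop) (fun _ => n2) (fun _ => b2)
    (fun t v => pj (Function.update v.1 i (v.1 i - (1 - (t:ℝ))))) (hup _ (by fun_prop))
    (fun R => ⟨3, fun t v _ hv => pj_update_far hm i hv (fun h => by
      have := t.2.1; linarith) (fun h => by have := t.2.2; linarith)⟩)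
  simp only [Set.Icc.coe_zero, Set.Icc.coe_one, sub_zero, one_mul, zero_mul, add_zero, sub_self, zero_add,
    mul_zero, mul_one, Function.update_eq_self] at s1 s2 s3
  change Deg β k = _ at s1
  have s22 : _ = Deg β k1 := s2.2
  have s32 : _ = Deg β k2 := s3.2
  rw [s1, ← s22, ← s32]
  refine dgc_split_aux β ((ContinuousLinearMap.proj i).comp (ContinuousLinearMap.fst ℝ (Fin m → ℝ) ℝ)) s2.1 s3.1
    ?_ ?_ one_pos ?_ ?_
  · intro v hv
    change v.1 i ≤ 1 at hv
    congr 1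
    have e : φ (v.1 i) = (pI (v.1 i + 2) : ℝ) / 2 := by
      simp only [φ]; rw [pI_of_le (t := v.1 i - 1) (by linarith)]; simp
    have e2 : (pI (φ (v.1 i)) : ℝ) = (pI (v.1 i + 2) : ℝ) / 2 := by rw [pI_of_mem (hφ0 _), e]
    rw [h1]
    · simp only [pj_update, Function.update_self, Function.update_idem, e2]
      congr 2
      rw [mul_div_cancel₀ _ two_ne_zero, pI_coe]
    · simp only [pj_update, Function.update_self, e2]
      have := (pI (v.1 i + 2)).2.2; linarith
  · intro v hv
    change -1 ≤ v.1 i at hv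
    congr 1
    have e : φ (v.1 i) = (1 + (pI (v.1 i - 1) : ℝ)) / 2 := by
      simp only [φ]; rw [pI_of_ge (t := v.1 i + 2) (by linarith)]; simp
    have e2 : (pI (φ (v.1 i)) : ℝ) = (1 + (pI (v.1 i - 1) : ℝ)) / 2 := by rw [pI_of_mem (hφ0 _), e]
    by_cases hh : (pI (φ (v.1 i)) : ℝ) ≤ 1 / 2
    · have h0 : pI (v.1 i - 1) = 0 := by
        have := (pI (v.1 i - 1)).2.1
        apply Subtype.ext
        simp only [Set.Icc.coe_zero]; linarith
      rw [h1]
      · rw [b1, b2]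
        · refine ⟨i, Or.inl ?_⟩
          simp only [pj_update, Function.update_self, h0]
        · refine ⟨i, Or.inr ?_⟩
          simp only [pj_update, Function.update_self, e2, h0]
          apply pI_of_ge; simp
      · simpa only [pj_update, Function.update_self] using hh
    · rw [h2]
      · simp only [pj_update, Function.update_self, Function.update_idem, e2]
        congr 2
        rw [mul_div_cancel₀ _ two_ne_zero, add_sub_cancel_left, pI_coe]
      · simpa only [pj_update, Function.update_self] using hh
  · intro v hv
    change -1 ≤ v.1 i at hv
    rw [b1]
    · exact e_add_norm _
    · exact pj_bd i (Or.inr (by simp; linarith))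
  · intro v hv
    change v.1 i ≤ 1 at hv
    rw [b2]
    · exact e_add_norm _
    · exact pj_bd i (Or.inl (by simp; linarith))

end CB

namespace CB
open MeasureTheory Matrix
open scoped ContDiff Topology

open Classical in
/-- the map on the punctured space attached to a map of the cube -/
noncomputable def fl {m : ℕ} {Z : Type*} (k : Cb m → Z) (z0 : Z) (v : Nz (V m)) : Z :=
  if v.1.2 < 0 then k (pj (fun i => 1 / 2 + v.1.1 i / (2 * (-v.1.2)))) else z0

theorem fl_bd {m : ℕ} (hm : 0 < m) {y : Fin m → ℝ} {s : ℝ} (hs : 0 < s) (h : s ≤ ‖y‖) :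
    pj (fun i => 1 / 2 + y i / (2 * s)) ∈ Cube.boundary (Fin m) := by
  obtain ⟨i, hi⟩ := exists_coord hm y
  refine pj_bd i ?_
  rw [hi] at h
  rcases le_abs.1 h with h | h
  · right
    have : 1 / 2 ≤ y i / (2 * s) := by rw [le_div_iff₀ (by positivity)]; linarith
    linarith
  · left
    have : y i / (2 * s) ≤ - (1 / 2) := by rw [div_le_iff₀ (by positivity)]; linarith
    linarith

theorem fl_far {m : ℕ} (hm : 0 < m) {Z : Type*} {k : Cb m → Z} {z0 : Z}
    (hb : ∀ x ∈ Cube.boundary (Fin m), k x = z0) (v : Nz (V m)) (h : - v.1.2 ≤ ‖v.1.1‖) : fl k z0 v = z0 := by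
  unfold fl
  split_ifs with hs
  · exact hb _ (fl_bd hm (by linarith) h)
  · rfl

theorem fl_cont {m : ℕ} (hm : 0 < m) {Z : Type*} [TopologicalSpace Z] {k : Cb m → Z} {z0 : Z} (hk : Continuous k)
    (hb : ∀ x ∈ Cube.boundary (Fin m), k x = z0) : Continuous (fl k z0) := by
  rw [continuous_iff_continuousAt]
  intro v
  by_cases hs : v.1.2 < 0
  · have h1 : ∀ᶠ w : Nz (V m) in 𝓝 v, w.1.2 < 0 :=
      (isOpen_lt (by fun_prop : Continuous fun w : Nz (V m) => w.1.2) continuous_const).mem_nhds hs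
    have h2 : (fl k z0) =ᶠ[𝓝 v] fun w => k (pj (fun i => 1 / 2 + w.1.1 i / (2 * (-w.1.2)))) := by
      filter_upwards [h1] with w hw
      simp [fl, hw]
    refine ContinuousAt.congr ?_ h2.symm
    refine (hk.comp pj_cont).continuousAt.comp ?_
    refine continuousAt_pi.2 fun i => ?_
    refine ContinuousAt.add continuousAt_const (ContinuousAt.div ?_ ?_ ?_)
    · exact Continuous.continuousAt (by fun_prop)
    · exact Continuous.continuousAt (by fun_prop)
    · simp [hs.ne]
  · have h0 : -v.1.2 < ‖v.1.1‖ := by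
      push Not at hs
      rcases hs.lt_or_eq with h | h
      · have := norm_nonneg v.1.1; linarith
      · rw [← h, neg_zero, norm_pos_iff]
        intro h3
        exact v.2 (Prod.ext h3 h.symm)
    have h1 : ∀ᶠ w : Nz (V m) in 𝓝 v, -w.1.2 < ‖w.1.1‖ :=
      (isOpen_lt (by fun_prop : Continuous fun w : Nz (V m) => -w.1.2)
        (by fun_prop : Continuous fun w : Nz (V m) => ‖w.1.1‖)).mem_nhds h0
    have h2 : (fl k z0) =ᶠ[𝓝 v] fun w => z0 := by
      filter_upwards [h1] with w hw
      exact fl_far hm hb w hw.le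
    exact ContinuousAt.congr continuousAt_const h2.symm

theorem fl_mem {m : ℕ} {Z : Type*} {k : Cb m → Z} {z0 : Z} {S : Set Z} (h : ∀ x, k x ∈ S) (h0 : z0 ∈ S) (v : Nz (V m)) :
    fl k z0 v ∈ S := by
  unfold fl; split_ifs
  · exact h _
  · exact h0

theorem fl_map {m : ℕ} {Z Z' : Type*} (φ : Z → Z') (k : Cb m → Z) (z0 : Z) (v : Nz (V m)) :
    φ (fl k z0 v) = fl (fun x => φ (k x)) (φ z0) v := by
  unfold fl; split_ifs <;> rfl

theorem fl_smul {m : ℕ} {Z : Type*} (k : Cb m → Z) (z0 : Z) {v : V m} (hv : v ≠ 0) :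
    fl k z0 (uv v hv) = fl k z0 ⟨v, hv⟩ := by
  have hn : 0 < ‖v‖⁻¹ := inv_pos.2 (norm_pos_iff.2 hv)
  unfold fl uv
  simp only [Prod.smul_snd, Prod.smul_fst, smul_eq_mul, Pi.smul_apply]
  have : ‖v‖⁻¹ * v.2 < 0 ↔ v.2 < 0 := by
    constructor
    · intro h; by_contra h2; push Not at h2; have := mul_nonneg hn.le h2; linarith
    · intro h; exact mul_neg_of_pos_of_neg hn h
  simp only [this]
  split_ifs with h
  · congr 2
    ext i
    congr 1
    field_simp [h.ne]
  · rfl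

theorem Deg_eq_sdeg {m : ℕ} (hm : 0 < m) (β : Bmp (V m)) {k : Cb m → V m} (hk : Continuous k) (n0 : ∀ x, k x ≠ 0)
    (b : ∀ x ∈ Cube.boundary (Fin m), k x = ev m) : Deg β k = sdeg β (fl k (ev m)) := by
  have hmax : Continuous fun p : I × V m => max 1 (-p.2.2) := by fun_prop
  have hmax0 : ∀ s : ℝ, 0 < max 1 (-s) := fun s => lt_of_lt_of_le one_pos (le_max_left _ _)
  have s1 := dg_fam β (fun _ => k) (by fun_prop) (fun _ => n0) (fun _ => b)
    (fun t v => pj (fun i => (t:ℝ) * v.1 i + (1 - t) * (1 / 2 + v.1 i / (2 * max 1 (-v.2)))))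
    (by
      refine pj_cont.comp (continuous_pi fun i => ?_)
      have : Continuous fun p : I × V m => p.2.1 i / (2 * max 1 (-p.2.2)) :=
        Continuous.div (by fun_prop) (by fun_prop) (fun p => by have := hmax0 p.2.2; positivity)
      fun_prop)
    (fun R => ⟨2 * max 1 R, fun t v hR hv => by
      obtain ⟨i, hi⟩ := exists_coord hm v.1
      refine pj_bd i ?_
      rw [hi] at hv
      have h1 : max 1 (-v.2) ≤ max 1 R := max_le_max le_rfl ((neg_le_abs _).trans hR)
      have h2 := hmax0 v.2
      have h4 := le_max_left 1 R
      have t0 := t.2.1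
      have t1 := t.2.2
      rcases le_abs.1 hv with h | h
      · right
        have : 1 ≤ v.1 i / (2 * max 1 (-v.2)) := by rw [le_div_iff₀ (by positivity)]; linarith
        nlinarith
      · left
        have : v.1 i / (2 * max 1 (-v.2)) ≤ -1 := by rw [div_le_iff₀ (by positivity)]; linarith
        nlinarith⟩)
  simp only [Set.Icc.coe_zero, Set.Icc.coe_one, sub_zero, one_mul, zero_mul, add_zero, sub_self, zero_add] at s1
  have e2 : Deg β k = (dgc β fun v => k (pj fun i => 1 / 2 + v.1 i / (2 * max 1 (-v.2))) + max 0 (v.2 + 1) • ev m) := by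
    exact s1.2.symm
  obtain ⟨C, hC, hb⟩ := fam_bounds k hk
  obtain ⟨c, hc, hbb⟩ := fam_bounds_below k hk n0
  have hcn := (cn_adm (fl_cont hm hk b) (fun v => fl_mem (S := {v | v ≠ 0}) n0 (ev_ne m) v)).1
  have hF := s1.1.1
  rw [e2, sdeg]
  have := dgc_homotopy β (fun t v => (1 - (pI t : ℝ)) • (k (pj fun i => 1 / 2 + v.1 i / (2 * max 1 (-v.2))) + max 0 (v.2 + 1) • ev m)
    + (pI t : ℝ) • cn (fl k (ev m)) v) ((((continuous_const.sub (continuous_subtype_val.comp (pI_cont.comp continuous_fst))).smul (hF.comp continuous_snd)).add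
    ((continuous_subtype_val.comp (pI_cont.comp continuous_fst)).smul (hcn.comp continuous_snd)))) (C + 2) (min c 1) (lt_min hc one_pos) ?_
  · simpa [pI_of_le le_rfl, pI_of_ge le_rfl] using this
  intro t v _ _ hv
  have hv1 : 1 ≤ ‖v‖ := by linarith
  have hv0 : v ≠ 0 := norm_pos_iff.1 (by linarith)
  have t0 := (pI t).2.1
  have t1 := (pI t).2.2
  set τ : ℝ := ((pI t : I) : ℝ)
  rw [cn_of_ne _ hv0, fl_smul]
  by_cases hs : v.2 ≤ -1
  · rw [max_eq_left (by linarith : v.2 + 1 ≤ 0), max_eq_right (by linarith : 1 ≤ -v.2)]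
    simp only [fl, if_pos (by linarith : v.2 < 0), zero_smul, add_zero]
    rw [smul_smul, ← add_smul, norm_smul, Real.norm_of_nonneg (by nlinarith)]
    have h1 := hbb (pj fun i => 1 / 2 + v.1 i / (2 * (-v.2)))
    refine (min_le_left _ _).trans (h1.trans ?_)
    have h9 : 1 ≤ 1 - τ + τ * ‖v‖ := by nlinarith
    exact le_mul_of_one_le_left (norm_nonneg _) h9
  push Not at hs
  rw [max_eq_right (by linarith : 0 ≤ v.2 + 1), max_eq_left (by linarith : -v.2 ≤ 1)]
  refine (min_le_right _ _).trans ?_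
  by_cases hy : 1 ≤ ‖v.1‖
  · rw [fl_far hm b _ (by simp only; linarith), b _ (fl_bd hm one_pos hy)]
    have : (1 - τ) • (ev m + (v.2 + 1) • ev m) + τ • ‖v‖ • ev m = ((1 - τ) * (v.2 + 2) + τ * ‖v‖) • ev m := by module
    rw [this, norm_smul, ev_norm, Real.norm_of_nonneg (by nlinarith)]
    nlinarith
  · push Not at hy
    have hs2 : C + 2 ≤ v.2 := by
      rw [Prod.norm_def, le_max_iff] at hv
      rcases hv with h | h
      · linarith
      · rw [Real.norm_eq_abs] at h
        rcases le_abs.1 h with h | h <;> linarith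
    rw [fl_far hm b _ (by have := norm_nonneg v.1; simp only; linarith)]
    set w := k (pj fun i => 1 / 2 + v.1 i / (2 * 1))
    have hw : ‖w‖ ≤ C := hb _
    have h3 := norm_sub_le ((1 - τ) • (w + (v.2 + 1) • ev m) + τ • ‖v‖ • ev m) ((1 - τ) • w)
    have : ((1 - τ) • (w + (v.2 + 1) • ev m) + τ • ‖v‖ • ev m) - (1 - τ) • w = ((1 - τ) * (v.2 + 1) + τ * ‖v‖) • ev m := by module
    rw [this, norm_smul, ev_norm, Real.norm_of_nonneg (by nlinarith), norm_smul, Real.norm_of_nonneg (by linarith)] at h3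
    nlinarith

end CB

namespace CB
open MeasureTheory Matrix
open scoped ContDiff Topology

/-- the negative ray -/
def Nr (m : ℕ) : Set (V m) := {v | v.1 = 0 ∧ v.2 ≤ 0}

theorem Nr_closed (m : ℕ) : IsClosed (Nr m) :=
  (isClosed_eq continuous_fst continuous_const).inter (isClosed_le continuous_snd continuous_const)

/-- base point -/
def eN (m : ℕ) : Nz (V m) := ⟨ev m, ev_ne m⟩

/-- homotopy group of the punctured space -/
abbrev PiV (m : ℕ) := HomotopyGroup (Fin m) (Nz (V m)) (eN m)

theorem bdry_closed (m : ℕ) : IsClosed (Cube.boundary (Fin m)) := by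
  have : Cube.boundary (Fin m) = ⋃ i : Fin m, {y : Cb m | y i = 0 ∨ y i = 1} := by
    ext y; simp [Cube.boundary]
  rw [this]
  refine isClosed_iUnion_of_finite fun i => ?_
  exact (isClosed_eq (continuous_apply i) continuous_const).union (isClosed_eq (continuous_apply i) continuous_const)

section
variable {m : ℕ}

/-- the class `z` is represented by `q` -/
def Rep (q : Cb m → V m) (z : PiV m) : Prop :=
  ∃ L : GenLoop (Fin m) (Nz (V m)) (eN m), (∀ x, (L x : V m) = q x) ∧ (⟦L⟧ : PiV m) = z

/-- loop from a function -/
def mkL (q : Cb m → V m) (hq : Continuous q) (h0 : ∀ x, q x ≠ 0) (hb : ∀ x ∈ Cube.boundary (Fin m), q x = ev m) :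
    GenLoop (Fin m) (Nz (V m)) (eN m) :=
  ⟨⟨fun x => ⟨q x, h0 x⟩, by fun_prop⟩, fun x hx => Subtype.ext (hb x hx)⟩

theorem rep_exists {q : Cb m → V m} (hq : Continuous q) (h0 : ∀ x, q x ≠ 0) (hb : ∀ x ∈ Cube.boundary (Fin m), q x = ev m) :
    ∃ z, Rep q z := ⟨_, mkL q hq h0 hb, fun _ => rfl, rfl⟩

theorem rep_hom (Q : I → Cb m → V m) (hQ : Continuous fun p : I × Cb m => Q p.1 p.2) (h0 : ∀ t x, Q t x ≠ 0)
    (hb : ∀ t, ∀ x ∈ Cube.boundary (Fin m), Q t x = ev m) {z z' : PiV m} (h : Rep (Q 0) z) (h' : Rep (Q 1) z') : z = z' := by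
  obtain ⟨L, hL, rfl⟩ := h
  obtain ⟨L', hL', rfl⟩ := h'
  refine Quotient.sound ?_
  refine ⟨⟨⟨⟨fun p => ⟨Q p.1 p.2, h0 _ _⟩, by fun_prop⟩, ?_, ?_⟩, ?_⟩⟩
  · intro x; exact Subtype.ext (hL x).symm
  · intro x; exact Subtype.ext (hL' x).symm
  · intro t x hx
    refine Subtype.ext ?_
    change Q t x = (L x : V m)
    rw [hL, hb t x hx, hb 0 x hx]

/-- the class obtained by blending with the base point -/
def Cls (k : Cb m → V m) (z : PiV m) : Prop :=
  ∃ τ : Cb m → ℝ, Continuous τ ∧ (∀ x, 0 ≤ τ x ∧ τ x ≤ 1) ∧ (∀ x ∈ Cube.boundary (Fin m), τ x = 1) ∧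
    (∀ x, k x ∈ Nr m → τ x = 0) ∧ Rep (fun x => (1 - τ x) • k x + τ x • ev m) z

theorem blend_ne {v : V m} {τ : ℝ} (hv : v ≠ 0) (h0 : 0 ≤ τ) (h1 : τ ≤ 1) (h : v ∈ Nr m → τ = 0) :
    (1 - τ) • v + τ • ev m ≠ 0 := by
  intro he
  have e1 := congrArg Prod.fst he
  have e2 := congrArg Prod.snd he
  simp only [ev, Prod.fst_add, Prod.smul_fst, smul_zero, add_zero, Prod.fst_zero, smul_eq_zero, Prod.snd_add,
    Prod.smul_snd, smul_eq_mul, mul_one, Prod.snd_zero] at e1 e2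
  rcases e1 with e1 | e1
  · have : τ = 1 := by linarith
    subst this; simp at e2
  · have h3 : τ = 0 := by
      rcases h1.lt_or_eq with h4 | h4
      · refine h ⟨e1, ?_⟩
        by_contra h5; push Not at h5; nlinarith [mul_pos (sub_pos.2 h4) h5]
      · subst h4; simp at e2
    subst h3
    apply hv
    refine Prod.ext e1 ?_
    simpa using e2

/-- functions of the cube with boundary off the negative ray -/
structure Good (k : Cb m → V m) : Prop where
  cont : Continuous k
  ne : ∀ x, k x ≠ 0
  bd : ∀ x ∈ Cube.boundary (Fin m), k x ∉ Nr m

theorem ury {X : Type*} [TopologicalSpace X] [NormalSpace X] {A B : Set X} (hA : IsClosed A) (hB : IsClosed B) (h : Disjoint A B) :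
    ∃ τ : X → ℝ, Continuous τ ∧ (∀ x, 0 ≤ τ x ∧ τ x ≤ 1) ∧ (∀ x ∈ A, τ x = 1) ∧ ∀ x ∈ B, τ x = 0 := by
  obtain ⟨f, h0, h1, h2⟩ := exists_continuous_zero_one_of_isClosed hB hA h.symm
  exact ⟨f, f.continuous, h2, h1, h0⟩

theorem cls_rep_exists {k : Cb m → V m} (hk : Good k) {τ : Cb m → ℝ} (h1 : Continuous τ) (h2 : ∀ x, 0 ≤ τ x ∧ τ x ≤ 1)
    (h3 : ∀ x ∈ Cube.boundary (Fin m), τ x = 1) (h4 : ∀ x, k x ∈ Nr m → τ x = 0) :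
    ∃ z, Rep (fun x => (1 - τ x) • k x + τ x • ev m) z := by
  have := hk.cont
  refine rep_exists (by fun_prop) (fun x => blend_ne (hk.ne x) (h2 x).1 (h2 x).2 (h4 x)) ?_
  intro x hx
  simp [h3 x hx]

theorem cls_exists {k : Cb m → V m} (hk : Good k) : ∃ z, Cls k z := by
  obtain ⟨τ, h1, h2, h3, h4⟩ := ury (bdry_closed m) ((Nr_closed m).preimage hk.cont)
    (Set.disjoint_left.2 fun x hx => hk.bd x hx)
  obtain ⟨z, hz⟩ := cls_rep_exists hk h1 h2 h3 h4
  exact ⟨z, τ, h1, h2, h3, h4, hz⟩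

theorem cls_unique0 {k : Cb m → V m} (hk : Good k) {z z' : PiV m} (h : Cls k z) (h' : Cls k z') : z = z' := by
  obtain ⟨τ, h1, h2, h3, h4, hz⟩ := h
  obtain ⟨τ', h1', h2', h3', h4', hz'⟩ := h'
  have := hk.cont
  refine rep_hom (fun t x => (1 - ((1 - (t:ℝ)) * τ x + t * τ' x)) • k x + ((1 - (t:ℝ)) * τ x + t * τ' x) • ev m)
    (by fun_prop) ?_ ?_ (by simpa using hz) (by simpa using hz')
  · intro t x
    have t0 := t.2.1
    have t1 := t.2.2
    have := h2 x
    have := h2' x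
    refine blend_ne (hk.ne x) (by nlinarith) (by nlinarith) fun hx => ?_
    rw [h4 x hx, h4' x hx]; simp
  · intro t x hx
    rw [h3 x hx, h3' x hx]; simp

theorem cls_unique (K : I → Cb m → V m) (hK : Continuous fun p : I × Cb m => K p.1 p.2) (h0 : ∀ t x, K t x ≠ 0)
    (hb : ∀ t, ∀ x ∈ Cube.boundary (Fin m), K t x ∉ Nr m) {z z' : PiV m} (h : Cls (K 0) z) (h' : Cls (K 1) z') : z = z' := by
  have hKt : ∀ t, Continuous (K t) := fun t => hK.comp (Continuous.prodMk_right t)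
  have hG : ∀ t, Good (K t) := fun t => ⟨hKt t, h0 t, hb t⟩
  obtain ⟨T, h1, h2, h3, h4⟩ := ury ((bdry_closed m).preimage (continuous_snd (X := I))) ((Nr_closed m).preimage hK)
    (Set.disjoint_left.2 fun p hx => hb p.1 p.2 hx)
  have hT : ∀ t : I, Continuous fun x => T (t, x) := fun t => h1.comp (Continuous.prodMk_right t)
  have hC : ∀ t, ∃ z, Rep (fun x => (1 - T (t, x)) • K t x + T (t, x) • ev m) z := fun t =>
    cls_rep_exists (hG t) (hT t) (fun x => h2 _) (fun x hx => h3 (t, x) hx) (fun x hx => h4 (t, x) hx)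
  obtain ⟨w0, hw0⟩ := hC 0
  obtain ⟨w1, hw1⟩ := hC 1
  have e0 : z = w0 := cls_unique0 (hG 0) h ⟨_, hT 0, fun x => h2 _, fun x hx => h3 (0, x) hx, fun x hx => h4 (0, x) hx, hw0⟩
  have e1 : z' = w1 := cls_unique0 (hG 1) h' ⟨_, hT 1, fun x => h2 _, fun x hx => h3 (1, x) hx, fun x hx => h4 (1, x) hx, hw1⟩
  rw [e0, e1]
  refine rep_hom (fun t x => (1 - T (t, x)) • K t x + T (t, x) • ev m) (by fun_prop) ?_ ?_ hw0 hw1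
  · intro t x
    exact blend_ne (h0 t x) (h2 _).1 (h2 _).2 (h4 (t, x))
  · intro t x hx
    have := h3 (t, x) hx
    simp [this]

theorem ev_notMem : ev m ∉ Nr m := by
  rintro ⟨_, h⟩; simp [ev] at h; linarith

theorem rep_cls {k : Cb m → V m} (hk : Continuous k) (h0 : ∀ x, k x ≠ 0) (hb : ∀ x ∈ Cube.boundary (Fin m), k x = ev m)
    {z : PiV m} (h : Rep k z) : Cls k z := by
  have hG : Good k := ⟨hk, h0, fun x hx => by rw [hb x hx]; exact ev_notMem⟩
  obtain ⟨z', hz'⟩ := cls_exists hG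
  obtain ⟨τ, h1, h2, h3, h4, hz⟩ := id hz'
  have : z = z' := by
    refine rep_hom (fun t x => (1 - (t : ℝ) * τ x) • k x + ((t:ℝ) * τ x) • ev m) (by fun_prop) ?_ ?_ (by simpa using h) (by simpa using hz)
    · intro t x
      have t0 := t.2.1
      have t1 := t.2.2
      have := h2 x
      exact blend_ne (h0 x) (by nlinarith) (by nlinarith) fun hx => by rw [h4 x hx]; simp
    · intro t x hx
      rw [hb x hx, ← add_smul]; simp
  rw [this]; exact hz'

variable [Nonempty (Fin m)]

theorem cls_flip {k : Cb m → V m} {z : PiV m} (h : Cls k z) (i : Fin m) :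
    Cls (fun x => k (fun j => if j = i then σ (x i) else x j)) z⁻¹ := by
  have hc : Continuous fun x : Cb m => (fun j => if j = i then σ (x i) else x j : Cb m) := by
    refine continuous_pi fun j => ?_
    split_ifs <;> fun_prop
  have hbd : ∀ x ∈ Cube.boundary (Fin m), (fun j => if j = i then σ (x i) else x j : Cb m) ∈ Cube.boundary (Fin m) := by
    rintro x ⟨j, hj⟩
    refine ⟨j, ?_⟩
    by_cases hji : j = i
    · subst hji
      simp only [if_true]
      rcases hj with h | h
      · right; simp [h]
      · left; simp [h]
    · simpa [hji] using hj
  obtain ⟨τ, h1, h2, h3, h4, L, hL, hz⟩ := h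
  refine ⟨fun x => τ (fun j => if j = i then σ (x i) else x j), h1.comp hc, fun x => h2 _, fun x hx => h3 _ (hbd x hx),
    fun x hx => h4 _ hx, GenLoop.symmAt i L, fun x => hL _, ?_⟩
  rw [← hz]
  exact HomotopyGroup.inv_spec.symm

theorem cls_split {k : Cb m → V m} (hk : Good k) (i : Fin m) {s : ℝ} (hs0 : 0 < s) (hs1 : s < 1)
    (hs : ∀ x : Cb m, (x i : ℝ) = s → k x ∉ Nr m) {z z1 z2 : PiV m} (h : Cls k z)
    (hz1 : Cls (fun x => k (Function.update x i (pI (s * x i)))) z1)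
    (hz2 : Cls (fun x => k (Function.update x i (pI (s + (1 - s) * x i)))) z2) : z = z2 * z1 := by
  have hupd : ∀ (Y : Type) [TopologicalSpace Y] (g : Y → Cb m) (f : Y → ℝ), Continuous g → Continuous f →
      Continuous fun p : Y => Function.update (g p) i (pI (f p)) := by
    intro Y _ g f hg hf
    exact Continuous.update hg i (pI_cont.comp hf)
  obtain ⟨τ, h1, h2, h3, h4⟩ := ury (A := Cube.boundary (Fin m) ∪ {x : Cb m | (x i : ℝ) = s})
    ((bdry_closed m).union (isClosed_eq (by fun_prop) continuous_const)) ((Nr_closed m).preimage hk.cont)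
    (Set.disjoint_left.2 fun x hx => by
      rcases hx with hx | hx
      · exact hk.bd x hx
      · exact hs x hx)
  -- the two halves
  have c1 : Continuous fun x : Cb m => Function.update x i (pI (s * x i)) := hupd _ _ _ continuous_id (by fun_prop)
  have c2 : Continuous fun x : Cb m => Function.update x i (pI (s + (1 - s) * x i)) := hupd _ _ _ continuous_id (by fun_prop)
  have m1 : ∀ x ∈ Cube.boundary (Fin m), Function.update x i (pI (s * x i)) ∈ Cube.boundary (Fin m) ∪ {x : Cb m | (x i : ℝ) = s} := by
    rintro x ⟨j, hj⟩
    by_cases hji : j = i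
    · subst hji
      rcases hj with h | h
      · left; refine ⟨j, Or.inl ?_⟩; simp [h, pI_of_le]
      · right; simp [h, pI_of_mem (⟨hs0.le, hs1.le⟩ : s ∈ Set.Icc (0:ℝ) 1)]
    · left; refine ⟨j, ?_⟩; simpa [hji] using hj
  have m2 : ∀ x ∈ Cube.boundary (Fin m), Function.update x i (pI (s + (1 - s) * x i)) ∈ Cube.boundary (Fin m) ∪ {x : Cb m | (x i : ℝ) = s} := by
    rintro x ⟨j, hj⟩
    by_cases hji : j = i
    · subst hji
      rcases hj with h | h
      · right; simp [h, pI_of_mem (⟨hs0.le, hs1.le⟩ : s ∈ Set.Icc (0:ℝ) 1)]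
      · left; refine ⟨j, Or.inr ?_⟩; simp [h, pI_of_ge]
    · left; refine ⟨j, ?_⟩; simpa [hji] using hj
  have d1 : Disjoint (Cube.boundary (Fin m) ∪ {x : Cb m | (x i : ℝ) = s}) (k ⁻¹' Nr m) :=
    Set.disjoint_left.2 fun x hx => by
      rcases hx with hx | hx
      · exact hk.bd x hx
      · exact hs x hx
  have G1 : Good (fun x => k (Function.update x i (pI (s * x i)))) :=
    ⟨hk.cont.comp c1, fun x => hk.ne _, fun x hx => Set.disjoint_left.1 d1 (m1 x hx)⟩
  have G2 : Good (fun x => k (Function.update x i (pI (s + (1 - s) * x i)))) :=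
    ⟨hk.cont.comp c2, fun x => hk.ne _, fun x hx => Set.disjoint_left.1 d1 (m2 x hx)⟩
  obtain ⟨w1, hw1⟩ := cls_rep_exists G1 (h1.comp c1) (fun x => h2 _) (fun x hx => h3 _ (m1 x hx)) (fun x hx => h4 _ hx)
  obtain ⟨w2, hw2⟩ := cls_rep_exists G2 (h1.comp c2) (fun x => h2 _) (fun x hx => h3 _ (m2 x hx)) (fun x hx => h4 _ hx)
  have e1 : z1 = w1 := cls_unique0 G1 hz1 ⟨_, h1.comp c1, fun x => h2 _, fun x hx => h3 _ (m1 x hx), fun x hx => h4 _ hx, hw1⟩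
  have e2 : z2 = w2 := cls_unique0 G2 hz2 ⟨_, h1.comp c2, fun x => h2 _, fun x hx => h3 _ (m2 x hx), fun x hx => h4 _ hx, hw2⟩
  -- reparametrization
  let ρ : ℝ → ℝ := fun y => s * pI (2 * y) + (1 - s) * pI (2 * y - 1)
  have hρ : Continuous ρ := by have := pI_cont; fun_prop
  have hρ0 : ρ 0 = 0 := by simp [ρ, pI_of_le]
  have hρ1 : ρ 1 = 1 := by simp only [ρ]; rw [pI_of_ge (by norm_num), pI_of_ge (by norm_num)]; simp
  let ψ : I → Cb m → Cb m := fun t x => Function.update x i (pI ((1 - (t:ℝ)) * x i + t * ρ (x i)))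
  have hψ : Continuous fun p : I × Cb m => ψ p.1 p.2 := hupd _ _ _ continuous_snd (by fun_prop)
  have hψb : ∀ t, ∀ x ∈ Cube.boundary (Fin m), ψ t x ∈ Cube.boundary (Fin m) := by
    rintro t x ⟨j, hj⟩
    refine ⟨j, ?_⟩
    by_cases hji : j = i
    · subst hji
      rcases hj with h | h
      · left; simp [ψ, h, hρ0, pI_of_le]
      · right; simp [ψ, h, hρ1, pI_of_ge]
    · simpa [ψ, hji] using hj
  have hψ1 : Continuous (ψ 1) := hψ.comp (Continuous.prodMk_right (1 : I))
  have hψ0 : ∀ x, ψ 0 x = x := fun x => by simp [ψ, pI_coe]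
  have G3 : Good (fun x => k (ψ 1 x)) := ⟨hk.cont.comp hψ1, fun x => hk.ne _, fun x hx => hk.bd _ (hψb 1 x hx)⟩
  obtain ⟨w, hw⟩ := cls_rep_exists G3 (h1.comp hψ1) (fun x => h2 _) (fun x hx => h3 _ (Or.inl (hψb 1 x hx))) (fun x hx => h4 _ hx)
  have e3 : z = w := by
    refine cls_unique (fun t x => k (ψ t x)) (hk.cont.comp hψ) (fun t x => hk.ne _) (fun t x hx => hk.bd _ (hψb t x hx))
      (by simpa [hψ0] using h) ⟨_, h1.comp hψ1, fun x => h2 _, fun x hx => h3 _ (Or.inl (hψb 1 x hx)), fun x hx => h4 _ hx, hw⟩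
  obtain ⟨L, hL, rfl⟩ := hw
  obtain ⟨L1, hL1, rfl⟩ := hw1
  obtain ⟨L2, hL2, rfl⟩ := hw2
  rw [e1, e2, e3]
  have : L = GenLoop.transAt i L1 L2 := by
    refine GenLoop.ext _ _ fun x => Subtype.ext ?_
    have hx := (x i).2
    rw [hL, GenLoop.transAt, GenLoop.coe_copy]
    split_ifs with hh
    · rw [hL1]
      have : Function.update (Function.update x i (Set.projIcc 0 1 zero_le_one (2 * (x i : ℝ)))) i
          (pI (s * (Function.update x i (Set.projIcc 0 1 zero_le_one (2 * (x i : ℝ))) i : I))) = ψ 1 x := by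
        simp only [Function.update_idem, Function.update_self, ψ]
        congr 2
        have : pI (2 * (x i : ℝ) - 1) = 0 := pI_of_le (by linarith)
        simp only [ρ, this]
        simp [pI]
      simp only [Function.comp_apply]
      rw [this]
    · rw [hL2]
      have : Function.update (Function.update x i (Set.projIcc 0 1 zero_le_one (2 * (x i : ℝ) - 1))) i
          (pI (s + (1 - s) * (Function.update x i (Set.projIcc 0 1 zero_le_one (2 * (x i : ℝ) - 1)) i : I))) = ψ 1 x := by
        simp only [Function.update_idem, Function.update_self, ψ]
        congr 2
        have : pI (2 * (x i : ℝ)) = 1 := pI_of_ge (by push Not at hh; linarith)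
        simp only [ρ, this]
        simp [pI]
      simp only [Function.comp_apply]
      rw [this]
  rw [this]
  exact HomotopyGroup.mul_spec.symm

end
end CB

namespace CB
open MeasureTheory Matrix
open scoped ContDiff Topology

section
variable {m : ℕ}

/-- linear model -/
def lin (A : Matrix (Fin m) (Fin m) ℝ) (x : Cb m) : V m := (A *ᵥ (fun i => 2 * (x i : ℝ) - 1), -1)

theorem bd_vec_ne {x : Cb m} (hx : x ∈ Cube.boundary (Fin m)) : (fun i => 2 * (x i : ℝ) - 1) ≠ (0 : Fin m → ℝ) := by
  obtain ⟨i, hi⟩ := hx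
  intro h
  have := congrFun h i
  rcases hi with hi | hi <;> simp [hi] at this <;> norm_num at this

theorem lin_bd {A : Matrix (Fin m) (Fin m) ℝ} (hA : A.det ≠ 0) {x : Cb m} (hx : x ∈ Cube.boundary (Fin m)) : lin A x ∉ Nr m := by
  rintro ⟨h, _⟩
  exact bd_vec_ne hx (Matrix.eq_zero_of_mulVec_eq_zero hA h)

theorem lin_ne (A : Matrix (Fin m) (Fin m) ℝ) (x : Cb m) : lin A x ≠ 0 := by
  intro h; have := congrArg Prod.snd h; simp [lin] at this

theorem lin_path (A : I → Matrix (Fin m) (Fin m) ℝ) (hA : Continuous A) (h : ∀ t, (A t).det ≠ 0) {z z' : PiV m}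
    (h0 : Cls (lin (A 0)) z) (h1 : Cls (lin (A 1)) z') : z = z' := by
  refine cls_unique (fun t x => lin (A t) x) ?_ (fun t x => lin_ne _ x) (fun t x hx => lin_bd (h t) hx) h0 h1
  unfold lin
  have : Continuous fun p : I × Cb m => A p.1 := hA.comp continuous_fst
  refine Continuous.prodMk (Continuous.matrix_mulVec this (by fun_prop)) (by fun_prop)

theorem lin_good {A : Matrix (Fin m) (Fin m) ℝ} (hA : A.det ≠ 0) : Good (lin A) := by
  refine ⟨?_, lin_ne A, fun x hx => lin_bd hA hx⟩
  unfold lin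
  refine Continuous.prodMk (Continuous.matrix_mulVec continuous_const (by fun_prop)) (by fun_prop)

variable [Nonempty (Fin m)] {ι : PiV m}

theorem lin_sign (hι : Cls (lin (1 : Matrix (Fin m) (Fin m) ℝ)) ι) (S : Finset (Fin m)) :
    ∀ z, Cls (lin (diagonal (fun i => if i ∈ S then (-1:ℝ) else 1))) z → z ∈ Subgroup.zpowers ι := by
  have hdet : ∀ S : Finset (Fin m), (diagonal (fun i => if i ∈ S then (-1:ℝ) else 1)).det ≠ 0 := by
    intro S
    rw [det_diagonal]
    refine Finset.prod_ne_zero_iff.2 fun i _ => ?_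
    split_ifs <;> norm_num
  induction S using Finset.induction_on with
  | empty =>
    intro z hz
    have : z = ι := by
      refine cls_unique0 (lin_good (A := 1) (by simp)) ?_ hι
      simpa using hz
    rw [this]; exact Subgroup.mem_zpowers ι
  | insert i S hi ih =>
    intro z hz
    obtain ⟨w, hw⟩ := cls_exists (lin_good (hdet S))
    have := cls_flip hw i
    have h2 : z = w⁻¹ := by
      refine cls_unique0 (lin_good (hdet (insert i S))) hz ?_
      convert this using 2 with x
      unfold lin
      congr 1
      ext j
      simp only [mulVec_diagonal, Finset.mem_insert]
      by_cases hj : j = i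
      · subst hj; simp [hi]; ring
      · simp [hj]
    rw [h2]
    exact inv_mem (ih w hw)

theorem det_tv_list (L : List (TransvectionStruct (Fin m) ℝ)) : (L.map TransvectionStruct.toMatrix).prod.det = 1 := by
  induction L with
  | nil => simp
  | cons a L ih => simp [ih, det_mul]

theorem lin_mem (hι : Cls (lin (1 : Matrix (Fin m) (Fin m) ℝ)) ι) {A : Matrix (Fin m) (Fin m) ℝ} (hA : A.det ≠ 0) {z : PiV m}
    (hz : Cls (lin A) z) : z ∈ Subgroup.zpowers ι := by
  obtain ⟨L, L', D, hD⟩ := Matrix.Pivot.exists_list_transvec_mul_diagonal_mul_list_transvec A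
  have hD0 : ∀ i, D i ≠ 0 := by
    rw [hD, det_mul, det_mul, det_diagonal, det_tv_list, det_tv_list] at hA
    simp only [one_mul, mul_one] at hA
    exact fun i => Finset.prod_ne_zero_iff.1 hA i (Finset.mem_univ i)
  -- scaled transvections
  let sc : ℝ → TransvectionStruct (Fin m) ℝ → TransvectionStruct (Fin m) ℝ := fun t a => ⟨a.i, a.j, a.hij, (1 - t) * a.c⟩
  let M : List (TransvectionStruct (Fin m) ℝ) → I → Matrix (Fin m) (Fin m) ℝ := fun L t =>
    ((L.map (sc t)).map TransvectionStruct.toMatrix).prod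
  have hM : ∀ L, Continuous (M L) := by
    intro L
    induction L with
    | nil => simp only [M, List.map_nil, List.prod_nil]; fun_prop
    | cons a L ih =>
      have : M (a :: L) = fun t : I => (1 + Matrix.single a.i a.j ((1 - (t:ℝ)) * a.c)) * M L t := by
        ext1 t; simp [M, sc, TransvectionStruct.toMatrix, transvection]
      rw [this]
      refine Continuous.mul (continuous_const.add ?_) ih
      refine continuous_matrix fun i j => ?_
      simp only [Matrix.single_apply]
      split_ifs <;> fun_prop
  have hM0 : ∀ L, M L 0 = (L.map TransvectionStruct.toMatrix).prod := by
    intro L; simp only [M, List.map_map]; congr 1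
    refine List.map_congr_left fun a _ => ?_
    simp [sc, TransvectionStruct.toMatrix]
  have hM1 : ∀ L, M L 1 = 1 := by
    intro L; simp only [M, List.map_map]
    refine List.prod_eq_one ?_
    intro B hB
    obtain ⟨a, _, rfl⟩ := List.mem_map.1 hB
    simp [sc, TransvectionStruct.toMatrix]
  let S : Finset (Fin m) := Finset.univ.filter fun i => D i < 0
  let D' : I → Fin m → ℝ := fun t i => (1 - (t:ℝ)) * D i + t * (if i ∈ S then -1 else 1)
  have hD' : ∀ t i, D' t i ≠ 0 := by
    intro t i
    have t0 := t.2.1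
    have t1 := t.2.2
    simp only [D', S, Finset.mem_filter, Finset.mem_univ, true_and]
    split_ifs with h
    · refine ne_of_lt ?_
      rcases t1.lt_or_eq with h1 | h1
      · nlinarith
      · rw [h1]; norm_num
    · have h2 : 0 < D i := lt_of_le_of_ne (not_lt.1 h) (hD0 i).symm
      refine ne_of_gt ?_
      rcases t1.lt_or_eq with h1 | h1
      · nlinarith
      · rw [h1]; norm_num
  have hdet : ∀ t, (M L t * diagonal (D' t) * M L' t).det ≠ 0 := by
    intro t
    rw [det_mul, det_mul, det_tv_list, det_tv_list, det_diagonal, one_mul, mul_one]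
    exact Finset.prod_ne_zero_iff.2 fun i _ => hD' t i
  obtain ⟨w, hw⟩ := cls_exists (lin_good (hdet 1))
  have e : z = w := by
    refine lin_path (fun t => M L t * diagonal (D' t) * M L' t) ?_ hdet ?_ hw
    · refine ((hM L).mul (Continuous.matrix_diagonal ?_)).mul (hM L')
      exact continuous_pi fun i => by simp only [D']; fun_prop
    · rw [hM0, hM0]
      have : D' 0 = D := by ext i; simp [D']
      rw [this, ← hD]; exact hz
  rw [e]
  rw [hM1, hM1, one_mul, mul_one] at hw
  refine lin_sign hι S w ?_
  have : D' 1 = fun i => if i ∈ S then (-1:ℝ) else 1 := by ext i; simp [D']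
  rw [← this]; exact hw

/-- restriction to a box -/
def kb (h : (Fin m → ℝ) → V m) (a b : Fin m → ℝ) (x : Cb m) : V m := h (fun i => a i + x i * (b i - a i))

theorem kb_mem {a b : Fin m → ℝ} (hab : ∀ i, a i < b i) (x : Cb m) : (fun i => a i + (x i : ℝ) * (b i - a i)) ∈ Set.Icc a b := by
  constructor
  · intro i; have := (x i).2.1; have := hab i; simp only; nlinarith
  · intro i; have := (x i).2.2; have := hab i; simp only; nlinarith

theorem kb_bd {a b y : Fin m → ℝ} (hy : ∀ i, a i < y i ∧ y i < b i) {x : Cb m} (hx : x ∈ Cube.boundary (Fin m)) :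
    (fun i => a i + (x i : ℝ) * (b i - a i)) ≠ y := by
  obtain ⟨i, hi⟩ := hx
  intro h
  have := congrFun h i
  have h2 := hy i
  rcases hi with hi | hi <;> simp [hi] at this <;> linarith

theorem one_zero (hι : Cls (lin (1 : Matrix (Fin m) (Fin m) ℝ)) ι) {h : (Fin m → ℝ) → V m} (hh : Continuous h)
    {a b y : Fin m → ℝ} (hn : ∀ v ∈ Set.Icc a b, h v ≠ 0) (hy : ∀ i, a i < y i ∧ y i < b i)
    (hZ : ∀ v ∈ Set.Icc a b, h v ∈ Nr m → v = y) (hyN : h y ∈ Nr m)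
    (A : (Fin m → ℝ) ≃L[ℝ] (Fin m → ℝ)) (hA : HasFDerivAt (fun v => (h v).1) (A : (Fin m → ℝ) →L[ℝ] (Fin m → ℝ)) y)
    {z : PiV m} (hz : Cls (kb h a b) z) : z ∈ Subgroup.zpowers ι := by
  have hab : ∀ i, a i < b i := fun i => (hy i).1.trans (hy i).2
  have hmem : y ∈ Set.Icc a b := ⟨fun i => (hy i).1.le, fun i => (hy i).2.le⟩
  have hy2 : (h y).2 < 0 := by
    refine lt_of_le_of_ne hyN.2 fun h2 => hn y hmem (Prod.ext hyN.1 h2)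
  obtain ⟨c, hc, hcA⟩ : ∃ c : ℝ, 0 < c ∧ ∀ v, c * ‖v‖ ≤ ‖A v‖ := by
    obtain ⟨C, hC, hC2⟩ := (A.symm : (Fin m → ℝ) →L[ℝ] (Fin m → ℝ)).bound
    refine ⟨C⁻¹, by positivity, fun v => ?_⟩
    have := hC2 (A v)
    simp only [ContinuousLinearEquiv.coe_coe, ContinuousLinearEquiv.symm_apply_apply] at this
    rw [inv_mul_le_iff₀ hC]; exact this
  -- choose the radius
  obtain ⟨ε, hε, hball⟩ : ∃ ε > 0, ∀ v : Fin m → ℝ, ‖v - y‖ ≤ ε → v ∈ Set.Icc a b ∧ (h v).2 < 0 ∧ (∀ i, a i < y i - ε ∧ y i + ε < b i) ∧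
      ‖(h v).1 - A (v - y)‖ ≤ c / 2 * ‖v - y‖ := by
    have e1 : ∀ᶠ v in 𝓝 y, v ∈ Set.Icc a b := by
      have : ∀ᶠ v in 𝓝 y, ∀ i, a i < v i ∧ v i < b i := by
        rw [Filter.eventually_all]
        intro i
        have hc : Continuous fun v : Fin m → ℝ => v i := continuous_apply i
        exact hc.continuousAt.eventually ((isOpen_Ioo (a := a i) (b := b i)).mem_nhds ⟨(hy i).1, (hy i).2⟩)
      filter_upwards [this] with v hv
      exact ⟨fun i => (hv i).1.le, fun i => (hv i).2.le⟩
    have e2 : ∀ᶠ v in 𝓝 y, (h v).2 < 0 := (isOpen_lt (by fun_prop) continuous_const).mem_nhds hy2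
    have e3 := hA.isLittleO.bound (half_pos hc)
    have e4 : ∀ᶠ r in 𝓝[>] (0:ℝ), ∀ i, a i < y i - r ∧ y i + r < b i := by
      refine Filter.Eventually.filter_mono nhdsWithin_le_nhds ?_
      rw [Filter.eventually_all]
      intro i
      have c1 : Continuous fun r : ℝ => y i - r := by fun_prop
      have c2 : Continuous fun r : ℝ => y i + r := by fun_prop
      exact (c1.continuousAt.eventually (isOpen_Ioi.mem_nhds (by simpa using (hy i).1))).and
        (c2.continuousAt.eventually (isOpen_Iio.mem_nhds (by simpa using (hy i).2)))
    obtain ⟨r, hr, hr2⟩ := Metric.eventually_nhds_iff.1 ((e1.and e2).and e3)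
    obtain ⟨r', hr', hr'2⟩ := (e4.and (Ioo_mem_nhdsGT hr)).exists
    refine ⟨r', hr'2.1, fun v hv => ?_⟩
    have hd : dist v y < r := by rw [dist_eq_norm]; exact hv.trans_lt hr'2.2
    obtain ⟨⟨q1, q2⟩, q3⟩ := hr2 hd
    refine ⟨q1, q2, hr', ?_⟩
    simpa [hyN.1] using q3
  have hyε := (hball y (by simpa using hε.le)).2.2.1
  -- first: shrink the box
  let a' : I → Fin m → ℝ := fun t i => (1 - (t:ℝ)) * a i + t * (y i - ε)
  let b' : I → Fin m → ℝ := fun t i => (1 - (t:ℝ)) * b i + t * (y i + ε)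
  have ha' : ∀ t i, a i ≤ a' t i ∧ a' t i < y i := by
    intro t i
    have t0 := t.2.1
    have t1 := t.2.2
    have := hyε i
    have := hy i
    constructor
    · simp only [a']; nlinarith
    · simp only [a']
      rcases t1.lt_or_eq with h1 | h1
      · nlinarith
      · rw [h1]; linarith
  have hb' : ∀ t i, b' t i ≤ b i ∧ y i < b' t i := by
    intro t i
    have t0 := t.2.1
    have t1 := t.2.2
    have := hyε i
    have := hy i
    constructor
    · simp only [b']; nlinarith
    · simp only [b']
      rcases t1.lt_or_eq with h1 | h1
      · nlinarith
      · rw [h1]; linarith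
  have hsub : ∀ (t : I) (x : Cb m), (fun i => a' t i + (x i : ℝ) * (b' t i - a' t i)) ∈ Set.Icc a b := by
    intro t x
    have := kb_mem (fun i => (ha' t i).2.trans (hb' t i).2) x
    exact ⟨fun i => (ha' t i).1.trans (this.1 i), fun i => (this.2 i).trans (hb' t i).1⟩
  have hKc : Continuous fun p : I × Cb m => kb h (a' p.1) (b' p.1) p.2 := by
    unfold kb
    refine hh.comp (continuous_pi fun i => ?_)
    simp only [a', b']
    fun_prop
  have hKb : ∀ t, ∀ x ∈ Cube.boundary (Fin m), kb h (a' t) (b' t) x ∉ Nr m := fun t x hx hN =>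
    kb_bd (fun i => ⟨(ha' t i).2, (hb' t i).2⟩) hx (hZ _ (hsub t x) hN)
  have hG1 : Good (kb h (a' 1) (b' 1)) := ⟨hKc.comp (Continuous.prodMk_right (1 : I)), fun x => hn _ (hsub 1 x), hKb 1⟩
  obtain ⟨z1, hz1⟩ := cls_exists hG1
  have e1 : z = z1 := cls_unique (fun t x => kb h (a' t) (b' t) x) hKc (fun t x => hn _ (hsub t x)) hKb (by
    have h1 : a' 0 = a := by ext i; simp [a']
    have h2 : b' 0 = b := by ext i; simp [b']
    rw [h1, h2]; exact hz) hz1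
  -- second: linear homotopy
  let B : Matrix (Fin m) (Fin m) ℝ := ε • LinearMap.toMatrix' ((A : (Fin m → ℝ) →L[ℝ] (Fin m → ℝ)) : (Fin m → ℝ) →ₗ[ℝ] (Fin m → ℝ))
  have hBv : ∀ v, B *ᵥ v = A (ε • v) := by
    intro v
    simp only [B, smul_mulVec, map_smul]
    congr 1
    rw [← Matrix.toLin'_apply, Matrix.toLin'_toMatrix']; rfl
  have hB : B.det ≠ 0 := by
    intro hB
    obtain ⟨v, hv, hv2⟩ := Matrix.exists_mulVec_eq_zero_iff.2 hB
    rw [hBv, map_eq_zero_iff _ A.injective, smul_eq_zero] at hv2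
    rcases hv2 with h | h
    · exact hε.ne' h
    · exact hv h
  obtain ⟨z2, hz2⟩ := cls_exists (lin_good hB)
  have hpt : ∀ x : Cb m, (fun i => a' 1 i + (x i : ℝ) * (b' 1 i - a' 1 i)) = y + ε • (fun i => 2 * (x i : ℝ) - 1) := by
    intro x; ext i; simp [a', b']; ring
  have hle : ∀ x : Cb m, ‖(y + ε • (fun i => 2 * (x i : ℝ) - 1)) - y‖ ≤ ε := by
    intro x
    rw [add_sub_cancel_left, norm_smul, Real.norm_of_nonneg hε.le]
    refine mul_le_of_le_one_right hε.le ((pi_norm_le_iff_of_nonneg zero_le_one).2 fun i => ?_)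
    rw [Real.norm_eq_abs, abs_le]
    have := (x i).2
    constructor
    · linarith [this.1]
    · linarith [this.2]
  have e2 : z1 = z2 := by
    refine cls_unique (fun t x => (1 - (t:ℝ)) • kb h (a' 1) (b' 1) x + (t:ℝ) • lin B x) ?_ ?_ ?_ (by simpa using hz1) (by simpa using hz2)
    · have := hG1.cont
      have := (lin_good hB).cont
      fun_prop
    · intro t x h0
      have h2 := congrArg Prod.snd h0
      have h3 := (hball _ (hle x)).2.1
      simp only [kb, hpt, lin, Prod.snd_add, Prod.smul_snd, smul_eq_mul, Prod.snd_zero] at h2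
      have t0 := t.2.1
      have t1 := t.2.2
      rcases t1.lt_or_eq with h1 | h1
      · nlinarith [mul_pos (sub_pos.2 h1) (neg_pos.2 h3)]
      · rw [h1] at h2; norm_num at h2
    · intro t x hx hN
      have h2 := hN.1
      have h3 := (hball _ (hle x)).2.2.2
      set w : Fin m → ℝ := fun i => 2 * (x i : ℝ) - 1 with hw
      have hw0 : w ≠ 0 := bd_vec_ne hx
      simp only [kb, hpt, lin, Prod.fst_add, Prod.smul_fst] at h2
      rw [← hw] at h2
      rw [hBv] at h2
      rw [add_sub_cancel_left] at h3
      have h4 := hcA (ε • w)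
      have h5 : A (ε • w) = -((1 - (t:ℝ)) • ((h (y + ε • w)).1 - A (ε • w))) := by
        rw [eq_neg_iff_add_eq_zero, ← h2]; module
      have h6 : 0 < ‖ε • w‖ := norm_pos_iff.2 (smul_ne_zero hε.ne' hw0)
      have t0 := t.2.1
      have t1 := t.2.2
      have h7 : ‖A (ε • w)‖ ≤ c / 2 * ‖ε • w‖ := by
        rw [h5, norm_neg, norm_smul, Real.norm_of_nonneg (by linarith)]
        refine le_trans (mul_le_of_le_one_left (norm_nonneg _) (by linarith)) h3
      nlinarith [mul_pos hc h6]
  rw [e1, e2]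
  exact lin_mem hι hB hz2

end
end CB

namespace CB
open MeasureTheory Matrix
open scoped ContDiff Topology

section
variable {m : ℕ} [Nonempty (Fin m)] {ι : PiV m}

theorem cls_const {z : PiV m} (h : Cls (fun _ => ev m) z) : z = 1 := by
  have hG : Good (fun _ : Cb m => ev m) := ⟨continuous_const, fun _ => ev_ne m, fun _ _ => ev_notMem⟩
  have i : Fin m := Classical.arbitrary _
  have := cls_split hG i (s := 1/2) (by norm_num) (by norm_num) (fun _ _ => ev_notMem) h h h
  simpa using this

theorem cls_triv {k : Cb m → V m} (hk : Continuous k) (hn : ∀ x, k x ∉ Nr m) {z : PiV m} (h : Cls k z) : z = 1 := by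
  have hG : Good (fun _ : Cb m => ev m) := ⟨continuous_const, fun _ => ev_ne m, fun _ _ => ev_notMem⟩
  obtain ⟨w, hw⟩ := cls_exists hG
  have key : ∀ (t : I) x, (1 - (t:ℝ)) • k x + (t:ℝ) • ev m ∉ Nr m := by
    rintro t x ⟨h1, h2⟩
    have t0 := t.2.1
    have t1 := t.2.2
    simp only [ev, Prod.fst_add, Prod.smul_fst, smul_zero, add_zero, Prod.snd_add, Prod.smul_snd, smul_eq_mul, mul_one] at h1 h2
    rcases smul_eq_zero.1 h1 with h3 | h3
    · rw [h3] at h2; linarith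
    · have : 0 < (k x).2 := by
        by_contra hc
        exact hn x ⟨h3, not_lt.1 hc⟩
      rcases t0.lt_or_eq with h4 | h4
      · nlinarith
      · rw [← h4] at h2; linarith
  have : z = w := by
    refine cls_unique (fun t x => (1 - (t:ℝ)) • k x + (t:ℝ) • ev m) (by fun_prop) (fun t x h0 => key t x ?_) (fun t x _ => key t x)
      (by simpa using h) (by simpa using hw)
    rw [h0]; exact ⟨rfl, le_refl _⟩
  rw [this, cls_const hw]

theorem box_mem (hι : Cls (lin (1 : Matrix (Fin m) (Fin m) ℝ)) ι) {h : (Fin m → ℝ) → V m} (hh : Continuous h) :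
    ∀ (N : ℕ) (Z : Finset (Fin m → ℝ)) (a b : Fin m → ℝ), Z.card ≤ N → (∀ i, a i < b i) →
    (∀ v ∈ Set.Icc a b, h v ≠ 0) → (∀ v ∈ Set.Icc a b, h v ∈ Nr m → v ∈ Z) →
    (∀ y ∈ Z, h y ∈ Nr m ∧ (∀ i, a i < y i ∧ y i < b i) ∧ ∃ A : (Fin m → ℝ) ≃L[ℝ] (Fin m → ℝ),
      HasFDerivAt (fun v => (h v).1) (A : (Fin m → ℝ) →L[ℝ] (Fin m → ℝ)) y) →
    ∀ z : PiV m, Cls (kb h a b) z → z ∈ Subgroup.zpowers ι := by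
  intro N
  induction N with
  | zero =>
    intro Z a b hZ hab hn hZ2 _ z hz
    have hZ0 : Z = ∅ := by simpa using hZ
    subst hZ0
    have : z = 1 := by
      refine cls_triv ?_ (fun x hx => by simpa using hZ2 _ (kb_mem hab x) hx) hz
      unfold kb
      exact hh.comp (continuous_pi fun i => by fun_prop)
    rw [this]; exact one_mem _
  | succ N ih =>
    intro Z a b hZ hab hn hZ2 hZ3 z hz
    by_cases h1 : Z.card ≤ N
    · exact ih Z a b h1 hab hn hZ2 hZ3 z hz
    rcases N.eq_zero_or_pos with h0 | hpos
    · subst h0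
      have : Z.card = 1 := by omega
      obtain ⟨y, rfl⟩ := Finset.card_eq_one.1 this
      obtain ⟨q1, q2, A, hA⟩ := hZ3 y (by simp)
      exact one_zero hι hh hn q2 (fun v hv hv2 => by simpa using hZ2 v hv hv2) q1 A hA hz
    have h2 : 1 < Z.card := by omega
    obtain ⟨y, hy, y', hy', hne⟩ := Finset.one_lt_card.1 h2
    obtain ⟨i, hi⟩ : ∃ i, y i ≠ y' i := by
      by_contra hc; push Not at hc; exact hne (funext hc)
    wlog hlt : y i < y' i generalizing y y'
    · exact this y' hy' y hy hne.symm hi.symm (lt_of_le_of_ne (not_lt.1 hlt) hi.symm)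
    obtain ⟨s', hs', hs'Z⟩ := (Set.Ioo_infinite hlt).exists_notMem_finset (Z.image fun v => v i)
    have hs'Z : ∀ v ∈ Z, v i ≠ s' := fun v hv h => hs'Z (Finset.mem_image.2 ⟨v, hv, h⟩)
    have has : a i < s' := ((hZ3 y hy).2.1 i).1.trans hs'.1
    have hsb : s' < b i := hs'.2.trans ((hZ3 y' hy').2.1 i).2
    have hd : 0 < b i - a i := sub_pos.2 (hab i)
    set s := (s' - a i) / (b i - a i) with hs
    have hs1 : s * (b i - a i) = s' - a i := by rw [hs]; field_simp
    have hs0 : 0 < s := div_pos (by linarith) hd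
    have hsl : s < 1 := by rw [hs, div_lt_one hd]; linarith
    have hkc : Continuous (kb h a b) := by
      unfold kb
      exact hh.comp (continuous_pi fun i => by fun_prop)
    have hG : Good (kb h a b) := by
      refine ⟨hkc, fun x => hn _ (kb_mem hab x), fun x hx hN => ?_⟩
      exact kb_bd (hZ3 _ (hZ2 _ (kb_mem hab x) hN)).2.1 hx rfl
    set b1 := Function.update b i s' with hb1
    set a2 := Function.update a i s' with ha2
    have hab1 : ∀ j, a j < b1 j := by
      intro j; by_cases hj : j = i
      · subst hj; simpa [hb1] using has
      · simpa [hb1, hj] using hab j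
    have hab2 : ∀ j, a2 j < b j := by
      intro j; by_cases hj : j = i
      · subst hj; simpa [ha2] using hsb
      · simpa [ha2, hj] using hab j
    have hsub1 : Set.Icc a b1 ⊆ Set.Icc a b := by
      refine Set.Icc_subset_Icc_right ?_
      intro j; by_cases hj : j = i
      · subst hj; simpa [hb1] using hsb.le
      · simp [hb1, hj]
    have hsub2 : Set.Icc a2 b ⊆ Set.Icc a b := by
      refine Set.Icc_subset_Icc_left ?_
      intro j; by_cases hj : j = i
      · subst hj; simpa [ha2] using has.le
      · simp [ha2, hj]
    have hZ31 : ∀ v ∈ Z.filter (fun v => v i < s'), ∀ j, a j < v j ∧ v j < b1 j := by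
      intro v hv j
      rw [Finset.mem_filter] at hv
      have := (hZ3 v hv.1).2.1 j
      refine ⟨this.1, ?_⟩
      by_cases hj : j = i
      · subst hj; simpa [hb1] using hv.2
      · simpa [hb1, hj] using this.2
    have hZ32 : ∀ v ∈ Z.filter (fun v => s' < v i), ∀ j, a2 j < v j ∧ v j < b j := by
      intro v hv j
      rw [Finset.mem_filter] at hv
      have := (hZ3 v hv.1).2.1 j
      refine ⟨?_, this.2⟩
      by_cases hj : j = i
      · subst hj; simpa [ha2] using hv.2
      · simpa [ha2, hj] using this.1
    have hZ21 : ∀ v ∈ Set.Icc a b1, h v ∈ Nr m → v ∈ Z.filter (fun v => v i < s') := by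
      intro v hv hN
      have h3 := hZ2 v (hsub1 hv) hN
      refine Finset.mem_filter.2 ⟨h3, lt_of_le_of_ne ?_ (hs'Z v h3)⟩
      simpa [hb1] using hv.2 i
    have hZ22 : ∀ v ∈ Set.Icc a2 b, h v ∈ Nr m → v ∈ Z.filter (fun v => s' < v i) := by
      intro v hv hN
      have h3 := hZ2 v (hsub2 hv) hN
      refine Finset.mem_filter.2 ⟨h3, lt_of_le_of_ne ?_ (hs'Z v h3).symm⟩
      simpa [ha2] using hv.1 i
    have c1 : (Z.filter (fun v => v i < s')).card ≤ N := by
      have : Z.filter (fun v => v i < s') ⊂ Z := Finset.filter_ssubset.2 ⟨y', hy', by simpa using hs'.2.le⟩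
      have := Finset.card_lt_card this
      omega
    have c2 : (Z.filter (fun v => s' < v i)).card ≤ N := by
      have : Z.filter (fun v => s' < v i) ⊂ Z := Finset.filter_ssubset.2 ⟨y, hy, by simpa using hs'.1.le⟩
      have := Finset.card_lt_card this
      omega
    have hG1 : Good (kb h a b1) := by
      refine ⟨?_, fun x => hn _ (hsub1 (kb_mem hab1 x)), fun x hx hN => ?_⟩
      · unfold kb; exact hh.comp (continuous_pi fun i => by fun_prop)
      · exact kb_bd (hZ31 _ (hZ21 _ (kb_mem hab1 x) hN)) hx rfl
    have hG2 : Good (kb h a2 b) := by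
      refine ⟨?_, fun x => hn _ (hsub2 (kb_mem hab2 x)), fun x hx hN => ?_⟩
      · unfold kb; exact hh.comp (continuous_pi fun i => by fun_prop)
      · exact kb_bd (hZ32 _ (hZ22 _ (kb_mem hab2 x) hN)) hx rfl
    obtain ⟨z1, hz1⟩ := cls_exists hG1
    obtain ⟨z2, hz2⟩ := cls_exists hG2
    have := cls_split hG i hs0 hsl (z := z) (z1 := z1) (z2 := z2) ?_ hz ?_ ?_
    · rw [this]
      refine mul_mem (ih _ a2 b c2 hab2 (fun v hv => hn v (hsub2 hv)) hZ22 (fun v hv => ?_) z2 hz2)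
        (ih _ a b1 c1 hab1 (fun v hv => hn v (hsub1 hv)) hZ21 (fun v hv => ?_) z1 hz1)
      · have h3 := hZ3 v (Finset.mem_filter.1 hv).1
        exact ⟨h3.1, hZ32 v hv, h3.2.2⟩
      · have h3 := hZ3 v (Finset.mem_filter.1 hv).1
        exact ⟨h3.1, hZ31 v hv, h3.2.2⟩
    · intro x hx hN
      refine hs'Z _ (hZ2 _ (kb_mem hab x) hN) ?_
      simp only [hx, hs1]; ring
    · convert hz1 using 1
      ext1 x
      unfold kb
      congr 1
      ext j
      by_cases hj : j = i
      · subst hj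
        have x0 := (x j).2.1
        have x1 := (x j).2.2
        simp only [Function.update_self, hb1]
        rw [pI_of_mem ⟨by positivity, by nlinarith⟩]
        linear_combination (x j : ℝ) * hs1
      · simp [hj, hb1]
    · convert hz2 using 1
      ext1 x
      unfold kb
      congr 1
      ext j
      by_cases hj : j = i
      · subst hj
        have x0 := (x j).2.1
        have x1 := (x j).2.2
        simp only [Function.update_self, ha2]
        rw [pI_of_mem ⟨by nlinarith [mul_nonneg (sub_nonneg.2 hsl.le) x0], by nlinarith⟩]
        linear_combination (1 - (x j : ℝ)) * hs1
      · simp [hj, ha2]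

end
end CB

namespace CB
open MeasureTheory Matrix
open scoped ContDiff Topology

section
variable {m : ℕ} [Nonempty (Fin m)] {ι : PiV m}

theorem clm_equiv_of_det {A : (Fin m → ℝ) →L[ℝ] (Fin m → ℝ)} (h : A.det ≠ 0) :
    ∃ B : (Fin m → ℝ) ≃L[ℝ] (Fin m → ℝ), (B : (Fin m → ℝ) →L[ℝ] (Fin m → ℝ)) = A :=
  ⟨A.toContinuousLinearEquivOfDetNeZero h, A.coe_toContinuousLinearEquivOfDetNeZero h⟩

theorem cyc (hι : Cls (lin (1 : Matrix (Fin m) (Fin m) ℝ)) ι) (z : PiV m) : z ∈ Subgroup.zpowers ι := by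
  induction z using Quotient.inductionOn with
  | _ L =>
  set z : PiV m := ⟦L⟧ with hz
  let h0 : (Fin m → ℝ) → V m := fun y => (L (pj y) : V m)
  have hLc : Continuous fun x : Cb m => (L x : V m) := continuous_subtype_val.comp L.1.continuous
  have hc0 : Continuous h0 := hLc.comp pj_cont
  have hLb : ∀ x ∈ Cube.boundary (Fin m), (L x : V m) = ev m := fun x hx => by
    have := L.2 x hx
    exact congrArg Subtype.val this
  have hcls : Cls (fun x : Cb m => (L x : V m)) z := rep_cls hLc (fun x => (L x).2) hLb ⟨L, fun _ => rfl, rfl⟩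
  obtain ⟨c', hc', hb'⟩ := fam_bounds_below (fun x : Cb m => (L x : V m)) hLc (fun x => (L x).2)
  obtain ⟨c, hc, hc1, hb⟩ : ∃ c : ℝ, 0 < c ∧ c ≤ 1 ∧ ∀ y, c ≤ ‖h0 y‖ :=
    ⟨min c' 1, by positivity, min_le_right _ _, fun y => (min_le_left _ _).trans (hb' _)⟩
  obtain ⟨P, hP, hP2⟩ := smooth_approx h0 hc0 (c / 4) (by positivity)
  have hP1 : ContDiff ℝ ∞ fun v => (P v).1 := contDiff_fst.comp hP
  have hPd : ∀ v, HasFDerivAt (fun v => (P v).1) (fderiv ℝ (fun v => (P v).1) v) v := fun v =>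
    (hP1.differentiable (by simp) v).hasFDerivAt
  let C : Set (Fin m → ℝ) := {v | (fderiv ℝ (fun v => (P v).1) v).det = 0}
  have hsard : volume ((fun v => (P v).1) '' C) = 0 :=
    addHaar_image_eq_zero_of_det_fderivWithin_eq_zero volume (fun x _ => (hPd x).hasFDerivWithinAt) (fun x hx => hx)
  obtain ⟨w, hw, hwC⟩ : ∃ w : Fin m → ℝ, ‖w‖ < c / 4 ∧ w ∉ (fun v => (P v).1) '' C := by
    by_contra hcon
    push Not at hcon
    have : Metric.ball (0 : Fin m → ℝ) (c / 4) ⊆ (fun v => (P v).1) '' C := fun w hw => hcon w (by simpa using hw)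
    have h1 := measure_mono_null this hsard
    exact (Metric.measure_ball_pos volume (0 : Fin m → ℝ) (by positivity : 0 < c / 4)).ne' h1
  let h : (Fin m → ℝ) → V m := fun v => P v - (w, 0)
  have hh : Continuous h := hP.continuous.sub continuous_const
  have hclose : ∀ v, ‖h v - h0 v‖ ≤ c / 2 := by
    intro v
    have : h v - h0 v = (P v - h0 v) - (w, 0) := by simp only [h]; abel
    rw [this]
    refine (norm_sub_le _ _).trans ?_
    have : ‖((w, 0) : V m)‖ < c / 4 := by simpa [Prod.norm_def] using hw
    linarith [hP2 v]
  have hKclose : ∀ (t : I) v, ‖((1 - (t:ℝ)) • h0 v + (t:ℝ) • h v) - h0 v‖ ≤ c / 2 := by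
    intro t v
    have : ((1 - (t:ℝ)) • h0 v + (t:ℝ) • h v) - h0 v = (t:ℝ) • (h v - h0 v) := by module
    rw [this, norm_smul, Real.norm_of_nonneg t.2.1]
    exact (mul_le_of_le_one_left (norm_nonneg _) t.2.2).trans (hclose v)
  have hKne : ∀ (t : I) v, (1 - (t:ℝ)) • h0 v + (t:ℝ) • h v ≠ 0 := by
    intro t v h1
    have := hKclose t v
    rw [h1, zero_sub, norm_neg] at this
    linarith [hb v]
  have hKbd : ∀ (t : I) v, h0 v = ev m → (1 - (t:ℝ)) • h0 v + (t:ℝ) • h v ∉ Nr m := by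
    intro t v hv hN
    have h1 := hKclose t v
    have h2 := (norm_snd_le _).trans h1
    have h3 := hN.2
    rw [Prod.snd_sub, Real.norm_eq_abs, abs_le] at h2
    have h4 : (h0 v).2 = 1 := by rw [hv]; rfl
    linarith [h2.1]
  have hn : ∀ v, h v ≠ 0 := fun v => by simpa using hKne 1 v
  have hbd : ∀ v, h0 v = ev m → h v ∉ Nr m := fun v hv => by simpa using hKbd 1 v hv
  -- zero set
  let Z : Set (Fin m → ℝ) := Set.Icc 0 1 ∩ h ⁻¹' Nr m
  have hZc : IsCompact Z := isCompact_Icc.inter_right ((Nr_closed m).preimage hh)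
  have hA : ∀ y, h y ∈ Nr m → ∃ A : (Fin m → ℝ) ≃L[ℝ] (Fin m → ℝ),
      HasFDerivAt (fun v => (h v).1) (A : (Fin m → ℝ) →L[ℝ] (Fin m → ℝ)) y := by
    intro y hy
    have h1 : (P y).1 = w := by
      have := hy.1
      simp only [h, Prod.fst_sub] at this
      exact sub_eq_zero.1 this
    have h2 : (fderiv ℝ (fun v => (P v).1) y).det ≠ 0 := fun h2 => hwC ⟨y, h2, h1⟩
    obtain ⟨B, hB⟩ := clm_equiv_of_det h2
    refine ⟨B, ?_⟩
    rw [hB]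
    simpa [h] using (hPd y).sub_const w
  have hZd : IsDiscrete Z := by
    rw [isDiscrete_iff_nhdsNE]
    intro y hy
    obtain ⟨A, hA⟩ := hA y hy.2
    have := hA.eventually_ne (c := 0) ⟨_, A.antilipschitz⟩
    rw [← disjoint_iff, Filter.disjoint_principal_right]
    filter_upwards [this] with v hv hvZ
    exact hv hvZ.2.1
  have hZf := hZc.finite hZd
  have hkb : Continuous (kb h 0 1) := by
    unfold kb
    exact hh.comp (continuous_pi fun i => by fun_prop)
  have hval : ∀ x : Cb m, (fun i => (0 : Fin m → ℝ) i + (x i : ℝ) * ((1 : Fin m → ℝ) i - (0 : Fin m → ℝ) i)) = fun i => (x i : ℝ) := by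
    intro x; ext i; simp
  have hcast : Continuous fun x : Cb m => (fun i => (x i : ℝ) : Fin m → ℝ) := continuous_pi fun i => by fun_prop
  have hL0 : ∀ x : Cb m, h0 (fun i => (x i : ℝ)) = L x := fun x => by simp only [h0, pj_coe]
  have hG : Good (kb h 0 1) := by
    refine ⟨hkb, fun x => hn _, fun x hx => ?_⟩
    unfold kb
    rw [hval]
    exact hbd _ (by rw [hL0]; exact hLb x hx)
  obtain ⟨z', hz'⟩ := cls_exists hG
  have e : z = z' := by
    refine cls_unique (fun t x => (1 - (t:ℝ)) • h0 (fun i => (x i : ℝ)) + (t:ℝ) • h (fun i => (x i : ℝ))) ?_ (fun t x => hKne _ _)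
      (fun t x hx => hKbd _ _ (by rw [hL0]; exact hLb x hx)) ?_ ?_
    · have h1 := hc0.comp hcast
      have h2 := hh.comp hcast
      simp only [Function.comp_def] at h1 h2
      fun_prop
    · simpa [hL0] using hcls
    · unfold kb at hz'
      simp only [hval] at hz'
      simpa using hz'
  rw [e]
  refine box_mem hι hh _ hZf.toFinset 0 1 le_rfl (fun i => by simp) (fun v _ => hn v) (fun v hv hN => by simpa using ⟨hv, hN⟩) ?_ z' hz'
  intro y hy
  have hy : y ∈ Z := by simpa using hy
  refine ⟨hy.2, fun i => ?_, hA y hy.2⟩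
  have h1 := hy.1.1 i
  have h2 := hy.1.2 i
  have key : ¬ (y i ≤ 0 ∨ 1 ≤ y i) := fun hc => hbd y (hLb _ (pj_bd i hc)) hy.2
  push Not at key
  exact key

end
end CB

namespace CB
open MeasureTheory Matrix
open scoped ContDiff Topology

section
variable {m : ℕ} [Nonempty (Fin m)]

/-- degree on the homotopy group -/
noncomputable def DegP (β : Bmp (V m)) : PiV m → ℝ :=
  Quotient.lift (fun L : GenLoop (Fin m) (Nz (V m)) (eN m) => Deg β (fun x => (L x : V m))) (by
    rintro L L' ⟨H⟩
    have hm : 0 < m := Fin.pos (Classical.arbitrary (Fin m))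
    have := Deg_hm hm β (fun t x => (H (t, x) : V m)) (continuous_subtype_val.comp (map_continuous H)) (fun t x => (H (t, x)).2) (fun t x hx => by
      have h1 := H.eq_fst t hx
      rw [h1]
      exact congrArg Subtype.val (L.2 x hx))
    simp only [ContinuousMap.HomotopyWith.apply_zero, ContinuousMap.HomotopyWith.apply_one] at this
    exact this)

theorem DegP_mk (β : Bmp (V m)) (L : GenLoop (Fin m) (Nz (V m)) (eN m)) : DegP β ⟦L⟧ = Deg β (fun x => (L x : V m)) := rfl

theorem DegP_mul (β : Bmp (V m)) (z w : PiV m) : DegP β (z * w) = DegP β z + DegP β w := by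
  induction z using Quotient.inductionOn with
  | _ p =>
  induction w using Quotient.inductionOn with
  | _ q =>
  have i : Fin m := Classical.arbitrary _
  have hm : 0 < m := Fin.pos i
  have h := HomotopyGroup.mul_spec (i := i) (p := p) (q := q)
  refine (congrArg (DegP β) h).trans ?_
  rw [DegP_mk, DegP_mk, DegP_mk, add_comm]
  have hc : ∀ L : GenLoop (Fin m) (Nz (V m)) (eN m), Continuous fun x => (L x : V m) := fun L =>
    continuous_subtype_val.comp L.1.continuous
  have hb : ∀ L : GenLoop (Fin m) (Nz (V m)) (eN m), ∀ x ∈ Cube.boundary (Fin m), (L x : V m) = ev m :=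
    fun L x hx => congrArg Subtype.val (L.2 x hx)
  refine Deg_add hm β i (hc _) (hc q) (hc p) (fun x => (q x).2) (fun x => (p x).2) (hb _) (hb q) (hb p) ?_ ?_
  · intro t ht
    rw [GenLoop.transAt, GenLoop.coe_copy, if_pos ht]; rfl
  · intro t ht
    rw [GenLoop.transAt, GenLoop.coe_copy, if_neg ht]; rfl

theorem kappa_hm {τ : Cb m → ℝ} (h1 : Continuous τ) (h2 : ∀ x, 0 ≤ τ x ∧ τ x ≤ 1)
    (h3 : ∀ x ∈ Cube.boundary (Fin m), τ x = 1) (h4 : ∀ x, lin (1 : Matrix (Fin m) (Fin m) ℝ) x ∈ Nr m → τ x = 0) :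
    Hm (nzs (V m)) (fl (fun x => (1 - τ x) • lin (1 : Matrix (Fin m) (Fin m) ℝ) x + τ x • ev m) (ev m)) (fun v => (v : V m)) := by
  have hm : 0 < m := Fin.pos (Classical.arbitrary (Fin m))
  have hG := lin_good (A := (1 : Matrix (Fin m) (Fin m) ℝ)) (by simp)
  have hk : Continuous (fun x => (1 - τ x) • lin (1 : Matrix (Fin m) (Fin m) ℝ) x + τ x • ev m) := by
    have := hG.cont
    fun_prop
  have hb : ∀ x ∈ Cube.boundary (Fin m), (fun x => (1 - τ x) • lin (1 : Matrix (Fin m) (Fin m) ℝ) x + τ x • ev m) x = ev m :=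
    fun x hx => by simp [h3 x hx]
  refine Hm.line (fl_cont hm hk hb) continuous_subtype_val ?_
  rintro ⟨⟨y, s⟩, hv⟩ t t0 t1
  intro h0
  have ht0 : (t:ℝ) ≠ 0 := by
    intro ht
    rw [ht] at h0
    simp only [sub_zero, one_smul, zero_smul, add_zero] at h0
    have := fl_mem (S := nzs (V m)) (k := (fun x => (1 - τ x) • lin (1 : Matrix (Fin m) (Fin m) ℝ) x + τ x • ev m)) (z0 := ev m)
      (fun x => blend_ne (lin_ne 1 x) (h2 x).1 (h2 x).2 (h4 x)) (ev_ne m) ⟨⟨y, s⟩, hv⟩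
    exact this h0
  have ht : 0 < (t:ℝ) := lt_of_le_of_ne t0 (Ne.symm ht0)
  have e1 := congrArg Prod.fst h0
  have e2 := congrArg Prod.snd h0
  unfold fl at e1 e2
  simp only at e1 e2
  by_cases hs : s < 0
  · simp only [hs, if_true, lin, one_mulVec, Prod.fst_add, Prod.smul_fst, Prod.snd_add, Prod.smul_snd, ev, smul_zero, add_zero,
      Prod.fst_zero, Prod.snd_zero, smul_eq_mul, mul_one] at e1 e2
    set x : Cb m := pj fun i => 1 / 2 + y i / (2 * -s) with hx
    have hy : y = 0 := by
      ext i
      have := congrFun e1 i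
      simp only [Pi.add_apply, Pi.smul_apply, smul_eq_mul, Pi.zero_apply] at this
      have hxi : (x i : ℝ) = max 0 (min 1 (1 / 2 + y i / (2 * -s))) := by rw [hx, pj, coe_pI]
      have hsgn : 0 ≤ (2 * (x i : ℝ) - 1) * y i := by
        rcases le_total 0 (y i) with hy | hy
        · refine mul_nonneg ?_ hy
          have : 0 ≤ y i / (2 * -s) := div_nonneg hy (by linarith)
          have : 1 / 2 ≤ min 1 (1 / 2 + y i / (2 * -s)) := le_min (by norm_num) (by linarith)
          rw [hxi]
          linarith [le_max_right 0 (min 1 (1 / 2 + y i / (2 * -s)))]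
        · refine mul_nonneg_of_nonpos_of_nonpos ?_ hy
          have : y i / (2 * -s) ≤ 0 := div_nonpos_of_nonpos_of_nonneg hy (by linarith)
          have : max 0 (min 1 (1 / 2 + y i / (2 * -s))) ≤ 1 / 2 := max_le (by norm_num) ((min_le_right _ _).trans (by linarith))
          rw [hxi]; linarith
      have h5 := (h2 x).2
      have h6 : 0 ≤ (1 - (t:ℝ)) * ((1 - τ x) * ((2 * (x i : ℝ) - 1) * y i)) :=
        mul_nonneg (by linarith) (mul_nonneg (by linarith) hsgn)
      have h7 : (t:ℝ) * (y i * y i) = -((1 - (t:ℝ)) * ((1 - τ x) * ((2 * (x i : ℝ) - 1) * y i))) := by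
        linear_combination y i * this
      have h8 : (t:ℝ) * (y i * y i) = 0 := le_antisymm (by linarith) (mul_nonneg t0 (mul_self_nonneg _))
      simpa [ht0] using h8
    have hτ : τ x = 0 := by
      refine h4 x ⟨?_, by simp [lin]⟩
      simp only [lin, one_mulVec]
      ext i
      rw [hx, hy]
      simp only [pj, Pi.zero_apply, zero_div, add_zero]
      rw [pI_of_mem ⟨by norm_num, by norm_num⟩]; norm_num
    rw [hτ] at e2
    nlinarith
  · simp only [hs, if_false, ev, Prod.fst_add, Prod.smul_fst, Prod.snd_add, Prod.smul_snd, smul_zero, zero_add,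
      Prod.fst_zero, Prod.snd_zero, smul_eq_mul, mul_one] at e1 e2
    have hy : y = 0 := by
      rcases smul_eq_zero.1 e1 with h | h
      · exact absurd h ht0
      · exact h
    have hs' : s ≠ 0 := fun h => hv (Prod.ext hy h)
    have : 0 < s := lt_of_le_of_ne (not_lt.1 hs) (Ne.symm hs')
    nlinarith

theorem DegP_iota (β : Bmp (V m)) {ι : PiV m} (hι : Cls (lin (1 : Matrix (Fin m) (Fin m) ℝ)) ι) : DegP β ι = 1 := by
  obtain ⟨τ, h1, h2, h3, h4, L, hL, rfl⟩ := hι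
  have hm : 0 < m := Fin.pos (Classical.arbitrary (Fin m))
  rw [DegP_mk]
  have : (fun x => (L x : V m)) = fun x => (1 - τ x) • lin (1 : Matrix (Fin m) (Fin m) ℝ) x + τ x • ev m := funext hL
  rw [Deg_eq_sdeg (k := fun x => (L x : V m)) hm β (continuous_subtype_val.comp L.1.continuous) (fun x => (L x).2) (fun x hx => congrArg Subtype.val (L.2 x hx)),
    this, sdeg_hm β (kappa_hm h1 h2 h3 h4), sdeg_id]

theorem PiV_iso (β : Bmp (V m)) : ∃ e : PiV m ≃* Multiplicative ℤ, ∀ z, ((Multiplicative.toAdd (e z) : ℤ) : ℝ) = DegP β z := by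
  obtain ⟨ι, hι⟩ := cls_exists (lin_good (m := m) (A := 1) (by simp))
  have h1 := DegP_iota β hι
  let D : PiV m →* Multiplicative ℝ :=
    { toFun := fun z => Multiplicative.ofAdd (DegP β z)
      map_one' := by
        have := DegP_mul β (1 : PiV m) 1
        rw [mul_one] at this
        have h : DegP β (1 : PiV m) = 0 := by linarith
        rw [h]; rfl
      map_mul' := fun z w => by rw [DegP_mul]; rfl }
  have hpow : ∀ k : ℤ, DegP β (ι ^ k) = k := by
    intro k
    have : D (ι ^ k) = (D ι) ^ k := map_zpow D ι k
    have h2 := congrArg Multiplicative.toAdd this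
    simp only [toAdd_zpow] at h2
    change DegP β (ι ^ k) = k • DegP β ι at h2
    rw [h2, h1]; simp
  let f : Multiplicative ℤ →* PiV m := zpowersHom (PiV m) ι
  have hf : ∀ k, f k = ι ^ (Multiplicative.toAdd k) := fun k => rfl
  have hb : Function.Bijective f := by
    constructor
    · intro k l h
      rw [hf, hf] at h
      have := congrArg (DegP β) h
      rw [hpow, hpow] at this
      exact Multiplicative.toAdd.injective (by exact_mod_cast this)
    · intro z
      obtain ⟨k, hk⟩ := Subgroup.mem_zpowers_iff.1 (cyc hι z)
      exact ⟨Multiplicative.ofAdd k, hk⟩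
  refine ⟨(MulEquiv.ofBijective f hb).symm, fun z => ?_⟩
  obtain ⟨k, rfl⟩ := hb.2 z
  have : (MulEquiv.ofBijective f hb).symm (f k) = k := (MulEquiv.ofBijective f hb).symm_apply_apply k
  rw [this, hf, hpow]

end
end CB

namespace CB
open MeasureTheory Matrix
open scoped ContDiff Topology

section
variable {κ : Type*} [Fintype κ] [DecidableEq κ]

/-- last basis vector -/
def ee (κ : Type*) : κ ⊕ Unit → ℂ := Sum.elim 0 1

/-- positivity function -/
noncomputable def qv (v : κ ⊕ Unit → ℂ) : ℝ := Real.sqrt (∑ i, ‖v i‖ ^ 2) + (v (Sum.inr ())).re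

theorem qv_cont : Continuous (qv (κ := κ)) := by unfold qv; fun_prop

theorem qv_pos {v : κ ⊕ Unit → ℂ} (h : ∀ r : ℝ, 0 ≤ r → v + r • ee κ ≠ 0) : 0 < qv v := by
  have hle : ∀ i, ‖v i‖ ^ 2 ≤ ∑ i, ‖v i‖ ^ 2 := fun i => Finset.single_le_sum (f := fun i => ‖v i‖ ^ 2) (fun i _ => by positivity) (Finset.mem_univ i)
  by_contra hq
  unfold qv at hq
  push Not at hq
  set N := Real.sqrt (∑ i, ‖v i‖ ^ 2) with hN
  have hN0 : 0 ≤ N := Real.sqrt_nonneg _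
  have hN2 : N ^ 2 = ∑ i, ‖v i‖ ^ 2 := Real.sq_sqrt (by positivity)
  have hre : (v (Sum.inr ())).re ^ 2 + (v (Sum.inr ())).im ^ 2 = ‖v (Sum.inr ())‖ ^ 2 := by
    rw [Complex.sq_norm, Complex.normSq_apply]; ring
  rw [Fintype.sum_sum_type] at hN2
  simp only [Finset.univ_unique, PUnit.default_eq_unit, Finset.sum_singleton] at hN2
  have h0 : 0 ≤ ∑ i : κ, ‖v (Sum.inl i)‖ ^ 2 := by positivity
  have h1 : N ^ 2 ≤ (v (Sum.inr ())).re ^ 2 := by nlinarith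
  have h2 : ∑ i : κ, ‖v (Sum.inl i)‖ ^ 2 = 0 := by nlinarith [sq_nonneg (v (Sum.inr ())).im]
  have h3 : (v (Sum.inr ())).im = 0 := by nlinarith [sq_nonneg (v (Sum.inr ())).im]
  have h4 : ∀ i : κ, v (Sum.inl i) = 0 := by
    intro i
    have := (Finset.sum_eq_zero_iff_of_nonneg (fun i _ => by positivity)).1 h2 i (Finset.mem_univ i)
    simpa using this
  refine h (-(v (Sum.inr ())).re) (by linarith) ?_
  ext i
  rcases i with i | i
  · simp [ee, h4]
  · have : v (Sum.inr ()) = (((v (Sum.inr ())).re : ℝ) : ℂ) := Complex.ext (by simp) (by simp [h3])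
    cases i
    simp only [ee, Pi.add_apply, Pi.smul_apply, Sum.elim_inr, Pi.one_apply, Pi.zero_apply, Complex.real_smul, mul_one]
    rw [Complex.ofReal_neg, ← this]; ring

theorem qv_ne {v : κ ⊕ Unit → ℂ} (h : 0 < qv v) {r : ℝ} (hr : 0 ≤ r) : v + r • ee κ ≠ 0 := by
  intro h0
  have h1 : v = -(r • ee κ) := eq_neg_of_add_eq_zero_left h0
  rw [h1] at h
  unfold qv at h
  rw [Fintype.sum_sum_type] at h
  simp [ee, abs_of_nonneg hr, Real.sqrt_sq hr] at h

theorem qv_star {v : κ ⊕ Unit → ℂ} (h : 0 < qv v) {t : ℝ} (h0 : 0 ≤ t) (h1 : t ≤ 1) : 0 < qv ((1 - t) • v + t • ee κ) := by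
  refine qv_pos fun r hr h2 => ?_
  rcases h1.lt_or_eq with h3 | h3
  · have hp : 0 < 1 - t := by linarith
    refine qv_ne h (r := (t + r) / (1 - t)) (by positivity) ?_
    have : (1 - t) • (v + ((t + r) / (1 - t)) • ee κ) = 0 := by
      rw [← h2, smul_add, smul_smul, mul_div_cancel₀ _ hp.ne']; module
    exact (smul_eq_zero.1 this).resolve_left hp.ne'
  · have := congrFun h2 (Sum.inr ())
    simp [h3, ee] at this
    have := congrArg Complex.re this
    simp at this; linarith

theorem qv_near {v : κ ⊕ Unit → ℂ} (h : ‖v - ee κ‖ < 1) : 0 < qv v := by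
  refine qv_pos fun r hr h2 => ?_
  have h3 := (norm_le_pi_norm (v - ee κ) (Sum.inr ())).trans_lt h
  have h4 := congrFun h2 (Sum.inr ())
  simp [ee] at h3 h4
  rw [eq_neg_of_add_eq_zero_left h4] at h3
  have h5 := (Complex.abs_re_le_norm _).trans_lt h3
  simp at h5
  rw [abs_lt] at h5
  linarith [h5.1]

/-- section of the last column map -/
noncomputable def sec (v : κ ⊕ Unit → ℂ) : Matrix (κ ⊕ Unit) (κ ⊕ Unit) ℂ :=
  fromBlocks 1 (Matrix.of fun i _ => v (Sum.inl i)) (Matrix.of fun _ i => - ((starRingEnd ℂ) (v (Sum.inl i))) / (qv v : ℂ)) (Matrix.of fun _ _ => v (Sum.inr ()))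

theorem sec_isUnit {v : κ ⊕ Unit → ℂ} (h : 0 < qv v) : IsUnit (sec v) := by
  rw [Matrix.isUnit_iff_isUnit_det, sec, Matrix.det_fromBlocks_one₁₁, isUnit_iff_ne_zero]
  have hdet : ∀ M : Matrix Unit Unit ℂ, M.det = M () () := fun M => Matrix.det_unique M
  rw [hdet]
  simp only [Matrix.sub_apply, Matrix.mul_apply, Matrix.of_apply]
  set a := v (Sum.inr ()) with ha
  set W : ℝ := ∑ i : κ, ‖v (Sum.inl i)‖ ^ 2 with hW
  have hW0 : 0 ≤ W := by positivity
  have hs : ∑ x : κ, - ((starRingEnd ℂ) (v (Sum.inl x))) / (qv v : ℂ) * v (Sum.inl x) = -((W / qv v : ℝ) : ℂ) := by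
    rw [hW]; push_cast
    rw [Finset.sum_div, ← Finset.sum_neg_distrib]
    refine Finset.sum_congr rfl fun i _ => ?_
    have : ((‖v (Sum.inl i)‖ : ℂ)) ^ 2 = (starRingEnd ℂ) (v (Sum.inl i)) * v (Sum.inl i) := by
      rw [mul_comm, Complex.mul_conj, Complex.normSq_eq_norm_sq]; push_cast; rfl
    rw [this]; ring
  rw [hs]
  intro h0
  have hre := congrArg Complex.re h0
  have him := congrArg Complex.im h0
  simp only [Complex.sub_re, Complex.neg_re, Complex.ofReal_re, Complex.zero_re, Complex.sub_im, Complex.neg_im, Complex.ofReal_im, Complex.zero_im] at hre him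
  have hWq : W = -a.re * qv v := by
    have : W / qv v = - a.re := by linarith
    rw [← this]; field_simp
  have hN : Real.sqrt (∑ i, ‖v i‖ ^ 2) ^ 2 = W + a.re ^ 2 := by
    rw [Real.sq_sqrt (by positivity), Fintype.sum_sum_type]
    simp only [Finset.univ_unique, PUnit.default_eq_unit, Finset.sum_singleton]
    rw [← hW, ← ha, Complex.sq_norm, Complex.normSq_apply]
    have : a.im = 0 := by linarith
    rw [this]; ring
  have hq : qv v = Real.sqrt (∑ i, ‖v i‖ ^ 2) + a.re := rfl
  set N := Real.sqrt (∑ i, ‖v i‖ ^ 2)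
  have hN0 : 0 ≤ N := Real.sqrt_nonneg _
  rw [hq] at h hWq
  have h5 : N * (N + a.re) = 0 := by nlinarith
  rcases mul_eq_zero.1 h5 with h6 | h6
  · rw [h6] at h hWq
    nlinarith
  · linarith

theorem sec_cont : ContinuousOn (sec (κ := κ)) {v | 0 < qv v} := by
  unfold sec
  rw [continuousOn_iff_continuous_domRestrict]
  have hq : Continuous fun v : {v : κ ⊕ Unit → ℂ | 0 < qv v} => ((qv (v : κ ⊕ Unit → ℂ) : ℝ) : ℂ) := by
    have := qv_cont (κ := κ)
    fun_prop
  have hn : ∀ v : {v : κ ⊕ Unit → ℂ | 0 < qv v}, ((qv (v : κ ⊕ Unit → ℂ) : ℝ) : ℂ) ≠ 0 := fun v => by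
    have : 0 < qv (v : κ ⊕ Unit → ℂ) := v.2
    exact_mod_cast this.ne'
  have hv : ∀ i, Continuous fun v : {v : κ ⊕ Unit → ℂ | 0 < qv v} => (v : κ ⊕ Unit → ℂ) i := fun i => (continuous_apply i).comp continuous_subtype_val
  refine Continuous.matrix_fromBlocks continuous_const ?_ ?_ ?_
  · exact continuous_matrix fun i j => hv _
  · refine continuous_matrix fun i j => Continuous.div ?_ hq hn
    exact (Complex.continuous_conj.comp (hv _)).neg
  · exact continuous_matrix fun i j => hv _

theorem sec_ee : sec (ee κ) = 1 := by
  unfold sec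
  rw [← fromBlocks_one]
  congr 1
  ext i j; simp [ee]

theorem sec_col (v : κ ⊕ Unit → ℂ) (i : κ ⊕ Unit) : sec v i (Sum.inr ()) = v i := by
  rcases i with i | i <;> rfl

/-- last column -/
def lcol (M : Matrix (κ ⊕ Unit) (κ ⊕ Unit) ℂ) : κ ⊕ Unit → ℂ := fun i => M i (Sum.inr ())

/-- matrices whose last column avoids the negative ray -/
def Rgd (κ : Type*) [Fintype κ] [DecidableEq κ] : Set (Matrix (κ ⊕ Unit) (κ ⊕ Unit) ℂ) := {M | IsUnit M ∧ 0 < qv (lcol M)}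

/-- reduction -/
noncomputable def red (M : Matrix (κ ⊕ Unit) (κ ⊕ Unit) ℂ) : Matrix κ κ ℂ := ((sec (lcol M))⁻¹ * M).toBlocks₁₁

theorem red_spec {M : Matrix (κ ⊕ Unit) (κ ⊕ Unit) ℂ} (h : M ∈ Rgd κ) :
    (sec (lcol M))⁻¹ * M = fromBlocks (red M) 0 ((sec (lcol M))⁻¹ * M).toBlocks₂₁ 1 := by
  have hu := sec_isUnit h.2
  have hd : IsUnit (sec (lcol M)).det := (Matrix.isUnit_iff_isUnit_det _).1 hu
  have hc : ∀ i, ((sec (lcol M))⁻¹ * M) i (Sum.inr ()) = (1 : Matrix (κ ⊕ Unit) (κ ⊕ Unit) ℂ) i (Sum.inr ()) := by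
    intro i
    rw [← Matrix.nonsing_inv_mul _ hd, mul_apply, mul_apply]
    refine Finset.sum_congr rfl fun j _ => ?_
    rw [sec_col]; rfl
  conv_lhs => rw [← fromBlocks_toBlocks ((sec (lcol M))⁻¹ * M)]
  congr 1
  · ext i j; cases j
    simp only [toBlocks₁₂, of_apply, hc]; simp
  · ext i j; cases j; cases i
    simp only [toBlocks₂₂, of_apply, hc]; simp

theorem red_isUnit {M : Matrix (κ ⊕ Unit) (κ ⊕ Unit) ℂ} (h : M ∈ Rgd κ) : IsUnit (red M) := by
  have hu := sec_isUnit h.2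
  have h1 : IsUnit ((sec (lcol M))⁻¹ * M) := ((Matrix.isUnit_nonsing_inv_iff).2 hu).mul h.1
  rw [red_spec h, Matrix.isUnit_iff_isUnit_det, Matrix.det_fromBlocks_zero₁₂] at h1
  rw [Matrix.isUnit_iff_isUnit_det]
  simpa using h1

theorem lcol_cont : Continuous (lcol (κ := κ)) := by
  unfold lcol
  exact continuous_pi fun i => by fun_prop

theorem secinv_cont : ContinuousOn (fun M : Matrix (κ ⊕ Unit) (κ ⊕ Unit) ℂ => (sec (lcol M))⁻¹ * M) (Rgd κ) := by
  refine ContinuousOn.mul ?_ continuousOn_id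
  refine continuousOn_matrix_inv.comp (t := GLs (κ ⊕ Unit)) (sec_cont.comp lcol_cont.continuousOn fun M hM => hM.2) fun M hM => sec_isUnit hM.2

theorem red_cont : ContinuousOn (red (κ := κ)) (Rgd κ) := by
  unfold red
  have : Continuous fun M : Matrix (κ ⊕ Unit) (κ ⊕ Unit) ℂ => M.toBlocks₁₁ := by
    exact continuous_matrix fun i j => by simp only [toBlocks₁₁, of_apply]; fun_prop
  exact this.comp_continuousOn secinv_cont

theorem lcol_bd (A : Matrix κ κ ℂ) : lcol (fromBlocks A 0 0 (1 : Matrix Unit Unit ℂ)) = ee κ := by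
  ext i; rcases i with i | i <;> simp [lcol, ee]

theorem red_bd (A : Matrix κ κ ℂ) : red (fromBlocks A 0 0 (1 : Matrix Unit Unit ℂ)) = A := by
  rw [red, lcol_bd, sec_ee]; simp

theorem Hm.red {X : Type*} [TopologicalSpace X] {f g : X → Matrix (κ ⊕ Unit) (κ ⊕ Unit) ℂ} (h : Hm (Rgd κ) f g) :
    Hm (GLs κ) (fun x => red (f x)) (fun x => red (g x)) := h.comp_left _ red_cont fun _ hM => red_isUnit hM

theorem red_hm {X : Type*} [TopologicalSpace X] {f : X → Matrix (κ ⊕ Unit) (κ ⊕ Unit) ℂ} (hf : Continuous f) (h : ∀ x, f x ∈ Rgd κ) :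
    Hm (GLs (κ ⊕ Unit)) f (fun x => fromBlocks (red (f x)) 0 0 1) := by
  let y : X → Matrix Unit κ ℂ := fun x => ((sec (lcol (f x)))⁻¹ * f x).toBlocks₂₁
  have hy : Continuous y := by
    have h1 := secinv_cont.comp_continuous hf h
    refine continuous_matrix fun i j => ?_
    simp only [y, toBlocks₂₁, of_apply]; fun_prop
  have hr : Continuous fun x => red (f x) := red_cont.comp_continuous hf h
  have hl : Continuous fun x => lcol (f x) := lcol_cont.comp hf
  have hl2 : Continuous fun p : I × X => lcol (f p.2) := hl.comp continuous_snd
  have hr2 : Continuous fun p : I × X => red (f p.2) := hr.comp continuous_snd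
  refine ⟨fun t x => sec ((1 - (t:ℝ)) • lcol (f x) + (t:ℝ) • ee κ) * fromBlocks (red (f x)) 0 ((1 - (t:ℝ)) • y x) 1, ?_, ?_, ?_, ?_⟩
  · refine Continuous.mul ?_ ?_
    · exact sec_cont.comp_continuous (by fun_prop) fun p => qv_star (h p.2).2 p.1.2.1 p.1.2.2
    · refine Continuous.matrix_fromBlocks (by fun_prop) continuous_const ?_ continuous_const
      have : Continuous fun p : I × X => y p.2 := hy.comp continuous_snd
      fun_prop
  · intro t x
    refine (sec_isUnit (qv_star (h x).2 t.2.1 t.2.2)).mul ?_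
    rw [Matrix.isUnit_iff_isUnit_det, Matrix.det_fromBlocks_zero₁₂]
    have := red_isUnit (h x)
    rw [Matrix.isUnit_iff_isUnit_det] at this
    simpa using this
  · intro x
    have hd : IsUnit (sec (lcol (f x))).det := (Matrix.isUnit_iff_isUnit_det _).1 (sec_isUnit (h x).2)
    have := red_spec (h x)
    simp only [Set.Icc.coe_zero, sub_zero, one_smul, zero_smul, add_zero, y]
    rw [← this, ← mul_assoc, Matrix.mul_nonsing_inv _ hd, one_mul]
  · intro x
    simp [sec_ee]

end
end CB

namespace CB
open MeasureTheory Matrix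
open scoped ContDiff Topology

section
variable {κ : Type*} [Fintype κ] [DecidableEq κ]

theorem gen_pos {W : Type*} [NormedAddCommGroup W] [NormedSpace ℝ W] [FiniteDimensional ℝ W] {D : ℕ}
    (hD : D + 2 < Module.finrank ℝ W) (P : ℝ × (Fin (D + 1) → ℝ) → W) (hP : ContDiff ℝ ∞ P) (e : W) (ε : ℝ) (hε : 0 < ε) :
    ∃ b : W, ‖b‖ < ε ∧ ∀ (t : ℝ) (x : Fin (D + 1) → ℝ) (r : ℝ), ‖x‖ = 1 → P (t, x) + b + r • e ≠ 0 := by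
  let Φ : Fin (D + 1) × Bool → (ℝ × ℝ) × (Fin D → ℝ) → W := fun p y =>
    - P (y.1.1, p.1.insertNth (if p.2 then 1 else -1) y.2) - y.1.2 • e
  have hins : ∀ p : Fin (D + 1) × Bool, ContDiff ℝ 1 fun y : (ℝ × ℝ) × (Fin D → ℝ) =>
      ((y.1.1, p.1.insertNth (α := fun _ => ℝ) (if p.2 then (1:ℝ) else -1) y.2) : ℝ × (Fin (D+1) → ℝ)) := by
    intro p
    refine ContDiff.prodMk (by fun_prop) ?_
    rw [contDiff_pi]
    intro i
    rcases Fin.eq_self_or_eq_succAbove p.1 i with h | ⟨j, h⟩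
    · subst h; simp only [Fin.insertNth_apply_same]; exact contDiff_const
    · subst h; simp only [Fin.insertNth_apply_succAbove]; fun_prop
  have hΦ : ∀ p, ContDiff ℝ 1 (Φ p) := by
    intro p
    have h1 : ContDiff ℝ 1 P := hP.of_le (by exact_mod_cast le_top)
    exact ((h1.comp (hins p)).neg).sub (by fun_prop)
  have hdim : dimH (⋃ p, Set.range (Φ p)) < Module.finrank ℝ W := by
    rw [dimH_iUnion]
    refine lt_of_le_of_lt (iSup_le fun p => (hΦ p).dimH_range_le) ?_
    have : Module.finrank ℝ ((ℝ × ℝ) × (Fin D → ℝ)) = D + 2 := by simp; ring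
    rw [this]
    exact_mod_cast hD
  obtain ⟨b, hb, hb2⟩ := (dense_compl_of_dimH_lt_finrank hdim).exists_dist_lt 0 hε
  refine ⟨b, by simpa [dist_eq_norm] using hb2, fun t x r hx h0 => hb ?_⟩
  have : ∃ i, ‖x i‖ = 1 := by
    obtain ⟨i, hi⟩ := exists_coord (Nat.succ_pos D) x
    exact ⟨i, by rw [Real.norm_eq_abs, ← hi, hx]⟩
  obtain ⟨i, hi⟩ := this
  rw [Set.mem_iUnion]
  have key : ∀ s : Bool, x i = (if s then 1 else -1) → ∃ p, b ∈ Set.range (Φ p) := by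
    intro s hs
    refine ⟨(i, s), ((t, r), i.removeNth x), ?_⟩
    simp only [Φ]
    rw [← hs]
    rw [Fin.insertNth_self_removeNth]
    rw [add_right_comm] at h0
    rw [eq_neg_of_add_eq_zero_right h0]
    abel
  rcases (abs_eq zero_le_one).1 (by simpa using hi) with h | h
  · exact key true (by simpa using h)
  · exact key false (by simpa using h)

theorem updateCol_isUnit {ι : Type*} [Fintype ι] [DecidableEq ι] {A : Matrix ι ι ℂ} (hA : IsUnit A) (j : ι) (d : ι → ℂ)
    (h : ‖(A⁻¹ *ᵥ d) j‖ < 1) : IsUnit (A.updateCol j (fun i => A i j + d i)) := by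
  have hd : IsUnit A.det := (Matrix.isUnit_iff_isUnit_det _).1 hA
  have e : A.updateCol j (fun i => A i j + d i) = A * (1 : Matrix ι ι ℂ).updateCol j (fun i => (1 : Matrix ι ι ℂ) i j + (A⁻¹ *ᵥ d) i) := by
    have : d = A *ᵥ (A⁻¹ *ᵥ d) := by rw [mulVec_mulVec, Matrix.mul_nonsing_inv _ hd, one_mulVec]
    ext i k
    rw [mul_apply]
    by_cases hk : k = j
    · subst hk
      simp only [updateCol_self, mul_add, Finset.sum_add_distrib]
      conv_lhs => rw [this]
      congr 1
      simp [Matrix.one_apply]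
    · simp only [updateCol_ne hk]
      simp [Matrix.one_apply]
  rw [e]
  refine hA.mul ?_
  rw [Matrix.isUnit_iff_isUnit_det, ← cramer_apply, cramer_one, isUnit_iff_ne_zero]
  intro h0
  simp only [Matrix.one_apply_eq, Module.End.one_apply] at h0
  rw [eq_neg_of_add_eq_zero_right h0] at h
  simp at h

theorem finrank_col : Module.finrank ℝ (κ ⊕ Unit → ℂ) = 2 * (Fintype.card κ + 1) := by
  rw [Module.finrank_pi_fintype]
  simp [Complex.finrank_real_complex]; ring

theorem avoid {D : ℕ} (hD : D + 2 < 2 * (Fintype.card κ + 1)) (F : I → Nz (Fin (D + 1) → ℝ) → Matrix (κ ⊕ Unit) (κ ⊕ Unit) ℂ)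
    (hF : Continuous fun p : I × Nz (Fin (D + 1) → ℝ) => F p.1 p.2) (hu : ∀ t x, IsUnit (F t x)) :
    ∃ M : I → I → Nz (Fin (D + 1) → ℝ) → Matrix (κ ⊕ Unit) (κ ⊕ Unit) ℂ,
      (Continuous fun p : I × I × Nz (Fin (D + 1) → ℝ) => M p.1 p.2.1 p.2.2) ∧ (∀ τ t x, IsUnit (M τ t x)) ∧
      (∀ t x, M 0 t x = F t (uv x.1 x.2)) ∧ (∀ t x, M 1 t x ∈ Rgd κ) ∧
      (∀ τ t x, lcol (F t (uv x.1 x.2)) = ee κ → M τ t x ∈ Rgd κ) := by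
  have hc : Continuous fun p : I × Nz (Fin (D + 1) → ℝ) => lcol (F p.1 p.2) := lcol_cont.comp hF
  have hinv : Continuous fun p : I × Nz (Fin (D + 1) → ℝ) => (F p.1 p.2)⁻¹ := cont_inv hF fun p => hu _ _
  obtain ⟨C, hC, hCb⟩ := cone_bounds (K := fun t x => ∑ i, ‖(F t x)⁻¹ (Sum.inr ()) i‖) (by
    refine continuous_finset_sum _ fun i _ => ?_
    exact (hinv.matrix_elem _ _).norm)
  obtain ⟨ε, hε, hε1, hε2⟩ : ∃ ε : ℝ, 0 < ε ∧ 2 * ε < 1 ∧ C * (2 * ε) < 1 := by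
    refine ⟨1 / (4 * (C + 1)), by positivity, ?_, ?_⟩
    · rw [mul_one_div, div_lt_one (by positivity)]; linarith
    · rw [mul_one_div, ← mul_div_assoc, div_lt_one (by positivity)]; linarith
  have hcone := cone_cont (K := fun t x => lcol (F t x)) hc
  have hpr : Continuous fun p : ℝ × (Fin (D + 1) → ℝ) => ((Set.projIcc (0:ℝ) 1 zero_le_one p.1, p.2) : I × (Fin (D + 1) → ℝ)) :=
    (continuous_projIcc.comp continuous_fst).prodMk continuous_snd
  obtain ⟨P, hP, hPε⟩ := smooth_approx (fun p : ℝ × (Fin (D + 1) → ℝ) => cn (fun x => lcol (F (Set.projIcc (0:ℝ) 1 zero_le_one p.1) x)) p.2)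
    (hcone.comp hpr) ε hε
  obtain ⟨b, hb, hbne⟩ := gen_pos (W := κ ⊕ Unit → ℂ) (by rw [finrank_col]; exact hD) P hP (ee κ) ε hε
  let δ : I → Nz (Fin (D + 1) → ℝ) → (κ ⊕ Unit → ℂ) := fun t x => P (t, x.1) + b - lcol (F t x)
  have hδc : Continuous fun p : I × Nz (Fin (D + 1) → ℝ) => δ p.1 p.2 := by
    have h1 : Continuous fun p : I × Nz (Fin (D + 1) → ℝ) => P (p.1, p.2.1) := hP.continuous.comp (by fun_prop)
    exact (h1.add continuous_const).sub hc
  have hδ : ∀ t (x : Nz (Fin (D + 1) → ℝ)), ‖(x : Fin (D + 1) → ℝ)‖ = 1 → ‖δ t x‖ < 2 * ε := by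
    intro t x hx
    have h1 := hPε (t, x.1)
    have hux : uv x.1 x.2 = x := by
      apply Subtype.ext; simp [uv, hx]
    simp only [Set.projIcc_val] at h1
    rw [cn_of_ne _ x.2, hx, one_smul, hux] at h1
    have : δ t x = (P (t, x.1) - lcol (F t x)) + b := by simp only [δ]; abel
    rw [this]
    calc _ ≤ _ := norm_add_le _ _
      _ < 2 * ε := by linarith
  have huv : Continuous fun x : Nz (Fin (D + 1) → ℝ) => uv x.1 x.2 := by
    refine Continuous.subtype_mk ?_ _
    exact Continuous.smul (Continuous.inv₀ (by fun_prop) (fun p => norm_ne_zero_iff.2 p.2)) (by fun_prop)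
  have huv3 : Continuous fun p : I × I × Nz (Fin (D + 1) → ℝ) => ((p.2.1, uv p.2.2.1 p.2.2.2) : I × Nz (Fin (D + 1) → ℝ)) :=
    (continuous_fst.comp continuous_snd).prodMk (huv.comp (continuous_snd.comp continuous_snd))
  have hF3 := hF.comp huv3
  have hδ3 := hδc.comp huv3
  have hlc : ∀ (A : Matrix (κ ⊕ Unit) (κ ⊕ Unit) ℂ) (v : κ ⊕ Unit → ℂ), lcol (A.updateCol (Sum.inr ()) v) = v := by
    intro A v; ext i; simp [lcol]
  have hun : ∀ (τ t : I) (x : Nz (Fin (D + 1) → ℝ)), IsUnit ((F t (uv x.1 x.2)).updateCol (Sum.inr ())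
        (fun i => (F t (uv x.1 x.2)) i (Sum.inr ()) + ((τ:ℝ) • δ t (uv x.1 x.2)) i)) := by
    intro τ t x
    refine updateCol_isUnit (hu _ _) _ _ ?_
    have h1 := hδ t _ (uv_norm x.1 x.2)
    have h2 := hCb t _ (uv_norm x.1 x.2)
    rw [Real.norm_of_nonneg (by positivity)] at h2
    calc ‖((F t (uv x.1 x.2))⁻¹ *ᵥ ((τ:ℝ) • δ t (uv x.1 x.2))) (Sum.inr ())‖ ≤ ∑ i, ‖(F t (uv x.1 x.2))⁻¹ (Sum.inr ()) i‖ * (2 * ε) := by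
          rw [mulVec, dotProduct]
          refine (norm_sum_le _ _).trans (Finset.sum_le_sum fun i _ => ?_)
          rw [norm_mul]
          gcongr
          rw [Pi.smul_apply, norm_smul, Real.norm_of_nonneg τ.2.1]
          have h3 := norm_le_pi_norm (δ t (uv x.1 x.2)) i
          calc (τ:ℝ) * ‖δ t (uv x.1 x.2) i‖ ≤ 1 * ‖δ t (uv x.1 x.2) i‖ := by gcongr; exact τ.2.2
            _ ≤ 2 * ε := by linarith
      _ ≤ C * (2 * ε) := by rw [← Finset.sum_mul]; gcongr
      _ < 1 := hε2
  refine ⟨fun τ t x => (F t (uv x.1 x.2)).updateCol (Sum.inr ())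
        (fun i => (F t (uv x.1 x.2)) i (Sum.inr ()) + ((τ:ℝ) • δ t (uv x.1 x.2)) i), ?_, hun, ?_, ?_, ?_⟩
  · refine Continuous.matrix_updateCol (Sum.inr ()) hF3 ?_
    refine continuous_pi fun i => ?_
    refine (hF3.matrix_elem _ _).add ?_
    have : Continuous fun p : I × I × Nz (Fin (D + 1) → ℝ) => δ p.2.1 (uv p.2.2.1 p.2.2.2) i := (continuous_apply i).comp hδ3
    simp only [Pi.smul_apply]
    fun_prop
  · intro t x
    ext i j
    by_cases hj : j = Sum.inr ()
    · subst hj; simp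
    · simp [updateCol_ne hj]
  · intro t x
    refine ⟨hun 1 t x, ?_⟩
    rw [hlc]
    refine qv_pos fun r hr h0 => hbne t (uv x.1 x.2).1 r (uv_norm x.1 x.2) ?_
    rw [← h0]
    congr 1
    ext i
    simp [δ, lcol]
  · intro τ t x hx
    refine ⟨hun τ t x, ?_⟩
    rw [hlc]
    refine qv_near ?_
    have : (fun i => (F t (uv x.1 x.2)) i (Sum.inr ()) + ((τ:ℝ) • δ t (uv x.1 x.2)) i) - ee κ = (τ:ℝ) • δ t (uv x.1 x.2) := by
      rw [← hx]; ext i; simp [lcol]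
    rw [this, norm_smul, Real.norm_of_nonneg τ.2.1]
    have h1 := hδ t _ (uv_norm x.1 x.2)
    calc (τ:ℝ) * ‖δ t (uv x.1 x.2)‖ ≤ 1 * ‖δ t (uv x.1 x.2)‖ := by gcongr; exact τ.2.2
      _ < 1 := by linarith

end
end CB

namespace CB
open MeasureTheory Matrix
open scoped ContDiff Topology

section
variable {κ : Type*} [Fintype κ] [DecidableEq κ]

theorem uv_cont {E : Type*} [NormedAddCommGroup E] [NormedSpace ℝ E] : Continuous fun x : Nz E => uv x.1 x.2 := by
  refine Continuous.subtype_mk ?_ _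
  exact Continuous.smul (Continuous.inv₀ (by fun_prop) (fun p => norm_ne_zero_iff.2 p.2)) (by fun_prop)

theorem hm_uv {E Y : Type*} [NormedAddCommGroup E] [NormedSpace ℝ E] [TopologicalSpace Y] {S : Set Y} {f : Nz E → Y} (hf : Continuous f)
    (h : ∀ x, f x ∈ S) : Hm S f (fun x => f (uv x.1 x.2)) := by
  have hpos : ∀ (t : I) (x : Nz E), 0 < (1 - (t:ℝ)) + (t:ℝ) * ‖x.1‖⁻¹ := by
    intro t x
    have h1 := t.2.1
    have h2 := t.2.2
    have hx : 0 < ‖x.1‖⁻¹ := inv_pos.2 (norm_pos_iff.2 x.2)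
    rcases h1.eq_or_lt with h3 | h3
    · rw [← h3]; simp
    · nlinarith [mul_pos h3 hx]
  have hc : Continuous fun p : I × Nz E => ((⟨((1 - (p.1:ℝ)) + (p.1:ℝ) * ‖p.2.1‖⁻¹) • p.2.1, smul_ne_zero (hpos p.1 p.2).ne' p.2.2⟩) : Nz E) := by
    refine Continuous.subtype_mk ?_ _
    have : Continuous fun p : I × Nz E => ‖p.2.1‖⁻¹ := Continuous.inv₀ (by fun_prop) (fun p => norm_ne_zero_iff.2 p.2.2)
    fun_prop
  refine ⟨fun t x => f ⟨((1 - (t:ℝ)) + (t:ℝ) * ‖x.1‖⁻¹) • x.1, smul_ne_zero (hpos t x).ne' x.2⟩, hf.comp hc, fun t x => h _, ?_, ?_⟩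
  · intro x; simp
  · intro x; simp [uv]

theorem c1_aux {D : ℕ} (hD : D + 2 < 2 * (Fintype.card κ + 1)) {f : Nz (Fin (D + 1) → ℝ) → Matrix (κ ⊕ Unit) (κ ⊕ Unit) ℂ}
    (hf : Continuous f) (hu : ∀ x, IsUnit (f x)) :
    ∃ g : Nz (Fin (D + 1) → ℝ) → Matrix κ κ ℂ, Continuous g ∧ (∀ x, IsUnit (g x)) ∧ Hm (GLs (κ ⊕ Unit)) f (fun x => fromBlocks (g x) 0 0 1) := by
  obtain ⟨M, hM, hMu, hM0, hM1, -⟩ := avoid hD (fun _ => f) (hf.comp continuous_snd) (fun _ => hu)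
  have h1 : Hm (GLs (κ ⊕ Unit)) (fun x => f (uv x.1 x.2)) (fun x => M 1 0 x) :=
    ⟨fun τ x => M τ 0 x, hM.comp (by fun_prop : Continuous fun p : I × Nz (Fin (D + 1) → ℝ) => (p.1, (0:I), p.2)), fun τ x => hMu _ _ _, fun x => hM0 _ _, fun x => rfl⟩
  have h2 := red_hm h1.cont_right (fun x => hM1 0 x)
  exact ⟨fun x => red (M 1 0 x), red_cont.comp_continuous h1.cont_right (fun x => hM1 0 x), fun x => red_isUnit (hM1 0 x),
    ((hm_uv hf hu).trans h1).trans h2⟩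

theorem c2_aux {D : ℕ} (hD : D + 2 < 2 * (Fintype.card κ + 1)) {f g : Nz (Fin (D + 1) → ℝ) → Matrix κ κ ℂ}
    (hf : Continuous f) (hg : Continuous g) (hfu : ∀ x, IsUnit (f x)) (hgu : ∀ x, IsUnit (g x))
    (h : Hm (GLs (κ ⊕ Unit)) (fun x => fromBlocks (f x) 0 0 1) (fun x => fromBlocks (g x) 0 0 1)) : Hm (GLs κ) f g := by
  obtain ⟨H, hH, hHu, hH0, hH1⟩ := h
  obtain ⟨M, hM, hMu, hM0, hM1, hM2⟩ := avoid hD H hH hHu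
  have a1 : Hm (Rgd κ) (fun x => fromBlocks (f (uv x.1 x.2)) 0 0 1) (fun x => M 1 0 x) :=
    ⟨fun τ x => M τ 0 x, hM.comp (by fun_prop : Continuous fun p : I × Nz (Fin (D + 1) → ℝ) => (p.1, (0:I), p.2)), fun τ x => hM2 _ _ _ (by rw [hH0, lcol_bd]), fun x => (hM0 _ _).trans (hH0 _), fun x => rfl⟩
  have a2 : Hm (Rgd κ) (fun x => fromBlocks (g (uv x.1 x.2)) 0 0 1) (fun x => M 1 1 x) :=
    ⟨fun τ x => M τ 1 x, hM.comp (by fun_prop : Continuous fun p : I × Nz (Fin (D + 1) → ℝ) => (p.1, (1:I), p.2)), fun τ x => hM2 _ _ _ (by rw [hH1, lcol_bd]), fun x => (hM0 _ _).trans (hH1 _), fun x => rfl⟩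
  have a3 : Hm (Rgd κ) (fun x => M 1 0 x) (fun x => M 1 1 x) :=
    ⟨fun τ x => M 1 τ x, hM.comp (by fun_prop : Continuous fun p : I × Nz (Fin (D + 1) → ℝ) => ((1:I), p.1, p.2)), fun τ x => hM1 _ _, fun x => rfl, fun x => rfl⟩
  have a4 := ((a1.trans a3).trans a2.symm).red
  simp only [red_bd] at a4
  exact ((hm_uv hf hfu).trans a4).trans (hm_uv hg hgu).symm

variable {E : Type*} [NormedAddCommGroup E] [NormedSpace ℝ E] [FiniteDimensional ℝ E]

theorem lin_exists {D : ℕ} (hE : Module.finrank ℝ E = D) : Nonempty (E ≃L[ℝ] (Fin D → ℝ)) :=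
  FiniteDimensional.nonempty_continuousLinearEquiv_of_finrank_eq (by simp [hE])

theorem nzc {A B : Type*} [NormedAddCommGroup A] [NormedSpace ℝ A] [NormedAddCommGroup B] [NormedSpace ℝ B] (L : A ≃L[ℝ] B) : Continuous (nzmap L) := by
  refine Continuous.subtype_mk ?_ _
  fun_prop

theorem nzmap_symm {G : Type*} [NormedAddCommGroup G] [NormedSpace ℝ G] (L : E ≃L[ℝ] G) (x : Nz E) : nzmap L.symm (nzmap L x) = x := by
  apply Subtype.ext; simp [nzmap]

theorem compress {D : ℕ} (hE : Module.finrank ℝ E = D + 1) (hD : D + 2 < 2 * (Fintype.card κ + 1)) {f : Nz E → Matrix (κ ⊕ Unit) (κ ⊕ Unit) ℂ}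
    (hf : Continuous f) (hu : ∀ x, IsUnit (f x)) :
    ∃ g : Nz E → Matrix κ κ ℂ, Continuous g ∧ (∀ x, IsUnit (g x)) ∧ Hm (GLs (κ ⊕ Unit)) f (fun x => fromBlocks (g x) 0 0 1) := by
  obtain ⟨L⟩ := lin_exists hE
  obtain ⟨g, hg, hgu, h⟩ := c1_aux hD (hf.comp (nzc L.symm)) (fun x => hu _)
  refine ⟨fun x => g (nzmap L x), hg.comp (nzc L), fun x => hgu _, ?_⟩
  exact (h.comp_right (nzmap L) (nzc L)).congr (fun x => by simp [nzmap_symm]) (fun x => rfl)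

theorem destab {D : ℕ} (hE : Module.finrank ℝ E = D + 1) (hD : D + 2 < 2 * (Fintype.card κ + 1)) {f g : Nz E → Matrix κ κ ℂ}
    (hf : Continuous f) (hg : Continuous g) (hfu : ∀ x, IsUnit (f x)) (hgu : ∀ x, IsUnit (g x))
    (h : Hm (GLs (κ ⊕ Unit)) (fun x => fromBlocks (f x) 0 0 1) (fun x => fromBlocks (g x) 0 0 1)) : Hm (GLs κ) f g := by
  obtain ⟨L⟩ := lin_exists hE
  have := c2_aux hD (hf.comp (nzc L.symm)) (hg.comp (nzc L.symm)) (fun x => hfu _) (fun x => hgu _)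
    (h.comp_right (nzmap L.symm) (nzc L.symm))
  exact (this.comp_right (nzmap L) (nzc L)).congr (fun x => by simp [nzmap_symm]) (fun x => by simp [nzmap_symm])

end
end CB

namespace CB
open MeasureTheory Matrix
open scoped ContDiff Topology

section
variable {X : Type*} [TopologicalSpace X] {ι κ K K' : Type*} [Fintype ι] [DecidableEq ι] [Fintype κ] [DecidableEq κ]
  [Fintype K] [DecidableEq K] [Fintype K'] [DecidableEq K']

/-- matrix of an embedding -/
def Jm (i : ι ↪ K) : Matrix K ι ℂ := Matrix.of fun a p => if i p = a then 1 else 0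

theorem Jm_tm (i : ι ↪ K) : (Jm i)ᵀ * Jm i = 1 := by
  ext p q
  simp only [Jm, mul_apply, transpose_apply, of_apply, Matrix.one_apply, ite_mul, one_mul, zero_mul]
  rw [Finset.sum_ite_eq]
  simp [eq_comm]

theorem Jm_trans (i : ι ↪ K) (j : K ↪ K') : Jm (i.trans j) = Jm j * Jm i := by
  ext a p
  simp only [Jm, mul_apply, of_apply, mul_ite, mul_one, mul_zero]
  rw [Finset.sum_ite_eq]; simp

/-- extension by the identity -/
def xt (i : ι ↪ K) (A : Matrix ι ι ℂ) : Matrix K K ℂ := 1 + Jm i * (A - 1) * (Jm i)ᵀ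

theorem xt_one (i : ι ↪ K) : xt i (1 : Matrix ι ι ℂ) = 1 := by simp [xt]

theorem xt_mul (i : ι ↪ K) (A B : Matrix ι ι ℂ) : xt i (A * B) = xt i A * xt i B := by
  have h : Jm i * (A - 1) * (Jm i)ᵀ * (Jm i * (B - 1) * (Jm i)ᵀ) = Jm i * ((A - 1) * (B - 1)) * (Jm i)ᵀ := by
    calc _ = Jm i * (A - 1) * ((Jm i)ᵀ * Jm i) * (B - 1) * (Jm i)ᵀ := by simp only [Matrix.mul_assoc]
      _ = _ := by rw [Jm_tm, Matrix.mul_one]; simp only [Matrix.mul_assoc]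
  have h2 : A * B - 1 = (A - 1) + (B - 1) + (A - 1) * (B - 1) := by noncomm_ring
  simp only [xt]
  rw [h2, mul_add, add_mul, add_mul, one_mul, one_mul, mul_one, h, Matrix.mul_add, Matrix.mul_add, Matrix.add_mul, Matrix.add_mul]
  abel

theorem xt_isUnit (i : ι ↪ K) {A : Matrix ι ι ℂ} (h : IsUnit A) : IsUnit (xt i A) := by
  obtain ⟨B, hB⟩ := h.exists_right_inv
  exact IsUnit.of_mul_eq_one (xt i B) (by rw [← xt_mul, hB, xt_one])

theorem xt_inv (i : ι ↪ K) {A : Matrix ι ι ℂ} (h : IsUnit A) : xt i A⁻¹ = (xt i A)⁻¹ := by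
  symm
  apply Matrix.inv_eq_right_inv
  rw [← xt_mul, Matrix.mul_nonsing_inv _ ((Matrix.isUnit_iff_isUnit_det _).1 h), xt_one]

theorem xt_cont (i : ι ↪ K) : Continuous (xt i) := by unfold xt; fun_prop

theorem xt_trans (i : ι ↪ K) (j : K ↪ K') (A : Matrix ι ι ℂ) : xt (i.trans j) A = xt j (xt i A) := by
  simp only [xt, Jm_trans, transpose_mul, add_sub_cancel_left, Matrix.mul_assoc]

theorem xt_equiv (e : ι ≃ K) (A : Matrix ι ι ℂ) : xt e.toEmbedding A = reindex e e A := by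
  have h : Jm e.toEmbedding * (Jm e.toEmbedding)ᵀ = 1 := by
    rw [mul_eq_one_comm_of_equiv e.symm]; exact Jm_tm _
  have : xt e.toEmbedding A = Jm e.toEmbedding * A * (Jm e.toEmbedding)ᵀ := by
    rw [xt, Matrix.mul_sub, Matrix.sub_mul, Matrix.mul_one, h]; abel
  rw [this]
  ext a b
  obtain ⟨p, rfl⟩ := e.surjective a
  obtain ⟨q, rfl⟩ := e.surjective b
  simp [Jm, mul_apply]

theorem xt_inl (A : Matrix ι ι ℂ) : xt (Function.Embedding.inl : ι ↪ ι ⊕ κ) A = fromBlocks A 0 0 1 := by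
  ext a b
  rcases a with a | a <;> rcases b with b | b <;> simp [xt, Jm, mul_apply, Matrix.one_apply]

theorem xt_refl (A : Matrix ι ι ℂ) : xt (Function.Embedding.refl ι) A = A := by
  have : Function.Embedding.refl ι = (Equiv.refl ι).toEmbedding := rfl
  rw [this, xt_equiv]; simp

theorem Hm.xt (i : ι ↪ K) {f g : X → Matrix ι ι ℂ} (h : Hm (GLs ι) f g) : Hm (GLs K) (fun x => xt i (f x)) (fun x => xt i (g x)) :=
  h.comp_left _ (xt_cont i).continuousOn fun _ hM => xt_isUnit i hM

theorem xt_perm (i j : ι ↪ K) {f : X → Matrix ι ι ℂ} (hf : Continuous f) (hu : ∀ x, IsUnit (f x)) :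
    Hm (GLs K) (fun x => xt i (f x)) (fun x => xt j (f x)) := by
  obtain ⟨s, hs⟩ : ∃ s : Equiv.Perm K, i.trans s.toEmbedding = j := by
    classical
    let e : {a // a ∈ Set.range i} ≃ {a // a ∈ Set.range j} := (Equiv.ofInjective i i.injective).symm.trans (Equiv.ofInjective j j.injective)
    refine ⟨e.extendSubtype, ?_⟩
    ext p
    have : e.extendSubtype (i p) = e ⟨i p, ⟨p, rfl⟩⟩ := e.extendSubtype_apply_of_mem _ _
    simp only [Function.Embedding.trans_apply, Equiv.toEmbedding_apply]
    rw [this]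
    have h2 : (⟨i p, ⟨p, rfl⟩⟩ : {a // a ∈ Set.range i}) = Equiv.ofInjective i i.injective p := rfl
    rw [h2]
    simp [e]
  have hP : Jm s.toEmbedding * (Jm s.toEmbedding)ᵀ = 1 := by
    rw [mul_eq_one_comm_of_equiv (Equiv.refl K)]; exact Jm_tm _
  have h1 : ∀ A, xt j A = Jm s.toEmbedding * xt i A * (Jm s.toEmbedding)ᵀ := by
    intro A
    rw [← hs, xt_trans]
    conv_lhs => rw [xt]
    rw [Matrix.mul_sub, Matrix.sub_mul, Matrix.mul_one, hP]; abel
  have u1 : IsUnit (Jm s.toEmbedding) := IsUnit.of_mul_eq_one _ hP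
  have u2 : IsUnit (Jm s.toEmbedding)ᵀ := IsUnit.of_mul_eq_one _ (Jm_tm _)
  have h2 := (((Hm.const (X := X) _ u1).mul (Hm.xt i (Hm.refl hf hu))).mul (Hm.const (X := X) _ u2)).symm
  exact h2.congr (fun x => by simp) (fun x => (h1 _).symm)

/-- stable homotopy -/
def St (f : X → Matrix ι ι ℂ) (g : X → Matrix κ κ ℂ) : Prop :=
  ∃ (N : ℕ) (i : ι ↪ Fin N) (j : κ ↪ Fin N), Hm (GLs (Fin N)) (fun x => xt i (f x)) (fun x => xt j (g x))

theorem St.of {f : X → Matrix ι ι ℂ} {g : X → Matrix κ κ ℂ} (i : ι ↪ K) (j : κ ↪ K)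
    (h : Hm (GLs K) (fun x => xt i (f x)) (fun x => xt j (g x))) : St f g := by
  refine ⟨Fintype.card K, i.trans (Fintype.equivFin K).toEmbedding, j.trans (Fintype.equivFin K).toEmbedding, ?_⟩
  simp only [xt_trans]
  exact h.xt _

theorem St.of_hm {f g : X → Matrix ι ι ℂ} (h : Hm (GLs ι) f g) : St f g := St.of (Function.Embedding.refl ι) (Function.Embedding.refl ι) (h.xt _)

theorem St.of_xt (i : ι ↪ K) {f : X → Matrix ι ι ℂ} (hf : Continuous f) (hu : ∀ x, IsUnit (f x)) : St f (fun x => xt i (f x)) := by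
  refine St.of i (Function.Embedding.refl K) ?_
  simp only [xt_refl]
  exact (Hm.refl hf hu).xt _

theorem St.symm {f : X → Matrix ι ι ℂ} {g : X → Matrix κ κ ℂ} (h : St f g) : St g f := by
  obtain ⟨N, i, j, h⟩ := h
  exact ⟨N, j, i, h.symm⟩

theorem St.trans {f : X → Matrix ι ι ℂ} {g : X → Matrix κ κ ℂ} {k : X → Matrix K K ℂ} (hg : Continuous g) (hu : ∀ x, IsUnit (g x))
    (h1 : St f g) (h2 : St g k) : St f k := by
  obtain ⟨N, i, j, h1⟩ := h1
  obtain ⟨N', i', j', h2⟩ := h2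
  refine St.of (K := Fin N ⊕ Fin N') (i.trans Function.Embedding.inl) (j'.trans Function.Embedding.inr) ?_
  have a1 := h1.xt (Function.Embedding.inl : Fin N ↪ Fin N ⊕ Fin N')
  have a2 := h2.xt (Function.Embedding.inr : Fin N' ↪ Fin N ⊕ Fin N')
  simp only [← xt_trans] at a1 a2
  exact (a1.trans (xt_perm _ _ hg hu)).trans a2

theorem St.inv {f : X → Matrix ι ι ℂ} {g : X → Matrix κ κ ℂ} (hf : ∀ x, IsUnit (f x)) (hg : ∀ x, IsUnit (g x)) (h : St f g) :
    St (fun x => (f x)⁻¹) (fun x => (g x)⁻¹) := by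
  obtain ⟨N, i, j, h⟩ := h
  exact ⟨N, i, j, h.inv.congr (fun x => (xt_inv i (hf x)).symm) (fun x => (xt_inv j (hg x)).symm)⟩

variable {E : Type*} [NormedAddCommGroup E] [NormedSpace ℝ E] [FiniteDimensional ℝ E]

/-- splitting off the last index -/
def spl (κ : Type*) (a : ℕ) : κ ⊕ Fin (a + 1) ≃ (κ ⊕ Fin a) ⊕ Unit :=
  ((Equiv.refl κ).sumCongr ((finSumFinEquiv (m := a) (n := 1)).symm.trans ((Equiv.refl _).sumCongr (Equiv.ofUnique (Fin 1) Unit)))).trans (Equiv.sumAssoc κ (Fin a) Unit).symm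

theorem inl_spl (a : ℕ) : (Function.Embedding.inl : κ ↪ κ ⊕ Fin (a + 1)).trans (spl κ a).toEmbedding =
    (Function.Embedding.inl : κ ↪ κ ⊕ Fin a).trans Function.Embedding.inl := by
  ext p; simp [spl]

theorem destab_it {D : ℕ} (hE : Module.finrank ℝ E = D + 1) (hD : D + 2 < 2 * (Fintype.card κ + 1)) {f g : Nz E → Matrix κ κ ℂ}
    (hf : Continuous f) (hg : Continuous g) (hfu : ∀ x, IsUnit (f x)) (hgu : ∀ x, IsUnit (g x)) (a : ℕ) 
    (h : Hm (GLs (κ ⊕ Fin a)) (fun x => xt Function.Embedding.inl (f x)) (fun x => xt Function.Embedding.inl (g x))) : Hm (GLs κ) f g := by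
  induction a with
  | zero =>
    have h2 := h.xt (Equiv.sumEmpty κ (Fin 0)).toEmbedding
    simp only [← xt_trans] at h2
    have : (Function.Embedding.inl : κ ↪ κ ⊕ Fin 0).trans (Equiv.sumEmpty κ (Fin 0)).toEmbedding = Function.Embedding.refl κ := by ext p; simp
    simp only [this, xt_refl] at h2
    exact h2
  | succ a ih =>
    apply ih
    have h2 := h.xt (spl κ a).toEmbedding
    simp only [← xt_trans, inl_spl] at h2
    simp only [xt_trans] at h2
    simp only [xt_inl] at h2
    refine (destab hE (by simp; omega) ((xt_cont _).comp hf) ((xt_cont _).comp hg) (fun x => xt_isUnit _ (hfu x)) (fun x => xt_isUnit _ (hgu x)) ?_)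
    simp only [xt_inl, Function.comp_def]
    exact h2

theorem St.destab {D : ℕ} (hE : Module.finrank ℝ E = D + 1) (hD : D + 2 < 2 * (Fintype.card κ + 1)) {f g : Nz E → Matrix κ κ ℂ}
    (hf : Continuous f) (hg : Continuous g) (hfu : ∀ x, IsUnit (f x)) (hgu : ∀ x, IsUnit (g x)) (h : St f g) : Hm (GLs κ) f g := by
  obtain ⟨N, i, j, h⟩ := h
  have hN : Fintype.card κ ≤ N := by simpa using Fintype.card_le_of_embedding i
  have e : Fin N ≃ κ ⊕ Fin (N - Fintype.card κ) := Fintype.equivOfCardEq (by simp; omega)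
  have h2 := h.xt e.toEmbedding
  simp only [← xt_trans] at h2
  exact destab_it hE hD hf hg hfu hgu _ (((xt_perm _ _ hf hfu).trans h2).trans (xt_perm _ _ hg hgu))

theorem compress_it {D : ℕ} (hE : Module.finrank ℝ E = D + 1) (hD : D + 2 < 2 * (Fintype.card κ + 1)) (a : ℕ) {f : Nz E → Matrix (κ ⊕ Fin a) (κ ⊕ Fin a) ℂ}
    (hf : Continuous f) (hu : ∀ x, IsUnit (f x)) :
    ∃ g : Nz E → Matrix κ κ ℂ, Continuous g ∧ (∀ x, IsUnit (g x)) ∧ St f g := by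
  induction a with
  | zero =>
    refine ⟨fun x => xt (Equiv.sumEmpty κ (Fin 0)).toEmbedding (f x), (xt_cont _).comp hf, fun x => xt_isUnit _ (hu x), St.of_xt _ hf hu⟩
  | succ a ih =>
    obtain ⟨g, hg, hgu, h⟩ := compress (κ := κ ⊕ Fin a) hE (by simp; omega) ((xt_cont (spl κ a).toEmbedding).comp hf) (fun x => xt_isUnit _ (hu x))
    obtain ⟨g', hg', hgu', h'⟩ := ih hg hgu
    refine ⟨g', hg', hgu', ?_⟩
    refine St.trans hg hgu (St.of (spl κ a).toEmbedding Function.Embedding.inl ?_) h'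
    simp only [xt_inl]
    exact h

theorem St.compress {D : ℕ} (hE : Module.finrank ℝ E = D + 1) (hD : D + 2 < 2 * (Fintype.card κ + 1)) {f : Nz E → Matrix ι ι ℂ}
    (hf : Continuous f) (hu : ∀ x, IsUnit (f x)) :
    ∃ g : Nz E → Matrix κ κ ℂ, Continuous g ∧ (∀ x, IsUnit (g x)) ∧ St f g := by
  let i : ι ↪ κ ⊕ Fin (Fintype.card ι) := (Fintype.equivFin ι).toEmbedding.trans Function.Embedding.inr
  obtain ⟨g, hg, hgu, h⟩ := compress_it (κ := κ) hE hD (Fintype.card ι) ((xt_cont i).comp hf) (fun x => xt_isUnit _ (hu x))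
  exact ⟨g, hg, hgu, St.trans ((xt_cont i).comp hf) (fun x => xt_isUnit _ (hu x)) (St.of_xt i hf hu) h⟩

end
end CB

namespace CB
open MeasureTheory Matrix
open scoped ContDiff Topology

section idem

/-- the circle -/
abbrev Tc := UnitAddCircle
/-- the probability measure on the circle -/
noncomputable abbrev mc : Measure Tc := AddCircle.haarAddCircle
/-- the coordinate -/
noncomputable def uc (t : Tc) : ℂ := (AddCircle.toCircle t : ℂ)

theorem uc_cont : Continuous uc := continuous_subtype_val.comp AddCircle.continuous_toCircle
theorem uc_norm (t : Tc) : ‖uc t‖ = 1 := Circle.norm_coe _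
theorem uc_ne (t : Tc) : uc t ≠ 0 := by intro h; have := uc_norm t; rw [h] at this; simp at this
theorem uc_add (s t : Tc) : uc (s + t) = uc s * uc t := by simp [uc, AddCircle.toCircle_add]
theorem uc_zero : uc 0 = 1 := by simp [uc]
theorem uc_neg (t : Tc) : uc (-t) * uc t = 1 := by rw [← uc_add]; simp [uc_zero]
theorem uc_inj {s t : Tc} (h : uc s = uc t) : s = t := AddCircle.injective_toCircle one_ne_zero (Subtype.ext h)

theorem mc_zero : mc {0} = 0 := by
  have h := AddCircle.volume_closedBall (T := 1) (x := 0) 0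
  rw [Metric.closedBall_zero, AddCircle.volume_eq_smul_haarAddCircle] at h
  simpa using h

variable {𝔸 : Type*} [NormedRing 𝔸] [NormedAlgebra ℂ 𝔸] [CompleteSpace 𝔸]

theorem ci {f : Tc → 𝔸} (hf : Continuous f) : Integrable f mc := hf.integrable_of_hasCompactSupport (HasCompactSupport.of_compactSpace f)

theorem il (a : 𝔸) {f : Tc → 𝔸} (hf : Continuous f) : ∫ t, a * f t ∂mc = a * ∫ t, f t ∂mc :=
  (ContinuousLinearMap.mul ℝ 𝔸 a).integral_comp_comm (ci hf)

theorem ir (a : 𝔸) {f : Tc → 𝔸} (hf : Continuous f) : ∫ t, f t * a ∂mc = (∫ t, f t ∂mc) * a :=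
  ((ContinuousLinearMap.mul ℝ 𝔸).flip a).integral_comp_comm (ci hf)

/-- the pencil `A + u B` has inverse `R` -/
structure Pen (A B : 𝔸) (R : Tc → 𝔸) : Prop where
  comm : A * B = B * A
  cont : Continuous R
  left : ∀ t, R t * (A + uc t • B) = 1
  right : ∀ t, (A + uc t • B) * R t = 1

/-- the idempotent of a pencil -/
noncomputable def idm (B : 𝔸) (R : Tc → 𝔸) : 𝔸 := ∫ t, uc t • (B * R t) ∂mc

variable {A B : 𝔸} {R : Tc → 𝔸}

theorem Pen.commB (h : Pen A B R) (t : Tc) : B * R t = R t * B := by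
  calc B * R t = R t * (A + uc t • B) * (B * R t) := by rw [h.left, one_mul]
    _ = R t * B * ((A + uc t • B) * R t) := by
      have : (A + uc t • B) * B = B * (A + uc t • B) := by simp [add_mul, mul_add, h.comm]
      rw [mul_assoc, ← mul_assoc (A + uc t • B), this]; simp only [mul_assoc]
    _ = _ := by rw [h.right, mul_one]

theorem Pen.commA (h : Pen A B R) (t : Tc) : A * R t = R t * A := by
  calc A * R t = R t * (A + uc t • B) * (A * R t) := by rw [h.left, one_mul]
    _ = R t * A * ((A + uc t • B) * R t) := by
      have : (A + uc t • B) * A = A * (A + uc t • B) := by simp [add_mul, mul_add, h.comm]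
      rw [mul_assoc, ← mul_assoc (A + uc t • B), this]; simp only [mul_assoc]
    _ = _ := by rw [h.right, mul_one]

theorem Pen.contG (h : Pen A B R) : Continuous fun t => uc t • (B * R t) := by
  have := h.cont
  have := uc_cont
  fun_prop

theorem Pen.idm_comm (h : Pen A B R) (C : 𝔸) (hB : C * B = B * C) (hR : ∀ t, C * R t = R t * C) : C * idm B R = idm B R * C := by
  rw [idm, ← il C h.contG, ← ir C h.contG]
  congr 1; ext t
  rw [mul_smul_comm, smul_mul_assoc, ← mul_assoc, hB, mul_assoc, hR, mul_assoc]

theorem Pen.resolvent (h : Pen A B R) (s w : Tc) :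
    (uc w - 1) • ((uc s • (B * R s)) * (uc (s + w) • (B * R (s + w)))) = uc w • (uc s • (B * R s)) - uc (s + w) • (B * R (s + w)) := by
  have h1 : R s - R (s + w) = (uc (s + w) - uc s) • (R s * B * R (s + w)) := by
    calc R s - R (s + w) = R s * ((A + uc (s + w) • B) * R (s + w)) - (R s * (A + uc s • B)) * R (s + w) := by
          rw [h.left, h.right, mul_one, one_mul]
      _ = _ := by
          simp only [sub_smul, mul_add, add_mul, mul_assoc, mul_smul_comm, smul_mul_assoc]; abel
  have h2 : B * R s - B * R (s + w) = (uc (s + w) - uc s) • (B * R s * (B * R (s + w))) := by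
    rw [← mul_sub, h1, mul_smul_comm]; simp only [mul_assoc]
  rw [uc_add] at h2 ⊢
  have h3 : uc w • uc s • (B * R s) - (uc s * uc w) • (B * R (s + w)) = (uc s * uc w) • (B * R s - B * R (s + w)) := by
    rw [smul_sub, smul_smul, mul_comm (uc w)]
  rw [h3, h2]
  simp only [smul_mul_assoc, mul_smul_comm, smul_smul]
  congr 1; ring

theorem Pen.corr (h : Pen A B R) {w : Tc} (hw : w ≠ 0) :
    ∫ s, (uc s • (B * R s)) * (uc (s + w) • (B * R (s + w))) ∂mc = idm B R := by
  have h1 : uc w - 1 ≠ 0 := by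
    rw [sub_ne_zero, ← uc_zero]; exact fun h0 => hw (uc_inj h0)
  have hG := h.contG
  have hG2 : Continuous fun s => uc (s + w) • (B * R (s + w)) := hG.comp (continuous_id.add continuous_const)
  have h2 : (uc w - 1) • ∫ s, (uc s • (B * R s)) * (uc (s + w) • (B * R (s + w))) ∂mc = (uc w - 1) • idm B R := by
    rw [← integral_smul]
    simp_rw [h.resolvent]
    have hG3 : Continuous fun s => uc w • uc s • (B * R s) := hG.const_smul _
    rw [integral_sub (ci hG3) (ci hG2), integral_smul, integral_add_right_eq_self (fun s => uc s • (B * R s)) w, sub_smul, one_smul]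
    rfl
  exact smul_right_injective _ h1 h2

theorem Pen.idem (h : Pen A B R) : idm B R * idm B R = idm B R := by
  have hG := h.contG
  have e1 : idm B R * idm B R = ∫ s, ∫ w, (uc s • (B * R s)) * (uc (s + w) • (B * R (s + w))) ∂mc ∂mc := by
    conv_lhs => rw [idm, ← ir _ hG]
    congr 1; ext s
    have hc2 : Continuous fun w => uc (s + w) • (B * R (s + w)) := hG.comp (continuous_const.add continuous_id)
    rw [il _ hc2]
    congr 1
    simp_rw [add_comm s]
    rw [integral_add_right_eq_self (fun s => uc s • (B * R s)) s]
  rw [e1, integral_integral_swap]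
  · have : (fun w => ∫ s, (uc s • (B * R s)) * (uc (s + w) • (B * R (s + w))) ∂mc) =ᵐ[mc] fun _ => idm B R := by
      have : ∀ᵐ w ∂mc, w ≠ (0 : Tc) := by
        rw [ae_iff]; simpa using mc_zero
      filter_upwards [this] with w hw
      exact h.corr hw
    rw [integral_congr_ae this]; simp
  · refine Continuous.integrable_of_hasCompactSupport ?_ (HasCompactSupport.of_compactSpace _)
    have h2 : Continuous fun p : Tc × Tc => uc (p.1 + p.2) • (B * R (p.1 + p.2)) := hG.comp (continuous_fst.add continuous_snd)
    have h3 : Continuous fun p : Tc × Tc => uc p.1 • (B * R p.1) := hG.comp continuous_fst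
    exact h3.mul h2


theorem one_sub_re {r : ℝ} (h0 : 0 ≤ r) (h1 : r < 1) (t : Tc) : 1 - r ≤ (1 - (r : ℂ) * uc t).re := by
  have h2 : ((r : ℂ) * uc t).re ≤ r := by
    refine (Complex.re_le_norm _).trans ?_
    rw [norm_mul, uc_norm, mul_one, Complex.norm_real, Real.norm_of_nonneg h0]
  rw [Complex.sub_re, Complex.one_re]; linarith

theorem one_sub_ne {r : ℝ} (h0 : 0 ≤ r) (h1 : r < 1) (t : Tc) : 1 - (r : ℂ) * uc t ≠ 0 := by
  intro h
  have := one_sub_re h0 h1 t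
  rw [h, Complex.zero_re] at this; linarith

theorem pois_cont {r : ℝ} (h0 : 0 ≤ r) (h1 : r < 1) : Continuous fun t => (1 - (r : ℂ) * uc t)⁻¹ := by
  have := uc_cont
  exact Continuous.inv₀ (by fun_prop) (one_sub_ne h0 h1)

theorem pois_int {r : ℝ} (h0 : 0 ≤ r) (h1 : r < 1) : ∫ t, (r : ℂ) * uc t * (1 - (r : ℂ) * uc t)⁻¹ ∂mc = 0 := by
  have hc := pois_cont h0 h1
  have hu := uc_cont
  have hP : Pen (1 : ℂ) (-(r : ℂ)) (fun t => (1 - (r : ℂ) * uc t)⁻¹) := by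
    refine ⟨by ring, hc, fun t => ?_, fun t => ?_⟩
    · have := one_sub_ne h0 h1 t
      rw [show (1 : ℂ) + uc t • (-(r : ℂ)) = 1 - r * uc t by simp; ring]; exact inv_mul_cancel₀ this
    · have := one_sub_ne h0 h1 t
      rw [show (1 : ℂ) + uc t • (-(r : ℂ)) = 1 - r * uc t by simp; ring]; exact mul_inv_cancel₀ this
  have hi := hP.idem
  set c := ∫ t, (r : ℂ) * uc t * (1 - (r : ℂ) * uc t)⁻¹ ∂mc with hcd
  have e1 : idm (-(r : ℂ)) (fun t => (1 - (r : ℂ) * uc t)⁻¹) = - c := by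
    rw [hcd, idm, ← integral_neg]; congr 1; ext t; simp; ring
  have hg : Continuous fun t => (r : ℂ) * uc t * (1 - (r : ℂ) * uc t)⁻¹ := by fun_prop
  have e2 : ∫ t, (1 - (r : ℂ) * uc t)⁻¹ ∂mc = 1 + c := by
    have : (fun t => (1 - (r : ℂ) * uc t)⁻¹) = fun t => 1 + (r : ℂ) * uc t * (1 - (r : ℂ) * uc t)⁻¹ := by
      ext t; have := one_sub_ne h0 h1 t; field_simp; ring
    rw [this, integral_add (ci continuous_const) (ci hg)]; simp [hcd]
  rw [e1] at hi
  have h3 : c * (1 + c) = 0 := by linear_combination hi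
  rcases mul_eq_zero.1 h3 with h | h
  · exact h
  · exfalso
    rw [h] at e2
    have e3 : ∫ t, ((1 - (r : ℂ) * uc t)⁻¹).re ∂mc = 0 := by
      have := Complex.reCLM.integral_comp_comm (ci hc)
      rw [e2] at this; simpa using this
    have hci : Continuous fun t => ((1 - (r : ℂ) * uc t)⁻¹).re := Complex.continuous_re.comp hc
    have e4 : ∫ t : Tc, (1 - r) / 4 ∂mc ≤ ∫ t, ((1 - (r : ℂ) * uc t)⁻¹).re ∂mc := by
      refine integral_mono (integrable_const _) (hci.integrable_of_hasCompactSupport (HasCompactSupport.of_compactSpace _)) fun t => ?_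
      have h5 := one_sub_re h0 h1 t
      have h6 : ‖1 - (r : ℂ) * uc t‖ ≤ 2 := by
        refine (norm_sub_le _ _).trans ?_
        rw [norm_mul, uc_norm, mul_one, Complex.norm_real, Real.norm_of_nonneg h0, norm_one]; linarith
      have h7 : 0 < ‖1 - (r : ℂ) * uc t‖ := norm_pos_iff.2 (one_sub_ne h0 h1 t)
      change (1 - r) / 4 ≤ ((1 - (r : ℂ) * uc t)⁻¹).re
      rw [Complex.inv_re, Complex.normSq_eq_norm_sq]
      have h8 : ‖1 - (r : ℂ) * uc t‖ ^ 2 ≤ 4 := by nlinarith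
      rw [div_le_div_iff₀ (by norm_num) (by positivity)]
      nlinarith
    rw [e3] at e4; simp at e4; linarith

theorem Pen.spec (h : Pen A B R) {r : ℝ} (h0 : 0 ≤ r) (h1 : r < 1) : ∃ Z, ((r : ℂ) • A + B) * Z = idm B R := by
  have hc := pois_cont h0 h1
  have hu := uc_cont
  have hR := h.cont
  have hF : Continuous fun t => (uc t * (1 - (r : ℂ) * uc t)⁻¹) • R t := by fun_prop
  refine ⟨∫ t, (uc t * (1 - (r : ℂ) * uc t)⁻¹) • R t ∂mc, ?_⟩
  rw [← il _ hF]
  have e : ∀ t, ((r : ℂ) • A + B) * ((uc t * (1 - (r : ℂ) * uc t)⁻¹) • R t) = ((r : ℂ) * uc t * (1 - (r : ℂ) * uc t)⁻¹) • (1 : 𝔸) + uc t • (B * R t) := by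
    intro t
    have h2 := one_sub_ne h0 h1 t
    have h3 : A * R t = 1 - uc t • (B * R t) := by
      have := h.right t
      rw [add_mul, smul_mul_assoc] at this; rw [← this]; abel
    rw [mul_smul_comm, add_mul, smul_mul_assoc, h3, smul_sub, smul_add, smul_sub, smul_smul, smul_smul, smul_smul]
    have h4 : uc t • (B * R t) = (uc t * (1 - (r : ℂ) * uc t)⁻¹) • (B * R t) - (uc t * (1 - (r : ℂ) * uc t)⁻¹ * (r * uc t)) • (B * R t) := by
      rw [← sub_smul]; congr 1
      linear_combination (-uc t) * (mul_inv_cancel₀ h2)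
    conv_rhs => rw [h4]
    rw [show uc t * (1 - (r : ℂ) * uc t)⁻¹ * r = (r : ℂ) * uc t * (1 - (r : ℂ) * uc t)⁻¹ by ring, ← mul_assoc]
    rw [show uc t * (1 - (r : ℂ) * uc t)⁻¹ * r = (r : ℂ) * uc t * (1 - (r : ℂ) * uc t)⁻¹ by ring]
    abel
  simp_rw [e]
  have hF2 : Continuous fun t => ((r : ℂ) * uc t * (1 - (r : ℂ) * uc t)⁻¹) • (1 : 𝔸) := by fun_prop
  rw [integral_add (ci hF2) (ci h.contG), integral_smul_const, pois_int h0 h1, zero_smul, zero_add]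
  rfl

theorem Pen.rot (h : Pen A B R) (t0 : Tc) : Pen A (uc t0 • B) (fun t => R (t + t0)) := by
  refine ⟨by rw [mul_smul_comm, smul_mul_assoc, h.comm], h.cont.comp (continuous_id.add continuous_const), fun t => ?_, fun t => ?_⟩
  · rw [smul_smul, ← uc_add]; exact h.left _
  · rw [smul_smul, ← uc_add]; exact h.right _

theorem Pen.idm_rot (t0 : Tc) : idm (uc t0 • B) (fun t => R (t + t0)) = idm B R := by
  rw [idm, idm, ← integral_add_right_eq_self (fun t => uc t • (B * R t)) t0]
  congr 1; ext t
  rw [smul_mul_assoc, smul_smul, ← uc_add]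

theorem Pen.swap (h : Pen A B R) : Pen B A (fun t => uc (-t) • R (-t)) := by
  have hu := uc_cont
  have hR := h.cont.comp (continuous_neg (G := Tc))
  have e : ∀ t, B + uc t • A = uc t • (A + uc (-t) • B) := by
    intro t; rw [smul_add, smul_smul, mul_comm, uc_neg, one_smul, add_comm]
  refine ⟨h.comm.symm, (hu.comp continuous_neg).smul hR, fun t => ?_, fun t => ?_⟩
  · rw [e, smul_mul_smul_comm, uc_neg, h.left, one_smul]
  · rw [e, smul_mul_smul_comm, mul_comm, uc_neg, h.right, one_smul]

theorem Pen.idm_swap (h : Pen A B R) : idm A (fun t => uc (-t) • R (-t)) = 1 - idm B R := by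
  have e : ∀ t, A * R t = 1 - uc t • (B * R t) := by
    intro t
    have := h.right t
    rw [add_mul, smul_mul_assoc] at this; rw [← this]; abel
  rw [idm]
  have e2 : (fun t => uc t • (A * (uc (-t) • R (-t)))) = fun t => (fun s => A * R s) (-t) := by
    ext t; rw [mul_smul_comm, smul_smul, mul_comm, uc_neg, one_smul]
  rw [e2, integral_neg_eq_self (fun s => A * R s) mc]
  simp_rw [e]
  rw [integral_sub (ci continuous_const) (ci h.contG)]
  simp [idm]

theorem Pen.path (h : Pen A B R) {r : ℝ} (h0 : 0 ≤ r) (h1 : r ≤ 1) (t : Tc) :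
    ∃ Z, (idm B R * ((r : ℂ) • A + uc t • B) + (1 - idm B R) * (A + (r : ℂ) • uc t • B)) * Z = 1 := by
  rcases h1.lt_or_eq with h1 | rfl
  · obtain ⟨Z1, hZ1⟩ := (h.rot t).spec h0 h1
    obtain ⟨Z2, hZ2⟩ := (h.rot t).swap.spec h0 h1
    rw [(h.rot t).idm_swap, Pen.idm_rot] at hZ2
    rw [Pen.idm_rot] at hZ1
    set p := idm B R with hp
    have hi : p * p = p := h.idem
    have hA : A * p = p * A := h.idm_comm A h.comm h.commA
    have hB : B * p = p * B := h.idm_comm B rfl h.commB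
    refine ⟨p * Z1 + (1 - p) * Z2, ?_⟩
    have h2 : ((r : ℂ) • A + uc t • B) * p = p * ((r : ℂ) • A + uc t • B) := by
      simp [add_mul, mul_add, hA, hB]
    have h3 : (A + (r : ℂ) • uc t • B) * p = p * (A + (r : ℂ) • uc t • B) := by
      simp [add_mul, mul_add, hA, hB]
    have hZ2' : (A + (r : ℂ) • uc t • B) * Z2 = 1 - p := by rw [add_comm]; exact hZ2
    generalize (r : ℂ) • A + uc t • B = M at *
    generalize A + (r : ℂ) • uc t • B = N at *
    have a1 : p * M * (p * Z1) = p := by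
      rw [mul_assoc, ← mul_assoc M, h2, mul_assoc, hZ1, hi, hi]
    have a2 : p * M * ((1 - p) * Z2) = 0 := by
      rw [mul_assoc, ← mul_assoc M, mul_sub, mul_one, h2]
      rw [sub_mul, mul_sub, ← mul_assoc p (p * M) Z2, ← mul_assoc p p M, hi, ← mul_assoc p M, sub_self]
    have a3 : (1 - p) * N * (p * Z1) = 0 := by
      rw [mul_assoc, ← mul_assoc N, h3, ← mul_assoc, ← mul_assoc, sub_mul, one_mul, hi, sub_self]; simp
    have h4 : N * (1 - p) = (1 - p) * N := by rw [mul_sub, sub_mul, h3]; simp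
    have h5 : (1 - p) * (1 - p) = 1 - p := by rw [mul_sub, sub_mul, sub_mul, hi]; simp
    have a4 : (1 - p) * N * ((1 - p) * Z2) = 1 - p := by
      rw [mul_assoc, ← mul_assoc N, h4, mul_assoc, hZ2', h5, h5]
    rw [add_mul, mul_add, mul_add, a1, a2, a3, a4]; abel
  · refine ⟨R t, ?_⟩
    rw [Complex.ofReal_one, one_smul, one_smul, ← add_mul]
    rw [show idm B R + (1 - idm B R) = 1 by abel, one_mul, h.right]

end idem
end CB

namespace CB
open MeasureTheory Matrix
open scoped ContDiff Topology

section laurent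
variable {X : Type} [TopologicalSpace X] [CompactSpace X] [T2Space X]

/-- evaluation at a point -/
noncomputable def evx (x : X) : C(X, ℂ) →+* ℂ where
  toFun f := f x
  map_one' := rfl
  map_mul' _ _ := rfl
  map_zero' := rfl
  map_add' _ _ := rfl

/-- scalar Laurent polynomials -/
def Lau (f : X × Tc → ℂ) : Prop :=
  ∃ d : ℕ, ∃ q : Polynomial C(X, ℂ), ∀ x t, uc t ^ d * f (x, t) = q.eval₂ (evx x) (uc t)

theorem lau_dense (f : C(X × Tc, ℂ)) {ε : ℝ} (hε : 0 < ε) : ∃ g : C(X × Tc, ℂ), Lau (X := X) g ∧ ∀ y, ‖g y - f y‖ < ε := by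
  let U : C(X × Tc, ℂ) := ⟨fun y => uc y.2, uc_cont.comp continuous_snd⟩
  let pb : C(X, ℂ) → C(X × Tc, ℂ) := fun g => g.comp ⟨Prod.fst, continuous_fst⟩
  let S : Set C(X × Tc, ℂ) := Set.range pb ∪ {U}
  have hS : (StarAlgebra.adjoin ℂ S).topologicalClosure = ⊤ := by
    apply ContinuousMap.starSubalgebra_topologicalClosure_eq_top_of_separatesPoints
    rintro ⟨x, t⟩ ⟨x', t'⟩ hne
    by_cases hx : x = x'
    · subst hx
      refine ⟨U, ⟨U, StarAlgebra.subset_adjoin _ _ (Or.inr rfl), rfl⟩, ?_⟩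
      intro h
      exact hne (congrArg (Prod.mk x) (uc_inj (h : uc t = uc t')))
    · obtain ⟨φ, h1, h2, -⟩ := exists_continuous_zero_one_of_isClosed (isClosed_singleton (x := x)) (isClosed_singleton (x := x')) (by simpa using fun h => hx h)
      let ψ : C(X, ℂ) := ⟨fun y => (φ y : ℂ), by fun_prop⟩
      refine ⟨pb ψ, ⟨pb ψ, StarAlgebra.subset_adjoin _ _ (Or.inl ⟨ψ, rfl⟩), rfl⟩, ?_⟩
      change (φ x : ℂ) ≠ (φ x' : ℂ)
      rw [h1 rfl, h2 rfl]; simp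
  have hf : f ∈ (StarAlgebra.adjoin ℂ S).topologicalClosure := by rw [hS]; trivial
  have hf2 : f ∈ closure ((StarAlgebra.adjoin ℂ S : StarSubalgebra ℂ C(X × Tc, ℂ)) : Set C(X × Tc, ℂ)) := hf
  obtain ⟨g, hg, hd⟩ := Metric.mem_closure_iff.1 hf2 ε hε
  refine ⟨g, ?_, fun y => ?_⟩
  · have hg2 : g ∈ Algebra.adjoin ℂ (S ∪ star S) := by
      rw [← StarAlgebra.adjoin_toSubalgebra]; exact hg
    clear hd hg
    induction hg2 using Algebra.adjoin_induction with
    | mem g hg =>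
      have key : ∀ k : C(X, ℂ), Lau (X := X) (pb k) := fun k => ⟨0, Polynomial.C k, fun x t => by simp [pb]; rfl⟩
      rcases hg with (⟨k, rfl⟩ | rfl) | hg
      · exact key k
      · exact ⟨0, Polynomial.X, fun x t => by simp [U]⟩
      · rcases hg with ⟨k, hk⟩ | hk
        · have : g = pb (star k) := by rw [← star_star g, ← hk]; rfl
          rw [this]; exact key _
        · have hgu : g = star U := by rw [← star_star g]; congr 1
          refine ⟨1, 1, fun x t => ?_⟩
          rw [hgu]
          simp only [Polynomial.eval₂_one, pow_one]
          change uc t * (starRingEnd ℂ) (uc t) = 1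
          rw [Complex.mul_conj, Complex.normSq_eq_norm_sq, uc_norm]; simp
    | algebraMap r => exact ⟨0, Polynomial.C (algebraMap ℂ _ r), fun x t => by simp; rfl⟩
    | add a b _ _ ha hb =>
      obtain ⟨d, q, h⟩ := ha
      obtain ⟨d', q', h'⟩ := hb
      refine ⟨d + d', Polynomial.X ^ d' * q + Polynomial.X ^ d * q', fun x t => ?_⟩
      rw [Polynomial.eval₂_add, Polynomial.eval₂_mul, Polynomial.eval₂_mul, ← h, ← h']
      simp; ring
    | mul a b _ _ ha hb =>
      obtain ⟨d, q, h⟩ := ha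
      obtain ⟨d', q', h'⟩ := hb
      refine ⟨d + d', q * q', fun x t => ?_⟩
      rw [Polynomial.eval₂_mul, ← h, ← h']
      simp; ring
  · rw [← dist_eq_norm, dist_comm]
    exact (ContinuousMap.dist_apply_le_dist y).trans_lt hd

variable {κ : Type} [Fintype κ] [DecidableEq κ]

theorem Hm.csmul {Y : Type*} [TopologicalSpace Y] {c : Y → ℂ} (hc : Continuous c) (h0 : ∀ y, c y ≠ 0) {f g : Y → Matrix κ κ ℂ} (h : Hm (GLs κ) f g) :
    Hm (GLs κ) (fun y => c y • f y) (fun y => c y • g y) := by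
  have h1 : Hm (GLs κ) (fun y => c y • (1 : Matrix κ κ ℂ)) (fun y => c y • 1) := by
    refine Hm.refl (by fun_prop) fun y => ?_
    exact IsUnit.of_mul_eq_one ((c y)⁻¹ • 1) (by rw [smul_mul_smul_comm, mul_inv_cancel₀ (h0 y), one_smul, one_mul])
  exact (h1.mul h).congr (fun y => by simp) (fun y => by simp)

/-- matrix polynomials with at most `N` terms -/
def MPol (N : ℕ) (F : X × Tc → Matrix κ κ ℂ) : Prop :=
  ∃ a : ℕ → X → Matrix κ κ ℂ, (∀ k, Continuous (a k)) ∧ ∀ x t, F (x, t) = ∑ k ∈ Finset.range N, uc t ^ k • a k x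

theorem MPol.mono {N M : ℕ} (h : N ≤ M) {F : X × Tc → Matrix κ κ ℂ} (hF : MPol N F) : MPol M F := by
  obtain ⟨a, ha, e⟩ := hF
  refine ⟨fun k x => if k < N then a k x else 0, fun k => ?_, fun x t => ?_⟩
  · by_cases hk : k < N
    · simp [hk]; exact ha k
    · simp [hk]; exact continuous_const
  · rw [e, ← Finset.sum_subset (Finset.range_subset_range.2 h)]
    · refine Finset.sum_congr rfl fun k hk => ?_
      simp [Finset.mem_range.1 hk]
    · intro k _ hk
      have : ¬ k < N := by simpa using hk
      simp [this]

theorem laurent_approx {L : X × Tc → Matrix κ κ ℂ} (hL : Continuous L) (hu : ∀ y, IsUnit (L y)) :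
    ∃ d N : ℕ, ∃ F : X × Tc → Matrix κ κ ℂ, MPol N F ∧ Hm (GLs κ) (fun y => uc y.2 ^ d • L y) F := by
  letI : NormedAddCommGroup (Matrix κ κ ℂ) := Matrix.normedAddCommGroup
  letI : NormedSpace ℝ (Matrix κ κ ℂ) := Matrix.normedSpace
  have hopen : IsOpen (GLs κ) := by
    have : GLs κ = (fun M : Matrix κ κ ℂ => M.det) ⁻¹' {0}ᶜ := by
      ext M; simp [GLs, Matrix.isUnit_iff_isUnit_det]
    rw [this]
    exact isOpen_compl_singleton.preimage (by fun_prop)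
  obtain ⟨δ, hδ, hsub⟩ := (isCompact_range hL).exists_thickening_subset_open hopen (by rintro _ ⟨y, rfl⟩; exact hu y)
  have hLij : ∀ i j, Continuous fun y => L y i j := fun i j => by fun_prop
  choose g hg1 hg2 using fun i j => lau_dense (X := X) ⟨fun y => L y i j, hLij i j⟩ (half_pos hδ)
  choose d q hq using hg1
  let D := ∑ i, ∑ j, d i j
  have hD : ∀ i j, d i j ≤ D := fun i j =>
    (Finset.single_le_sum (f := fun j => d i j) (fun _ _ => Nat.zero_le _) (Finset.mem_univ j)).trans
      (Finset.single_le_sum (f := fun i => ∑ j, d i j) (fun _ _ => Nat.zero_le _) (Finset.mem_univ i))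
  let Q : κ → κ → Polynomial C(X, ℂ) := fun i j => Polynomial.X ^ (D - d i j) * q i j
  let N := ∑ i, ∑ j, ((Q i j).natDegree + 1)
  have hN : ∀ i j, (Q i j).natDegree < N := fun i j =>
    (Nat.lt_succ_self _).trans_le ((Finset.single_le_sum (f := fun j => (Q i j).natDegree + 1) (fun _ _ => Nat.zero_le _) (Finset.mem_univ j)).trans
      (Finset.single_le_sum (f := fun i => ∑ j, ((Q i j).natDegree + 1)) (fun _ _ => Nat.zero_le _) (Finset.mem_univ i)))
  let G : X × Tc → Matrix κ κ ℂ := fun y => Matrix.of fun i j => g i j y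
  have hG : Continuous G := by
    refine continuous_matrix fun i j => (g i j).continuous
  refine ⟨D, N, fun y => uc y.2 ^ D • G y, ⟨fun k x => Matrix.of fun i j => (Q i j).coeff k x, fun k => continuous_matrix fun i j => ((Q i j).coeff k).continuous, fun x t => ?_⟩, ?_⟩
  · ext i j
    rw [Matrix.sum_apply]
    simp only [Matrix.smul_apply, Matrix.of_apply, smul_eq_mul, G]
    have h1 : uc t ^ D * g i j (x, t) = (Q i j).eval₂ (evx x) (uc t) := by
      rw [Polynomial.eval₂_mul, ← hq]
      simp only [Polynomial.eval₂_X_pow]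
      rw [← mul_assoc, ← pow_add, Nat.sub_add_cancel (hD i j)]
    rw [h1, Polynomial.eval₂_eq_sum_range' _ (hN i j)]
    refine Finset.sum_congr rfl fun k _ => ?_
    rw [mul_comm]; rfl
  · have h1 : Hm (GLs κ) L G := by
      apply Hm.line hL hG
      intro y s hs0 hs1
      apply hsub
      rw [Metric.mem_thickening_iff]
      refine ⟨L y, ⟨y, rfl⟩, ?_⟩
      have h2 : ‖G y - L y‖ ≤ δ / 2 := by
        rw [Matrix.norm_le_iff (by positivity)]
        intro i j
        exact (hg2 i j y).le
      rw [dist_eq_norm, show (1 - s) • L y + s • G y - L y = s • (G y - L y) by rw [sub_smul, smul_sub, one_smul]; abel,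
        norm_smul, Real.norm_of_nonneg hs0]
      have := norm_nonneg (G y - L y)
      nlinarith
    have hc : Continuous fun y : X × Tc => uc y.2 ^ D := (uc_cont.comp continuous_snd).pow D
    exact h1.csmul hc fun y => pow_ne_zero _ (uc_ne _)

end laurent
end CB

namespace CB
open MeasureTheory Matrix
open scoped ContDiff Topology

section lz
variable {X : Type} [TopologicalSpace X] [CompactSpace X] [T2Space X]
variable {κ : Type} [Fintype κ] [DecidableEq κ]

theorem sum_blocks {s : Finset ℕ} (a b c d : ℕ → Matrix κ κ ℂ) :
    ∑ k ∈ s, fromBlocks (a k) (b k) (c k) (d k) = fromBlocks (∑ k ∈ s, a k) (∑ k ∈ s, b k) (∑ k ∈ s, c k) (∑ k ∈ s, d k) := by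
  induction s using Finset.induction_on with
  | empty => simp
  | insert k s hk ih => simp only [Finset.sum_insert hk, ih, Matrix.fromBlocks_add]

theorem MPol.blocks {N : ℕ} {F1 F2 F3 F4 : X × Tc → Matrix κ κ ℂ} (h1 : MPol N F1) (h2 : MPol N F2) (h3 : MPol N F3) (h4 : MPol N F4) :
    MPol N (fun y => fromBlocks (F1 y) (F2 y) (F3 y) (F4 y)) := by
  obtain ⟨a, ha, ea⟩ := h1
  obtain ⟨b, hb, eb⟩ := h2
  obtain ⟨c, hc, ec⟩ := h3
  obtain ⟨d, hd, ed⟩ := h4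
  refine ⟨fun k x => fromBlocks (a k x) (b k x) (c k x) (d k x), fun k => (ha k).matrix_fromBlocks (hb k) (hc k) (hd k), fun x t => ?_⟩
  simp only [Matrix.fromBlocks_smul, sum_blocks, ea, eb, ec, ed]

theorem MPol.cont {N : ℕ} {F : X × Tc → Matrix κ κ ℂ} (h : MPol N F) : Continuous F := by
  obtain ⟨a, ha, e⟩ := h
  have : F = fun y => ∑ k ∈ Finset.range N, uc y.2 ^ k • a k y.1 := by ext1 ⟨x, t⟩; exact e x t
  rw [this]
  refine continuous_finset_sum _ fun k _ => ?_
  exact ((uc_cont.comp continuous_snd).pow k).smul ((ha k).comp continuous_fst)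

theorem MPol.const {a : X → Matrix κ κ ℂ} (ha : Continuous a) {N : ℕ} (hN : 1 ≤ N) : MPol N (fun y : X × Tc => a y.1) := by
  refine MPol.mono hN ⟨fun _ => a, fun _ => ha, fun x t => ?_⟩
  simp

theorem MPol.lin {a : X → Matrix κ κ ℂ} (ha : Continuous a) {N : ℕ} (hN : 2 ≤ N) : MPol N (fun y : X × Tc => uc y.2 • a y.1) := by
  refine MPol.mono hN ⟨fun k x => if k = 1 then a x else 0, fun k => ?_, fun x t => ?_⟩
  · by_cases hk : k = 1
    · simp [hk]; exact ha
    · simp [hk]; exact continuous_const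
  · simp [Finset.sum_range_succ]

theorem tri_unit (b : Matrix κ κ ℂ) : IsUnit (fromBlocks 1 b 0 1 : Matrix (κ ⊕ κ) (κ ⊕ κ) ℂ) := by
  rw [Matrix.isUnit_iff_isUnit_det, Matrix.det_fromBlocks_zero₂₁]; simp

theorem tri_unit2 (b : Matrix κ κ ℂ) : IsUnit (fromBlocks 1 0 b 1 : Matrix (κ ⊕ κ) (κ ⊕ κ) ℂ) := by
  rw [Matrix.isUnit_iff_isUnit_det, Matrix.det_fromBlocks_zero₁₂]; simp

theorem tri_hm {Y : Type*} [TopologicalSpace Y] {b : Y → Matrix κ κ ℂ} (hb : Continuous b) :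
    Hm (GLs (κ ⊕ κ)) (fun y => fromBlocks 1 (b y) 0 1) (fun _ => 1) := by
  refine ⟨fun s y => fromBlocks 1 ((1 - (s : ℝ)) • b y) 0 1, ?_, fun s y => tri_unit _, by simp, by simp⟩
  exact continuous_const.matrix_fromBlocks (by fun_prop) continuous_const continuous_const

theorem tri_hm2 {Y : Type*} [TopologicalSpace Y] {b : Y → Matrix κ κ ℂ} (hb : Continuous b) :
    Hm (GLs (κ ⊕ κ)) (fun y => fromBlocks 1 0 (b y) 1) (fun _ => 1) := by
  refine ⟨fun s y => fromBlocks 1 0 ((1 - (s : ℝ)) • b y) 1, ?_, fun s y => tri_unit2 _, by simp, by simp⟩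
  exact continuous_const.matrix_fromBlocks continuous_const (by fun_prop) continuous_const

theorem linz (N : ℕ) : ∀ {κ : Type} [Fintype κ] [DecidableEq κ] {F : X × Tc → Matrix κ κ ℂ} (_ : MPol (N + 2) F) (_ : ∀ y, IsUnit (F y)),
    ∃ (K : Type) (_ : Fintype K) (_ : DecidableEq K) (i : κ ↪ K) (A B : X → Matrix K K ℂ), Continuous A ∧ Continuous B ∧
      Hm (GLs K) (fun y => xt i (F y)) (fun y => A y.1 + uc y.2 • B y.1) := by
  induction N with
  | zero =>
    intro κ _ _ F hF hu
    have hc := hF.cont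
    obtain ⟨a, ha, e⟩ := hF
    refine ⟨κ, inferInstance, inferInstance, Function.Embedding.refl κ, a 0, a 1, ha 0, ha 1, ?_⟩
    refine (Hm.refl hc hu).congr (fun y => (xt_refl _).symm) fun y => ?_
    obtain ⟨x, t⟩ := y
    rw [e]; simp [Finset.sum_range_succ]
  | succ N ih =>
    intro κ _ _ F hF hu
    have hc := hF.cont
    obtain ⟨a, ha, e⟩ := hF
    let b : X × Tc → Matrix κ κ ℂ := fun y => ∑ k ∈ Finset.range (N + 2), uc y.2 ^ k • a (k + 1) y.1
    have hb : MPol (N + 2) b := ⟨fun k => a (k + 1), fun k => ha _, fun x t => rfl⟩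
    have hbc := hb.cont
    have he : ∀ y, F y = a 0 y.1 + uc y.2 • b y := by
      rintro ⟨x, t⟩
      rw [e, Finset.sum_range_succ']
      simp only [b, Finset.smul_sum, smul_smul, pow_zero, one_smul]
      rw [add_comm]
      congr 1
      refine Finset.sum_congr rfl fun k _ => ?_
      rw [pow_succ, mul_comm]
    let G : X × Tc → Matrix (κ ⊕ κ) (κ ⊕ κ) ℂ := fun y => fromBlocks (a 0 y.1) (b y) (uc y.2 • (-1)) 1
    have hG : MPol (N + 2) G := MPol.blocks (MPol.const (ha 0) (by omega)) hb (MPol.lin (a := fun _ => -1) continuous_const (by omega)) (MPol.const (a := fun _ => 1) continuous_const (by omega))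
    have hGc := hG.cont
    have hgl : ∀ y, fromBlocks 1 (b y) 0 1 * fromBlocks (F y) 0 0 1 = G y * fromBlocks 1 0 (uc y.2 • 1) 1 := by
      intro y
      simp only [G, fromBlocks_multiply, he]
      congr 1 <;> simp
    have huc : Continuous fun y : X × Tc => uc y.2 := uc_cont.comp continuous_snd
    have t2 : Hm (GLs (κ ⊕ κ)) (fun y : X × Tc => (fromBlocks 1 0 (uc y.2 • 1) 1 : Matrix (κ ⊕ κ) (κ ⊕ κ) ℂ)) (fun _ => 1) :=
      tri_hm2 (by fun_prop)
    have hGu : ∀ y, IsUnit (G y) := by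
      intro y
      have h1 : IsUnit (G y * fromBlocks 1 0 (uc y.2 • 1) 1) := by
        rw [← hgl]; exact ((tri_hm hbc).mem_left y).mul (isUnit_blockdiag (hu y) isUnit_one)
      have h2 : IsUnit (fromBlocks 1 0 (uc y.2 • 1) 1 : Matrix (κ ⊕ κ) (κ ⊕ κ) ℂ) := t2.mem_left y
      rw [Matrix.isUnit_iff_isUnit_det, Matrix.det_mul] at h1
      exact (Matrix.isUnit_iff_isUnit_det _).2 (isUnit_of_mul_isUnit_left h1)
    obtain ⟨K, _, _, i, A, B, hA, hB, h⟩ := ih hG hGu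
    refine ⟨K, inferInstance, inferInstance, Function.Embedding.inl.trans i, A, B, hA, hB, ?_⟩
    have h1 : Hm (GLs (κ ⊕ κ)) (fun y => fromBlocks (F y) 0 0 1) G := by
      have e1 : Hm (GLs (κ ⊕ κ)) (fun y => fromBlocks (F y) 0 0 1) (fun y => fromBlocks 1 (b y) 0 1 * fromBlocks (F y) 0 0 1) :=
        (((tri_hm hbc).symm).mul (Hm.refl (by fun_prop) fun y => isUnit_blockdiag (hu y) isUnit_one)).congr (fun y => one_mul _) (fun y => rfl)
      have e2 : Hm (GLs (κ ⊕ κ)) (fun y => G y * fromBlocks 1 0 (uc y.2 • 1) 1) G :=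
        ((Hm.refl hGc hGu).mul t2).congr (fun y => rfl) (fun y => mul_one _)
      exact e1.trans (e2.congr (fun y => (hgl y).symm) fun y => rfl)
    refine ((h1.xt i).trans h).congr (fun y => ?_) (fun y => rfl)
    rw [xt_trans, xt_inl]

theorem Hm.norm {f g : X × Tc → Matrix κ κ ℂ} (h : Hm (GLs κ) f g) :
    Hm (GLs κ) (fun y => f y * (f (y.1, 0))⁻¹) (fun y => g y * (g (y.1, 0))⁻¹) :=
  h.mul ((h.comp_right (fun y : X × Tc => (y.1, (0 : Tc))) (by fun_prop)).inv)

theorem int_cont {Y 𝔸 : Type*} [TopologicalSpace Y] [NormedAddCommGroup 𝔸] [NormedSpace ℝ 𝔸] {F : Y → Tc → 𝔸} (hF : Continuous fun q : Y × Tc => F q.1 q.2) :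
    Continuous fun y => ∫ t, F y t ∂mc := by
  let C : C(Y, C(Tc, 𝔸)) := ContinuousMap.curry ⟨fun q : Y × Tc => F q.1 q.2, hF⟩
  have h1 : Continuous fun f : C(Tc, 𝔸) => ∫ t, f t ∂mc := by
    refine LipschitzWith.continuous (K := 1) (LipschitzWith.of_dist_le_mul fun f g => ?_)
    have hi : ∀ f : C(Tc, 𝔸), Integrable f mc := fun f => f.continuous.integrable_of_hasCompactSupport (HasCompactSupport.of_compactSpace _)
    rw [dist_eq_norm, ← integral_sub (hi f) (hi g)]
    refine (norm_integral_le_of_norm_le_const (C := dist f g) (Filter.Eventually.of_forall fun t => ?_)).trans ?_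
    · rw [← dist_eq_norm]; exact ContinuousMap.dist_apply_le_dist t
    · simp
  exact h1.comp C.continuous

attribute [local instance] Matrix.linftyOpNormedRing Matrix.linftyOpNormedAlgebra

theorem pencil_idem {A B : X → Matrix κ κ ℂ} (hA : Continuous A) (hB : Continuous B) (hAB : ∀ x, A x + B x = 1)
    (hu : ∀ x t, IsUnit (A x + uc t • B x)) : ∃ p : X → Matrix κ κ ℂ, Continuous p ∧ (∀ x, p x * p x = p x) ∧
      Hm (GLs κ) (fun y : X × Tc => A y.1 + uc y.2 • B y.1) (fun y : X × Tc => 1 - p y.1 + uc y.2 • p y.1) := by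
  let R : X → Tc → Matrix κ κ ℂ := fun x t => (A x + uc t • B x)⁻¹
  have hMc : Continuous fun q : X × Tc => A q.1 + uc q.2 • B q.1 :=
    (hA.comp continuous_fst).add ((uc_cont.comp continuous_snd).smul (hB.comp continuous_fst))
  have hR : Continuous fun q : X × Tc => R q.1 q.2 := cont_inv hMc fun q => hu q.1 q.2
  have hP : ∀ x, Pen (A x) (B x) (R x) := by
    intro x
    refine ⟨?_, hR.comp (Continuous.prodMk_right x), fun t => ?_, fun t => ?_⟩
    · have : A x = 1 - B x := by rw [← hAB x]; abel
      rw [this, sub_mul, mul_sub]; simp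
    · exact Matrix.nonsing_inv_mul _ ((Matrix.isUnit_iff_isUnit_det _).1 (hu x t))
    · exact Matrix.mul_nonsing_inv _ ((Matrix.isUnit_iff_isUnit_det _).1 (hu x t))
  let p : X → Matrix κ κ ℂ := fun x => idm (B x) (R x)
  have hp : Continuous p := by
    have : Continuous fun q : X × Tc => uc q.2 • (B q.1 * R q.1 q.2) :=
      (uc_cont.comp continuous_snd).smul ((hB.comp continuous_fst).mul hR)
    exact int_cont (F := fun x t => uc t • (B x * R x t)) this
  have hi : ∀ x, p x * p x = p x := fun x => (hP x).idem
  refine ⟨p, hp, hi, ?_⟩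
  have hpath : Hm (GLs κ) (fun y : X × Tc => A y.1 + uc y.2 • B y.1) (fun y : X × Tc => (1 - p y.1) * A y.1 + uc y.2 • (p y.1 * B y.1)) := by
    refine ⟨fun s y => p y.1 * (((1 - (s : ℝ) : ℝ) : ℂ) • A y.1 + uc y.2 • B y.1) + (1 - p y.1) * (A y.1 + ((1 - (s : ℝ) : ℝ) : ℂ) • uc y.2 • B y.1), ?_, fun s y => ?_, ?_, ?_⟩
    · have h1 : Continuous fun z : I × (X × Tc) => A z.2.1 := hA.comp (by fun_prop)
      have h2 : Continuous fun z : I × (X × Tc) => B z.2.1 := hB.comp (by fun_prop)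
      have h3 : Continuous fun z : I × (X × Tc) => p z.2.1 := hp.comp (by fun_prop)
      have h4 : Continuous fun z : I × (X × Tc) => uc z.2.2 := uc_cont.comp (by fun_prop)
      fun_prop
    · obtain ⟨Z, hZ⟩ := (hP y.1).path (r := 1 - (s : ℝ)) (by linarith [s.2.2]) (by linarith [s.2.1]) y.2
      exact IsUnit.of_mul_eq_one Z hZ
    · intro y; simp; rw [← add_mul]; simp
    · intro y; simp; rw [add_comm]
  refine hpath.norm.congr (fun y => ?_) (fun y => ?_)
  · simp [uc_zero, hAB]
  · have hu0 := hpath.mem_right (y.1, 0)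
    simp only [uc_zero, one_smul, Set.mem_ofPred_eq] at hu0 ⊢
    have hi' := hi y.1
    generalize p y.1 = P at *
    have e : (1 - P) * A y.1 + uc y.2 • (P * B y.1) = (1 - P + uc y.2 • P) * ((1 - P) * A y.1 + P * B y.1) := by
      have a1 : (1 - P) * (1 - P) = 1 - P := by rw [mul_sub, sub_mul, sub_mul, hi']; simp
      have a2 : (1 - P) * P = 0 := by rw [sub_mul, hi']; simp
      have a3 : P * (1 - P) = 0 := by rw [mul_sub, hi']; simp
      rw [add_mul, mul_add, mul_add, ← mul_assoc, ← mul_assoc, a1, a2, smul_mul_assoc, smul_mul_assoc, ← mul_assoc, ← mul_assoc, a3, hi']; simp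
    rw [e, mul_assoc, Matrix.mul_nonsing_inv _ ((Matrix.isUnit_iff_isUnit_det _).1 hu0), mul_one]

theorem bottA {L : X × Tc → Matrix κ κ ℂ} (hL : Continuous L) (hu : ∀ y, IsUnit (L y)) (h1 : ∀ x, L (x, 0) = 1) :
    ∃ (K : Type) (_ : Fintype K) (_ : DecidableEq K) (i : κ ↪ K) (p : X → Matrix K K ℂ) (d : ℕ), Continuous p ∧ (∀ x, p x * p x = p x) ∧
      Hm (GLs K) (fun y => xt i (uc y.2 ^ d • L y)) (fun y => 1 - p y.1 + uc y.2 • p y.1) := by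
  obtain ⟨d, N, F, hF, hLF⟩ := laurent_approx hL hu
  obtain ⟨K, _, _, i, A, B, hA, hB, h⟩ := linz N (hF.mono (by omega)) hLF.mem_right
  have hh := ((hLF.xt i).trans h).norm
  have hAB : Continuous fun x => (A x + B x)⁻¹ := by
    refine cont_inv (by fun_prop) fun x => ?_
    have := h.mem_right (x, 0)
    simpa [uc_zero] using this
  have hABu : ∀ x, IsUnit (A x + B x) := by
    intro x
    have := h.mem_right (x, 0)
    simpa [uc_zero] using this
  have e2 : ∀ y : X × Tc, (A y.1 + uc y.2 • B y.1) * (A y.1 + uc (0 : Tc) • B y.1)⁻¹ = A y.1 * (A y.1 + B y.1)⁻¹ + uc y.2 • (B y.1 * (A y.1 + B y.1)⁻¹) := by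
    intro y; rw [uc_zero, one_smul, add_mul, smul_mul_assoc]
  obtain ⟨p, hp, hi, hpp⟩ := pencil_idem (A := fun x => A x * (A x + B x)⁻¹) (B := fun x => B x * (A x + B x)⁻¹) (by fun_prop) (by fun_prop)
    (fun x => by rw [← add_mul]; exact Matrix.mul_nonsing_inv _ ((Matrix.isUnit_iff_isUnit_det _).1 (hABu x)))
    (fun x t => by have := hh.mem_right (x, t); rw [e2] at this; exact this)
  refine ⟨K, inferInstance, inferInstance, i, p, d, hp, hi, ?_⟩
  refine (hh.congr (fun y => ?_) (fun y => e2 y)).trans hpp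
  simp [uc_zero, h1, xt_one]

end lz
end CB

namespace CB
open MeasureTheory Matrix
open scoped ContDiff Topology

section hat

/-- the direction of a complex number, as a circle point -/
noncomputable def dirc (z : ℂ) : Circle :=
  (⟨if z ≠ 0 then (‖z‖⁻¹ : ℂ) * z else 1, by
    change _ ∈ Metric.sphere (0 : ℂ) 1
    rw [mem_sphere_zero_iff_norm]
    split_ifs with h
    · rw [norm_mul, norm_inv, Complex.norm_real, norm_norm, inv_mul_cancel₀ (norm_ne_zero_iff.2 h)]
    · exact norm_one⟩ : Submonoid.unitSphere ℂ)

theorem dirc_coe {z : ℂ} (h : z ≠ 0) : (dirc z : ℂ) = (‖z‖⁻¹ : ℂ) * z := by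
  change (if z ≠ 0 then (‖z‖⁻¹ : ℂ) * z else 1) = _
  rw [if_pos h]

theorem dirc_cont : ContinuousOn dirc {0}ᶜ := by
  rw [continuousOn_iff_continuous_restrict]
  refine continuous_induced_rng.2 ?_
  have h2 : Continuous fun z : ({0}ᶜ : Set ℂ) => (‖(z : ℂ)‖⁻¹ : ℂ) * z := by
    refine Continuous.mul (Continuous.inv₀ (by fun_prop) fun z => ?_) (by fun_prop)
    have h : (z : ℂ) ≠ 0 := z.2
    simpa using h
  exact h2.congr fun z => (dirc_coe z.2).symm

/-- the argument of a complex number in the additive circle -/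
noncomputable def ac (z : ℂ) : Tc := (AddCircle.homeomorphCircle one_ne_zero).symm (dirc z)

theorem uc_ac {z : ℂ} (h : z ≠ 0) : uc (ac z) = (‖z‖⁻¹ : ℂ) * z := by
  rw [← dirc_coe h, ac, uc, ← AddCircle.homeomorphCircle_apply one_ne_zero, Homeomorph.apply_symm_apply]

theorem ac_cont : ContinuousOn ac {0}ᶜ := (Homeomorph.continuous _).comp_continuousOn dirc_cont

variable {E : Type} [NormedAddCommGroup E] [NormedSpace ℝ E] [FiniteDimensional ℝ E]

/-- slope coordinate on the one-point compactification -/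
noncomputable def Wp (v : E × ℂ) : OnePoint E := if v.2 = 0 then OnePoint.infty else ((‖v.2‖⁻¹ • v.1 : E) : OnePoint E)

theorem Wp_cont : Continuous fun v : Nz (E × ℂ) => Wp v.1 := by
  rw [continuous_iff_continuousAt]
  rintro ⟨⟨x0, z0⟩, h0⟩
  by_cases hz : z0 = 0
  · subst hz
    have hx : x0 ≠ 0 := by rintro rfl; exact h0 rfl
    have e : Wp ((x0, 0) : E × ℂ) = OnePoint.infty := by simp [Wp]
    rw [ContinuousAt, e, OnePoint.hasBasis_nhds_infty.tendsto_right_iff]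
    rintro s ⟨-, hs⟩
    obtain ⟨R, hR⟩ := hs.isBounded.exists_norm_le
    have h1 : ∀ᶠ v : Nz (E × ℂ) in 𝓝 ⟨(x0, 0), h0⟩, R * ‖v.1.2‖ < ‖v.1.1‖ := by
      have hc1 : Continuous fun v : Nz (E × ℂ) => R * ‖v.1.2‖ := by fun_prop
      have hc2 : Continuous fun v : Nz (E × ℂ) => ‖v.1.1‖ := by fun_prop
      exact hc1.continuousAt.eventually_lt hc2.continuousAt (by simpa using hx)
    filter_upwards [h1] with v hv
    by_cases h2 : v.1.2 = 0
    · right; simp [Wp, h2]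
    · left
      refine ⟨‖v.1.2‖⁻¹ • v.1.1, fun h3 => ?_, by simp [Wp, h2]⟩
      have h4 := hR _ h3
      have hp : 0 < ‖v.1.2‖ := norm_pos_iff.2 h2
      rw [norm_smul, norm_inv, norm_norm, inv_mul_le_iff₀ hp] at h4
      linarith
  · have h1 : ∀ᶠ v : Nz (E × ℂ) in 𝓝 ⟨(x0, z0), h0⟩, v.1.2 ≠ 0 := by
      have hc : Continuous fun v : Nz (E × ℂ) => v.1.2 := by fun_prop
      exact hc.continuousAt.eventually_ne hz
    have h2 : ContinuousAt (fun v : Nz (E × ℂ) => ((‖v.1.2‖⁻¹ • v.1.1 : E) : OnePoint E)) ⟨(x0, z0), h0⟩ := by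
      refine OnePoint.continuous_coe.continuousAt.comp ?_
      refine ContinuousAt.smul (ContinuousAt.inv₀ (by fun_prop) (by simpa using hz)) (by fun_prop)
    refine h2.congr ?_
    filter_upwards [h1] with v hv
    simp [Wp, hv]

variable {κ : Type} [Fintype κ] [DecidableEq κ]

theorem hat_cont {Y : Type*} [TopologicalSpace Y] {M : Y → OnePoint E × Tc → Matrix κ κ ℂ} (hM : Continuous fun q : Y × (OnePoint E × Tc) => M q.1 q.2)
    (h1 : ∀ y t, M y (OnePoint.infty, t) = 1) : Continuous fun q : Y × Nz (E × ℂ) => M q.1 (Wp q.2.1, ac q.2.1.2) := by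
  rw [continuous_iff_continuousAt]
  rintro ⟨y0, v0⟩
  have hW : Continuous fun q : Y × Nz (E × ℂ) => (q.1, Wp q.2.1) := continuous_fst.prodMk (Wp_cont.comp continuous_snd)
  by_cases hz : v0.1.2 = 0
  · have e : Wp v0.1 = OnePoint.infty := by simp [Wp, hz]
    intro U hU
    rw [Filter.mem_map]
    have hU' : U ∈ 𝓝 (1 : Matrix κ κ ℂ) := by
      change U ∈ 𝓝 (M y0 (Wp v0.1, ac v0.1.2)) at hU
      rwa [e, h1] at hU
    have h2 : ∀ᶠ q : Y × OnePoint E in 𝓝 (y0, OnePoint.infty), ∀ t ∈ (Set.univ : Set Tc), M q.1 (q.2, t) ∈ U := by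
      refine isCompact_univ.eventually_forall_of_forall_eventually fun t _ => ?_
      have hc : Continuous fun q : (Y × OnePoint E) × Tc => M q.1.1 (q.1.2, q.2) :=
        hM.comp (by fun_prop : Continuous fun q : (Y × OnePoint E) × Tc => (q.1.1, (q.1.2, q.2)))
      have := hc.continuousAt (x := ((y0, OnePoint.infty), t))
      apply this
      change U ∈ 𝓝 (M y0 (OnePoint.infty, t))
      rw [h1]; exact hU'
    have h3 : Filter.Tendsto (fun q : Y × Nz (E × ℂ) => (q.1, Wp q.2.1)) (𝓝 (y0, v0)) (𝓝 (y0, OnePoint.infty)) := by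
      have := hW.tendsto (y0, v0)
      rwa [e] at this
    filter_upwards [h3.eventually h2] with q hq
    exact hq _ trivial
  · have h2 : ContinuousAt (fun q : Y × Nz (E × ℂ) => ac q.2.1.2) (y0, v0) := by
      have h4 : ContinuousAt ac v0.1.2 := ac_cont.continuousAt (isOpen_compl_singleton.mem_nhds hz)
      exact ContinuousAt.comp (f := fun q : Y × Nz (E × ℂ) => q.2.1.2) (x := (y0, v0)) h4 (by fun_prop)
    exact ContinuousAt.comp (f := fun q : Y × Nz (E × ℂ) => (q.1, (Wp q.2.1, ac q.2.1.2))) hM.continuousAt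
      (continuousAt_fst.prodMk ((Wp_cont.comp continuous_snd).continuousAt.prodMk h2))

/-- clutching map -/
noncomputable def hat (L : OnePoint E × Tc → Matrix κ κ ℂ) (v : Nz (E × ℂ)) : Matrix κ κ ℂ :=
  L (Wp v.1, ac v.1.2) * (L (OnePoint.infty, ac v.1.2))⁻¹

theorem hat_hm {L L' : OnePoint E × Tc → Matrix κ κ ℂ} (h : Hm (GLs κ) L L') : Hm (GLs κ) (hat L) (hat L') := by
  obtain ⟨H, hc, hu, h0, h1⟩ := h
  refine ⟨fun s => hat (H s), ?_, fun s v => (hu _ _).mul ?_, ?_, ?_⟩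
  · have hi : Continuous fun q : I × (OnePoint E × Tc) => (H q.1 (OnePoint.infty, q.2.2))⁻¹ :=
      cont_inv (f := fun q : I × (OnePoint E × Tc) => H q.1 (OnePoint.infty, q.2.2)) (hc.comp (g := fun q : I × (OnePoint E × Tc) => H q.1 q.2) (by fun_prop : Continuous fun q : I × (OnePoint E × Tc) => (q.1, ((OnePoint.infty : OnePoint E), q.2.2)))) fun q => hu _ _
    exact hat_cont (M := fun s q => H s q * (H s (OnePoint.infty, q.2))⁻¹) (hc.mul hi) fun s t =>
      Matrix.mul_nonsing_inv _ ((Matrix.isUnit_iff_isUnit_det _).1 (hu _ _))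
  · exact (Matrix.isUnit_nonsing_inv_iff).2 (hu _ _)
  · intro v; simp only [hat, h0]
  · intro v; simp only [hat, h1]

/-- collapse map -/
noncomputable def cmap (v : Nz (E × ℂ)) : Nz (E × ℂ) := ⟨(v.1.1, (max 0 (‖v.1.2‖ - ‖v.1.1‖)) • v.1.2), by
  rintro h
  have h1 : v.1.1 = 0 := congrArg Prod.fst h
  have h2 := congrArg Prod.snd h
  have h3 : v.1.2 ≠ 0 := fun h3 => v.2 (Prod.ext h1 h3)
  simp [h1, h3] at h2⟩

/-- absolute value of the complex coordinate -/
noncomputable def amap (v : Nz (E × ℂ)) : Nz (E × ℂ) := ⟨(v.1.1, ((‖v.1.2‖ : ℝ) : ℂ)), by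
  rintro h
  have h1 : v.1.1 = 0 := congrArg Prod.fst h
  have h2 := congrArg Prod.snd h
  have h3 : v.1.2 ≠ 0 := fun h3 => v.2 (Prod.ext h1 h3)
  simp [h3] at h2⟩

theorem cmap_cont : Continuous (cmap (E := E)) := by
  refine Continuous.subtype_mk ?_ _
  fun_prop

theorem amap_cont : Continuous (amap (E := E)) := by
  refine Continuous.subtype_mk ?_ _
  fun_prop

theorem cmap_hm {Y : Type*} [TopologicalSpace Y] {S : Set Y} {f : Nz (E × ℂ) → Y} (hf : Continuous f) (hS : ∀ x, f x ∈ S) :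
    Hm S f (fun v => f (cmap v)) := by
  refine (Hm.source hf hS (fun (s : I) (v : Nz (E × ℂ)) => (⟨(v.1.1, ((1 - (s : ℝ)) + s * max 0 (‖v.1.2‖ - ‖v.1.1‖)) • v.1.2), ?_⟩ : Nz (E × ℂ))) ?_).congr (fun v => ?_) (fun v => ?_)
  · rintro h
    have h1 : v.1.1 = 0 := congrArg Prod.fst h
    have h2 := congrArg Prod.snd h
    have h3 : v.1.2 ≠ 0 := fun h3 => v.2 (Prod.ext h1 h3)
    have h4 := norm_pos_iff.2 h3
    have h5 : 0 < (1 - (s : ℝ)) + s * max 0 (‖v.1.2‖ - ‖v.1.1‖) := by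
      rw [h1, norm_zero, sub_zero, max_eq_right h4.le]
      have := s.2.1; have := s.2.2
      rcases this.lt_or_eq with h | h
      · have := mul_nonneg s.2.1 h4.le; linarith
      · rw [h]; simpa using h3
    exact smul_ne_zero h5.ne' h3 h2
  · refine Continuous.subtype_mk ?_ _
    fun_prop
  · congr 1; apply Subtype.ext; simp
  · congr 1; apply Subtype.ext; simp [cmap]

theorem amap_hm {Y : Type*} [TopologicalSpace Y] {S : Set Y} {f : Nz (E × ℂ) → Y} (hf : Continuous f) (hS : ∀ x, f x ∈ S) :
    Hm S (fun v => f (amap v)) (fun _ => f ⟨(0, 1), by simp⟩) := by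
  refine (Hm.source hf hS (fun (s : I) (v : Nz (E × ℂ)) => (⟨((1 - (s : ℝ)) • v.1.1, (((1 - (s : ℝ)) * ‖v.1.2‖ + s : ℝ) : ℂ)), ?_⟩ : Nz (E × ℂ))) ?_).congr (fun v => ?_) (fun v => ?_)
  · rintro h
    have h1 : (1 - (s : ℝ)) • v.1.1 = 0 := congrArg Prod.fst h
    have h2 : (((1 - (s : ℝ)) * ‖v.1.2‖ + s : ℝ) : ℂ) = 0 := congrArg Prod.snd h
    rw [Complex.ofReal_eq_zero] at h2
    have h4 : 0 ≤ (1 - (s : ℝ)) * ‖v.1.2‖ := mul_nonneg (by linarith [s.2.2]) (norm_nonneg _)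
    have h5 : (s : ℝ) = 0 := by linarith [s.2.1]
    rw [h5] at h1 h2
    simp at h1 h2
    exact v.2 (Prod.ext h1 h2)
  · refine Continuous.subtype_mk ?_ _
    fun_prop
  · congr 1; apply Subtype.ext; simp [amap]
  · congr 1; apply Subtype.ext; simp

theorem to_hat {f : Nz (E × ℂ) → Matrix κ κ ℂ} (hf : Continuous f) (hu : ∀ v, IsUnit (f v)) :
    ∃ L : OnePoint E × Tc → Matrix κ κ ℂ, Continuous L ∧ (∀ y, IsUnit (L y)) ∧ (∀ w, L (w, 0) = 1) ∧ (∀ t, L (OnePoint.infty, t) = 1) ∧ Hm (GLs κ) f (hat L) := by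
  let f0 : Nz (E × ℂ) → Matrix κ κ ℂ := fun v => f (cmap v)
  have hf0 : Continuous f0 := hf.comp cmap_cont
  have hu0 : ∀ v, IsUnit (f0 v) := fun v => hu _
  let f1 : Nz (E × ℂ) → Matrix κ κ ℂ := fun v => f0 v * (f0 (amap v))⁻¹
  have hm1 : Hm (GLs κ) f f1 := by
    have h1 := cmap_hm (S := GLs κ) hf hu
    have h2 := (amap_hm (S := GLs κ) hf0 hu0).trans (Hm.const _ (hu0 _))
    exact h1.trans (((Hm.refl hf0 hu0).mul h2.symm.inv).congr (fun v => by simp [f0]) fun v => rfl)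
  have hf1 := hm1.cont_right
  have hu1 : ∀ v, IsUnit (f1 v) := hm1.mem_right
  have hcan : ∀ v, f0 v * (f0 v)⁻¹ = 1 := fun v => Matrix.mul_nonsing_inv _ ((Matrix.isUnit_iff_isUnit_det _).1 (hu0 v))
  have far : ∀ v : Nz (E × ℂ), ‖v.1.2‖ ≤ ‖v.1.1‖ → f1 v = 1 := by
    intro v hv
    have : cmap (amap v) = cmap v := by
      apply Subtype.ext
      have h1 : max 0 (‖v.1.2‖ - ‖v.1.1‖) = 0 := max_eq_left (by linarith)
      simp [cmap, amap, h1]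
    simp only [f1, f0, this]; exact hcan v
  have hbase : ∀ v : Nz (E × ℂ), amap v = v → f1 v = 1 := by
    intro v hv; simp only [f1, hv]; exact hcan v
  let L0 : C(E × Tc, Matrix κ κ ℂ) := ⟨fun y => f1 ⟨(y.1, uc y.2), fun h => uc_ne y.2 (congrArg Prod.snd h)⟩, by
    refine hf1.comp (Continuous.subtype_mk ?_ _)
    exact continuous_fst.prodMk (uc_cont.comp continuous_snd)⟩
  have hL0 : ∀ x t, 1 ≤ ‖x‖ → L0 (x, t) = 1 := fun x t hx => far _ (by simpa [uc_norm] using hx)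
  let L1 : C(OnePoint E, C(Tc, Matrix κ κ ℂ)) := OnePoint.continuousMapMk L0.curry 1 (by
    refine tendsto_nhds_of_eventually_eq ?_
    rw [Filter.coclosedCompact_eq_cocompact]
    have h2 := (tendsto_norm_cocompact_atTop (E := E)).eventually (Filter.eventually_ge_atTop 1)
    filter_upwards [h2] with x hx
    ext1 t
    exact hL0 x t hx)
  let L : OnePoint E × Tc → Matrix κ κ ℂ := fun y => L1 y.1 y.2
  have hLinf : ∀ t, L (OnePoint.infty, t) = 1 := fun t => rfl
  have hLc : ∀ (x : E) t, L ((x : OnePoint E), t) = L0 (x, t) := fun x t => rfl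
  have hcont : Continuous L := ContinuousMap.continuous_uncurry_of_continuous L1
  refine ⟨L, hcont, ?_, ?_, hLinf, ?_⟩
  · rintro ⟨w, t⟩
    induction w using OnePoint.rec with
    | infty => rw [hLinf]; exact isUnit_one
    | coe x => rw [hLc]; exact hu1 _
  · intro w
    induction w using OnePoint.rec with
    | infty => rw [hLinf]
    | coe x => rw [hLc]; exact hbase _ (Subtype.ext (by simp [amap, uc_norm, uc_zero]))
  · refine (hm1.trans (hm_uv (S := GLs κ) hf1 hu1)).congr (fun v => rfl) fun v => ?_
    rw [hat, hLinf, inv_one, mul_one]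
    by_cases hz : v.1.2 = 0
    · have : Wp v.1 = OnePoint.infty := by simp [Wp, hz]
      rw [this, hLinf]
      apply far; simp [uv, hz]
    · have e : Wp v.1 = ((‖v.1.2‖⁻¹ • v.1.1 : E) : OnePoint E) := by simp [Wp, hz]
      have hp := norm_pos_iff.2 hz
      rw [e, hLc]
      rcases le_or_gt ‖v.1.2‖ ‖v.1.1‖ with h | h
      · rw [hL0, far]
        · simp only [uv, Prod.smul_fst, Prod.smul_snd, norm_smul]
          exact mul_le_mul_of_nonneg_left h (norm_nonneg _)
        · rw [norm_smul, norm_inv, norm_norm, ← div_eq_inv_mul, le_div_iff₀ hp, one_mul]; exact h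
      · have hn : ‖v.1‖ = ‖v.1.2‖ := by rw [Prod.norm_def]; exact max_eq_right h.le
        change f1 _ = f1 _
        congr 1
        apply Subtype.ext
        simp only [uv, hn]
        refine Prod.ext rfl ?_
        change ‖v.1.2‖⁻¹ • v.1.2 = uc (ac v.1.2)
        rw [uc_ac hz]; simp

theorem to_idem {f : Nz (E × ℂ) → Matrix κ κ ℂ} (hf : Continuous f) (hu : ∀ v, IsUnit (f v)) :
    ∃ (K : Type) (_ : Fintype K) (_ : DecidableEq K) (i : κ ↪ K) (p : OnePoint E → Matrix K K ℂ), Continuous p ∧ (∀ x, p x * p x = p x) ∧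
      Hm (GLs K) (fun v => xt i (f v)) (hat (fun y : OnePoint E × Tc => 1 - p y.1 + uc y.2 • p y.1)) := by
  obtain ⟨L, hL, hLu, h0, hinf, hm⟩ := to_hat hf hu
  obtain ⟨K, _, _, i, p, d, hp, hi, h⟩ := bottA hL hLu h0
  refine ⟨K, inferInstance, inferInstance, i, p, hp, hi, ?_⟩
  refine (hm.xt i).trans ((hat_hm h).congr (fun v => ?_) fun v => rfl)
  simp only [hat, hinf, inv_one, mul_one]
  have hsu : IsUnit (uc (ac v.1.2) ^ d • (1 : Matrix κ κ ℂ)) :=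
    IsUnit.of_mul_eq_one ((uc (ac v.1.2) ^ d)⁻¹ • 1) (by rw [smul_mul_smul_comm, mul_inv_cancel₀ (pow_ne_zero _ (uc_ne _)), one_smul, one_mul])
  have e : uc (ac v.1.2) ^ d • L (Wp v.1, ac v.1.2) = L (Wp v.1, ac v.1.2) * (uc (ac v.1.2) ^ d • (1 : Matrix κ κ ℂ)) := by simp
  rw [e, xt_mul, mul_assoc, Matrix.mul_nonsing_inv _ ((Matrix.isUnit_iff_isUnit_det _).1 (xt_isUnit i hsu)), mul_one]

end hat
end CB

namespace CB
open MeasureTheory Matrix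
open scoped ContDiff Topology

section triv
variable {κ : Type} [Fintype κ] [DecidableEq κ]

/-- intertwiner of two idempotents -/
def Wi (P Q : Matrix κ κ ℂ) : Matrix κ κ ℂ := Q * P + (1 - Q) * (1 - P)

theorem Wi_self {P : Matrix κ κ ℂ} (h : P * P = P) : Wi P P = 1 := by
  have h2 : (1 - P) * P = 0 := by rw [sub_mul, one_mul, h, sub_self]
  unfold Wi; rw [mul_sub, h, h2]; simp

theorem Wi_int {P Q : Matrix κ κ ℂ} (hP : P * P = P) (hQ : Q * Q = Q) : Q * Wi P Q = Wi P Q * P := by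
  have a : Q * (1 - Q) = 0 := by rw [mul_sub, mul_one, hQ, sub_self]
  have b : (1 - P) * P = 0 := by rw [sub_mul, one_mul, hP, sub_self]
  unfold Wi
  rw [mul_add, ← mul_assoc, hQ, ← mul_assoc, a, add_mul, mul_assoc Q, hP, mul_assoc (1 - Q), b]; simp

theorem Wi_cont {Y : Type*} [TopologicalSpace Y] {p q : Y → Matrix κ κ ℂ} (hp : Continuous p) (hq : Continuous q) : Continuous fun y => Wi (p y) (q y) := by
  unfold Wi; fun_prop

variable {E : Type} [NormedAddCommGroup E] [NormedSpace ℝ E] [FiniteDimensional ℝ E]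

/-- transport along rays -/
noncomputable def tr (q : E → Matrix κ κ ℂ) (m : ℕ) : ℕ → E → Matrix κ κ ℂ
  | 0, _ => 1
  | j + 1, y => Wi (q (((j : ℝ) / m) • y)) (q ((((j + 1 : ℕ) : ℝ) / m) • y)) * tr q m j y

theorem tr_cont {q : E → Matrix κ κ ℂ} (hq : Continuous q) (m j : ℕ) : Continuous (tr q m j) := by
  induction j with
  | zero => exact continuous_const
  | succ j ih =>
    refine (Wi_cont (hq.comp ?_) (hq.comp ?_)).mul ih <;> fun_prop

theorem tr_int {q : E → Matrix κ κ ℂ} (hq : ∀ y, q y * q y = q y) (m j : ℕ) (y : E) : q (((j : ℝ) / m) • y) * tr q m j y = tr q m j y * q 0 := by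
  induction j with
  | zero => simp [tr]
  | succ j ih =>
    rw [tr, ← mul_assoc, Wi_int (hq _) (hq _), mul_assoc, ih, mul_assoc]

theorem triv {q : E → Matrix κ κ ℂ} (hc : Continuous q) (hq : ∀ y, q y * q y = q y) :
    ∃ U : E → Matrix κ κ ℂ, Continuous U ∧ (∀ y, ‖y‖ ≤ 1 → IsUnit (U y)) ∧ ∀ y, q y * U y = U y * q 0 := by
  let B := Metric.closedBall (0 : E) 1
  let F : I × I × B → ℂ := fun a => (Wi (q ((a.1 : ℝ) • (a.2.2 : E))) (q ((a.2.1 : ℝ) • (a.2.2 : E)))).det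
  have hF : Continuous F := by
    refine Continuous.matrix_det (Wi_cont (hc.comp ?_) (hc.comp ?_)) <;> fun_prop
  have hB : CompactSpace B := isCompact_iff_compactSpace.1 (isCompact_closedBall _ _)
  have hU := CompactSpace.uniformContinuous_of_continuous hF
  rw [Metric.uniformContinuous_iff] at hU
  obtain ⟨δ, hδ, h⟩ := hU 1 one_pos
  obtain ⟨m, hm⟩ := exists_nat_one_div_lt hδ
  let M := m + 1
  have hM : (0 : ℝ) < (M : ℕ) := by positivity
  have hM1 : 1 / (M : ℝ) < δ := by simpa [M] using hm
  have key : ∀ j, j ≤ M → ∀ y, ‖y‖ ≤ 1 → IsUnit (tr q M j y) := by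
    intro j
    induction j with
    | zero => intro _ y _; exact isUnit_one
    | succ j ih =>
      intro hj y hy
      refine IsUnit.mul ?_ (ih (by omega) y hy)
      rw [Matrix.isUnit_iff_isUnit_det, isUnit_iff_ne_zero]
      have a1 : (j : ℝ) / M ∈ Set.Icc (0 : ℝ) 1 := ⟨by positivity, by rw [div_le_one hM]; exact_mod_cast (by omega)⟩
      have a2 : ((j + 1 : ℕ) : ℝ) / M ∈ Set.Icc (0 : ℝ) 1 := ⟨by positivity, by rw [div_le_one hM]; exact_mod_cast hj⟩
      have hy' : y ∈ B := by simpa [B] using hy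
      have h1 := @h (⟨_, a1⟩, ⟨_, a2⟩, ⟨y, hy'⟩) (⟨_, a1⟩, ⟨_, a1⟩, ⟨y, hy'⟩) (by
        rw [Prod.dist_eq, Prod.dist_eq, dist_self, dist_self, Subtype.dist_eq]
        simp only [Real.dist_eq]
        have : ((j + 1 : ℕ) : ℝ) / M - (j : ℝ) / M = 1 / M := by push_cast; ring
        rw [this, abs_of_pos (by positivity)]
        simp [hδ]; simpa using hM1)
      intro h0
      have e1 : F (⟨_, a1⟩, ⟨_, a2⟩, ⟨y, hy'⟩) = 0 := h0
      have e2 : F (⟨_, a1⟩, ⟨_, a1⟩, ⟨y, hy'⟩) = 1 := by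
        change (Wi _ _).det = 1
        rw [Wi_self (hq _), det_one]
      rw [e1, e2] at h1
      simp at h1
  refine ⟨tr q M M, tr_cont hc _ _, key M le_rfl, fun y => ?_⟩
  have := tr_int hq M M y
  rwa [div_self hM.ne', one_smul] at this

/-- trivialization based at the boundary value -/
theorem triv2 [Nontrivial E] {q : E → Matrix κ κ ℂ} (hc : Continuous q) (hq : ∀ y, q y * q y = q y) {P : Matrix κ κ ℂ} (hP : ∀ y, ‖y‖ = 1 → q y = P) :
    ∃ V : E → Matrix κ κ ℂ, Continuous V ∧ (∀ y, ‖y‖ ≤ 1 → IsUnit (V y)) ∧ (∀ y, q y * V y = V y * P) := by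
  obtain ⟨U, hU, hu, h⟩ := triv hc hq
  obtain ⟨x0, hx0⟩ := exists_norm_eq E (zero_le_one (α := ℝ))
  have hx := (Matrix.isUnit_iff_isUnit_det _).1 (hu x0 hx0.le)
  refine ⟨fun y => U y * (U x0)⁻¹, hU.mul continuous_const, fun y hy => (hu y hy).mul (Matrix.isUnit_nonsing_inv_iff.2 (hu x0 hx0.le)), fun y => ?_⟩
  have h1 : q 0 * (U x0)⁻¹ = (U x0)⁻¹ * P := by
    have h2 := h x0
    rw [hP x0 hx0] at h2
    calc q 0 * (U x0)⁻¹ = (U x0)⁻¹ * (U x0 * q 0) * (U x0)⁻¹ := by rw [← mul_assoc, Matrix.nonsing_inv_mul _ hx, one_mul]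
      _ = _ := by rw [← h2, mul_assoc, mul_assoc, Matrix.mul_nonsing_inv _ hx, mul_one]
  rw [← mul_assoc, h, mul_assoc, h1, mul_assoc]

end triv
end CB

namespace CB
open MeasureTheory Matrix
open scoped ContDiff Topology

section rb
variable {κ : Type} [Fintype κ] [DecidableEq κ]

/-- rotation block -/
noncomputable def Rb (P : Matrix κ κ ℂ) (ζ : ℂ) (r : ℝ) : Matrix (κ ⊕ κ) (κ ⊕ κ) ℂ :=
  fromBlocks (1 - P + ζ • P) ((r : ℂ) • P) (-((r : ℂ) • P)) (1 - P + (starRingEnd ℂ ζ) • P)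

theorem lc_unit {P : Matrix κ κ ℂ} (hP : P * P = P) {c : ℂ} (hc : c ≠ 0) : (1 - P + c • P) * (1 - P + c⁻¹ • P) = 1 := by
  have : (1 - P + c • P) * (1 - P + c⁻¹ • P) = 1 - P + (c * c⁻¹) • P := by
    simp only [mul_add, add_mul, sub_mul, mul_sub, smul_mul_assoc, mul_smul_comm, hP, one_mul, mul_one, smul_smul, smul_sub]
    module
  rw [this, mul_inv_cancel₀ hc]; simp

theorem nz_aux {ζ : ℂ} {r : ℝ} (h : ζ ≠ 0 ∨ r ≠ 0) : ζ * starRingEnd ℂ ζ + (r : ℂ) * r ≠ 0 := by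
  rw [Complex.mul_conj, ← Complex.ofReal_mul, ← Complex.ofReal_add, Complex.ofReal_ne_zero]
  rcases h with h | h
  · have := Complex.normSq_pos.2 h; nlinarith [mul_self_nonneg r]
  · have := Complex.normSq_nonneg ζ; have := mul_self_pos.2 h; linarith

theorem Rb_unit {P : Matrix κ κ ℂ} (hP : P * P = P) {ζ : ℂ} {r : ℝ} (h : ζ ≠ 0 ∨ r ≠ 0) : IsUnit (Rb P ζ r) := by
  have h2 : Rb P ζ r * Rb P (starRingEnd ℂ ζ) (-r) = fromBlocks (1 - P + (ζ * starRingEnd ℂ ζ + (r : ℂ) * r) • P) 0 0 (1 - P + (ζ * starRingEnd ℂ ζ + (r : ℂ) * r) • P) := by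
    unfold Rb
    rw [fromBlocks_multiply]
    congr 1 <;>
    · simp only [mul_add, add_mul, sub_mul, mul_sub, smul_mul_assoc, mul_smul_comm, hP, one_mul, mul_one, smul_smul, smul_sub, neg_mul, mul_neg, Complex.ofReal_neg, Complex.conj_conj, neg_smul, smul_neg, neg_neg]
      module
  have h3 := lc_unit hP (nz_aux h)
  refine IsUnit.of_mul_eq_one (Rb P (starRingEnd ℂ ζ) (-r) * fromBlocks (1 - P + (ζ * starRingEnd ℂ ζ + (r : ℂ) * r)⁻¹ • P) 0 0 (1 - P + (ζ * starRingEnd ℂ ζ + (r : ℂ) * r)⁻¹ • P)) ?_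
  rw [← mul_assoc, h2, fromBlocks_multiply, h3]; simp

theorem Rb_cont {Y : Type*} [TopologicalSpace Y] (P : Matrix κ κ ℂ) {ζ : Y → ℂ} {r : Y → ℝ} (hζ : Continuous ζ) (hr : Continuous r) :
    Continuous fun y => Rb P (ζ y) (r y) := by
  unfold Rb
  refine Continuous.matrix_fromBlocks ?_ ?_ ?_ ?_ <;> fun_prop

variable {E : Type} [NormedAddCommGroup E] [NormedSpace ℝ E]

/-- normalized complex coordinate -/
noncomputable def zt (v : Nz (E × ℂ)) : ℂ := ‖v.1‖⁻¹ • v.1.2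
/-- normalized real coordinate -/
noncomputable def rr (v : Nz (E × ℂ)) : ℝ := ‖v.1‖⁻¹ * max 0 (‖v.1.1‖ - ‖v.1.2‖)
/-- normalized vector coordinate -/
noncomputable def xi (v : Nz (E × ℂ)) : E := ‖v.1‖⁻¹ • v.1.1

theorem ninv_cont : Continuous fun v : Nz (E × ℂ) => ‖v.1‖⁻¹ :=
  Continuous.inv₀ (by fun_prop) fun v => norm_ne_zero_iff.2 v.2
theorem zt_cont : Continuous (zt (E := E)) := ninv_cont.smul (by fun_prop)
theorem rr_cont : Continuous (rr (E := E)) := ninv_cont.mul (by fun_prop)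
theorem xi_cont : Continuous (xi (E := E)) := ninv_cont.smul (by fun_prop)
theorem npos (v : Nz (E × ℂ)) : 0 < ‖v.1‖ := norm_pos_iff.2 v.2
theorem rr_nonneg (v : Nz (E × ℂ)) : 0 ≤ rr v := mul_nonneg (inv_nonneg.2 (norm_nonneg _)) (le_max_left _ _)

theorem zr_ne (v : Nz (E × ℂ)) : zt v ≠ 0 ∨ rr v ≠ 0 := by
  by_cases hz : v.1.2 = 0
  · right
    have hx : v.1.1 ≠ 0 := fun h => v.2 (Prod.ext h hz)
    have h2 : 0 < ‖v.1.1‖ := norm_pos_iff.2 hx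
    unfold rr
    rw [hz, norm_zero, sub_zero, max_eq_right h2.le]
    exact mul_ne_zero (inv_ne_zero (npos v).ne') h2.ne'
  · left; exact smul_ne_zero (inv_ne_zero (npos v).ne') hz

theorem Rb_hm {P : Matrix κ κ ℂ} (hP : P * P = P) : Hm (GLs (κ ⊕ κ)) (fun v : Nz (E × ℂ) => Rb P (zt v) (rr v)) (fun _ => 1) := by
  have h1 : Hm (GLs (κ ⊕ κ)) (fun v : Nz (E × ℂ) => Rb P (zt v) (rr v)) (fun _ => Rb P 0 1) := by
    refine ⟨fun s v => Rb P (((1 - s : ℝ) : ℂ) * zt v) ((1 - s) * rr v + s), ?_, fun s v => Rb_unit hP ?_, fun v => by simp, fun v => by simp⟩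
    · refine Rb_cont P ?_ ?_
      · exact Continuous.mul (by fun_prop) (zt_cont.comp continuous_snd)
      · exact Continuous.add (Continuous.mul (by fun_prop) (rr_cont.comp continuous_snd)) (by fun_prop)
    · by_contra! h
      obtain ⟨h2, h3⟩ := h
      have h4 : 0 ≤ (1 - (s : ℝ)) * rr v := mul_nonneg (by linarith [s.2.2]) (rr_nonneg v)
      have h5 : (s : ℝ) = 0 := by linarith [s.2.1]
      rw [h5] at h2 h3
      rcases zr_ne v with h | h
      · apply h; simpa using h2
      · apply h; simpa using h3
  exact h1.trans (Hm.const _ (Rb_unit hP (Or.inr one_ne_zero)))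

/-- radial extension -/
noncomputable def rg (g : Nz E → Matrix κ κ ℂ) (v : Nz (E × ℂ)) : Matrix κ κ ℂ :=
  open Classical in if h : v.1.1 = 0 then 0 else (rr v : ℂ) • g ⟨v.1.1, h⟩

/-- clutching product with the circle class -/
noncomputable def Tg (g : Nz E → Matrix κ κ ℂ) (v : Nz (E × ℂ)) : Matrix (κ ⊕ κ) (κ ⊕ κ) ℂ :=
  fromBlocks (zt v • 1) (rg g v) (-(rg (fun x => (g x)⁻¹) v)) ((starRingEnd ℂ (zt v)) • 1)

theorem rr_zero {v : Nz (E × ℂ)} (h : ‖v.1.1‖ ≤ ‖v.1.2‖) : rr v = 0 := by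
  unfold rr; rw [max_eq_left (by linarith), mul_zero]

theorem rg_zero (g : Nz E → Matrix κ κ ℂ) {v : Nz (E × ℂ)} (h : ‖v.1.1‖ ≤ ‖v.1.2‖) : rg g v = 0 := by
  unfold rg; split_ifs
  · rfl
  · rw [rr_zero h]; simp

theorem rg_of (g : Nz E → Matrix κ κ ℂ) {v : Nz (E × ℂ)} (h : v.1.1 ≠ 0) : rg g v = (rr v : ℂ) • g ⟨v.1.1, h⟩ := by
  unfold rg; rw [dif_neg h]

end rb

section m4
variable {E : Type} [NormedAddCommGroup E] [NormedSpace ℝ E] [FiniteDimensional ℝ E] [Nontrivial E]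
variable {κ : Type} [Fintype κ] [DecidableEq κ]

/-- profile of the collapse map -/
noncomputable def bp (y : E) : OnePoint E := Wp (y, ((max 0 (1 - ‖y‖) : ℝ) : ℂ))

theorem bp_cont : Continuous (bp (E := E)) := by
  have h : ∀ y : E, ((y, ((max 0 (1 - ‖y‖) : ℝ) : ℂ)) : E × ℂ) ≠ 0 := by
    intro y h
    have h1 : y = 0 := congrArg Prod.fst h
    have h2 : ((max 0 (1 - ‖y‖) : ℝ) : ℂ) = 0 := congrArg Prod.snd h
    rw [h1] at h2; simp at h2
  exact Wp_cont.comp (f := fun y : E => (⟨_, h y⟩ : Nz (E × ℂ))) (Continuous.subtype_mk (by fun_prop) _)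

theorem bp_far {y : E} (h : 1 ≤ ‖y‖) : bp y = OnePoint.infty := by
  unfold bp Wp; rw [if_pos]; simp; linarith

theorem Wp_c1 {v : Nz (E × ℂ)} (h : ‖v.1.2‖ ≤ ‖v.1.1‖) : Wp (cmap v).1 = OnePoint.infty := by
  unfold cmap Wp; rw [if_pos]; simp; left; exact h

theorem Wp_c2 {v : Nz (E × ℂ)} (h : ‖v.1.2‖ = 1) : Wp (cmap v).1 = bp v.1.1 := by
  have hz : v.1.2 ≠ 0 := by rw [← norm_ne_zero_iff, h]; exact one_ne_zero
  simp only [bp, cmap, Wp, h, smul_eq_zero, hz, or_false, Complex.ofReal_eq_zero, norm_smul, mul_one, Complex.norm_real]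

theorem alg_A {P V W : Matrix κ κ ℂ} (hP : P * P = P) (h1 : V * W = 1) (h3 : P * V = V * P) (h4 : P * W = W * P) (ζ : ℂ) (r : ℝ) :
    fromBlocks V 0 0 1 * Rb P ζ r * fromBlocks W 0 0 1 * Rb (1 - P) ζ r =
      fromBlocks (ζ • 1) ((r : ℂ) • (1 - P + P * V * P)) (-((r : ℂ) • (1 - P + P * W * P))) ((starRingEnd ℂ ζ) • 1) := by
  have h3' : ∀ X, P * (V * X) = V * (P * X) := fun X => by rw [← mul_assoc, h3, mul_assoc]
  have h4' : ∀ X, P * (W * X) = W * (P * X) := fun X => by rw [← mul_assoc, h4, mul_assoc]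
  have h1' : ∀ X, V * (W * X) = X := fun X => by rw [← mul_assoc, h1, one_mul]
  have hP' : ∀ X, P * (P * X) = P * X := fun X => by rw [← mul_assoc, hP]
  unfold Rb
  simp only [fromBlocks_multiply]
  congr 1 <;>
  · simp only [mul_zero, zero_mul, add_zero, zero_add, mul_add, add_mul, sub_mul, mul_sub, smul_mul_assoc, mul_smul_comm, hP, hP', h3, h3', h4, h4', h1, h1', one_mul, mul_one, smul_smul, smul_sub, smul_add, neg_mul, mul_neg, smul_neg, neg_neg, mul_assoc]
    module

theorem alg_B {P V W Q h : Matrix κ κ ℂ} (hP : P * P = P) (h1 : V * W = 1) (h2 : Q * V = V * P) {ζ : ℂ} (hζ : ζ ≠ 0)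
    (hh : h = (1 - Q + ζ • Q) * (1 - P + ζ • P)⁻¹) :
    fromBlocks V 0 0 1 * Rb P ζ 0 * fromBlocks W 0 0 1 * Rb (1 - P) ζ 0 =
      fromBlocks h 0 0 1 * fromBlocks (ζ • 1) 0 0 ((starRingEnd ℂ ζ) • 1) := by
  have e0 : (1 - P + ζ • P)⁻¹ = 1 - P + ζ⁻¹ • P := Matrix.inv_eq_right_inv (lc_unit hP hζ)
  have e1 : V * (1 - P + ζ • P) * W = 1 - Q + ζ • Q := by
    have : V * (1 - P + ζ • P) = (1 - Q + ζ • Q) * V := by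
      simp only [mul_add, add_mul, sub_mul, mul_sub, smul_mul_assoc, mul_smul_comm, h2, one_mul, mul_one]
    rw [this, mul_assoc, h1, mul_one]
  have e2 : (1 - P + ζ⁻¹ • P) * (ζ • 1) = 1 - (1 - P) + ζ • (1 - P) := by
    simp only [mul_smul_comm, mul_one, smul_add, smul_smul, mul_inv_cancel₀ hζ, one_smul]
    module
  unfold Rb
  simp only [fromBlocks_multiply, Complex.ofReal_zero, zero_smul, mul_zero, zero_mul, add_zero, zero_add, one_mul, mul_one, neg_zero]
  congr 1
  · rw [e1, hh, e0, mul_assoc (1 - Q + ζ • Q), e2]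
  · simp only [mul_add, add_mul, sub_mul, mul_sub, smul_mul_assoc, mul_smul_comm, hP, one_mul, mul_one, smul_smul, smul_sub, smul_add]
    module

theorem M4a (p : OnePoint E → Matrix κ κ ℂ) (hp : Continuous p) (hi : ∀ x, p x * p x = p x)
    {h : Nz (E × ℂ) → Matrix κ κ ℂ} (hh : Continuous h) (hu : ∀ v, IsUnit (h v))
    (e : ∀ v, h v = hat (fun y : OnePoint E × Tc => 1 - p y.1 + uc y.2 • p y.1) v) :
    ∃ g : Nz E → Matrix κ κ ℂ, Continuous g ∧ (∀ x, IsUnit (g x)) ∧ Hm (GLs (κ ⊕ κ)) (fun v => (xt (Function.Embedding.inl : κ ↪ κ ⊕ κ) (h v))⁻¹) (Tg g) := by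
  set P := p OnePoint.infty with hPdef
  have hP : P * P = P := hi _
  obtain ⟨V, hV, hVu, hVq⟩ := triv2 (q := fun y => p (bp y)) (P := P) (hp.comp bp_cont) (fun y => hi _) (fun y hy => by rw [bp_far hy.ge])
  have hVV : ∀ y, ‖y‖ ≤ 1 → V y * (V y)⁻¹ = 1 := fun y hy => Matrix.mul_nonsing_inv _ ((Matrix.isUnit_iff_isUnit_det _).1 (hVu y hy))
  have hWV : ∀ y, ‖y‖ ≤ 1 → (V y)⁻¹ * V y = 1 := fun y hy => Matrix.nonsing_inv_mul _ ((Matrix.isUnit_iff_isUnit_det _).1 (hVu y hy))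
  have hPV : ∀ y, ‖y‖ = 1 → P * V y = V y * P := fun y hy => by
    have := hVq y
    rwa [bp_far hy.ge] at this
  have hPW : ∀ y, ‖y‖ = 1 → P * (V y)⁻¹ = (V y)⁻¹ * P := fun y hy => by
    calc P * (V y)⁻¹ = (V y)⁻¹ * (V y * P) * (V y)⁻¹ := by rw [← mul_assoc, hWV y hy.le, one_mul]
      _ = _ := by rw [← hPV y hy, mul_assoc, mul_assoc, hVV y hy.le, mul_one]
  have hn1 : ∀ x : Nz E, ‖(‖x.1‖⁻¹ • x.1 : E)‖ = 1 := fun x => by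
    rw [norm_smul, norm_inv, norm_norm, inv_mul_cancel₀ (norm_ne_zero_iff.2 x.2)]
  have hxi : ∀ v : Nz (E × ℂ), ‖xi v‖ ≤ 1 := fun v => by
    rw [xi, norm_smul, norm_inv, norm_norm, inv_mul_le_iff₀ (npos v), mul_one]
    exact norm_fst_le v.1
  let g : Nz E → Matrix κ κ ℂ := fun x => 1 - P + P * V (‖x.1‖⁻¹ • x.1) * P
  have hgm : ∀ x : Nz E, g x * (1 - P + P * (V (‖x.1‖⁻¹ • x.1))⁻¹ * P) = 1 := by
    intro x
    have a1 := hVV _ (hn1 x).le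
    have a2 := hPW _ (hn1 x)
    have a3 := hPV _ (hn1 x)
    simp only [g]
    generalize V (‖x.1‖⁻¹ • x.1) = A at *
    have h3' : ∀ X, P * (A * X) = A * (P * X) := fun X => by rw [← mul_assoc, a3, mul_assoc]
    have h4' : ∀ X, P * (A⁻¹ * X) = A⁻¹ * (P * X) := fun X => by rw [← mul_assoc, a2, mul_assoc]
    have h1' : ∀ X, A * (A⁻¹ * X) = X := fun X => by rw [← mul_assoc, a1, one_mul]
    have hP' : ∀ X, P * (P * X) = P * X := fun X => by rw [← mul_assoc, hP]
    simp only [mul_add, add_mul, sub_mul, mul_sub, hP, hP', a3, h3', a2, h4', a1, h1', one_mul, mul_one, mul_assoc]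
    module
  have hginv : ∀ x : Nz E, (g x)⁻¹ = 1 - P + P * (V (‖x.1‖⁻¹ • x.1))⁻¹ * P := fun x => Matrix.inv_eq_right_inv (hgm x)
  have hgc : Continuous g := by
    have h1 : Continuous fun x : Nz E => V (‖x.1‖⁻¹ • x.1) :=
      hV.comp (Continuous.smul (Continuous.inv₀ (by fun_prop) fun x => norm_ne_zero_iff.2 x.2) (by fun_prop))
    exact continuous_const.add ((continuous_const.mul h1).mul continuous_const)
  refine ⟨g, hgc, fun x => IsUnit.of_mul_eq_one _ (hgm x), ?_⟩
  let h3 : Nz (E × ℂ) → Matrix κ κ ℂ := fun v => h (cmap (uv v.1 v.2))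
  have hm3 : Hm (GLs κ) h h3 := (cmap_hm (S := GLs κ) hh hu).trans (hm_uv (S := GLs κ) (f := fun v => h (cmap v)) (hh.comp cmap_cont) fun v => hu _)
  let A0 : Nz (E × ℂ) → Matrix (κ ⊕ κ) (κ ⊕ κ) ℂ := fun v => xt Function.Embedding.inl (V (xi v))
  have hVm : Hm (GLs κ) (fun v : Nz (E × ℂ) => V (xi v)) (fun _ => 1) := by
    refine Hm.trans ?_ (Hm.const (V 0) (hVu 0 (by simp)))
    refine ⟨fun s v => V ((1 - (s : ℝ)) • xi v), ?_, fun s v => hVu _ ?_, fun v => by simp, fun v => by simp⟩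
    · exact hV.comp (Continuous.smul (by fun_prop) (xi_cont.comp continuous_snd))
    · rw [norm_smul, Real.norm_of_nonneg (by linarith [s.2.2])]
      have := s.2.1
      exact mul_le_one₀ (by linarith) (norm_nonneg _) (hxi v)
  have hA : Hm (GLs (κ ⊕ κ)) A0 (fun _ => 1) := (hVm.xt Function.Embedding.inl).congr (fun v => rfl) fun v => xt_one _
  have hB := (((hA.mul (Rb_hm hP)).mul hA.inv).mul (Rb_hm (E := E) (P := 1 - P) (by simp [mul_sub, sub_mul, hP]))).symm
  have hC := (hm3.xt (Function.Embedding.inl : κ ↪ κ ⊕ κ)).inv.mul hB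
  refine hC.congr (fun v => by simp) fun v => ?_
  have hu3 : IsUnit (xt (Function.Embedding.inl : κ ↪ κ ⊕ κ) (h3 v)) := xt_isUnit _ (hu _)
  have key : A0 v * Rb P (zt v) (rr v) * (A0 v)⁻¹ * Rb (1 - P) (zt v) (rr v) = xt Function.Embedding.inl (h3 v) * Tg g v := by
    have hA' : (A0 v)⁻¹ = fromBlocks (V (xi v))⁻¹ 0 0 1 := by
      simp only [A0]; rw [← xt_inv _ (hVu _ (hxi v)), xt_inl]
    rw [hA']
    simp only [A0, xt_inl]
    rcases le_or_gt ‖v.1.2‖ ‖v.1.1‖ with hle | hlt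
    · have hn : ‖v.1‖ = ‖v.1.1‖ := by rw [Prod.norm_def]; exact max_eq_left hle
      have hx : v.1.1 ≠ 0 := by rw [← norm_ne_zero_iff, ← hn]; exact (npos v).ne'
      have hx1 : ‖xi v‖ = 1 := by rw [xi, hn]; exact hn1 ⟨v.1.1, hx⟩
      have e3 : h3 v = 1 := by
        simp only [h3, e, hat]
        rw [Wp_c1]
        · exact Matrix.mul_nonsing_inv _ ((Matrix.isUnit_iff_isUnit_det _).1 (IsUnit.of_mul_eq_one _ (lc_unit hP (uc_ne _))))
        · simp only [uv, Prod.smul_fst, Prod.smul_snd, norm_smul]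
          exact mul_le_mul_of_nonneg_left hle (norm_nonneg _)
      rw [e3, alg_A hP (hVV _ hx1.le) (hPV _ hx1) (hPW _ hx1), fromBlocks_one, one_mul, Tg, rg_of _ hx, rg_of _ hx, hginv]
      simp only [g, xi, hn]
    · have hn : ‖v.1‖ = ‖v.1.2‖ := by rw [Prod.norm_def]; exact max_eq_right hlt.le
      have hz1 : ‖zt v‖ = 1 := by
        rw [zt, hn, norm_smul, norm_inv, norm_norm, inv_mul_cancel₀]; rw [← hn]; exact (npos v).ne'
      have hz : zt v ≠ 0 := by rw [← norm_ne_zero_iff, hz1]; exact one_ne_zero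
      rw [Tg, rg_zero _ hlt.le, rg_zero _ hlt.le, rr_zero hlt.le, neg_zero]
      refine alg_B (Q := p (bp (xi v))) hP (hVV _ (hxi v)) (hVq _) hz ?_
      have hw2 : (uv v.1 v.2).1.2 = zt v := rfl
      have hw1 : (uv v.1 v.2).1.1 = xi v := rfl
      have hx1 : ‖xi v‖ < 1 := by
        rw [xi, norm_smul, norm_inv, norm_norm, inv_mul_lt_iff₀ (npos v), mul_one, hn]; exact hlt
      have hc : 0 < 1 - ‖xi v‖ := by linarith
      have hu2 : uc (ac (cmap (uv v.1 v.2)).1.2) = zt v := by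
        have : (cmap (uv v.1 v.2)).1.2 = (1 - ‖xi v‖) • zt v := by
          simp only [cmap, hw1, hw2, hz1]; rw [max_eq_right hc.le]
        rw [this, uc_ac (smul_ne_zero hc.ne' hz), norm_smul, hz1, Real.norm_of_nonneg hc.le, mul_one, Complex.real_smul, ← mul_assoc, inv_mul_cancel₀ (by exact_mod_cast hc.ne'), one_mul]
      simp only [h3, e, hat]
      rw [hu2, Wp_c2 (by rw [hw2, hz1]), hw1]
  rw [key, ← mul_assoc, Matrix.nonsing_inv_mul _ ((Matrix.isUnit_iff_isUnit_det _).1 hu3), one_mul]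

/-- every clutching function is stably a product with the circle class -/
theorem M4 {f : Nz (E × ℂ) → Matrix κ κ ℂ} (hf : Continuous f) (hu : ∀ v, IsUnit (f v)) :
    ∃ (K : Type) (_ : Fintype K) (_ : DecidableEq K) (g : Nz E → Matrix K K ℂ), Continuous g ∧ (∀ x, IsUnit (g x)) ∧ Continuous (Tg g) ∧ (∀ v, IsUnit (Tg g v)) ∧ St f (Tg g) := by
  obtain ⟨K, _, _, i, p, hp, hi, h⟩ := to_idem (f := fun v => (f v)⁻¹) (cont_inv hf hu) (fun v => Matrix.isUnit_nonsing_inv_iff.2 (hu v))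
  obtain ⟨g, hg, hgu, h2⟩ := M4a p hp hi h.cont_right h.mem_right (fun v => rfl)
  refine ⟨K, inferInstance, inferInstance, g, hg, hgu, h2.cont_right, h2.mem_right, ?_⟩
  refine St.of (i.trans (Function.Embedding.inl : K ↪ K ⊕ K)) (Function.Embedding.refl _) ?_
  refine ((h.xt (Function.Embedding.inl : K ↪ K ⊕ K)).inv.trans h2).congr (fun v => ?_) (fun v => (xt_refl _).symm)
  rw [xt_trans, xt_inv i (hu v), xt_inv _ (xt_isUnit _ (hu v))]
  exact (Matrix.nonsing_inv_nonsing_inv _ ((Matrix.isUnit_iff_isUnit_det _).1 (xt_isUnit _ (xt_isUnit _ (hu v)))))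

end m4
end CB

namespace CB
open MeasureTheory Matrix
open scoped ContDiff Topology

section tg
variable {E : Type} [NormedAddCommGroup E] [NormedSpace ℝ E]
variable {κ : Type} [Fintype κ] [DecidableEq κ]

theorem rg_cont {Y : Type*} [TopologicalSpace Y] {H : Y → Nz E → Matrix κ κ ℂ} (hH : Continuous fun q : Y × Nz E => H q.1 q.2) :
    Continuous fun q : Y × Nz (E × ℂ) => rg (H q.1) q.2 := by
  rw [continuous_iff_continuousAt]
  rintro ⟨y0, v0⟩
  by_cases hx : v0.1.1 = 0
  · have hz : 0 < ‖v0.1.2‖ := norm_pos_iff.2 fun h => v0.2 (Prod.ext hx h)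
    have h1 : ∀ᶠ q : Y × Nz (E × ℂ) in 𝓝 (y0, v0), ‖q.2.1.1‖ < ‖q.2.1.2‖ := by
      have c1 : Continuous fun q : Y × Nz (E × ℂ) => ‖q.2.1.1‖ := by fun_prop
      have c2 : Continuous fun q : Y × Nz (E × ℂ) => ‖q.2.1.2‖ := by fun_prop
      exact c1.continuousAt.eventually_lt c2.continuousAt (by simpa [hx] using hz)
    refine (continuousAt_const (y := (0 : Matrix κ κ ℂ))).congr ?_
    filter_upwards [h1] with q hq
    exact (rg_zero _ hq.le).symm
  · have ho : IsOpen {q : Y × Nz (E × ℂ) | q.2.1.1 ≠ 0} := by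
      have c1 : Continuous fun q : Y × Nz (E × ℂ) => q.2.1.1 := by fun_prop
      exact isOpen_compl_singleton.preimage c1
    have hc : ContinuousOn (fun q : Y × Nz (E × ℂ) => rg (H q.1) q.2) {q : Y × Nz (E × ℂ) | q.2.1.1 ≠ 0} := by
      rw [continuousOn_iff_continuous_restrict]
      have : Continuous fun q : {q : Y × Nz (E × ℂ) | q.2.1.1 ≠ 0} => (rr q.1.2 : ℂ) • H q.1.1 ⟨q.1.2.1.1, q.2⟩ := by
        refine Continuous.smul (Complex.continuous_ofReal.comp (rr_cont.comp (by fun_prop))) ?_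
        exact hH.comp (f := fun q : {q : Y × Nz (E × ℂ) | q.2.1.1 ≠ 0} => ((q.1.1, ⟨q.1.2.1.1, q.2⟩) : Y × Nz E)) (Continuous.prodMk (by fun_prop) (Continuous.subtype_mk (by fun_prop) _))
      exact this.congr fun q => (rg_of _ q.2).symm
    exact hc.continuousAt (ho.mem_nhds hx)

theorem rg_mul_inv {g : Nz E → Matrix κ κ ℂ} (hu : ∀ x, IsUnit (g x)) (v : Nz (E × ℂ)) :
    rg g v * rg (fun x => (g x)⁻¹) v = ((rr v : ℂ) * rr v) • 1 ∧ rg (fun x => (g x)⁻¹) v * rg g v = ((rr v : ℂ) * rr v) • 1 := by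
  by_cases hx : v.1.1 = 0
  · have hz : rr v = 0 := rr_zero (by rw [hx]; simp)
    simp [rg, hx, hz]
  · have hd := (Matrix.isUnit_iff_isUnit_det _).1 (hu ⟨v.1.1, hx⟩)
    rw [rg_of _ hx, rg_of _ hx, smul_mul_smul_comm, smul_mul_smul_comm, Matrix.mul_nonsing_inv _ hd, Matrix.nonsing_inv_mul _ hd]
    exact ⟨rfl, rfl⟩

theorem Tg_unit {g : Nz E → Matrix κ κ ℂ} (hu : ∀ x, IsUnit (g x)) (v : Nz (E × ℂ)) : IsUnit (Tg g v) := by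
  obtain ⟨h1, h2⟩ := rg_mul_inv hu v
  have hc := nz_aux (zr_ne v)
  have h3 : Tg g v * fromBlocks ((starRingEnd ℂ (zt v)) • 1) (-(rg g v)) (rg (fun x => (g x)⁻¹) v) (zt v • 1) =
      (zt v * starRingEnd ℂ (zt v) + (rr v : ℂ) * rr v) • 1 := by
    unfold Tg
    rw [fromBlocks_multiply, ← fromBlocks_one, fromBlocks_smul]
    congr 1
    · rw [h1, smul_mul_smul_comm, mul_one, ← add_smul]
    · simp
    · simp
    · rw [neg_mul_neg, h2, smul_mul_smul_comm, mul_one, ← add_smul, add_comm, mul_comm (starRingEnd ℂ (zt v))]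
  refine IsUnit.of_mul_eq_one (fromBlocks ((starRingEnd ℂ (zt v)) • 1) (-(rg g v)) (rg (fun x => (g x)⁻¹) v) (zt v • 1) * ((zt v * starRingEnd ℂ (zt v) + (rr v : ℂ) * rr v)⁻¹ • 1)) ?_
  rw [← mul_assoc, h3, smul_mul_smul_comm, mul_inv_cancel₀ hc, one_smul, one_mul]

theorem Tg_hm {g g' : Nz E → Matrix κ κ ℂ} (h : Hm (GLs κ) g g') : Hm (GLs (κ ⊕ κ)) (Tg (E := E) g) (Tg g') := by
  obtain ⟨H, hc, hu, h0, h1⟩ := h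
  refine ⟨fun s => Tg (H s), ?_, fun s v => Tg_unit (hu s) v, ?_, ?_⟩
  · unfold Tg
    have hz : Continuous fun q : I × Nz (E × ℂ) => zt q.2 := zt_cont.comp continuous_snd
    refine Continuous.matrix_fromBlocks (by fun_prop) (rg_cont hc) (Continuous.neg ?_) (by fun_prop)
    exact rg_cont (H := fun s x => (H s x)⁻¹) (cont_inv (f := fun q : I × Nz E => H q.1 q.2) hc fun q => hu q.1 q.2)
  · intro v; change Tg (H 0) v = _; rw [show H 0 = g from funext h0]
  · intro v; change Tg (H 1) v = _; rw [show H 1 = g' from funext h1]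

theorem Tg_cont {g : Nz E → Matrix κ κ ℂ} (hg : Continuous g) (hu : ∀ x, IsUnit (g x)) : Continuous (Tg (E := E) g) :=
  (Tg_hm (Hm.refl (S := GLs κ) hg hu)).cont_left

variable {K : Type} [Fintype K] [DecidableEq K]

theorem Jm_sum (i : κ ↪ K) : Jm (i.sumMap i) = fromBlocks (Jm i) 0 0 (Jm i) := by
  ext a b
  rcases a with a | a <;> rcases b with b | b <;> simp [Jm]

theorem Tg_xt_eq (i : κ ↪ K) {g : Nz E → Matrix κ κ ℂ} (hu : ∀ x, IsUnit (g x)) (v : Nz (E × ℂ)) :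
    Tg (fun x => xt i (g x)) v = xt (i.sumMap i) (Tg g v) * Rb (1 - Jm i * (Jm i)ᵀ) (zt v) (rr v) := by
  set J := Jm i with hJ
  have hJJ : Jᵀ * J = 1 := Jm_tm i
  have e1 : xt (i.sumMap i) (Tg g v) = fromBlocks (1 - J * Jᵀ + zt v • (J * Jᵀ)) (J * rg g v * Jᵀ) (-(J * rg (fun x => (g x)⁻¹) v * Jᵀ)) (1 - J * Jᵀ + (starRingEnd ℂ (zt v)) • (J * Jᵀ)) := by
    unfold xt Tg
    rw [Jm_sum, fromBlocks_transpose, ← fromBlocks_one, ← fromBlocks_one, sub_eq_add_neg, fromBlocks_neg, fromBlocks_add, fromBlocks_multiply, fromBlocks_multiply, fromBlocks_add, ← hJ]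
    congr 1 <;>
    · simp only [Matrix.mul_zero, Matrix.zero_mul, transpose_zero, neg_zero, add_zero, zero_add, Matrix.mul_add, Matrix.add_mul, Matrix.mul_smul, Matrix.smul_mul, Matrix.mul_one, Matrix.mul_neg, Matrix.neg_mul]
      try module
  have e2 : ∀ k : Nz E → Matrix κ κ ℂ, rg (fun x => xt i (k x)) v = (rr v : ℂ) • (1 - J * Jᵀ) + J * rg k v * Jᵀ := by
    intro k
    by_cases hx : v.1.1 = 0
    · have hz : rr v = 0 := rr_zero (by rw [hx]; simp)
      simp [rg, hx, hz]
    · rw [rg_of _ hx, rg_of _ hx]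
      simp only [xt, ← hJ, Matrix.mul_sub, Matrix.sub_mul, Matrix.mul_smul, Matrix.smul_mul, Matrix.mul_one]
      module
  have e3 : (fun x => (xt i (g x))⁻¹) = fun x => xt i (g x)⁻¹ := funext fun x => (xt_inv i (hu x)).symm
  have q1 : Jᵀ * (J * Jᵀ) = Jᵀ := by rw [← Matrix.mul_assoc, hJJ, Matrix.one_mul]
  rw [e1]
  unfold Tg Rb
  rw [e3, e2, e2, fromBlocks_multiply]
  congr 1 <;>
  · simp only [Matrix.mul_zero, Matrix.zero_mul, add_zero, zero_add, Matrix.mul_add, Matrix.add_mul, Matrix.mul_sub, Matrix.sub_mul, Matrix.mul_smul, Matrix.smul_mul, Matrix.mul_one, Matrix.one_mul, Matrix.mul_neg, Matrix.neg_mul, q1, Matrix.mul_assoc]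
    module

theorem Tg_xt (i : κ ↪ K) {g : Nz E → Matrix κ κ ℂ} (hg : Continuous g) (hu : ∀ x, IsUnit (g x)) :
    St (Tg (E := E) g) (Tg (fun x => xt i (g x))) := by
  refine St.of (i.sumMap i) (Function.Embedding.refl _) ?_
  have hP : (1 - Jm i * (Jm i)ᵀ) * (1 - Jm i * (Jm i)ᵀ) = 1 - Jm i * (Jm i)ᵀ := by
    have q1 : (Jm i)ᵀ * (Jm i * (Jm i)ᵀ) = (Jm i)ᵀ := by rw [← Matrix.mul_assoc, Jm_tm, Matrix.one_mul]
    simp [Matrix.mul_sub, Matrix.sub_mul, Matrix.mul_assoc, q1]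
  have h1 := ((Hm.refl (S := GLs _) (Tg_cont hg hu) (Tg_unit hu)).xt (i.sumMap i)).mul (Rb_hm (E := E) hP).symm
  exact h1.congr (fun v => by simp) fun v => by rw [xt_refl, Tg_xt_eq i hu]

theorem Tg_st {g : Nz E → Matrix κ κ ℂ} {g' : Nz E → Matrix K K ℂ} (hg : Continuous g) (hu : ∀ x, IsUnit (g x)) (hg' : Continuous g') (hu' : ∀ x, IsUnit (g' x))
    (h : St g g') : St (Tg (E := E) g) (Tg g') := by
  obtain ⟨N, i, j, h⟩ := h
  have a1 : Continuous fun x => xt i (g x) := (xt_cont i).comp hg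
  have a2 : Continuous fun x => xt j (g' x) := (xt_cont j).comp hg'
  have b1 : ∀ x, IsUnit (xt i (g x)) := fun x => xt_isUnit i (hu x)
  have b2 : ∀ x, IsUnit (xt j (g' x)) := fun x => xt_isUnit j (hu' x)
  exact St.trans (Tg_cont a1 b1) (Tg_unit b1) (Tg_xt i hg hu) (St.trans (Tg_cont a2 b2) (Tg_unit b2) (St.of_hm (Tg_hm h)) (Tg_xt j hg' hu').symm)

end tg
end CB

namespace CB
open MeasureTheory Matrix
open scoped ContDiff Topology

section schur
variable {ι κ : Type} [Fintype κ] [DecidableEq κ] [Fintype ι] [DecidableEq ι]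

theorem schur_hm {X : Type*} [TopologicalSpace X] {M : X → Matrix (ι ⊕ κ) (ι ⊕ κ) ℂ} (hM : Continuous M) (hu : ∀ x, IsUnit (M x)) (h1 : ∀ x, (M x).toBlocks₂₂ = 1) :
    Hm (GLs (ι ⊕ κ)) M (fun x => xt Function.Embedding.inl ((M x).toBlocks₁₁ - (M x).toBlocks₁₂ * (M x).toBlocks₂₁)) := by
  have c12 : Continuous fun x => (M x).toBlocks₁₂ := by
    refine continuous_matrix fun i j => ?_
    exact hM.matrix_elem _ _
  have c21 : Continuous fun x => (M x).toBlocks₂₁ := by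
    refine continuous_matrix fun i j => ?_
    exact hM.matrix_elem _ _
  have a1 : Hm (GLs (ι ⊕ κ)) (fun x => fromBlocks 1 (-(M x).toBlocks₁₂) 0 1) (fun _ => 1) := by
    refine ⟨fun s y => fromBlocks 1 ((1 - (s : ℝ)) • -(M y).toBlocks₁₂) 0 1, ?_, fun s y => ?_, by simp, by simp⟩
    · exact continuous_const.matrix_fromBlocks ((by fun_prop : Continuous fun q : I × X => 1 - (q.1 : ℝ)).smul (c12.comp continuous_snd).neg) continuous_const continuous_const
    · change IsUnit _
      rw [Matrix.isUnit_iff_isUnit_det, Matrix.det_fromBlocks_zero₂₁]; simp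
  have a2 : Hm (GLs (ι ⊕ κ)) (fun x => fromBlocks 1 0 (-(M x).toBlocks₂₁) 1) (fun _ => 1) := by
    refine ⟨fun s y => fromBlocks 1 0 ((1 - (s : ℝ)) • -(M y).toBlocks₂₁) 1, ?_, fun s y => ?_, by simp, by simp⟩
    · exact continuous_const.matrix_fromBlocks continuous_const ((by fun_prop : Continuous fun q : I × X => 1 - (q.1 : ℝ)).smul (c21.comp continuous_snd).neg) continuous_const
    · change IsUnit _
      rw [Matrix.isUnit_iff_isUnit_det, Matrix.det_fromBlocks_zero₁₂]; simp
  refine ((a1.symm.mul (Hm.refl (S := GLs _) hM hu)).mul a2.symm).congr (fun x => by simp) fun x => ?_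
  rw [xt_inl]
  have e : M x = fromBlocks (M x).toBlocks₁₁ (M x).toBlocks₁₂ (M x).toBlocks₂₁ 1 := by
    rw [← h1 x, fromBlocks_toBlocks]
  generalize (M x).toBlocks₁₁ = A at *
  generalize (M x).toBlocks₁₂ = B at *
  generalize (M x).toBlocks₂₁ = C at *
  rw [e, fromBlocks_multiply, fromBlocks_multiply]
  congr 1 <;> simp
  abel

theorem xt_diag (j : Fin 2 ↪ κ) (d : Fin 2 → ℂ) :
    xt j (diagonal d) = diagonal fun a => 1 + ∑ p, if j p = a then d p - 1 else 0 := by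
  ext a b
  simp only [xt, Jm, Matrix.add_apply, mul_apply, of_apply, transpose_apply, Matrix.sub_apply, diagonal_apply, Matrix.one_apply, Fin.sum_univ_two]
  by_cases hab : a = b
  · subst hab
    by_cases h0 : j 0 = a <;> by_cases h1 : j 1 = a <;> simp [h0, h1]
  · by_cases h0 : j 0 = a <;> by_cases h1 : j 1 = a <;> simp [h0, h1, hab]

/-- a two by two rotation extending a diagonal matrix over the disc -/
noncomputable def K2 (ζ : ℂ) : Matrix (Fin 2) (Fin 2) ℂ :=
  !![ζ * (((max (‖ζ‖ ^ 2) (1 / 4))⁻¹ : ℝ) : ℂ), -((max 0 (1 / 2 - ‖ζ‖) : ℝ) : ℂ); ((max 0 (1 / 2 - ‖ζ‖) : ℝ) : ℂ), starRingEnd ℂ ζ]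

theorem K2_cont : Continuous K2 := by
  have h1 : Continuous fun ζ : ℂ => (max (‖ζ‖ ^ 2) (1 / 4))⁻¹ :=
    Continuous.inv₀ (by fun_prop) fun ζ => (lt_of_lt_of_le (by norm_num) (le_max_right _ _)).ne'
  refine continuous_matrix fun i j => ?_
  fin_cases i <;> fin_cases j
  · exact continuous_id.mul (Complex.continuous_ofReal.comp h1)
  · change Continuous fun ζ : ℂ => -((max 0 (1 / 2 - ‖ζ‖) : ℝ) : ℂ)
    fun_prop
  · change Continuous fun ζ : ℂ => ((max 0 (1 / 2 - ‖ζ‖) : ℝ) : ℂ)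
    fun_prop
  · exact Complex.continuous_conj

theorem K2_unit (ζ : ℂ) : IsUnit (K2 ζ) := by
  rw [Matrix.isUnit_iff_isUnit_det, isUnit_iff_ne_zero, K2, det_fin_two_of]
  have e : ζ * (((max (‖ζ‖ ^ 2) (1 / 4))⁻¹ : ℝ) : ℂ) * starRingEnd ℂ ζ - -((max 0 (1 / 2 - ‖ζ‖) : ℝ) : ℂ) * ((max 0 (1 / 2 - ‖ζ‖) : ℝ) : ℂ) =
      ((Complex.normSq ζ * (max (‖ζ‖ ^ 2) (1 / 4))⁻¹ + max 0 (1 / 2 - ‖ζ‖) * max 0 (1 / 2 - ‖ζ‖) : ℝ) : ℂ) := by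
    rw [mul_right_comm, Complex.mul_conj, neg_mul, sub_neg_eq_add]; norm_cast
  rw [e, Complex.ofReal_ne_zero]
  have h1 : 0 < (max (‖ζ‖ ^ 2) (1 / 4))⁻¹ := inv_pos.2 (lt_of_lt_of_le (by norm_num) (le_max_right _ _))
  by_cases hz : ζ = 0
  · subst hz; simp
  · have := mul_pos (Complex.normSq_pos.2 hz) h1
    have := mul_self_nonneg (max 0 (1 / 2 - ‖ζ‖))
    linarith

theorem K2_far {ζ : ℂ} (h : 1 / 2 ≤ ‖ζ‖) : K2 ζ = diagonal ![(starRingEnd ℂ ζ)⁻¹, starRingEnd ℂ ζ] := by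
  have h1 : max 0 (1 / 2 - ‖ζ‖) = 0 := max_eq_left (by linarith)
  have h2 : max (‖ζ‖ ^ 2) (1 / 4) = ‖ζ‖ ^ 2 := max_eq_left (by nlinarith)
  have hz : ζ ≠ 0 := by rw [← norm_pos_iff]; linarith
  have h3 : ζ * (((‖ζ‖ ^ 2)⁻¹ : ℝ) : ℂ) = (starRingEnd ℂ ζ)⁻¹ := by
    refine eq_inv_of_mul_eq_one_left ?_
    rw [mul_right_comm, Complex.mul_conj, Complex.normSq_eq_norm_sq, ← Complex.ofReal_mul, mul_inv_cancel₀ (by positivity)]; simp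
  rw [K2, h1, h2, h3]
  ext i j
  fin_cases i <;> fin_cases j <;> simp

theorem Fex (s : Finset κ) : ∃ F : ℂ → Matrix (κ ⊕ Unit) (κ ⊕ Unit) ℂ, Continuous F ∧ (∀ ζ, IsUnit (F ζ)) ∧
    ∀ ζ, 1 / 2 ≤ ‖ζ‖ → F ζ = diagonal (Sum.elim (fun i => if i ∈ s then (starRingEnd ℂ ζ)⁻¹ else 1) (fun _ => (starRingEnd ℂ ζ) ^ s.card)) := by
  induction s using Finset.induction_on with
  | empty =>
    refine ⟨fun _ => 1, continuous_const, fun _ => isUnit_one, fun ζ _ => ?_⟩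
    rw [← diagonal_one]
    congr 1; ext a; rcases a with a | a <;> simp
  | insert i s hi ih =>
    obtain ⟨F, hF, hu, h⟩ := ih
    let j : Fin 2 ↪ κ ⊕ Unit := ⟨![Sum.inl i, Sum.inr ()], by
      intro a b hab
      fin_cases a <;> fin_cases b <;> simp at hab ⊢⟩
    refine ⟨fun ζ => xt j (K2 ζ) * F ζ, ((xt_cont j).comp K2_cont).mul hF, fun ζ => (xt_isUnit j (K2_unit ζ)).mul (hu ζ), fun ζ hζ => ?_⟩
    have j0 : j 0 = Sum.inl i := rfl
    have j1 : j 1 = Sum.inr () := rfl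
    clear_value j
    change xt j (K2 ζ) * F ζ = _
    rw [K2_far hζ, xt_diag, h ζ hζ, diagonal_mul_diagonal]
    congr 1; ext a
    rcases a with a | a
    · by_cases ha : i = a
      · subst ha; simp [j0, j1, Fin.sum_univ_two, hi]
      · simp [j0, j1, Fin.sum_univ_two, ha, Ne.symm ha]
    · simp [j0, j1, Fin.sum_univ_two, Finset.card_insert_of_notMem hi, pow_succ']

end schur
end CB

namespace CB
open MeasureTheory Matrix
open scoped ContDiff Topology

section m5
variable {κ : Type} [Fintype κ] [DecidableEq κ]
variable {E : Type} [NormedAddCommGroup E] [NormedSpace ℝ E]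

/-- regrouping of indices -/
def e5 (κ N : Type) : N ⊕ (κ ⊕ Unit) ≃ (N ⊕ Unit) ⊕ κ where
  toFun := Sum.elim (fun a => Sum.inl (Sum.inl a)) (Sum.elim Sum.inr (fun u => Sum.inl (Sum.inr u)))
  invFun := Sum.elim (Sum.elim Sum.inl (fun u => Sum.inr (Sum.inr u))) (fun k => Sum.inr (Sum.inl k))
  left_inv := by rintro (a | a | a) <;> rfl
  right_inv := by rintro ((a | a) | a) <;> rfl

/-- target diagonal block -/
noncomputable def Dz (κ : Type) [Fintype κ] [DecidableEq κ] (ζ : ℂ) : Matrix (κ ⊕ Unit) (κ ⊕ Unit) ℂ :=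
  diagonal (Sum.elim (fun _ => 1) (fun _ => (starRingEnd ℂ ζ) ^ (Fintype.card κ + 1)))

theorem Dz_cont : Continuous (Dz κ) := by
  refine Continuous.matrix_diagonal (continuous_pi fun a => ?_)
  rcases a with a | a
  · exact continuous_const
  · exact Complex.continuous_conj.pow _

/-- the correction block -/
noncomputable def Xc (χ : ℂ → Matrix κ κ ℂ) (g : Nz E → Matrix κ κ ℂ) (v : Nz (E × ℂ)) : Matrix κ κ ℂ :=
  open Classical in if h : v.1.1 = 0 then 0 else (rr v : ℂ)⁻¹ • (χ (zt v) * (g ⟨v.1.1, h⟩)⁻¹)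

theorem zt_half {v : Nz (E × ℂ)} (h : ‖v.1.1‖ ≤ ‖v.1.2‖) : ‖zt v‖ = 1 := by
  have hn : ‖v.1‖ = ‖v.1.2‖ := by rw [Prod.norm_def]; exact max_eq_right h
  rw [zt, hn, norm_smul, norm_inv, norm_norm, inv_mul_cancel₀]; rw [← hn]; exact (npos v).ne'

theorem Xc_zero {χ : ℂ → Matrix κ κ ℂ} (h0 : ∀ ζ, 1 / 2 ≤ ‖ζ‖ → χ ζ = 0) (g : Nz E → Matrix κ κ ℂ) {v : Nz (E × ℂ)} (h : 1 / 2 ≤ ‖zt v‖) : Xc χ g v = 0 := by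
  unfold Xc; split_ifs
  · rfl
  · rw [h0 _ h]; simp

theorem Xc_mul {χ : ℂ → Matrix κ κ ℂ} (h0 : ∀ ζ, 1 / 2 ≤ ‖ζ‖ → χ ζ = 0) {g : Nz E → Matrix κ κ ℂ} (hu : ∀ x, IsUnit (g x)) (v : Nz (E × ℂ)) : Xc χ g v * rg g v = χ (zt v) := by
  rcases le_or_gt ‖v.1.1‖ ‖v.1.2‖ with h | h
  · rw [rg_zero _ h, h0 _ (by rw [zt_half h]; norm_num), mul_zero]
  · have hx : v.1.1 ≠ 0 := by rw [← norm_pos_iff]; exact (norm_nonneg _).trans_lt h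
    have hr : (rr v : ℂ) ≠ 0 := by
      rw [Complex.ofReal_ne_zero, rr, max_eq_right (by linarith)]
      exact mul_ne_zero (inv_ne_zero (npos v).ne') (by linarith)
    have hd := (Matrix.isUnit_iff_isUnit_det _).1 (hu ⟨v.1.1, hx⟩)
    rw [rg_of _ hx, Xc, dif_neg hx, smul_mul_smul_comm, mul_assoc, Matrix.nonsing_inv_mul _ hd, mul_one, inv_mul_cancel₀ hr, one_smul]

theorem Xc_cont {χ : ℂ → Matrix κ κ ℂ} (hχ : Continuous χ) (h0 : ∀ ζ, 1 / 2 ≤ ‖ζ‖ → χ ζ = 0) {g : Nz E → Matrix κ κ ℂ} (hg : Continuous g) (hu : ∀ x, IsUnit (g x)) :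
    Continuous (Xc χ g) := by
  rw [continuous_iff_continuousAt]
  intro v0
  rcases le_or_gt ‖v0.1.1‖ ‖v0.1.2‖ with h | h
  · have h1 : ∀ᶠ v in 𝓝 v0, 1 / 2 < ‖zt v‖ :=
      continuousAt_const.eventually_lt zt_cont.norm.continuousAt (by rw [zt_half h]; norm_num)
    refine (continuousAt_const (y := (0 : Matrix κ κ ℂ))).congr ?_
    filter_upwards [h1] with q hq
    exact (Xc_zero h0 g hq.le).symm
  · let S : Set (Nz (E × ℂ)) := {v | ‖v.1.2‖ < ‖v.1.1‖}
    have ho : IsOpen S := isOpen_lt (by fun_prop) (by fun_prop)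
    have hx : ∀ v : S, v.1.1.1 ≠ 0 := fun v => by
      rw [← norm_pos_iff]; exact (norm_nonneg _).trans_lt v.2
    have hr : ∀ v : S, (rr v.1 : ℂ) ≠ 0 := fun v => by
      have : ‖v.1.1.2‖ < ‖v.1.1.1‖ := v.2
      rw [Complex.ofReal_ne_zero, rr, max_eq_right (by linarith)]
      exact mul_ne_zero (inv_ne_zero (npos v.1).ne') (by linarith)
    have hc : ContinuousOn (Xc χ g) S := by
      rw [continuousOn_iff_continuous_restrict]
      have : Continuous fun q : S => (rr q.1 : ℂ)⁻¹ • (χ (zt q.1) * (g ⟨q.1.1.1, hx q⟩)⁻¹) := by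
        refine Continuous.smul (Continuous.inv₀ (Complex.continuous_ofReal.comp (rr_cont.comp (by fun_prop))) hr) ?_
        refine (hχ.comp (zt_cont.comp (by fun_prop))).mul ?_
        refine cont_inv (f := fun q : S => g ⟨q.1.1.1, hx q⟩) ?_ fun q => hu _
        exact hg.comp (Continuous.subtype_mk (by fun_prop) _)
      refine this.congr fun q => ?_
      change _ = Xc χ g q.1
      rw [Xc, dif_neg (hx q)]
    exact hc.continuousAt (ho.mem_nhds h)

theorem M5 {g : Nz E → Matrix (κ ⊕ Unit) (κ ⊕ Unit) ℂ} (hg : Continuous g) (hu : ∀ x, IsUnit (g x)) :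
    ∃ G : Nz (E × ℂ) → Matrix ((κ ⊕ Unit) ⊕ Unit) ((κ ⊕ Unit) ⊕ Unit) ℂ, Continuous G ∧ (∀ v, IsUnit (G v)) ∧ St (Tg g) G ∧
      ∀ v, (∀ a, G v (Sum.inl a) (Sum.inr ()) = rg g v a (Sum.inr ())) ∧ G v (Sum.inr ()) (Sum.inr ()) = (starRingEnd ℂ (zt v)) ^ (Fintype.card κ + 1) := by
  obtain ⟨F, hF, hFu, hFd⟩ := Fex (Finset.univ : Finset κ)
  let χ : ℂ → Matrix (κ ⊕ Unit) (κ ⊕ Unit) ℂ := fun ζ => Dz κ ζ - starRingEnd ℂ ζ • F ζ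
  have hχ : Continuous χ := Dz_cont.sub (Complex.continuous_conj.smul hF)
  have hχ0 : ∀ ζ, 1 / 2 ≤ ‖ζ‖ → χ ζ = 0 := by
    intro ζ hζ
    have hz : starRingEnd ℂ ζ ≠ 0 := by
      have : ζ ≠ 0 := by rw [← norm_pos_iff]; linarith
      simpa using this
    simp only [χ, hFd ζ hζ, Dz]
    rw [sub_eq_zero, ← diagonal_smul]
    congr 1; ext a
    rcases a with a | a
    · simp [hz]
    · simp [pow_succ']
  let T2 : Nz (E × ℂ) → Matrix ((κ ⊕ Unit) ⊕ (κ ⊕ Unit)) ((κ ⊕ Unit) ⊕ (κ ⊕ Unit)) ℂ := fun v => fromBlocks 1 0 (Xc χ g v) 1 * (fromBlocks 1 0 0 (F (zt v)) * Tg g v)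
  have hFm : Hm (GLs (κ ⊕ Unit)) (fun v : Nz (E × ℂ) => F (zt v)) (fun _ => 1) := by
    refine Hm.trans ?_ (Hm.const (F 0) (hFu 0))
    refine ⟨fun s v => F (((1 - s : ℝ) : ℂ) * zt v), ?_, fun s v => hFu _, fun v => by simp, fun v => by simp⟩
    exact hF.comp (Continuous.mul (by fun_prop) (zt_cont.comp continuous_snd))
  have hT2 : Hm (GLs _) (Tg g) T2 := by
    have h1 := (Hm.refl (S := GLs (κ ⊕ Unit)) (X := Nz (E × ℂ)) (f := fun _ => 1) continuous_const fun _ => isUnit_one).blockdiag hFm.symm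
    have h2 := (tri_hm2 (Xc_cont hχ hχ0 hg hu)).symm.mul (h1.mul (Hm.refl (S := GLs _) (Tg_cont hg hu) (Tg_unit hu)))
    exact h2.congr (fun v => by simp) fun v => rfl
  have hT2e : ∀ v, ∃ A C, T2 v = fromBlocks A (rg g v) C (Dz κ (zt v)) := by
    intro v
    refine ⟨zt v • 1, Xc χ g v * (zt v • 1) - F (zt v) * rg (fun x => (g x)⁻¹) v, ?_⟩
    simp only [T2, Tg, fromBlocks_multiply]
    congr 1
    · simp
    · simp
    · simp [sub_eq_add_neg]
    · rw [one_mul, zero_mul, add_zero, Xc_mul hχ0 hu]; simp [χ]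
  let M : Nz (E × ℂ) → Matrix (((κ ⊕ Unit) ⊕ Unit) ⊕ κ) (((κ ⊕ Unit) ⊕ Unit) ⊕ κ) ℂ := fun v => xt (e5 κ (κ ⊕ Unit)).toEmbedding (T2 v)
  have hMc : Continuous M := (xt_cont _).comp hT2.cont_right
  have hMu : ∀ v, IsUnit (M v) := fun v => xt_isUnit _ (hT2.mem_right v)
  have hMe : ∀ v a b, M v a b = T2 v ((e5 κ (κ ⊕ Unit)).symm a) ((e5 κ (κ ⊕ Unit)).symm b) := by
    intro v a b; simp only [M]; rw [xt_equiv]; rfl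
  have hM1 : ∀ v, (M v).toBlocks₂₂ = 1 := by
    intro v
    obtain ⟨A, C, h⟩ := hT2e v
    ext a b
    change M v (Sum.inr a) (Sum.inr b) = _
    rw [hMe, h]
    change Dz κ (zt v) (Sum.inl a) (Sum.inl b) = _
    simp [Dz, diagonal_apply, Matrix.one_apply]
  have hs := schur_hm hMc hMu hM1
  let G : Nz (E × ℂ) → Matrix ((κ ⊕ Unit) ⊕ Unit) ((κ ⊕ Unit) ⊕ Unit) ℂ := fun v => (M v).toBlocks₁₁ - (M v).toBlocks₁₂ * (M v).toBlocks₂₁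
  have c11 : Continuous fun x => (M x).toBlocks₁₁ := continuous_matrix fun i j => hMc.matrix_elem _ _
  have c12 : Continuous fun x => (M x).toBlocks₁₂ := continuous_matrix fun i j => hMc.matrix_elem _ _
  have c21 : Continuous fun x => (M x).toBlocks₂₁ := continuous_matrix fun i j => hMc.matrix_elem _ _
  have hcol : ∀ v a, G v a (Sum.inr ()) = M v (Sum.inl a) (Sum.inl (Sum.inr ())) := by
    intro v a
    obtain ⟨A, C, h⟩ := hT2e v
    simp only [G]
    rw [Matrix.sub_apply, mul_apply, Finset.sum_eq_zero, sub_zero]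
    · rfl
    · intro k _
      have : (M v).toBlocks₂₁ k (Sum.inr ()) = 0 := by
        change M v (Sum.inr k) (Sum.inl (Sum.inr ())) = 0
        rw [hMe, h]
        change Dz κ (zt v) (Sum.inl k) (Sum.inr ()) = 0
        simp [Dz]
      rw [this, mul_zero]
  refine ⟨G, c11.sub (c12.matrix_mul c21), fun v => ?_, ?_, fun v => ⟨fun a => ?_, ?_⟩⟩
  · have h1 : IsUnit (xt (Function.Embedding.inl : (κ ⊕ Unit) ⊕ Unit ↪ ((κ ⊕ Unit) ⊕ Unit) ⊕ κ) (G v)) := hs.mem_right v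
    rw [xt_inl, Matrix.isUnit_iff_isUnit_det, Matrix.det_fromBlocks_zero₁₂, det_one, mul_one] at h1
    exact (Matrix.isUnit_iff_isUnit_det _).2 h1
  · refine St.of (e5 κ (κ ⊕ Unit)).toEmbedding Function.Embedding.inl ?_
    exact (hT2.xt _).trans hs
  · obtain ⟨A, C, h⟩ := hT2e v
    rw [hcol, hMe, h]; rfl
  · obtain ⟨A, C, h⟩ := hT2e v
    rw [hcol, hMe, h]
    change Dz κ (zt v) (Sum.inr ()) (Sum.inr ()) = _
    simp [Dz]

end m5
end CB

namespace CB
open MeasureTheory Matrix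
open scoped ContDiff Topology

section rec
variable {κ : Type} [Fintype κ] [DecidableEq κ]

theorem col_ne {ι : Type*} [Fintype ι] [DecidableEq ι] {A : Matrix ι ι ℂ} (hA : IsUnit A) (j : ι) : (fun a => A a j) ≠ 0 := by
  intro h
  have h1 : A *ᵥ (Pi.single j 1) = 0 := by
    rw [Matrix.mulVec_single_one]
    exact h
  have h2 : (A⁻¹ * A) *ᵥ (Pi.single j 1 : ι → ℂ) = 0 := by
    rw [← Matrix.mulVec_mulVec, h1, Matrix.mulVec_zero]
  rw [Matrix.nonsing_inv_mul _ ((Matrix.isUnit_iff_isUnit_det _).1 hA), Matrix.one_mulVec] at h2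
  have h3 := congrFun h2 j
  simp at h3

theorem Hm.col {X : Type*} [TopologicalSpace X] {f g : X → Matrix κ κ ℂ} (j : κ) (h : Hm (GLs κ) f g) :
    Hm (nzs (κ → ℂ)) (fun x a => f x a j) (fun x a => g x a j) :=
  h.comp_left (fun (A : Matrix κ κ ℂ) a => A a j)
    (Continuous.continuousOn (continuous_pi fun a => continuous_id.matrix_elem a j)) (fun A hA => col_ne hA j)

theorem cn_cont {E G : Type*} [NormedAddCommGroup E] [NormedSpace ℝ E] [NormedAddCommGroup G] [NormedSpace ℝ G] [FiniteDimensional ℝ E]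
    {q : Nz E → G} (hq : Continuous q) : Continuous (cn q) := by
  have := cone_cont (K := fun (_ : I) x => q x) (hq.comp continuous_snd)
  exact this.comp (by fun_prop : Continuous fun x : E => ((0 : I), x))

theorem col_step {E : Type} [NormedAddCommGroup E] [NormedSpace ℝ E] [FiniteDimensional ℝ E]
    {g : Nz E → Matrix (κ ⊕ Unit) (κ ⊕ Unit) ℂ} (hg : Continuous g) (hu : ∀ x, IsUnit (g x)) (huv : ∀ x, g (uv x.1 x.2) = g x) (n : ℕ) :
    Hm (nzs ((κ ⊕ Unit → ℂ) × ℂ)) (fun v : Nz (E × ℂ) => ((fun a => rg g v a (Sum.inr ())), starRingEnd ℂ (zt v) ^ n))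
      (fun v => (cn (fun x a => g x a (Sum.inr ())) v.1.1, starRingEnd ℂ v.1.2 ^ n)) := by
  have hrg : Continuous (rg g) :=
    (rg_cont (Y := Unit) (H := fun _ => g) (hg.comp continuous_snd)).comp (by fun_prop : Continuous fun v : Nz (E × ℂ) => ((), v))
  apply Hm.line
  · refine Continuous.prodMk (continuous_pi fun a => hrg.matrix_elem _ _) ?_
    exact ((Complex.continuous_conj).comp zt_cont).pow n
  · refine Continuous.prodMk ((cn_cont (q := fun x a => g x a (Sum.inr ())) (continuous_pi fun a => hg.matrix_elem _ _)).comp (by fun_prop)) ?_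
    exact ((Complex.continuous_conj).comp (by fun_prop)).pow n
  · intro v t h0 h1 hz
    rw [Prod.ext_iff] at hz
    obtain ⟨hz1, hz2⟩ := hz
    change (1 - t) • (fun a => rg g v a (Sum.inr ())) + t • cn (fun x a => g x a (Sum.inr ())) v.1.1 = 0 at hz1
    change (1 - t) • (starRingEnd ℂ (zt v) ^ n) + t • (starRingEnd ℂ v.1.2 ^ n) = 0 at hz2
    have hc : ((1 - t) * (‖v.1‖⁻¹) ^ n + t : ℝ) • (starRingEnd ℂ v.1.2 ^ n) = 0 := by
      rw [← hz2, add_smul]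
      congr 1
      rw [mul_smul]
      congr 1
      rw [zt]
      simp [Complex.real_smul, mul_pow]
    have hp : 0 < (1 - t) * (‖v.1‖⁻¹) ^ n + t := by
      have := npos v
      have h2 : 0 < (‖v.1‖⁻¹) ^ n := by positivity
      rcases eq_or_lt_of_le h1 with h | h
      · rw [h]; simp
      · have : 0 < (1 - t) * (‖v.1‖⁻¹) ^ n := mul_pos (by linarith) h2
        linarith
    have hz0 : v.1.2 = 0 := by
      rcases smul_eq_zero.1 hc with h | h
      · exact absurd h hp.ne'
      · by_contra hne
        exact (pow_ne_zero n ((map_ne_zero (starRingEnd ℂ)).2 hne)) h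
    have hx : v.1.1 ≠ 0 := fun h => v.2 (Prod.ext h hz0)
    have hzt : zt v = 0 := by rw [zt]; simp [hz0]
    have hr : rr v ≠ 0 := (zr_ne v).resolve_left (by simp [hzt])
    have hrp : 0 < rr v := lt_of_le_of_ne (rr_nonneg v) hr.symm
    rw [rg_of g hx, cn_of_ne _ hx, huv ⟨v.1.1, hx⟩] at hz1
    have hk : ((1 - t) * rr v + t * ‖v.1.1‖) • (fun a => g ⟨v.1.1, hx⟩ a (Sum.inr ())) = 0 := by
      rw [← hz1, add_smul, mul_smul, mul_smul]
      congr 1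
    have hp2 : 0 < (1 - t) * rr v + t * ‖v.1.1‖ := by
      have hn : 0 < ‖v.1.1‖ := norm_pos_iff.2 hx
      rcases eq_or_lt_of_le h1 with h | h
      · rw [h]; simpa using hn
      · have : 0 < (1 - t) * rr v := mul_pos (by linarith) hrp
        have : 0 ≤ t * ‖v.1.1‖ := by positivity
        linarith
    rcases smul_eq_zero.1 hk with h | h
    · exact hp2.ne' h
    · exact col_ne (hu _) _ h

/-- splitting off the last coordinate -/
noncomputable def Ls (κ : Type) [Fintype κ] : (κ ⊕ Unit → ℂ) ≃L[ℝ] (κ → ℂ) × ℂ :=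
  LinearEquiv.toContinuousLinearEquiv
    { toFun := fun v => (fun a => v (Sum.inl a), v (Sum.inr ()))
      invFun := fun p => Sum.elim p.1 (fun _ => p.2)
      map_add' := fun _ _ => rfl
      map_smul' := fun _ _ => rfl
      left_inv := fun v => by ext (a | a) <;> rfl
      right_inv := fun p => rfl }

theorem Ls_apply (v : κ ⊕ Unit → ℂ) : Ls κ v = (fun a => v (Sum.inl a), v (Sum.inr ())) := rfl
theorem Ls_symm (p : (κ → ℂ) × ℂ) : (Ls κ).symm p = Sum.elim p.1 (fun _ => p.2) := by
  rw [ContinuousLinearEquiv.symm_apply_eq]; rfl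

theorem Ls_norm (v : κ ⊕ Unit → ℂ) : ‖v‖ ≤ ‖Ls κ v‖ := by
  rw [pi_norm_le_iff_of_nonneg (norm_nonneg _), Ls_apply, Prod.norm_def]
  rintro (a | a)
  · exact le_max_of_le_left (norm_le_pi_norm (fun a => v (Sum.inl a)) a)
  · exact le_max_of_le_right le_rfl

/-- last columns of clutching maps have degrees exactly the multiples of the factorial -/
def CF (κ : Type) [Fintype κ] [DecidableEq κ] : Prop :=
  ∃ β : Bmp (κ ⊕ Unit → ℂ),
    (∀ G : Nz (κ ⊕ Unit → ℂ) → Matrix (κ ⊕ Unit) (κ ⊕ Unit) ℂ, Continuous G → (∀ x, IsUnit (G x)) →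
      ∃ k : ℤ, sdeg β (fun x a => G x a (Sum.inr ())) = ((Fintype.card κ).factorial : ℝ) * k) ∧
    (∀ k : ℤ, ∃ G : Nz (κ ⊕ Unit → ℂ) → Matrix (κ ⊕ Unit) (κ ⊕ Unit) ℂ, Continuous G ∧ (∀ x, IsUnit (G x)) ∧
      sdeg β (fun x a => G x a (Sum.inr ())) = ((Fintype.card κ).factorial : ℝ) * k)

theorem deg_step (β : Bmp (κ ⊕ Unit → ℂ)) {β' : Bmp ((κ ⊕ Unit) ⊕ Unit → ℂ)}
    (hβ : ∀ (q : Nz ((κ ⊕ Unit → ℂ) × ℂ) → (κ ⊕ Unit → ℂ) × ℂ), Continuous q → (∀ x, q x ≠ 0) →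
      (sdeg β' fun v => (Ls (κ ⊕ Unit)).symm (q (nzmap (Ls (κ ⊕ Unit)) v))) = sdeg (β.prod bumpC) q)
    {g : Nz (κ ⊕ Unit → ℂ) → Matrix (κ ⊕ Unit) (κ ⊕ Unit) ℂ} (hg : Continuous g) (hu : ∀ x, IsUnit (g x)) :
    ∃ G : Nz ((κ ⊕ Unit → ℂ) × ℂ) → Matrix ((κ ⊕ Unit) ⊕ Unit) ((κ ⊕ Unit) ⊕ Unit) ℂ, Continuous G ∧ (∀ v, IsUnit (G v)) ∧
      St (Tg g) G ∧ sdeg β' (fun v a => G (nzmap (Ls (κ ⊕ Unit)) v) a (Sum.inr ())) =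
        -((Fintype.card κ + 1 : ℕ) : ℝ) * sdeg β (fun x a => g x a (Sum.inr ())) := by
  have h1 := hm_uv (S := GLs (κ ⊕ Unit)) hg hu
  set g' : Nz (κ ⊕ Unit → ℂ) → Matrix (κ ⊕ Unit) (κ ⊕ Unit) ℂ := fun x => g (uv x.1 x.2) with hg'
  have hg'c : Continuous g' := hg.comp uv_cont
  have hg'u : ∀ x, IsUnit (g' x) := fun x => hu _
  obtain ⟨G, hG, hGu, hS, hc⟩ := M5 hg'c hg'u
  refine ⟨G, hG, hGu, ?_, ?_⟩
  · exact St.trans (Tg_cont hg'c hg'u) (Tg_unit hg'u) (St.of_hm (Tg_hm h1)) hS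
  · have huv : ∀ x, g' (uv x.1 x.2) = g' x := by
      intro x
      simp only [hg']
      congr 1
      apply Subtype.ext
      have := uv_norm x.1 x.2
      change ‖(uv x.1 x.2 : κ ⊕ Unit → ℂ)‖⁻¹ • (uv x.1 x.2 : κ ⊕ Unit → ℂ) = _
      rw [this]; simp
    have h2 := col_step hg'c hg'u huv (Fintype.card κ + 1)
    have h3 := sdeg_hm (β.prod bumpC) h2
    have hq : Continuous fun x a => g' x a (Sum.inr ()) := continuous_pi fun a => hg'c.matrix_elem _ _
    rw [sdeg_prod_conj β _ (Nat.succ_ne_zero _) hq (fun x => col_ne (hg'u x) _)] at h3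
    rw [sdeg_hm β (h1.col (Sum.inr ())), ← h3, ← hβ _ h2.cont_left h2.mem_left]
    congr 1
    funext v a
    rw [Ls_symm]
    rcases a with a | a
    · exact (hc _).1 a
    · exact (hc _).2

theorem CF_step (h : CF κ) : CF (κ ⊕ Unit) := by
  obtain ⟨β, hA, hB⟩ := h
  obtain ⟨β', hβ⟩ := sdeg_transport (Ls (κ ⊕ Unit)) Ls_norm (β.prod bumpC)
  have hcard : Fintype.card (κ ⊕ Unit) = Fintype.card κ + 1 := by simp
  have hfac : ((Fintype.card (κ ⊕ Unit)).factorial : ℝ) = ((Fintype.card κ + 1 : ℕ) : ℝ) * ((Fintype.card κ).factorial : ℝ) := by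
    rw [hcard, Nat.factorial_succ, Nat.cast_mul]
  refine ⟨β', ?_, ?_⟩
  · intro F hF hFu
    set f : Nz ((κ ⊕ Unit → ℂ) × ℂ) → Matrix ((κ ⊕ Unit) ⊕ Unit) ((κ ⊕ Unit) ⊕ Unit) ℂ := fun v => F (nzmap (Ls (κ ⊕ Unit)).symm v) with hf
    have hfc : Continuous f := hF.comp (nzc _)
    have hfu : ∀ v, IsUnit (f v) := fun v => hFu _
    obtain ⟨K, _, _, g0, hg0, hg0u, hT, hTu, hS0⟩ := M4 hfc hfu
    have hE : Module.finrank ℝ (κ ⊕ Unit → ℂ) = (2 * Fintype.card κ + 1) + 1 := by rw [finrank_col]; ring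
    obtain ⟨g, hg, hgu, hSg⟩ := St.compress (κ := κ ⊕ Unit) hE (by rw [hcard]; omega) hg0 hg0u
    obtain ⟨G, hG, hGu, hSG, hd⟩ := deg_step β hβ hg hgu
    have hS1 : St f G := St.trans hT hTu hS0 (St.trans (Tg_cont hg hgu) (Tg_unit hgu) (Tg_st hg0 hg0u hg hgu hSg) hSG)
    have hE2 : Module.finrank ℝ ((κ ⊕ Unit → ℂ) × ℂ) = (2 * Fintype.card κ + 3) + 1 := by
      rw [Module.finrank_prod, finrank_col, Complex.finrank_real_complex]; ring
    have hH := St.destab hE2 (by rw [Fintype.card_sum, hcard, Fintype.card_unit]; omega) hfc hG hfu hGu hS1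
    obtain ⟨k, hk⟩ := hA g hg hgu
    refine ⟨-k, ?_⟩
    have h5 := sdeg_hm β' ((hH.col (Sum.inr ())).comp_right _ (nzc (Ls (κ ⊕ Unit))))
    have h6 : (fun (x : Nz ((κ ⊕ Unit) ⊕ Unit → ℂ)) a => F x a (Sum.inr ())) = (fun x a => f (nzmap (Ls (κ ⊕ Unit)) x) a (Sum.inr ())) := by
      funext x a
      simp only [hf]
      rw [nzmap_symm]
    rw [h6]
    refine h5.trans (hd.trans ?_)
    rw [hk, hfac]; push_cast; ring
  · intro k
    obtain ⟨g, hg, hgu, hk⟩ := hB (-k)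
    obtain ⟨G, hG, hGu, hSG, hd⟩ := deg_step β hβ hg hgu
    refine ⟨fun v => G (nzmap (Ls (κ ⊕ Unit)) v), hG.comp (nzc _), fun v => hGu _, ?_⟩
    rw [hd, hk, hfac]; push_cast; ring
end rec
end CB

namespace CB
open MeasureTheory Matrix
open scoped ContDiff Topology

section
variable {m : ℕ} [Nonempty (Fin m)]

theorem kap_exists : ∃ K : GenLoop (Fin m) (Nz (V m)) (eN m), Hm Set.univ (fl (fun x => K x) (eN m)) (fun v => v) := by
  have hG := lin_good (m := m) (A := (1 : Matrix (Fin m) (Fin m) ℝ)) (by simp)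
  obtain ⟨τ, h1, h2, h3, h4⟩ := ury (bdry_closed m) ((Nr_closed m).preimage hG.cont)
    (Set.disjoint_left.2 fun x hx => hG.bd x hx)
  have hc := hG.cont
  refine ⟨mkL (fun x => (1 - τ x) • lin (1 : Matrix (Fin m) (Fin m) ℝ) x + τ x • ev m) (by fun_prop)
    (fun x => blend_ne (hG.ne x) (h2 x).1 (h2 x).2 (h4 x)) (fun x hx => by simp [h3 x hx]), ?_⟩
  obtain ⟨H, hH, hm, h0, hh1⟩ := kappa_hm h1 h2 h3 h4
  refine ⟨fun t x => ⟨H t x, hm t x⟩, hH.subtype_mk _, fun _ _ => Set.mem_univ _, ?_, ?_⟩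
  · intro x
    apply Subtype.ext
    refine (h0 x).trans ?_
    rw [fl_map (Subtype.val : Nz (V m) → V m) _ _ x]
    rfl
  · intro x
    exact Subtype.ext (hh1 x)

theorem fl_hm {Z : Type*} [TopologicalSpace Z] {S : Set Z} {K : GenLoop (Fin m) (Nz (V m)) (eN m)}
    (hK : Hm Set.univ (fl (fun x => K x) (eN m)) (fun v => v)) {F : Nz (V m) → Z} (hF : Continuous F) (hS : ∀ v, F v ∈ S) :
    Hm S (fl (fun x => F (K x)) (F (eN m))) F := by
  have := hK.comp_left (T := S) F hF.continuousOn (fun v _ => hS v)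
  refine this.congr (fun x => ?_) (fun x => rfl)
  exact fl_map F _ _ x
end


theorem bmp_exists (E : Type*) [NormedAddCommGroup E] [NormedSpace ℝ E] [FiniteDimensional ℝ E] [MeasureSpace E] [BorelSpace E]
    [(volume : Measure E).IsAddHaarMeasure] : Nonempty (Bmp E) := by
  let f : ContDiffBump (0 : E) := ⟨1 / 2, 1, by norm_num, by norm_num⟩
  refine ⟨⟨f.normed volume, f.contDiff_normed, ?_, f.integral_normed⟩⟩
  intro x hx
  by_contra h
  have h1 : x ∈ Function.support (f.normed volume) := h
  rw [f.support_normed_eq] at h1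
  simp only [Metric.mem_ball, dist_zero_right] at h1
  exact absurd hx (not_le.2 h1)

section
variable {κ : Type} [Fintype κ] [DecidableEq κ] {m : ℕ}

theorem sig_exists (hm : m + 1 = 2 * (Fintype.card κ + 1)) : ∃ s : Fin m ⊕ Unit ≃ (κ ⊕ Unit) × Bool, s (Sum.inr ()) = (Sum.inr (), false) := by
  have h : Fintype.card (Fin m ⊕ Unit) = Fintype.card ((κ ⊕ Unit) × Bool) := by
    simp; omega
  let s0 := Fintype.equivOfCardEq h
  refine ⟨s0.trans (Equiv.swap (s0 (Sum.inr ())) (Sum.inr (), false)), ?_⟩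
  simp

/-- the coordinate isomorphism -/
noncomputable def Lc (s : Fin m ⊕ Unit ≃ (κ ⊕ Unit) × Bool) : V m ≃L[ℝ] (κ ⊕ Unit → ℂ) :=
  LinearEquiv.toContinuousLinearEquiv
    { toFun := fun v a => ⟨Sum.elim v.1 (fun _ => v.2) (s.symm (a, false)), Sum.elim v.1 (fun _ => v.2) (s.symm (a, true))⟩
      invFun := fun w => (fun i => bif (s (Sum.inl i)).2 then (w (s (Sum.inl i)).1).im else (w (s (Sum.inl i)).1).re,
        bif (s (Sum.inr ())).2 then (w (s (Sum.inr ())).1).im else (w (s (Sum.inr ())).1).re)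
      map_add' := fun v w => by
        ext a
        apply Complex.ext
        · rcases h : s.symm (a, false) with i | i <;> simp [h]
        · rcases h : s.symm (a, true) with i | i <;> simp [h]
      map_smul' := fun c w => by
        ext a
        apply Complex.ext
        · rcases h : s.symm (a, false) with i | i <;> simp [h]
        · rcases h : s.symm (a, true) with i | i <;> simp [h]
      left_inv := fun v => by
        have key : ∀ j, (bif (s j).2 then Sum.elim v.1 (fun _ => v.2) (s.symm ((s j).1, true)) else Sum.elim v.1 (fun _ => v.2) (s.symm ((s j).1, false)))
            = Sum.elim v.1 (fun _ => v.2) j := by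
          intro j
          rcases h : s j with ⟨a, b⟩
          have h' := (s.symm_apply_eq).2 h.symm
          cases b <;> simp [h']
        refine Prod.ext (funext fun i => ?_) ?_
        · exact key (Sum.inl i)
        · exact key (Sum.inr ())
      right_inv := fun w => by
        have key : ∀ q : (κ ⊕ Unit) × Bool, Sum.elim (fun i => bif (s (Sum.inl i)).2 then (w (s (Sum.inl i)).1).im else (w (s (Sum.inl i)).1).re)
            (fun _ => bif (s (Sum.inr ())).2 then (w (s (Sum.inr ())).1).im else (w (s (Sum.inr ())).1).re) (s.symm q) = bif q.2 then (w q.1).im else (w q.1).re := by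
          intro q
          rcases h : s.symm q with i | i
          · have h' := (s.symm_apply_eq).1 h
            simp [h']
          · have h' := (s.symm_apply_eq).1 h
            cases i
            simp [h']
        funext a
        apply Complex.ext
        · exact key (a, false)
        · exact key (a, true) }

theorem Lc_apply (s : Fin m ⊕ Unit ≃ (κ ⊕ Unit) × Bool) (v : V m) (a : κ ⊕ Unit) :
    Lc s v a = ⟨Sum.elim v.1 (fun _ => v.2) (s.symm (a, false)), Sum.elim v.1 (fun _ => v.2) (s.symm (a, true))⟩ := rfl

theorem Lc_norm (s : Fin m ⊕ Unit ≃ (κ ⊕ Unit) × Bool) (v : V m) : ‖v‖ ≤ ‖Lc s v‖ := by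
  have key : ∀ j : Fin m ⊕ Unit, |Sum.elim v.1 (fun _ => v.2) j| ≤ ‖Lc s v‖ := by
    intro j
    rcases h : s j with ⟨a, b⟩
    have h' := (s.symm_apply_eq).2 h.symm
    refine le_trans ?_ (norm_le_pi_norm (Lc s v) a)
    rw [Lc_apply]
    cases b
    · rw [h']; exact Complex.abs_re_le_norm ⟨_, _⟩
    · rw [h']; exact Complex.abs_im_le_norm ⟨_, _⟩
  rw [Prod.norm_def, max_le_iff, pi_norm_le_iff_of_nonneg (norm_nonneg _)]
  exact ⟨fun i => key (Sum.inl i), key (Sum.inr ())⟩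

theorem Lc_ev (s : Fin m ⊕ Unit ≃ (κ ⊕ Unit) × Bool) (hs : s (Sum.inr ()) = (Sum.inr (), false)) : Lc s (ev m) = ee κ := by
  have h0 : s.symm (Sum.inr (), false) = Sum.inr () := (s.symm_apply_eq).2 hs.symm
  have key : ∀ q, q ≠ (Sum.inr (), false) → Sum.elim (ev m).1 (fun _ => (ev m).2) (s.symm q) = 0 := by
    intro q hq
    rcases h : s.symm q with i | i
    · simp [ev]
    · exact absurd (((s.symm_apply_eq).1 h).trans hs) hq
  funext a
  rw [Lc_apply]
  rcases a with a | a
  · rw [key _ (by simp), key _ (by simp)]; rfl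
  · rw [h0, key _ (by simp)]; rfl
end
end CB

namespace CB
open MeasureTheory Matrix
open scoped ContDiff Topology

section
variable {κ : Type} [Fintype κ] [DecidableEq κ] {m : ℕ} [Nonempty (Fin m)]

/-- relation of degrees under a linear isomorphism -/
def Trp (L : V m ≃L[ℝ] (κ ⊕ Unit → ℂ)) (β : Bmp (κ ⊕ Unit → ℂ)) (β' : Bmp (V m)) : Prop :=
  ∀ (q : Nz (κ ⊕ Unit → ℂ) → (κ ⊕ Unit → ℂ)), Continuous q → (∀ x, q x ≠ 0) → sdeg β' (fun v => L.symm (q (nzmap L v))) = sdeg β q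

theorem lcol_ne {A : Matrix (κ ⊕ Unit) (κ ⊕ Unit) ℂ} (h : IsUnit A) : lcol A ≠ 0 := col_ne h _

theorem lcol_one : lcol (1 : Matrix (κ ⊕ Unit) (κ ⊕ Unit) ℂ) = ee κ := by
  funext a
  rcases a with a | a
  · simp [lcol, ee]
  · simp [lcol, ee]

theorem to_loop {L : V m ≃L[ℝ] (κ ⊕ Unit → ℂ)} {β : Bmp (κ ⊕ Unit → ℂ)} {β' : Bmp (V m)} (hT : Trp L β β') (hL : L (ev m) = ee κ)
    {G : Nz (κ ⊕ Unit → ℂ) → Matrix (κ ⊕ Unit) (κ ⊕ Unit) ℂ} (hG : Continuous G) (hu : ∀ x, IsUnit (G x)) :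
    ∃ γ : Cb m → Matrix (κ ⊕ Unit) (κ ⊕ Unit) ℂ, Continuous γ ∧ (∀ x, IsUnit (γ x)) ∧ (∀ x ∈ Cube.boundary (Fin m), γ x = 1) ∧
      Deg β' (fun x => L.symm (lcol (γ x))) = sdeg β (fun x a => G x a (Sum.inr ())) := by
  have hm : 0 < m := Fin.pos (Classical.arbitrary (Fin m))
  obtain ⟨K, hK⟩ := kap_exists (m := m)
  have hLs : L.symm (ee κ) = ev m := by rw [← hL]; simp
  set e0 : Nz (κ ⊕ Unit → ℂ) := nzmap L (eN m) with he0
  have hA : IsUnit (G e0)⁻¹ := (Matrix.isUnit_nonsing_inv_iff).2 (hu e0)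
  set G' : Nz (κ ⊕ Unit → ℂ) → Matrix (κ ⊕ Unit) (κ ⊕ Unit) ℂ := fun x => (G e0)⁻¹ * G x with hG'
  have hGG : Hm (GLs (κ ⊕ Unit)) G' G := by
    have h1 := (Hm.const (X := Nz (κ ⊕ Unit → ℂ)) (G e0)⁻¹ hA).mul (Hm.refl (S := GLs (κ ⊕ Unit)) hG hu)
    exact h1.congr (fun x => rfl) (fun x => by simp)
  have hc : Continuous G' := hGG.cont_left
  have hu' : ∀ x, IsUnit (G' x) := hGG.mem_left
  have h1 : G' e0 = 1 := by
    simp only [hG']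
    exact Matrix.nonsing_inv_mul _ ((Matrix.isUnit_iff_isUnit_det _).1 (hu e0))
  have hKc : Continuous fun x => K x := K.1.continuous
  have hγ : Continuous fun x => G' (nzmap L (K x)) := hc.comp ((nzc L).comp hKc)
  have hγb : ∀ x ∈ Cube.boundary (Fin m), G' (nzmap L (K x)) = 1 := by
    intro x hx
    have hx2 : K x = eN m := K.2 x hx
    rw [hx2, ← h1]
  refine ⟨fun x => G' (nzmap L (K x)), hγ, fun x => hu' _, hγb, ?_⟩
  refine (Deg_eq_sdeg hm β' (L.symm.continuous.comp (lcol_cont.comp hγ)) (fun x => by simpa using lcol_ne (hu' _))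
    (fun x hx => by
      change L.symm (lcol (G' (nzmap L (K x)))) = ev m
      rw [hγb x hx, lcol_one, hLs])).trans ?_
  have hF : Continuous fun v => L.symm (lcol (G' (nzmap L v))) := L.symm.continuous.comp (lcol_cont.comp (hc.comp (nzc L)))
  have h2 := fl_hm (S := nzs (V m)) hK hF (fun v => by
    change L.symm (lcol (G' (nzmap L v))) ≠ 0
    simpa using lcol_ne (hu' _))
  have h3 : L.symm (lcol (G' (nzmap L (eN m)))) = ev m := by
    rw [← he0, h1, lcol_one, hLs]
  rw [h3] at h2
  refine (sdeg_hm β' h2).trans ?_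
  refine (hT (fun x => lcol (G' x)) (lcol_cont.comp hc) (fun x => lcol_ne (hu' x))).trans ?_
  exact sdeg_hm β (hGG.col (Sum.inr ()))

theorem of_loop {L : V m ≃L[ℝ] (κ ⊕ Unit → ℂ)} {β : Bmp (κ ⊕ Unit → ℂ)} {β' : Bmp (V m)} (hT : Trp L β β') (hL : L (ev m) = ee κ)
    {γ : Cb m → Matrix (κ ⊕ Unit) (κ ⊕ Unit) ℂ} (hγ : Continuous γ) (hu : ∀ x, IsUnit (γ x)) (hb : ∀ x ∈ Cube.boundary (Fin m), γ x = 1) :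
    ∃ G : Nz (κ ⊕ Unit → ℂ) → Matrix (κ ⊕ Unit) (κ ⊕ Unit) ℂ, Continuous G ∧ (∀ x, IsUnit (G x)) ∧
      Deg β' (fun x => L.symm (lcol (γ x))) = sdeg β (fun x a => G x a (Sum.inr ())) := by
  have hm : 0 < m := Fin.pos (Classical.arbitrary (Fin m))
  have hLs : L.symm (ee κ) = ev m := by rw [← hL]; simp
  have hf : Continuous (fl γ 1) := fl_cont hm hγ hb
  have hfu : ∀ v, IsUnit (fl γ 1 v) := fl_mem (S := GLs (κ ⊕ Unit)) hu isUnit_one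
  refine ⟨fun x => fl γ 1 (nzmap L.symm x), hf.comp (nzc _), fun x => hfu _, ?_⟩
  refine (Deg_eq_sdeg hm β' (L.symm.continuous.comp (lcol_cont.comp hγ)) (fun x => by simpa using lcol_ne (hu _))
    (fun x hx => by
      change L.symm (lcol (γ x)) = ev m
      rw [hb x hx, lcol_one, hLs])).trans ?_
  refine Eq.trans ?_ (hT (fun x => lcol (fl γ 1 (nzmap L.symm x))) (lcol_cont.comp (hf.comp (nzc _))) (fun x => lcol_ne (hfu _)))
  congr 1
  funext v
  rw [nzmap_symm]
  have := fl_map (fun A : Matrix (κ ⊕ Unit) (κ ⊕ Unit) ℂ => L.symm (lcol A)) γ 1 v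
  rw [this, lcol_one, hLs]
  rfl

theorem CF_base : CF Empty := by
  obtain ⟨β⟩ := bmp_exists (Empty ⊕ Unit → ℂ)
  obtain ⟨s, hs⟩ := sig_exists (κ := Empty) (m := 1) (by simp)
  have hL := Lc_ev s hs
  obtain ⟨β', hT⟩ := sdeg_transport (Lc s) (Lc_norm s) β
  set L := Lc s with hLdef
  obtain ⟨e, he⟩ := PiV_iso β'
  have hLs : L.symm (ee Empty) = ev 1 := by rw [← hL]; simp
  refine ⟨β, ?_, ?_⟩
  · intro G hG hu
    obtain ⟨γ, hγ, hγu, hb, hd⟩ := to_loop (β := β) (β' := β') hT hL hG hu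
    let l := mkL (fun x => L.symm (lcol (γ x))) (L.symm.continuous.comp (lcol_cont.comp hγ)) (fun x => by simpa using lcol_ne (hγu x))
      (fun x hx => by rw [hb x hx, lcol_one, hLs])
    refine ⟨Multiplicative.toAdd (e ⟦l⟧), ?_⟩
    have h9 : ((Multiplicative.toAdd (e ⟦l⟧) : ℤ) : ℝ) = Deg β' (fun x => L.symm (lcol (γ x))) := he _
    refine hd.symm.trans (h9.symm.trans ?_)
    simp
  · intro k
    obtain ⟨z, hz⟩ := e.surjective (Multiplicative.ofAdd k)
    have h1 := he z
    rw [hz] at h1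
    induction z using Quotient.inductionOn with
    | _ l =>
    have hlc : Continuous fun x => (l x : V 1) := continuous_subtype_val.comp l.1.continuous
    have hlb : ∀ x ∈ Cube.boundary (Fin 1), (l x : V 1) = ev 1 := fun x hx => congrArg Subtype.val (l.2 x hx)
    have h2 : Deg β' (fun x => (l x : V 1)) = k := h1.symm
    rw [Deg_eq_sdeg one_pos β' hlc (fun x => (l x).2) hlb] at h2
    set F := fl (fun x => (l x : V 1)) (ev 1) with hF
    have hFc : Continuous F := fl_cont one_pos hlc hlb
    have hFn : ∀ v, F v ≠ 0 := fl_mem (S := nzs (V 1)) (fun x => (l x).2) (ev_ne 1)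
    have hq : Continuous fun x => L (F (nzmap L.symm x)) := L.continuous.comp (hFc.comp (nzc _))
    have hqn : ∀ x, L (F (nzmap L.symm x)) ≠ 0 := fun x => by simpa using hFn _
    have h3 := hT (fun x => L (F (nzmap L.symm x))) hq hqn
    refine ⟨fun x => Matrix.of fun _ _ => L (F (nzmap L.symm x)) (Sum.inr ()), ?_, ?_, ?_⟩
    · exact continuous_matrix fun i j => (continuous_apply (Sum.inr ())).comp hq
    · intro x
      letI : Unique (Empty ⊕ Unit) := ⟨⟨Sum.inr ()⟩, fun a => by rcases a with a | a; exacts [a.elim, rfl]⟩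
      rw [Matrix.isUnit_iff_isUnit_det, isUnit_iff_ne_zero, Matrix.det_unique]
      intro h
      apply hqn x
      funext a
      rcases a with a | a
      · exact a.elim
      · exact h
    · have h4 : (fun (x : Nz (Empty ⊕ Unit → ℂ)) (a : Empty ⊕ Unit) => (Matrix.of fun _ _ => L (F (nzmap L.symm x)) (Sum.inr ()) : Matrix (Empty ⊕ Unit) (Empty ⊕ Unit) ℂ) a (Sum.inr ()))
          = fun x => L (F (nzmap L.symm x)) := by
        funext x a
        rcases a with a | a
        · exact a.elim
        · rfl
      rw [h4, ← h3]
      have h5 : (fun v => L.symm (L (F (nzmap L.symm (nzmap L v))))) = F := by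
        funext v
        rw [nzmap_symm]; simp
      rw [h5, h2]
      simp

theorem CF_all (n : ℕ) : ∃ (κ : Type) (_ : Fintype κ) (_ : DecidableEq κ), Fintype.card κ = n ∧ CF κ := by
  induction n with
  | zero => exact ⟨Empty, inferInstance, inferInstance, by simp, CF_base⟩
  | succ n ih =>
    obtain ⟨κ, _, _, hc, h⟩ := ih
    exact ⟨κ ⊕ Unit, inferInstance, inferInstance, by simp [hc], CF_step h⟩

theorem loops_main (n : ℕ) : ∃ (κ : Type) (_ : Fintype κ) (_ : DecidableEq κ) (β : Bmp (V (2 * n + 1))) (L : V (2 * n + 1) ≃L[ℝ] (κ ⊕ Unit → ℂ)),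
    Fintype.card κ = n ∧ L (ev (2 * n + 1)) = ee κ ∧
    (∀ γ : Cb (2 * n + 1) → Matrix (κ ⊕ Unit) (κ ⊕ Unit) ℂ, Continuous γ → (∀ x, IsUnit (γ x)) →
      (∀ x ∈ Cube.boundary (Fin (2 * n + 1)), γ x = 1) → ∃ k : ℤ, Deg β (fun x => L.symm (lcol (γ x))) = (n.factorial : ℝ) * k) ∧
    (∀ k : ℤ, ∃ γ : Cb (2 * n + 1) → Matrix (κ ⊕ Unit) (κ ⊕ Unit) ℂ, Continuous γ ∧ (∀ x, IsUnit (γ x)) ∧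
      (∀ x ∈ Cube.boundary (Fin (2 * n + 1)), γ x = 1) ∧ Deg β (fun x => L.symm (lcol (γ x))) = (n.factorial : ℝ) * k) := by
  obtain ⟨κ, i1, i2, hc, β, hA, hB⟩ := CF_all n
  obtain ⟨s, hs⟩ := sig_exists (κ := κ) (m := 2 * n + 1) (by rw [hc]; ring)
  obtain ⟨β', hT⟩ := sdeg_transport (Lc s) (Lc_norm s) β
  refine ⟨κ, i1, i2, β', Lc s, hc, Lc_ev s hs, ?_, ?_⟩
  · intro γ hγ hu hb
    obtain ⟨G, hG, hGu, hd⟩ := of_loop (β := β) (β' := β') hT (Lc_ev s hs) hγ hu hb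
    obtain ⟨k, hk⟩ := hA G hG hGu
    exact ⟨k, by rw [hd, hk, hc]⟩
  · intro k
    obtain ⟨G, hG, hGu, hk⟩ := hB k
    obtain ⟨γ, hγ, hγu, hb, hd⟩ := to_loop (β := β) (β' := β') hT (Lc_ev s hs) hG hGu
    exact ⟨γ, hγ, hγu, hb, by rw [hd, hk, hc]⟩
end
end CB

namespace CB
open MeasureTheory Matrix
open scoped ContDiff Topology

/-- last column as a euclidean vector -/
def lc {n : ℕ} (A : Matrix (Fin (n + 1)) (Fin (n + 1)) ℂ) : EuclideanSpace ℂ (Fin (n + 1)) := WithLp.toLp 2 (fun a => A a (Fin.last n))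

theorem lc_cont {n : ℕ} : Continuous (lc (n := n)) :=
  (PiLp.continuous_toLp 2 _).comp (continuous_pi fun a => continuous_id.matrix_elem a _)

theorem loops_fin (n : ℕ) : ∃ (β : Bmp (V (2 * n + 1))) (L : V (2 * n + 1) ≃L[ℝ] EuclideanSpace ℂ (Fin (n + 1))),
    L (ev (2 * n + 1)) = lc 1 ∧
    (∀ γ : Cb (2 * n + 1) → Matrix (Fin (n + 1)) (Fin (n + 1)) ℂ, Continuous γ → (∀ x, IsUnit (γ x)) →
      (∀ x ∈ Cube.boundary (Fin (2 * n + 1)), γ x = 1) → ∃ k : ℤ, Deg β (fun x => L.symm (lc (γ x))) = (n.factorial : ℝ) * k) ∧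
    (∀ k : ℤ, ∃ γ : Cb (2 * n + 1) → Matrix (Fin (n + 1)) (Fin (n + 1)) ℂ, Continuous γ ∧ (∀ x, IsUnit (γ x)) ∧
      (∀ x ∈ Cube.boundary (Fin (2 * n + 1)), γ x = 1) ∧ Deg β (fun x => L.symm (lc (γ x))) = (n.factorial : ℝ) * k) := by
  obtain ⟨κ, i1, i2, β, L, hc, hL, hA, hB⟩ := loops_main n
  have hcard : Fintype.card (κ ⊕ Unit) = Fintype.card (Fin (n + 1)) := by simp [hc]
  obtain ⟨e, he⟩ : ∃ e : κ ⊕ Unit ≃ Fin (n + 1), e (Sum.inr ()) = Fin.last n := by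
    let e0 := Fintype.equivOfCardEq hcard
    exact ⟨e0.trans (Equiv.swap (e0 (Sum.inr ())) (Fin.last n)), by simp⟩
  let M : (κ ⊕ Unit → ℂ) ≃L[ℝ] EuclideanSpace ℂ (Fin (n + 1)) :=
    LinearEquiv.toContinuousLinearEquiv
      { toFun := fun v => WithLp.toLp 2 (fun a => v (e.symm a))
        invFun := fun w a => w (e a)
        map_add' := fun _ _ => rfl
        map_smul' := fun _ _ => rfl
        left_inv := fun v => by ext a; simp
        right_inv := fun w => by ext a; simp }
  have hM : ∀ v, M v = WithLp.toLp 2 (fun a => v (e.symm a)) := fun v => rfl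
  have key : ∀ A : Matrix (κ ⊕ Unit) (κ ⊕ Unit) ℂ, M (lcol A) = lc (Matrix.reindex e e A) := by
    intro A
    have h2 : e.symm (Fin.last n) = Sum.inr () := (e.symm_apply_eq).2 he.symm
    rw [hM]
    simp only [lc, lcol, Matrix.reindex_apply, Matrix.submatrix_apply, h2]
  have key2 : ∀ A : Matrix (κ ⊕ Unit) (κ ⊕ Unit) ℂ, (L.trans M).symm (lc (Matrix.reindex e e A)) = L.symm (lcol A) := by
    intro A
    rw [← key, ContinuousLinearEquiv.symm_apply_eq]
    simp
  have hcont : ∀ {X : Type} [TopologicalSpace X] {p q : Type} (s : p ≃ q) (f : X → Matrix p p ℂ), Continuous f → Continuous fun x => Matrix.reindex s s (f x) := by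
    intro X _ p q s f hf
    exact continuous_matrix fun i j => hf.matrix_elem _ _
  refine ⟨β, L.trans M, ?_, ?_, ?_⟩
  · change M (L (ev _)) = _
    rw [hL, ← lcol_one, key]
    simp
  · intro γ hγ hu hb
    obtain ⟨k, hk⟩ := hA (fun x => Matrix.reindex e.symm e.symm (γ x)) (hcont _ _ hγ) (fun x => isUnit_reindex _ (hu x)) (fun x hx => by
      rw [hb x hx]; simp)
    refine ⟨k, ?_⟩
    rw [← hk]
    congr 1
    funext x
    rw [← key2]
    congr 2
    ext i j
    simp
  · intro k
    obtain ⟨γ, hγ, hu, hb, hd⟩ := hB k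
    refine ⟨fun x => Matrix.reindex e e (γ x), hcont _ _ hγ, fun x => isUnit_reindex _ (hu x), fun x hx => by change Matrix.reindex e e (γ x) = 1; rw [hb x hx]; simp, ?_⟩
    rw [← hd]
    congr 1
    funext x
    exact key2 _

section gs
variable {N : ℕ}

theorem gs_cont {X E : Type*} [TopologicalSpace X] [NormedAddCommGroup E] [InnerProductSpace ℂ E] (f : X → Fin N → E)
    (hf : ∀ i, Continuous fun x => f x i) (hl : ∀ x, LinearIndependent ℂ (f x)) (i : Fin N) :
    Continuous fun x => InnerProductSpace.gramSchmidt ℂ (f x) i := by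
  induction i using WellFoundedLT.induction with
  | _ i ih =>
  have h : (fun x => InnerProductSpace.gramSchmidt ℂ (f x) i) = fun x => f x i - ∑ j ∈ Finset.Iio i,
      (inner ℂ (InnerProductSpace.gramSchmidt ℂ (f x) j) (f x i) / ((‖InnerProductSpace.gramSchmidt ℂ (f x) j‖ ^ 2 : ℝ) : ℂ)) • InnerProductSpace.gramSchmidt ℂ (f x) j := by
    funext x
    rw [InnerProductSpace.gramSchmidt_def]
    congr 1
    refine Finset.sum_congr rfl fun j _ => ?_
    rw [Submodule.starProjection_singleton]
    rfl
  rw [h]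
  refine (hf i).sub (continuous_finset_sum _ fun j hj => ?_)
  have hj' := ih j (Finset.mem_Iio.1 hj)
  refine Continuous.smul (Continuous.div (hj'.inner (hf i)) (Complex.continuous_ofReal.comp (hj'.norm.pow 2)) fun x => ?_) hj'
  have := InnerProductSpace.gramSchmidt_ne_zero (𝕜 := ℂ) j (hl x)
  have h2 : ‖InnerProductSpace.gramSchmidt ℂ (f x) j‖ ^ 2 ≠ 0 := pow_ne_zero 2 (norm_ne_zero_iff.2 this)
  exact_mod_cast h2

/-- columns in reversed order -/
def rc {n : ℕ} (A : Matrix (Fin (n + 1)) (Fin (n + 1)) ℂ) (j : Fin (n + 1)) : EuclideanSpace ℂ (Fin (n + 1)) :=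
  WithLp.toLp 2 (fun a => A a j.rev)

theorem rc_indep {n : ℕ} {A : Matrix (Fin (n + 1)) (Fin (n + 1)) ℂ} (h : IsUnit A) : LinearIndependent ℂ (rc A) := by
  have h1 := (Matrix.linearIndependent_cols_iff_isUnit).2 h
  have h2 := h1.comp Fin.rev Fin.rev_injective
  have h3 := h2.map' (WithLp.linearEquiv 2 ℂ (Fin (n + 1) → ℂ)).symm.toLinearMap (LinearEquiv.ker _)
  exact h3

/-- Gram Schmidt unitary matrix -/
noncomputable def GU {n : ℕ} (A : Matrix (Fin (n + 1)) (Fin (n + 1)) ℂ) : Matrix (Fin (n + 1)) (Fin (n + 1)) ℂ :=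
  Matrix.of fun i j => InnerProductSpace.gramSchmidtNormed ℂ (rc A) j.rev i

theorem GU_mem {n : ℕ} {A : Matrix (Fin (n + 1)) (Fin (n + 1)) ℂ} (h : IsUnit A) : GU A ∈ Matrix.unitaryGroup (Fin (n + 1)) ℂ := by
  rw [Matrix.mem_unitaryGroup_iff']
  have ho := InnerProductSpace.gramSchmidtNormed_orthonormal (𝕜 := ℂ) (rc_indep h)
  rw [orthonormal_iff_ite] at ho
  ext i j
  have h1 := ho i.rev j.rev
  rw [Matrix.star_eq_conjTranspose, Matrix.mul_apply, Matrix.one_apply]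
  simp only [Fin.rev_inj] at h1
  rw [← h1, PiLp.inner_apply]
  refine Finset.sum_congr rfl fun a _ => ?_
  simp [GU, mul_comm]

theorem GU_one {n : ℕ} : GU (1 : Matrix (Fin (n + 1)) (Fin (n + 1)) ℂ) = 1 := by
  have hb : ∀ j, rc (1 : Matrix (Fin (n + 1)) (Fin (n + 1)) ℂ) j = EuclideanSpace.single j.rev 1 := by
    intro j
    ext a
    simp [rc, Matrix.one_apply, PiLp.single_apply]
  have h1 : InnerProductSpace.gramSchmidt ℂ (rc (1 : Matrix (Fin (n + 1)) (Fin (n + 1)) ℂ)) = rc 1 := by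
    apply InnerProductSpace.gramSchmidt_of_orthogonal
    intro i j hij
    change inner ℂ (rc 1 i) (rc 1 j) = 0
    rw [hb, hb]
    simp [EuclideanSpace.inner_single_left, PiLp.single_apply, hij]
  ext i j
  simp only [GU, Matrix.of_apply, InnerProductSpace.gramSchmidtNormed, h1, hb]
  simp [Matrix.one_apply, PiLp.single_apply]

theorem GU_last {n : ℕ} (A : Matrix (Fin (n + 1)) (Fin (n + 1)) ℂ) : lc (GU A) = ‖lc A‖⁻¹ • lc A := by
  have h0 : InnerProductSpace.gramSchmidt ℂ (rc A) 0 = lc A := by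
    have := InnerProductSpace.gramSchmidt_bot (𝕜 := ℂ) (rc A)
    refine Eq.trans this ?_
    ext a
    simp [rc, lc]
    rfl
  ext a
  simp only [lc, GU, Matrix.of_apply, Fin.rev_last, InnerProductSpace.gramSchmidtNormed, h0]
  simp [lc]

theorem GU_cont {n : ℕ} {X : Type*} [TopologicalSpace X] {f : X → Matrix (Fin (n + 1)) (Fin (n + 1)) ℂ} (hf : Continuous f) (hu : ∀ x, IsUnit (f x)) :
    Continuous fun x => GU (f x) := by
  have hc : ∀ i, Continuous fun x => rc (f x) i := fun i =>
    (PiLp.continuous_toLp 2 _).comp (continuous_pi fun a => hf.matrix_elem a _)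
  have h := gs_cont (fun x => rc (f x)) hc (fun x => rc_indep (hu x))
  refine continuous_matrix fun i j => ?_
  change Continuous fun x => InnerProductSpace.gramSchmidtNormed ℂ (rc (f x)) j.rev i
  unfold InnerProductSpace.gramSchmidtNormed
  have h2 : Continuous fun x => ((‖InnerProductSpace.gramSchmidt ℂ (rc (f x)) j.rev‖ : ℂ))⁻¹ • InnerProductSpace.gramSchmidt ℂ (rc (f x)) j.rev := by
    refine Continuous.smul (Continuous.inv₀ (Complex.continuous_ofReal.comp (h _).norm) fun x => ?_) (h _)
    have := InnerProductSpace.gramSchmidt_ne_zero (𝕜 := ℂ) j.rev (rc_indep (hu x))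
    exact Complex.ofReal_ne_zero.2 (norm_ne_zero_iff.2 this)
  exact (PiLp.continuous_apply 2 _ i).comp h2
end gs
end CB

namespace CB
open MeasureTheory Matrix
open scoped ContDiff Topology

section fin
variable {n : ℕ}

/-- the sphere -/
abbrev Sp (n : ℕ) := Metric.sphere (0 : EuclideanSpace ℂ (Fin (n + 1))) 1

theorem lc_sph (g : Matrix.unitaryGroup (Fin (n + 1)) ℂ) : lc (g : Matrix (Fin (n + 1)) (Fin (n + 1)) ℂ) ∈ Metric.sphere (0 : EuclideanSpace ℂ (Fin (n + 1))) 1 := by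
  rw [mem_sphere_zero_iff_norm, EuclideanSpace.norm_eq, Real.sqrt_eq_one]
  have h := (Matrix.mem_unitaryGroup_iff').1 g.2
  have h1 := congrFun (congrFun h (Fin.last n)) (Fin.last n)
  rw [Matrix.star_eq_conjTranspose, Matrix.mul_apply, Matrix.one_apply_eq] at h1
  have h2 : ((∑ i, ‖(lc (g : Matrix (Fin (n + 1)) (Fin (n + 1)) ℂ)) i‖ ^ 2 : ℝ) : ℂ) = 1 := by
    rw [← h1]
    push_cast
    refine Finset.sum_congr rfl fun a _ => ?_
    rw [Matrix.conjTranspose_apply, ← Complex.conj_mul']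
    rfl
  exact_mod_cast h2

/-- the projection -/
noncomputable def pr (n : ℕ) : C(Matrix.unitaryGroup (Fin (n + 1)) ℂ, Sp n) :=
  ⟨fun g => ⟨lc (g : Matrix (Fin (n + 1)) (Fin (n + 1)) ℂ), lc_sph g⟩, (lc_cont.comp continuous_subtype_val).subtype_mk _⟩

variable (L : V (2 * n + 1) ≃L[ℝ] EuclideanSpace ℂ (Fin (n + 1))) (hL : L (ev (2 * n + 1)) = lc 1)

theorem sp_ne (s : Sp n) : (s : EuclideanSpace ℂ (Fin (n + 1))) ≠ 0 := by
  intro h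
  have := mem_sphere_zero_iff_norm.1 s.2
  rw [h] at this
  simp at this

/-- the inclusion of the sphere -/
noncomputable def jj (s : Sp n) : Nz (V (2 * n + 1)) := ⟨L.symm s, by simpa using sp_ne s⟩

theorem jj_cont : Continuous (jj L) := (L.symm.continuous.comp continuous_subtype_val).subtype_mk _

/-- loops push forward -/
noncomputable def jl (l : GenLoop (Fin (2 * n + 1)) (Sp n) (pr n 1)) : GenLoop (Fin (2 * n + 1)) (Nz (V (2 * n + 1))) (eN (2 * n + 1)) :=
  ⟨⟨fun x => jj L (l x), (jj_cont L).comp l.1.continuous⟩, fun x hx => by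
    have h : l x = pr n 1 := l.2 x hx
    apply Subtype.ext
    change L.symm (l x : EuclideanSpace ℂ (Fin (n + 1))) = ev _
    rw [h, ContinuousLinearEquiv.symm_apply_eq, hL]
    rfl⟩

/-- induced map on homotopy groups -/
noncomputable def JJ : HomotopyGroup (Fin (2 * n + 1)) (Sp n) (pr n 1) → PiV (2 * n + 1) :=
  Quotient.map (jl L hL) (by
    rintro a b ⟨H⟩
    refine ⟨⟨⟨⟨fun p => jj L (H p), (jj_cont L).comp H.continuous⟩, ?_, ?_⟩, ?_⟩⟩
    · intro x
      exact congrArg (jj L) (H.apply_zero x)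
    · intro x
      exact congrArg (jj L) (H.apply_one x)
    · intro t x hx
      exact congrArg (jj L) (H.eq_fst t hx))

theorem JJ_mk (l : GenLoop (Fin (2 * n + 1)) (Sp n) (pr n 1)) : JJ L hL ⟦l⟧ = ⟦jl L hL l⟧ := rfl

theorem JJ_mul (z w : HomotopyGroup (Fin (2 * n + 1)) (Sp n) (pr n 1)) : JJ L hL (z * w) = JJ L hL z * JJ L hL w := by
  induction z using Quotient.inductionOn with
  | _ p =>
  induction w using Quotient.inductionOn with
  | _ q =>
  have h := HomotopyGroup.mul_spec (i := (0 : Fin (2 * n + 1))) (p := p) (q := q)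
  have h' := HomotopyGroup.mul_spec (i := (0 : Fin (2 * n + 1))) (p := jl L hL p) (q := jl L hL q)
  refine (congrArg (JJ L hL) h).trans (Eq.trans ?_ h'.symm)
  rw [JJ_mk]
  congr 1
  apply Subtype.ext
  apply ContinuousMap.ext
  intro t
  change jj L (GenLoop.transAt 0 q p t) = GenLoop.transAt 0 (jl L hL q) (jl L hL p) t
  rw [GenLoop.transAt, GenLoop.transAt, GenLoop.coe_copy, GenLoop.coe_copy]
  split_ifs <;> rfl

/-- radial projection of a loop -/
noncomputable def rl (l : GenLoop (Fin (2 * n + 1)) (Nz (V (2 * n + 1))) (eN (2 * n + 1))) : GenLoop (Fin (2 * n + 1)) (Sp n) (pr n 1) :=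
  ⟨⟨fun x => ⟨‖L (l x)‖⁻¹ • L (l x), by
      have : ‖L (l x)‖ ≠ 0 := norm_ne_zero_iff.2 (by simpa using (l x).2)
      rw [mem_sphere_zero_iff_norm, norm_smul, norm_inv, norm_norm, inv_mul_cancel₀ this]⟩, by
      have h : Continuous fun x => L (l x : V (2 * n + 1)) := L.continuous.comp (continuous_subtype_val.comp l.1.continuous)
      exact ((h.norm.inv₀ fun x => norm_ne_zero_iff.2 (by simpa using (l x).2)).smul h).subtype_mk _⟩, fun x hx => by
    have h : l x = eN _ := l.2 x hx
    apply Subtype.ext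
    change ‖L (l x)‖⁻¹ • L (l x) = lc 1
    rw [h]
    change ‖L (ev _)‖⁻¹ • L (ev _) = lc 1
    have h3 : ‖lc (1 : Matrix (Fin (n + 1)) (Fin (n + 1)) ℂ)‖ = 1 := mem_sphere_zero_iff_norm.1 (lc_sph (1 : Matrix.unitaryGroup (Fin (n + 1)) ℂ))
    rw [hL, h3]; simp⟩

theorem pos_ne {E : Type*} [AddCommGroup E] [Module ℝ E] {v : E} (hv : v ≠ 0) {c t : ℝ} (hc : 0 < c) (h0 : 0 ≤ t) (h1 : t ≤ 1) :
    (1 - t) • (c • v) + t • v ≠ 0 := by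
  rw [smul_smul, ← add_smul]
  refine smul_ne_zero (ne_of_gt ?_) hv
  rcases eq_or_lt_of_le h1 with h | h
  · rw [h]; simp
  · have : 0 < (1 - t) * c := mul_pos (by linarith) hc
    linarith

theorem JJ_bij : Function.Bijective (JJ L hL) := by
  constructor
  · intro z w h
    induction z using Quotient.inductionOn with
    | _ p =>
    induction w using Quotient.inductionOn with
    | _ q =>
    rw [JJ_mk, JJ_mk] at h
    obtain ⟨H⟩ := Quotient.exact h
    refine Quotient.sound ?_
    have hn : ∀ y : I × (Fin (2 * n + 1) → I), ‖L (H y)‖ ≠ 0 := fun y => norm_ne_zero_iff.2 (by simpa using (H y).2)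
    have hc : Continuous fun y => L (H y : V (2 * n + 1)) := L.continuous.comp (continuous_subtype_val.comp H.continuous)
    have key : ∀ (s : Sp n), ‖L (jj L s)‖⁻¹ • L (jj L s) = (s : EuclideanSpace ℂ (Fin (n + 1))) := by
      intro s
      have h1 : L (jj L s) = (s : EuclideanSpace ℂ (Fin (n + 1))) := by simp [jj]
      rw [h1, mem_sphere_zero_iff_norm.1 s.2]; simp
    refine ⟨⟨⟨⟨fun y => ⟨‖L (H y)‖⁻¹ • L (H y), ?_⟩, ?_⟩, ?_, ?_⟩, ?_⟩⟩
    · rw [mem_sphere_zero_iff_norm, norm_smul, norm_inv, norm_norm, inv_mul_cancel₀ (hn y)]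
    · exact ((hc.norm.inv₀ hn).smul hc).subtype_mk _
    · intro x
      apply Subtype.ext
      have h2 : H (0, x) = jj L (p x) := H.apply_zero x
      change ‖L (H (0, x))‖⁻¹ • L (H (0, x)) = p x
      rw [h2, key]
    · intro x
      apply Subtype.ext
      have h2 : H (1, x) = jj L (q x) := H.apply_one x
      change ‖L (H (1, x))‖⁻¹ • L (H (1, x)) = q x
      rw [h2, key]
    · intro t x hx
      apply Subtype.ext
      have h2 : H (t, x) = jj L (p x) := H.eq_fst t hx
      change ‖L (H (t, x))‖⁻¹ • L (H (t, x)) = p x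
      rw [h2, key]
  · intro z
    induction z using Quotient.inductionOn with
    | _ l =>
    refine ⟨⟦rl L hL l⟧, ?_⟩
    rw [JJ_mk]
    have hlc : Continuous fun x => (l x : V (2 * n + 1)) := continuous_subtype_val.comp l.1.continuous
    have hjc : Continuous fun x => (jl L hL (rl L hL l) x : V (2 * n + 1)) := continuous_subtype_val.comp (jl L hL (rl L hL l)).1.continuous
    have hlb : ∀ x ∈ Cube.boundary (Fin (2 * n + 1)), (l x : V (2 * n + 1)) = ev _ := fun x hx => congrArg Subtype.val (l.2 x hx)
    have hjb : ∀ x ∈ Cube.boundary (Fin (2 * n + 1)), (jl L hL (rl L hL l) x : V (2 * n + 1)) = ev _ := fun x hx => congrArg Subtype.val ((jl L hL (rl L hL l)).2 x hx)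
    have hval : ∀ x, (jl L hL (rl L hL l) x : V (2 * n + 1)) = ‖L (l x)‖⁻¹ • (l x : V (2 * n + 1)) := by
      intro x
      change L.symm (‖L (l x)‖⁻¹ • L (l x)) = _
      simp
    refine rep_hom (fun t x => (1 - (t : ℝ)) • (jl L hL (rl L hL l) x : V (2 * n + 1)) + (t : ℝ) • (l x : V (2 * n + 1))) ?_ ?_ ?_ ?_ ?_
    · exact ((by fun_prop : Continuous fun p : I × Cb (2 * n + 1) => 1 - (p.1 : ℝ)).smul (hjc.comp continuous_snd)).add
        ((by fun_prop : Continuous fun p : I × Cb (2 * n + 1) => (p.1 : ℝ)).smul (hlc.comp continuous_snd))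
    · intro t x
      rw [hval]
      exact pos_ne (l x).2 (inv_pos.2 (norm_pos_iff.2 (by simpa using (l x).2))) t.2.1 t.2.2
    · intro t x hx
      rw [hlb x hx, hjb x hx, ← add_smul]; simp
    · exact ⟨_, fun x => by simp, rfl⟩
    · exact ⟨_, fun x => by simp, rfl⟩

end fin

theorem final (n : ℕ) :
    ∃ e : HomotopyGroup (Fin (2 * n + 1)) (Sp n) (pr n 1) ≃* Multiplicative ℤ,
        ∀ z : HomotopyGroup (Fin (2 * n + 1)) (Sp n) (pr n 1),
          (∃ γ : GenLoop (Fin (2 * n + 1)) (Matrix.unitaryGroup (Fin (n + 1)) ℂ) 1,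
            ∃ hpγ : (pr n).comp γ.1 ∈ GenLoop (Fin (2 * n + 1)) (Sp n) (pr n 1),
            z = Quotient.mk _ ⟨(pr n).comp γ.1, hpγ⟩) ↔
          ((n.factorial : ℤ) ∣ Multiplicative.toAdd (e z)) := by
  obtain ⟨β, L, hL, hA, hB⟩ := loops_fin n
  obtain ⟨e0, he0⟩ := PiV_iso β
  let J := MulEquiv.ofBijective (MulHom.mk (JJ L hL) (JJ_mul L hL)) (JJ_bij L hL)
  have hJ : ∀ z, J z = JJ L hL z := fun z => rfl
  have hev : L.symm (lc 1) = ev (2 * n + 1) := by rw [← hL]; simp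
  have hdeg : ∀ (γ : GenLoop (Fin (2 * n + 1)) (Matrix.unitaryGroup (Fin (n + 1)) ℂ) 1) (hpγ : (pr n).comp γ.1 ∈ GenLoop (Fin (2 * n + 1)) (Sp n) (pr n 1)),
      ((Multiplicative.toAdd ((J.trans e0) (Quotient.mk _ ⟨(pr n).comp γ.1, hpγ⟩)) : ℤ) : ℝ) =
        Deg β (fun x => L.symm (lc (γ x : Matrix (Fin (n + 1)) (Fin (n + 1)) ℂ))) := by
    intro γ hpγ
    exact he0 _
  refine ⟨J.trans e0, fun z => ⟨?_, ?_⟩⟩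
  · rintro ⟨γ, hpγ, rfl⟩
    obtain ⟨k, hk⟩ := hA (fun x => (γ x : Matrix (Fin (n + 1)) (Fin (n + 1)) ℂ)) (continuous_subtype_val.comp γ.1.continuous)
      (fun x => IsUnit.of_mul_eq_one _ ((Matrix.mem_unitaryGroup_iff).1 (γ x).2)) (fun x hx => by
        have : γ x = 1 := γ.2 x hx
        change ((γ x : Matrix.unitaryGroup (Fin (n + 1)) ℂ) : Matrix (Fin (n + 1)) (Fin (n + 1)) ℂ) = 1
        rw [this]; rfl)
    refine ⟨k, ?_⟩
    have h1 := (hdeg γ hpγ).trans hk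
    exact_mod_cast h1
  · rintro ⟨k, hk⟩
    obtain ⟨g, hg, hu, hb, hd⟩ := hB k
    let γ : GenLoop (Fin (2 * n + 1)) (Matrix.unitaryGroup (Fin (n + 1)) ℂ) 1 :=
      ⟨⟨fun x => ⟨GU (g x), GU_mem (hu x)⟩, (GU_cont hg hu).subtype_mk _⟩, fun x hx => Subtype.ext (by
        change GU (g x) = 1
        rw [hb x hx, GU_one])⟩
    have hγ : ∀ x, (γ x : Matrix (Fin (n + 1)) (Fin (n + 1)) ℂ) = GU (g x) := fun x => rfl
    have hpγ : (pr n).comp γ.1 ∈ GenLoop (Fin (2 * n + 1)) (Sp n) (pr n 1) := by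
      intro x hx
      have : γ.1 x = 1 := γ.2 x hx
      change pr n (γ.1 x) = _
      rw [this]
    refine ⟨γ, hpγ, ?_⟩
    apply (J.trans e0).injective
    apply Multiplicative.toAdd.injective
    rw [hk]
    have h1 := hdeg γ hpγ
    have hne : ∀ x, L.symm (lc (g x)) ≠ 0 := by
      intro x h
      have h2 : lc (g x) = 0 := by simpa using h
      apply col_ne (hu x) (Fin.last n)
      funext a
      exact congrArg (fun w : EuclideanSpace ℂ (Fin (n + 1)) => w a) h2
    have hne2 : ∀ x, lc (g x) ≠ 0 := fun x h => hne x (by rw [h]; simp)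
    have hc : Continuous fun x => L.symm (lc (g x)) := L.symm.continuous.comp (lc_cont.comp hg)
    have hc2 : Continuous fun x => L.symm (lc (GU (g x))) := L.symm.continuous.comp (lc_cont.comp (GU_cont hg hu))
    have h3 := Deg_hm (Nat.succ_pos (2 * n)) β (fun t x => (1 - (t : ℝ)) • L.symm (lc (GU (g x))) + (t : ℝ) • L.symm (lc (g x)))
      (((by fun_prop : Continuous fun p : I × Cb (2 * n + 1) => 1 - (p.1 : ℝ)).smul (hc2.comp continuous_snd)).add
        ((by fun_prop : Continuous fun p : I × Cb (2 * n + 1) => (p.1 : ℝ)).smul (hc.comp continuous_snd)))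
      (fun t x => by
        rw [GU_last, map_smul]
        exact pos_ne (hne x) (inv_pos.2 (norm_pos_iff.2 (hne2 x))) t.2.1 t.2.2)
      (fun t x hx => by
        rw [hb x hx, GU_one, hev, ← add_smul]; simp)
    simp only [Set.Icc.coe_zero, Set.Icc.coe_one, sub_zero, one_smul, zero_smul, add_zero, sub_self, zero_add] at h3
    have h4 := h1.trans (h3.trans hd)
    have h5 : Multiplicative.toAdd ((J.trans e0) (Quotient.mk _ ⟨(pr n).comp γ.1, hpγ⟩)) = (n.factorial : ℤ) * k := by exact_mod_cast h4
    exact h5.symm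
end CB

/-- The top Chern classes `c_{n+1}` of rank-`(n+1)` complex vector bundles
over `S^{2n+2}` realize exactly the multiples of `n!` in `H^{2n+2}(S^{2n+2};ℤ) ≅ ℤ`.
Equivalently (via the clutching-function bijection between such bundles and
`π_{2n+1}(U(n+1))`, under which `c_{n+1}` corresponds to composing with the projection
`p : U(n+1) → U(n+1)/U(n) = S^{2n+1}`, followed by the identification
`π_{2n+1}(S^{2n+1}) ≅ ℤ`):  the image of `p_* : π_{2n+1}(U(n+1)) → π_{2n+1}(S^{2n+1})`
corresponds to `n!·ℤ` under some isomorphism `π_{2n+1}(S^{2n+1}) ≃ ℤ`. -/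
theorem chern_classes_of_bundles_over_sphere (n : ℕ) :
    ∃ p : C(Matrix.unitaryGroup (Fin (n + 1)) ℂ,
        Metric.sphere (0 : EuclideanSpace ℂ (Fin (n + 1))) 1),
      (∀ g : Matrix.unitaryGroup (Fin (n + 1)) ℂ, ∀ i : Fin (n + 1),
        ((p g : EuclideanSpace ℂ (Fin (n + 1))) i =
          (g : Matrix (Fin (n + 1)) (Fin (n + 1)) ℂ) i (Fin.last n))) ∧
      ∃ e : HomotopyGroup (Fin (2 * n + 1))
          (Metric.sphere (0 : EuclideanSpace ℂ (Fin (n + 1))) 1) (p 1) ≃*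
          Multiplicative ℤ,
        ∀ z : HomotopyGroup (Fin (2 * n + 1))
            (Metric.sphere (0 : EuclideanSpace ℂ (Fin (n + 1))) 1) (p 1),
          (∃ γ : GenLoop (Fin (2 * n + 1)) (Matrix.unitaryGroup (Fin (n + 1)) ℂ) 1,
            ∃ hpγ : p.comp γ.1 ∈ GenLoop (Fin (2 * n + 1))
              (Metric.sphere (0 : EuclideanSpace ℂ (Fin (n + 1))) 1) (p 1),
            z = Quotient.mk _ ⟨p.comp γ.1, hpγ⟩) ↔
          ((n.factorial : ℤ) ∣ Multiplicative.toAdd (e z)) := by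
  exact ⟨CB.pr n, fun g i => rfl, CB.final n⟩
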